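/- Let q = p^f be a power of a prime p, let n ≥ 3 and suppose GU_n(q) is not solvable. Let π be a set of primes with 2 ∉ π and p ∉ π such that |π ∩ π(GU_n(q))| ≥ 2, and suppose GU_n(q) has a Hall π-subgroup H. Set G = H·SU_n(q). Then there exist x, y, z ∈ G such that H ∩ H^x ∩ H^y ∩ H^z is contained in the center Z(GU_n(q)), i.e. consists of scalar matrices. -/

import Mathlib

open Matrix Pointwise

/-- `H^x = x⁻¹ H x`. -/
def conjBy {G : Type*} [Group G] (H : Subgroup G) (x : G) : Subgroup G :=
  Subgroup.map ((MulAut.conj x⁻¹).toMonoidHom) H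

/-- Hall π-subgroup of the whole group. -/
def IsHallSubgroup {G : Type*} [Group G] (π : Set ℕ) (H : Subgroup G) : Prop :=
  (∀ r : ℕ, r.Prime → r ∣ Nat.card H → r ∈ π) ∧ ∀ r ∈ π, ¬ r ∣ H.index

/-- Hall π-subgroup of the subgroup `K`. -/
def IsHallSubgroupIn {G : Type*} [Group G] (π : Set ℕ) (K H : Subgroup G) : Prop :=
  H ≤ K ∧ (∀ r : ℕ, r.Prime → r ∣ Nat.card H → r ∈ π) ∧ ∀ r ∈ π, ¬ r ∣ H.relIndex K

/-- The subgroup `SL_n` of `GL_n`. -/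
def SLsub (n : ℕ) (F : Type*) [Field F] : Subgroup (GL (Fin n) F) where
  carrier := {g | Matrix.det (g : Matrix (Fin n) (Fin n) F) = 1}
  one_mem' := by simp
  mul_mem' := by
    intro a b ha hb
    simp only [Set.mem_setOf_eq, Units.val_mul, Matrix.det_mul] at *
    rw [ha, hb, one_mul]
  inv_mem' := by
    intro g hg
    simp only [Set.mem_setOf_eq] at *
    have h1 : ((g⁻¹ : GL (Fin n) F) : Matrix (Fin n) (Fin n) F) *
        (g : Matrix (Fin n) (Fin n) F) = 1 := g.inv_mul
    have := congrArg Matrix.det h1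
    rw [Matrix.det_mul, Matrix.det_one, hg, mul_one] at this
    exact this

/-- The group of similitudes of the bilinear form `B` (acting on row vectors). -/
def similitudeGroup {n : ℕ} {F : Type*} [Field F]
    (B : (Fin n → F) → (Fin n → F) → F) : Subgroup (GL (Fin n) F) where
  carrier := {g | ∃ c : Fˣ, ∀ u v : Fin n → F,
    B (Matrix.vecMul u (g : Matrix (Fin n) (Fin n) F))
      (Matrix.vecMul v (g : Matrix (Fin n) (Fin n) F)) = (c : F) * B u v}
  one_mem' := ⟨1, by simp⟩
  mul_mem' := by
    rintro a b ⟨c, hc⟩ ⟨d, hd⟩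
    refine ⟨c * d, fun u v => ?_⟩
    simp only [Units.val_mul, ← Matrix.vecMul_vecMul, hd, hc]
    ring
  inv_mem' := by
    rintro g ⟨c, hc⟩
    refine ⟨c⁻¹, fun u v => ?_⟩
    have h1 : ∀ w : Fin n → F, Matrix.vecMul
        (Matrix.vecMul w ((g⁻¹ : GL (Fin n) F) : Matrix (Fin n) (Fin n) F))
        (g : Matrix (Fin n) (Fin n) F) = w := by
      intro w
      rw [Matrix.vecMul_vecMul, g.inv_mul, Matrix.vecMul_one]
    have h2 := hc (Matrix.vecMul u ((g⁻¹ : GL (Fin n) F) : Matrix (Fin n) (Fin n) F))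
      (Matrix.vecMul v ((g⁻¹ : GL (Fin n) F) : Matrix (Fin n) (Fin n) F))
    rw [h1, h1] at h2
    rw [h2, Units.val_inv_eq_inv_val, inv_mul_cancel_left₀ (by exact_mod_cast c.ne_zero)]

/-- The isometry group of the bilinear form `B` (acting on row vectors). -/
def isometryGroup {n : ℕ} {F : Type*} [Field F]
    (B : (Fin n → F) → (Fin n → F) → F) : Subgroup (GL (Fin n) F) where
  carrier := {g | ∀ u v : Fin n → F,
    B (Matrix.vecMul u (g : Matrix (Fin n) (Fin n) F))
      (Matrix.vecMul v (g : Matrix (Fin n) (Fin n) F)) = B u v}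
  one_mem' := by simp
  mul_mem' := by
    intro a b ha hb u v
    simp only [Set.mem_setOf_eq] at ha hb
    simp only [Units.val_mul, ← Matrix.vecMul_vecMul]
    rw [hb, ha]
  inv_mem' := by
    intro g hg u v
    have h1 : ∀ w : Fin n → F, Matrix.vecMul
        (Matrix.vecMul w ((g⁻¹ : GL (Fin n) F) : Matrix (Fin n) (Fin n) F))
        (g : Matrix (Fin n) (Fin n) F) = w := by
      intro w
      rw [Matrix.vecMul_vecMul, g.inv_mul, Matrix.vecMul_one]
    have h2 := hg (Matrix.vecMul u ((g⁻¹ : GL (Fin n) F) : Matrix (Fin n) (Fin n) F))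
      (Matrix.vecMul v ((g⁻¹ : GL (Fin n) F) : Matrix (Fin n) (Fin n) F))
    rw [h1, h1] at h2
    exact h2.symm

/-- The group of similitudes of the quadratic form `Q` (acting on row vectors). -/
def qSimilitudeGroup {n : ℕ} {F : Type*} [Field F]
    (Q : (Fin n → F) → F) : Subgroup (GL (Fin n) F) where
  carrier := {g | ∃ c : Fˣ, ∀ v : Fin n → F,
    Q (Matrix.vecMul v (g : Matrix (Fin n) (Fin n) F)) = (c : F) * Q v}
  one_mem' := ⟨1, by simp⟩
  mul_mem' := by
    rintro a b ⟨c, hc⟩ ⟨d, hd⟩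
    refine ⟨c * d, fun v => ?_⟩
    simp only [Units.val_mul, ← Matrix.vecMul_vecMul, hd, hc]
    ring
  inv_mem' := by
    rintro g ⟨c, hc⟩
    refine ⟨c⁻¹, fun v => ?_⟩
    have h1 : ∀ w : Fin n → F, Matrix.vecMul
        (Matrix.vecMul w ((g⁻¹ : GL (Fin n) F) : Matrix (Fin n) (Fin n) F))
        (g : Matrix (Fin n) (Fin n) F) = w := by
      intro w
      rw [Matrix.vecMul_vecMul, g.inv_mul, Matrix.vecMul_one]
    have h2 := hc (Matrix.vecMul v ((g⁻¹ : GL (Fin n) F) : Matrix (Fin n) (Fin n) F))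
    rw [h1] at h2
    rw [h2, Units.val_inv_eq_inv_val, inv_mul_cancel_left₀ (by exact_mod_cast c.ne_zero)]

/-- The unitary group `GU_n` with respect to the field automorphism `φ`. -/
def GUgrp (n : ℕ) {K : Type*} [Field K] (φ : K →+* K) : Subgroup (GL (Fin n) K) where
  carrier := {g | ((g : Matrix (Fin n) (Fin n) K).map φ)ᵀ * (g : Matrix (Fin n) (Fin n) K) = 1}
  one_mem' := by
    simp [Matrix.map_one φ φ.map_zero φ.map_one]
  mul_mem' := by
    intro a b ha hb
    simp only [Set.mem_setOf_eq, Units.val_mul, Matrix.map_mul, Matrix.transpose_mul] at *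
    calc ((b : Matrix (Fin n) (Fin n) K).map φ)ᵀ * ((a : Matrix (Fin n) (Fin n) K).map φ)ᵀ *
          ((a : Matrix (Fin n) (Fin n) K) * (b : Matrix (Fin n) (Fin n) K))
        = ((b : Matrix (Fin n) (Fin n) K).map φ)ᵀ *
          (((a : Matrix (Fin n) (Fin n) K).map φ)ᵀ * (a : Matrix (Fin n) (Fin n) K)) *
          (b : Matrix (Fin n) (Fin n) K) := by noncomm_ring
      _ = 1 := by rw [ha, mul_one, hb]
  inv_mem' := by
    intro g hg
    simp only [Set.mem_setOf_eq] at *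
    have hcomm : (g : Matrix (Fin n) (Fin n) K) * ((g : Matrix (Fin n) (Fin n) K).map φ)ᵀ = 1 :=
      _root_.mul_eq_one_comm.mp hg
    have h1 : ((g : Matrix (Fin n) (Fin n) K) * ((g⁻¹ : GL (Fin n) K) : Matrix (Fin n) (Fin n) K)).map φ = 1 := by
      rw [g.mul_inv]
      exact Matrix.map_one φ φ.map_zero φ.map_one
    rw [Matrix.map_mul] at h1
    have h2 := congrArg Matrix.transpose h1
    rw [Matrix.transpose_mul, Matrix.transpose_one] at h2
    calc (((g⁻¹ : GL (Fin n) K) : Matrix (Fin n) (Fin n) K).map φ)ᵀ *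
          ((g⁻¹ : GL (Fin n) K) : Matrix (Fin n) (Fin n) K)
        = (((g⁻¹ : GL (Fin n) K) : Matrix (Fin n) (Fin n) K).map φ)ᵀ *
          (((g : Matrix (Fin n) (Fin n) K).map φ)ᵀ * (g : Matrix (Fin n) (Fin n) K)) *
          ((g⁻¹ : GL (Fin n) K) : Matrix (Fin n) (Fin n) K) := by rw [hg, mul_one]
      _ = ((((g⁻¹ : GL (Fin n) K) : Matrix (Fin n) (Fin n) K).map φ)ᵀ *
          ((g : Matrix (Fin n) (Fin n) K).map φ)ᵀ) *
          ((g : Matrix (Fin n) (Fin n) K) * ((g⁻¹ : GL (Fin n) K) : Matrix (Fin n) (Fin n) K)) := by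
            noncomm_ring
      _ = 1 := by rw [h2, g.mul_inv, mul_one]


set_option linter.all false

/-- A finite hermitian space with an orthonormal basis. -/
structure UData (K V : Type) [Field K] [AddCommGroup V] [Module K V] where
  p : ℕ
  f : ℕ
  q : ℕ
  n : ℕ
  hp : p.Prime
  hf : 1 ≤ f
  hq : q = p ^ f
  hcard : Nat.card K = q ^ 2
  φ : K →+* K
  hφ : ∀ x, φ x = x ^ q
  B : V → V →ₗ[K] K
  herm : ∀ x y, B y x = φ (B x y)
  b : Module.Basis (Fin n) K V
  orth : ∀ i j, B (b i) (b j) = if i = j then 1 else 0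

namespace UData

section basics

variable {K V : Type} [Field K] [Finite K] [AddCommGroup V] [Module K V] [Finite V] (D : UData K V)

theorem fd (D : UData K V) : FiniteDimensional K V := Module.Basis.finiteDimensional_of_finite D.b

theorem two_le_q : 2 ≤ D.q := by
  rw [D.hq]
  calc 2 ≤ D.p := D.hp.two_le
    _ = D.p ^ 1 := (pow_one _).symm
    _ ≤ D.p ^ D.f := Nat.pow_le_pow_right D.hp.pos D.hf

theorem phi_phi (x : K) : D.φ (D.φ x) = x := by
  haveI := Fintype.ofFinite K
  rw [D.hφ, D.hφ, ← pow_mul, ← sq, ← D.hcard, Nat.card_eq_fintype_card, FiniteField.pow_card]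

theorem charP : CharP K D.p := by
  haveI := Fintype.ofFinite K
  haveI : Fact D.p.Prime := ⟨D.hp⟩
  obtain ⟨r, hr⟩ := CharP.exists K
  haveI : Fact r.Prime := ⟨CharP.char_is_prime K r⟩
  obtain ⟨m, h1, h2⟩ := FiniteField.card K r
  have h3 := D.hcard
  rw [Nat.card_eq_fintype_card, h2, D.hq] at h3
  have : r ∣ D.p := by
    have h4 : r ∣ (D.p ^ D.f) ^ 2 := by
      rw [← h3]; exact dvd_pow_self _ m.ne_zero
    exact h1.dvd_of_dvd_pow (h1.dvd_of_dvd_pow h4)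
  rw [(Nat.prime_dvd_prime_iff_eq h1 D.hp).mp this] at hr
  exact hr

theorem natCast_ne_zero {m : ℕ} (h : ¬ D.p ∣ m) : (m : K) ≠ 0 := by
  haveI := D.charP
  rwa [Ne, CharP.cast_eq_zero_iff K D.p]

@[simp] theorem B_zero_left (y : V) : D.B 0 y = 0 := by
  rw [D.herm y 0]; simp

theorem B_add_left (x x' y : V) : D.B (x + x') y = D.B x y + D.B x' y := by
  rw [D.herm y, D.herm y x, D.herm y x', map_add, map_add]

theorem B_sub_left (x x' y : V) : D.B (x - x') y = D.B x y - D.B x' y := by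
  rw [D.herm y, D.herm y x, D.herm y x', map_sub, map_sub]

theorem B_neg_left (x y : V) : D.B (-x) y = - D.B x y := by
  rw [D.herm y, D.herm y x, map_neg, map_neg]

theorem B_smul_left (c : K) (x y : V) : D.B (c • x) y = D.φ c * D.B x y := by
  rw [D.herm y, D.herm y x, map_smul, smul_eq_mul, map_mul]

theorem B_sum_left {ι : Type*} (s : Finset ι) (x : ι → V) (y : V) :
    D.B (∑ i ∈ s, x i) y = ∑ i ∈ s, D.B (x i) y := by
  rw [D.herm y, map_sum, map_sum]
  exact Finset.sum_congr rfl fun i _ => (D.herm _ _).symm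

theorem B_symm_zero {x y : V} (h : D.B x y = 0) : D.B y x = 0 := by
  rw [D.herm x y, h, map_zero]

theorem nondeg {x : V} (h : ∀ y, D.B y x = 0) : x = 0 := by
  have h1 : ∀ i, D.b.repr x i = 0 := by
    intro i
    have h2 := h (D.b i)
    rw [← D.b.sum_repr x, map_sum] at h2
    simpa [D.orth] using h2
  rw [← D.b.sum_repr x]
  simp [h1]

/-- orthogonal complement -/
def perp (U : Submodule K V) : Submodule K V where
  carrier := {x | ∀ u ∈ U, D.B u x = 0}
  add_mem' := by
    intro a b ha hb u hu
    rw [map_add, ha u hu, hb u hu, add_zero]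
  zero_mem' := by intro u _; simp
  smul_mem' := by
    intro c x hx u hu
    rw [map_smul, hx u hu, smul_zero]

theorem mem_perp {U : Submodule K V} {x : V} : x ∈ D.perp U ↔ ∀ u ∈ U, D.B u x = 0 := Iff.rfl

theorem perp_anti {U W : Submodule K V} (h : U ≤ W) : D.perp W ≤ D.perp U :=
  fun _ hx u hu => hx u (h hu)

theorem le_perp_perp (U : Submodule K V) : U ≤ D.perp (D.perp U) :=
  fun _ hx u hu => D.B_symm_zero (hu _ hx)

theorem le_perp_comm {U W : Submodule K V} : U ≤ D.perp W ↔ W ≤ D.perp U :=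
  ⟨fun h => (D.le_perp_perp W).trans (D.perp_anti h), fun h => (D.le_perp_perp U).trans (D.perp_anti h)⟩

theorem perp_iSup {ι : Sort*} (U : ι → Submodule K V) : D.perp (⨆ i, U i) = ⨅ i, D.perp (U i) := by
  apply le_antisymm
  · exact le_iInf fun i => D.perp_anti (le_iSup U i)
  · rw [le_perp_comm]
    exact iSup_le fun i => D.le_perp_comm.mp (iInf_le _ i)

/-- nondegenerate subspaces -/
def ND (U : Submodule K V) : Prop := IsCompl U (D.perp U)

variable {D}

theorem ND_of {U : Submodule K V} (h : ∀ x, ∃ u ∈ U, x - u ∈ D.perp U) : D.ND U := by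
  refine ⟨?_, ?_⟩
  · rw [Submodule.disjoint_def]
    intro x hx hx'
    apply D.nondeg
    intro y
    obtain ⟨u, hu, hy⟩ := h y
    have h1 : y = u + (y - u) := by abel
    rw [h1, D.B_add_left, hx' u hu, zero_add]
    exact D.B_symm_zero (hy x hx)
  · rw [codisjoint_iff, eq_top_iff]
    intro x _
    obtain ⟨u, hu, hx⟩ := h x
    exact Submodule.mem_sup.mpr ⟨u, hu, x - u, hx, by abel⟩

theorem ND.exists {U : Submodule K V} (h : D.ND U) (x : V) : ∃ u ∈ U, x - u ∈ D.perp U := by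
  have h1 : x ∈ U ⊔ D.perp U := by rw [h.sup_eq_top]; trivial
  obtain ⟨u, hu, w, hw, rfl⟩ := Submodule.mem_sup.mp h1
  exact ⟨u, hu, by simpa using hw⟩

theorem ND.eq_zero {U : Submodule K V} (h : D.ND U) {x : V} (hx : x ∈ U) (hx' : x ∈ D.perp U) : x = 0 :=
  Submodule.disjoint_def.mp h.disjoint x hx hx'

theorem ND.perp_perp {U : Submodule K V} (h : D.ND U) : D.perp (D.perp U) = U := by
  apply le_antisymm _ (D.le_perp_perp U)
  intro x hx
  obtain ⟨u, hu, hxu⟩ := h.exists x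
  have : x - u = 0 := by
    apply D.nondeg
    intro y
    obtain ⟨u', hu', hyu⟩ := h.exists y
    have h1 : y = u' + (y - u') := by abel
    rw [h1, D.B_add_left, hxu u' hu', zero_add]
    rw [map_sub, hx _ hyu, D.B_symm_zero (hyu u hu), sub_zero]
  rw [sub_eq_zero.mp this]; exact hu

theorem ND.perp {U : Submodule K V} (h : D.ND U) : D.ND (D.perp U) := by
  unfold ND; rw [h.perp_perp]; exact h.symm

theorem ND.finrank {U : Submodule K V} (h : D.ND U) :
    Module.finrank K U + Module.finrank K (D.perp U) = D.n := by
  haveI := D.fd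
  rw [Submodule.finrank_add_eq_of_isCompl h, Module.finrank_eq_card_basis D.b, Fintype.card_fin]

variable (D) in
theorem finrank_V : Module.finrank K V = D.n := by
  rw [Module.finrank_eq_card_basis D.b, Fintype.card_fin]

theorem ND_bot : D.ND (⊥ : Submodule K V) :=
  ND_of fun x => ⟨0, by simp, by rw [mem_perp]; intro u hu; rw [(Submodule.mem_bot K).mp hu]; simp⟩

theorem ND_top : D.ND (⊤ : Submodule K V) := ND_of fun x => ⟨x, by simp, by simp⟩

theorem ND.sup {U W : Submodule K V} (hU : D.ND U) (hW : D.ND W) (h : U ≤ D.perp W) : D.ND (U ⊔ W) := by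
  apply ND_of
  intro x
  obtain ⟨u, hu, hxu⟩ := hU.exists x
  obtain ⟨w, hw, hxw⟩ := hW.exists x
  refine ⟨u + w, Submodule.add_mem_sup hu hw, ?_⟩
  rw [mem_perp]
  intro z hz
  obtain ⟨u', hu', w', hw', rfl⟩ := Submodule.mem_sup.mp hz
  have e1 : x - (u + w) = (x - u) - w := by abel
  have e2 : x - (u + w) = (x - w) - u := by abel
  rw [D.B_add_left]
  nth_rewrite 1 [e1]
  rw [e2, map_sub (D.B u') (x - u) w, map_sub (D.B w') (x - w) u, hxu u' hu', hxw w' hw',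
    D.B_symm_zero (h hu' w hw), h hu w' hw']
  simp

end basics

end UData

/-- moved space of a linear automorphism on a subspace -/
def mvo {K V : Type} [Field K] [AddCommGroup V] [Module K V] (g : V ≃ₗ[K] V) (U : Submodule K V) :
    Submodule K V := U.map (g.toLinearMap - LinearMap.id)

/-- moved space of a linear automorphism -/
def mv {K V : Type} [Field K] [AddCommGroup V] [Module K V] (g : V ≃ₗ[K] V) : Submodule K V := mvo g ⊤

/-- stability of a subspace -/
def Stb {K V : Type} [Field K] [AddCommGroup V] [Module K V] (g : V ≃ₗ[K] V) (U : Submodule K V) : Prop :=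
  U.map g.toLinearMap = U

instance finite_lequiv {K V : Type} [Field K] [AddCommGroup V] [Module K V] [Finite V] :
    Finite (V ≃ₗ[K] V) := Finite.of_injective (fun g => (g : V → V)) DFunLike.coe_injective

section mvbasics

variable {K V : Type} [Field K] [AddCommGroup V] [Module K V] {g h : V ≃ₗ[K] V} {U W : Submodule K V}

theorem mem_mvo {y : V} : y ∈ mvo g U ↔ ∃ x ∈ U, g x - x = y := by
  simp [mvo, Submodule.mem_map]

theorem mem_mv {y : V} : y ∈ mv g ↔ ∃ x, g x - x = y := by
  simp [mv, mem_mvo]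

theorem sub_mem_mv (g : V ≃ₗ[K] V) (x : V) : g x - x ∈ mv g := mem_mv.mpr ⟨x, rfl⟩

theorem sub_mem_mvo (g : V ≃ₗ[K] V) {x : V} (hx : x ∈ U) : g x - x ∈ mvo g U := mem_mvo.mpr ⟨x, hx, rfl⟩

theorem mvo_le_mv : mvo g U ≤ mv g := Submodule.map_mono le_top

theorem mvo_mono (h : U ≤ W) : mvo g U ≤ mvo g W := Submodule.map_mono h

theorem mv_le_iff : mv g ≤ U ↔ ∀ x, g x - x ∈ U := by
  constructor
  · intro h x; exact h (sub_mem_mv g x)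
  · rintro h y hy
    obtain ⟨x, rfl⟩ := mem_mv.mp hy
    exact h x

theorem mv_one : mv (1 : V ≃ₗ[K] V) = ⊥ := by
  rw [eq_bot_iff, mv_le_iff]; simp

theorem mv_eq_bot : mv g = ⊥ ↔ g = 1 := by
  constructor
  · intro h
    ext x
    have := sub_mem_mv g x
    rw [h, Submodule.mem_bot, sub_eq_zero] at this
    exact this
  · rintro rfl; exact mv_one

theorem mvo_eq_bot : mvo g U = ⊥ ↔ ∀ x ∈ U, g x = x := by
  constructor
  · intro h x hx
    have := sub_mem_mvo g hx
    rw [h, Submodule.mem_bot, sub_eq_zero] at this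
    exact this
  · intro h
    rw [eq_bot_iff]
    rintro y hy
    obtain ⟨x, hx, rfl⟩ := mem_mvo.mp hy
    simp [h x hx]

theorem mv_mul_le (hg : mv g ≤ U) (hh : mv h ≤ U) : mv (g * h) ≤ U := by
  rw [mv_le_iff]
  intro x
  have : (g * h) x - x = (g (h x) - h x) + (h x - x) := by
    rw [LinearEquiv.mul_apply]; abel
  rw [this]
  exact U.add_mem (hg (sub_mem_mv _ _)) (hh (sub_mem_mv _ _))

theorem inv_apply_self' (g : V ≃ₗ[K] V) (x : V) : g⁻¹ (g x) = x := by
  rw [← LinearEquiv.mul_apply, inv_mul_cancel]; rfl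

theorem apply_inv_self' (g : V ≃ₗ[K] V) (x : V) : g (g⁻¹ x) = x := by
  rw [← LinearEquiv.mul_apply, mul_inv_cancel]; rfl

theorem mv_inv_le (hg : mv g ≤ U) : mv g⁻¹ ≤ U := by
  rw [mv_le_iff]
  intro x
  have : g⁻¹ x - x = - (g (g⁻¹ x) - g⁻¹ x) := by
    rw [apply_inv_self']; abel
  rw [this]
  exact U.neg_mem (hg (sub_mem_mv _ _))

theorem mv_closure_le {S : Set (V ≃ₗ[K] V)} (hS : ∀ g ∈ S, mv g ≤ U) :
    ∀ g ∈ Subgroup.closure S, mv g ≤ U := by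
  intro g hg
  induction hg using Subgroup.closure_induction with
  | mem x hx => exact hS x hx
  | one => rw [mv_one]; exact bot_le
  | mul x y _ _ hx hy => exact mv_mul_le hx hy
  | inv x _ hx => exact mv_inv_le hx

theorem mv_pow_le (g : V ≃ₗ[K] V) (m : ℕ) : mv (g ^ m) ≤ mv g := by
  refine mv_closure_le (S := {g}) (by simp) _ ?_
  exact Subgroup.pow_mem _ (Subgroup.subset_closure (Set.mem_singleton g)) m

theorem mv_conj (g h : V ≃ₗ[K] V) : mv (h * g * h⁻¹) = (mv g).map h.toLinearMap := by
  ext y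
  rw [mem_mv, Submodule.mem_map]
  constructor
  · rintro ⟨x, rfl⟩
    refine ⟨g (h⁻¹ x) - h⁻¹ x, sub_mem_mv _ _, ?_⟩
    simp [LinearEquiv.mul_apply, apply_inv_self']
  · rintro ⟨z, hz, rfl⟩
    obtain ⟨x, rfl⟩ := mem_mv.mp hz
    refine ⟨h x, ?_⟩
    simp [LinearEquiv.mul_apply, inv_apply_self']

theorem finrank_map_equiv (g : V ≃ₗ[K] V) (U : Submodule K V) :
    Module.finrank K (U.map g.toLinearMap) = Module.finrank K U :=
  LinearEquiv.finrank_map_eq g U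

theorem Stb.mem (h : Stb g U) {x : V} (hx : x ∈ U) : g x ∈ U := by
  have : g x ∈ U.map g.toLinearMap := ⟨x, hx, rfl⟩
  rwa [h] at this

theorem Stb_of [FiniteDimensional K V] (h : ∀ x ∈ U, g x ∈ U) : Stb g U := by
  refine Submodule.eq_of_le_of_finrank_eq ?_ (finrank_map_equiv g U)
  rintro _ ⟨x, hx, rfl⟩
  exact h x hx

theorem Stb.inv (h : Stb g U) : Stb g⁻¹ U := by
  unfold Stb
  conv_lhs => rw [← h]
  rw [← Submodule.map_comp]
  convert Submodule.map_id U
  ext x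
  exact inv_apply_self' g x

theorem Stb.mul (hg : Stb g U) (hh : Stb h U) : Stb (g * h) U := by
  unfold Stb
  conv_rhs => rw [← hg, ← hh]
  rw [← Submodule.map_comp]
  rfl

theorem Stb_one : Stb (1 : V ≃ₗ[K] V) U := Submodule.map_id U

theorem Stb.pow (h : Stb g U) (m : ℕ) : Stb (g ^ m) U := by
  induction m with
  | zero => simpa using Stb_one
  | succ k ih => rw [pow_succ]; exact ih.mul h

theorem mvo_le (h : Stb g U) : mvo g U ≤ U := by
  intro y hy
  obtain ⟨x, hx, rfl⟩ := mem_mvo.mp hy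
  exact U.sub_mem (h.mem hx) hx

theorem Stb_of_mv_le [FiniteDimensional K V] (h : mv g ≤ U) : Stb g U := by
  apply Stb_of
  intro x hx
  have : g x = (g x - x) + x := by abel
  rw [this]
  exact U.add_mem (h (sub_mem_mv _ _)) hx

/-- the subgroup stabilizing a subspace -/
def stbG (U : Submodule K V) : Subgroup (V ≃ₗ[K] V) where
  carrier := {g | Stb g U}
  one_mem' := Stb_one
  mul_mem' := Stb.mul
  inv_mem' := Stb.inv

theorem mem_stbG : g ∈ stbG U ↔ Stb g U := Iff.rfl

theorem mv_conj_of_comm (hc : h * g = g * h) : Stb h (mv g) := by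
  unfold Stb
  rw [← mv_conj, hc, mul_inv_cancel_right]

theorem conj_mv_stb (hs : Stb h (mv g)) : mv (h * g * h⁻¹) = mv g := by rw [mv_conj]; exact hs

theorem mvo_stb_of_comm (hc : h * g = g * h) (hs : Stb h U) : Stb h (mvo g U) := by
  unfold Stb
  have h1 : ∀ x, h (g x) = g (h x) := fun x => by
    rw [← LinearEquiv.mul_apply, hc, LinearEquiv.mul_apply]
  apply le_antisymm
  · rintro _ ⟨y, hy, rfl⟩
    obtain ⟨x, hx, rfl⟩ := mem_mvo.mp hy
    exact mem_mvo.mpr ⟨h x, hs.mem hx, by simp [h1]⟩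
  · intro y hy
    obtain ⟨x, hx, rfl⟩ := mem_mvo.mp hy
    refine ⟨g (h⁻¹ x) - h⁻¹ x, sub_mem_mvo g (hs.inv.mem hx), ?_⟩
    simp [h1, apply_inv_self']

end mvbasics

namespace UData

section gu

variable {K V : Type} [Field K] [Finite K] [AddCommGroup V] [Module K V] [Finite V] (D : UData K V)

/-- the unitary group -/
def GU : Subgroup (V ≃ₗ[K] V) where
  carrier := {g | ∀ x y, D.B (g x) (g y) = D.B x y}
  one_mem' := fun x y => rfl
  mul_mem' := by
    intro a b ha hb x y
    rw [LinearEquiv.mul_apply, LinearEquiv.mul_apply, ha, hb]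
  inv_mem' := by
    intro g hg x y
    rw [← hg, apply_inv_self', apply_inv_self']

theorem GU_apply {g : V ≃ₗ[K] V} (hg : g ∈ D.GU) (x y : V) : D.B (g x) (g y) = D.B x y := hg x y

theorem mem_GU {g : V ≃ₗ[K] V} : g ∈ D.GU ↔ ∀ x y, D.B (g x) (g y) = D.B x y := Iff.rfl

variable {D} {g h : V ≃ₗ[K] V} {U W : Submodule K V}

theorem mem_perp_mv (hg : g ∈ D.GU) {y : V} : y ∈ D.perp (mv g) ↔ g y = y := by
  constructor
  · intro hy
    have : g y - y = 0 := by
      apply D.nondeg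
      intro z
      have h1 := hy _ (sub_mem_mv g (g⁻¹ z))
      rw [D.B_sub_left, apply_inv_self'] at h1
      have h2 := D.GU_apply hg (g⁻¹ z) y
      rw [apply_inv_self'] at h2
      rw [map_sub, h2, ← neg_sub, h1, neg_zero]
    exact sub_eq_zero.mp this
  · intro hy u hu
    obtain ⟨x, rfl⟩ := mem_mv.mp hu
    rw [D.B_sub_left]
    conv_lhs => enter [1]; rw [← hy]
    rw [D.GU_apply hg, sub_self]

theorem perp_stb (hg : g ∈ D.GU) (hs : Stb g U) : Stb g (D.perp U) := by
  haveI := D.fd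
  apply Stb_of
  intro x hx u hu
  have h1 := D.GU_apply hg (g⁻¹ u) x
  rw [apply_inv_self'] at h1
  rw [h1]
  exact hx _ (hs.inv.mem hu)

theorem ND.map (hg : g ∈ D.GU) (h : D.ND U) : D.ND (U.map g.toLinearMap) := by
  apply ND_of
  intro x
  obtain ⟨u, hu, hx⟩ := h.exists (g⁻¹ x)
  refine ⟨g u, ⟨u, hu, rfl⟩, ?_⟩
  rintro _ ⟨w, hw, rfl⟩
  have h2 : x - g u = g (g⁻¹ x - u) := by rw [map_sub, apply_inv_self']
  rw [h2]
  exact (D.GU_apply hg _ _).trans (hx w hw)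

theorem ND_mv (hg : g ∈ D.GU) (ho : ¬ D.p ∣ orderOf g) : D.ND (mv g) := by
  apply ND_of
  intro x
  set N := orderOf g with hN
  have hN0 : (N : K) ≠ 0 := D.natCast_ne_zero ho
  set S := ∑ i ∈ Finset.range N, (g ^ i) x with hS
  have hfix : g S = S := by
    have h1 : g S = ∑ i ∈ Finset.range N, (g ^ (i + 1)) x := by
      rw [hS, map_sum]
      refine Finset.sum_congr rfl fun i _ => ?_
      rw [pow_succ', LinearEquiv.mul_apply]
    have h2 := Finset.sum_range_succ (fun i => (g ^ i) x) N
    have h3 := Finset.sum_range_succ' (fun i => (g ^ i) x) N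
    rw [h2] at h3
    rw [h1, hS]
    simp only [hN, pow_orderOf_eq_one, pow_zero] at h3 ⊢
    exact (add_right_cancel h3).symm
  refine ⟨x - (N : K)⁻¹ • S, ?_, ?_⟩
  · have h1 : x - (N : K)⁻¹ • S = (N : K)⁻¹ • ∑ i ∈ Finset.range N, (x - (g ^ i) x) := by
      rw [Finset.sum_sub_distrib, Finset.sum_const, Finset.card_range, smul_sub, ← hS,
        ← Nat.cast_smul_eq_nsmul K, smul_smul, inv_mul_cancel₀ hN0, one_smul]
    rw [h1]
    refine Submodule.smul_mem _ _ (Submodule.sum_mem _ fun i _ => ?_)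
    rw [← neg_sub]
    exact Submodule.neg_mem _ (mv_pow_le g i (sub_mem_mv _ _))
  · rw [mem_perp_mv hg, sub_sub_cancel, map_smul, hfix]

theorem exists_res (hg : g ∈ D.GU) (hU : D.ND U) (hs : Stb g U) :
    ∃ g' ∈ D.GU, (∀ x ∈ U, g' x = g x) ∧ ∀ x ∈ D.perp U, g' x = x := by
  haveI := D.fd
  set P := U.projectionOnto (D.perp U) hU with hP
  set P := U.subtype ∘ₗ P with hPP
  have hP1 : ∀ x ∈ U, P x = x := fun x hx => by
    simp [hPP, hP, Submodule.projectionOnto_apply_left hU ⟨x, hx⟩]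
  have hP2 : ∀ x ∈ D.perp U, P x = 0 := fun x hx => by
    simp [hPP, hP, Submodule.projectionOnto_apply_right hU ⟨x, hx⟩]
  set T : V →ₗ[K] V := g.toLinearMap ∘ₗ P + (LinearMap.id - P) with hT
  have hT1 : ∀ x ∈ U, T x = g x := fun x hx => by simp [hT, hP1 x hx]
  have hT2 : ∀ x ∈ D.perp U, T x = x := fun x hx => by simp [hT, hP2 x hx]
  have hB : ∀ x y, D.B (T x) (T y) = D.B x y := by
    intro x y
    obtain ⟨u, hu, hx⟩ := hU.exists x
    obtain ⟨w, hw, hy⟩ := hU.exists y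
    obtain ⟨x', rfl⟩ : ∃ x', x = u + x' := ⟨x - u, by abel⟩
    obtain ⟨y', rfl⟩ : ∃ y', y = w + y' := ⟨y - w, by abel⟩
    rw [add_sub_cancel_left] at hx hy
    simp only [map_add, hT1 u hu, hT1 w hw, hT2 _ hx, hT2 _ hy, D.B_add_left, D.GU_apply hg,
      hy u hu, hy _ (hs.mem hu), D.B_symm_zero (hx w hw), D.B_symm_zero (hx _ (hs.mem hw))]
  have hinj : Function.Injective T := by
    rw [injective_iff_map_eq_zero]
    intro x hx
    apply D.nondeg
    intro y
    rw [← hB, hx, map_zero]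
  exact ⟨LinearEquiv.ofInjectiveEndo T hinj, fun x y => hB x y, fun x hx => hT1 x hx, fun x hx => hT2 x hx⟩

theorem ext_ND {a b : V ≃ₗ[K] V} (hU : D.ND U) (h1 : ∀ x ∈ U, a x = b x) (h2 : ∀ x ∈ D.perp U, a x = b x) :
    a = b := by
  ext x
  obtain ⟨u, hu, hx⟩ := hU.exists x
  have h3 : x = u + (x - u) := by abel
  rw [h3, map_add, map_add, h1 u hu, h2 _ hx]

theorem pow_fix_of {a : V ≃ₗ[K] V} {x : V} (h : a x = x) (m : ℕ) : (a ^ m) x = x := by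
  induction m with
  | zero => rfl
  | succ k ih => rw [pow_succ, LinearEquiv.mul_apply, h, ih]

theorem res_pow {g' : V ≃ₗ[K] V} (hU : D.ND U) (hs : Stb g U) (h1 : ∀ x ∈ U, g' x = g x)
    (h2 : ∀ x ∈ D.perp U, g' x = x) {m : ℕ} (hm : g ^ m = 1) : g' ^ m = 1 := by
  apply ext_ND hU
  · intro x hx
    have h3 : ∀ k : ℕ, (g' ^ k) x = (g ^ k) x := by
      intro k
      induction k with
      | zero => rfl
      | succ k ih =>
        rw [pow_succ', pow_succ', LinearEquiv.mul_apply, LinearEquiv.mul_apply, ih,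
          h1 _ ((hs.pow k).mem hx)]
    rw [h3, hm]
  · intro x hx
    rw [pow_fix_of (h2 x hx)]; rfl

theorem res_mv {g' : V ≃ₗ[K] V} (hU : D.ND U) (h1 : ∀ x ∈ U, g' x = g x)
    (h2 : ∀ x ∈ D.perp U, g' x = x) : mv g' = mvo g U := by
  ext y
  rw [mem_mv, mem_mvo]
  constructor
  · rintro ⟨x, rfl⟩
    obtain ⟨u, hu, hx⟩ := hU.exists x
    refine ⟨u, hu, ?_⟩
    have h3 : x = u + (x - u) := by abel
    rw [h3, map_add, h1 u hu, h2 _ hx]; abel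
  · rintro ⟨x, hx, rfl⟩
    exact ⟨x, by rw [h1 x hx]⟩

theorem ND_mvo (hg : g ∈ D.GU) (ho : ¬ D.p ∣ orderOf g) (hU : D.ND U) (hs : Stb g U) : D.ND (mvo g U) := by
  obtain ⟨g', hg', h1, h2⟩ := exists_res hg hU hs
  rw [← res_mv hU h1 h2]
  apply ND_mv hg'
  intro h3
  exact ho (h3.trans (orderOf_dvd_of_pow_eq_one (res_pow hU hs h1 h2 (pow_orderOf_eq_one g))))

end gu

end UData

namespace UData

section count

variable {K V : Type} [Field K] [Finite K] [AddCommGroup V] [Module K V] [Finite V] (D : UData K V)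

open Polynomial in
theorem norm_aux : (∀ a : K, a ≠ 0 → D.φ a = a → Nat.card {x : K // x * D.φ x = a} = D.q + 1) ∧
    Nat.card {a : K // a ≠ 0 ∧ D.φ a = a} = D.q - 1 := by
  classical
  haveI := Fintype.ofFinite K
  have hq := D.two_le_q
  have hcard : Fintype.card K = D.q ^ 2 := by rw [← D.hcard, Nat.card_eq_fintype_card]
  have hroots : ∀ (m : ℕ) (c : K), 0 < m → (Finset.univ.filter fun x : K => x ^ m = c).card ≤ m := by
    intro m c hm
    refine le_trans (Finset.card_le_card (t := (Polynomial.nthRoots m c).toFinset) ?_)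
      ((Multiset.toFinset_card_le _).trans (Polynomial.card_nthRoots m c))
    intro x hx
    rw [Multiset.mem_toFinset, Polynomial.mem_nthRoots hm]
    simpa using hx
  set F := Finset.univ.filter fun a : K => a ≠ 0 ∧ D.φ a = a with hF
  have hFle : F.card ≤ D.q - 1 := by
    refine le_trans (Finset.card_le_card ?_) (hroots (D.q - 1) 1 (by omega))
    intro a ha
    simp only [hF, Finset.mem_filter, Finset.mem_univ, true_and] at ha ⊢
    have h1 := ha.2
    rw [D.hφ] at h1
    have h2 : a ^ (D.q - 1) * a = 1 * a := by
      rw [← pow_succ, Nat.sub_add_cancel (by omega), h1, one_mul]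
    exact mul_right_cancel₀ ha.1 h2
  have hfib : ∀ a : K, (Finset.univ.filter fun x : K => x * D.φ x = a).card ≤ D.q + 1 := by
    intro a
    refine le_trans (Finset.card_le_card ?_) (hroots (D.q + 1) a (by omega))
    intro x hx
    simp only [Finset.mem_filter, Finset.mem_univ, true_and, D.hφ] at hx ⊢
    rw [pow_succ', hx]
  have hsum : ∑ a ∈ F, (Finset.univ.filter fun x : K => x * D.φ x = a).card = D.q ^ 2 - 1 := by
    have h0 : (Finset.univ.filter fun x : K => x ≠ 0).card = D.q ^ 2 - 1 := by
      rw [Finset.filter_ne', Finset.card_erase_of_mem (Finset.mem_univ _), Finset.card_univ, hcard]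
    rw [← h0, Finset.card_eq_sum_card_fiberwise (f := fun x => x * D.φ x) (t := F)]
    · refine Finset.sum_congr rfl fun a ha => ?_
      congr 1
      ext x
      simp only [hF, Finset.mem_filter, Finset.mem_univ, true_and] at ha ⊢
      constructor
      · intro h
        refine ⟨?_, h⟩
        rintro rfl
        rw [zero_mul] at h
        exact ha.1 h.symm
      · exact fun h => h.2
    · intro x hx
      simp only [Finset.coe_filter, Finset.mem_univ, true_and, Set.mem_ofPred_eq, hF] at hx ⊢
      refine ⟨mul_ne_zero hx (by rwa [_root_.map_ne_zero]), ?_⟩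
      rw [map_mul, D.phi_phi, mul_comm]
  have hle : ∑ a ∈ F, (Finset.univ.filter fun x : K => x * D.φ x = a).card ≤ ∑ a ∈ F, (D.q + 1) :=
    Finset.sum_le_sum fun a _ => hfib a
  have hsq : D.q ^ 2 - 1 = (D.q - 1) * (D.q + 1) := by
    obtain ⟨k, hk⟩ : ∃ k, D.q = k + 1 := ⟨D.q - 1, by omega⟩
    rw [hk, Nat.add_sub_cancel]
    have : (k + 1) ^ 2 = k * (k + 1 + 1) + 1 := by ring
    omega
  have hFc : F.card = D.q - 1 := by
    apply le_antisymm hFle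
    rw [hsum, Finset.sum_const, smul_eq_mul, hsq] at hle
    exact Nat.le_of_mul_le_mul_right hle (by omega)
  have hall : ∀ a ∈ F, (Finset.univ.filter fun x : K => x * D.φ x = a).card = D.q + 1 := by
    apply (Finset.sum_eq_sum_iff_of_le fun a _ => hfib a).mp
    rw [hsum, Finset.sum_const, smul_eq_mul, hsq, hFc]
  refine ⟨?_, ?_⟩
  · intro a ha ha'
    rw [Nat.card_eq_fintype_card, Fintype.card_subtype]
    exact hall a (by simp [hF, ha, ha'])
  · rw [Nat.card_eq_fintype_card, Fintype.card_subtype]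
    exact hFc

theorem norm_fiber {a : K} (h : a ≠ 0) (h' : D.φ a = a) : Nat.card {x : K // x * D.φ x = a} = D.q + 1 :=
  D.norm_aux.1 a h h'

theorem phi_norm (x : K) : D.φ (x * D.φ x) = x * D.φ x := by rw [map_mul, D.phi_phi, mul_comm]

theorem exists_trace_ne : ∃ x : K, x + D.φ x ≠ 0 := by
  classical
  haveI := Fintype.ofFinite K
  by_contra! h
  have h1 : Nat.card {a : K // a ≠ 0 ∧ D.φ a = a} = D.q - 1 := D.norm_aux.2
  -- 1 is fixed so char 2 so all fixed
  have h2 : (1 : K) + 1 = 0 := by simpa using h 1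
  have h3 : ∀ a : K, D.φ a = a := by
    intro a
    have h4 : a + a = 0 := by rw [← two_mul, ← one_add_one_eq_two, h2, zero_mul]
    have h5 := h a
    exact (add_left_cancel (h4.trans h5.symm)).symm
  have h6 : Nat.card {a : K // a ≠ 0 ∧ D.φ a = a} = D.q ^ 2 - 1 := by
    rw [← D.hcard, Nat.card_eq_fintype_card, Nat.card_eq_fintype_card, Fintype.card_subtype]
    simp only [h3, and_true, Finset.filter_ne']
    rw [Finset.card_erase_of_mem (Finset.mem_univ _), Finset.card_univ]
  have hq := D.two_le_q
  have : D.q < D.q ^ 2 := by nlinarith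
  omega

theorem exists_norm {a : K} (h' : D.φ a = a) : ∃ x : K, x * D.φ x = a := by
  by_cases h : a = 0
  · exact ⟨0, by simp [h]⟩
  have h1 := D.norm_fiber h h'
  have : Nonempty {x : K // x * D.φ x = a} := by
    by_contra hne
    rw [not_nonempty_iff] at hne
    rw [Nat.card_of_isEmpty] at h1
    omega
  exact ⟨this.some.1, this.some.2⟩

theorem exists_norm_ne {a : K} (h : a ≠ 0) (h' : D.φ a = a) (c : K) : ∃ x : K, x * D.φ x = a ∧ x ≠ c := by
  by_contra! hne
  have h1 := D.norm_fiber h h'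
  have : Subsingleton {x : K // x * D.φ x = a} :=
    ⟨fun x y => Subtype.ext ((hne x.1 x.2).trans (hne y.1 y.2).symm)⟩
  have h2 := Finite.card_le_one_iff_subsingleton.mpr this
  have := D.two_le_q
  omega

variable {D} {U W : Submodule K V}

theorem B_self_fix (x : V) : D.φ (D.B x x) = D.B x x := (D.herm x x).symm

theorem exists_norm_one (hU : D.ND U) (h0 : U ≠ ⊥) : ∃ u ∈ U, D.B u u = 1 := by
  have h1 : ∃ u ∈ U, D.B u u ≠ 0 := by
    by_contra! h
    apply h0
    rw [eq_bot_iff]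
    intro x hx
    rw [Submodule.mem_bot]
    refine hU.eq_zero hx ?_
    intro y hy
    by_contra hne
    obtain ⟨c, hc⟩ := D.exists_trace_ne
    have h2 := h (y + (c * (D.B y x)⁻¹) • x) (U.add_mem hy (U.smul_mem _ hx))
    rw [D.B_add_left, map_add, map_add, D.B_smul_left, D.B_smul_left, map_smul, map_smul,
      h x hx, h y hy, smul_eq_mul, mul_assoc, inv_mul_cancel₀ hne, D.herm y x, ← map_mul, mul_assoc,
      inv_mul_cancel₀ hne] at h2
    apply hc
    simpa using h2
  obtain ⟨u, hu, hne⟩ := h1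
  obtain ⟨c, hc⟩ := D.exists_norm (a := (D.B u u)⁻¹) (by rw [map_inv₀, B_self_fix])
  refine ⟨c • u, U.smul_mem _ hu, ?_⟩
  rw [D.B_smul_left, map_smul, smul_eq_mul, ← mul_assoc, mul_comm (D.φ c), hc, inv_mul_cancel₀ hne]

/-- Splitting off a vector of norm 1. -/
theorem split_one (hU : D.ND U) {u : V} (hu : u ∈ U) (h1 : D.B u u = 1) :
    D.ND (U ⊓ D.perp (K ∙ u)) ∧ Module.finrank K U = Module.finrank K ↥(U ⊓ D.perp (K ∙ u)) + 1 ∧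
    ∀ x ∈ U, x - D.B u x • u ∈ U ⊓ D.perp (K ∙ u) := by
  haveI := D.fd
  have hkey : ∀ x ∈ U, x - D.B u x • u ∈ U ⊓ D.perp (K ∙ u) := by
    intro x hx
    refine ⟨U.sub_mem hx (U.smul_mem _ hu), ?_⟩
    intro w hw
    obtain ⟨c, rfl⟩ := Submodule.mem_span_singleton.mp hw
    rw [D.B_smul_left, map_sub, map_smul, h1]; simp
  refine ⟨?_, ?_, hkey⟩
  · apply ND_of
    intro x
    obtain ⟨y, hy, hxy⟩ := hU.exists x
    refine ⟨y - D.B u y • u, hkey y hy, ?_⟩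
    rintro z ⟨hz, hz'⟩
    have : x - (y - D.B u y • u) = (x - y) + D.B u y • u := by abel
    rw [this, map_add, hxy z hz, map_smul, D.B_symm_zero (hz' u (Submodule.mem_span_singleton_self u))]
    simp
  · have hu0 : u ≠ 0 := by rintro rfl; simp at h1
    have h3 : U = (U ⊓ D.perp (K ∙ u)) ⊔ (K ∙ u) := by
      apply le_antisymm
      · intro x hx
        refine Submodule.mem_sup.mpr ⟨_, hkey x hx, D.B u x • u, Submodule.mem_span_singleton.mpr ⟨_, rfl⟩, by abel⟩
      · refine sup_le inf_le_left ?_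
        rw [Submodule.span_singleton_le_iff_mem]; exact hu
    have h4 : (U ⊓ D.perp (K ∙ u)) ⊓ (K ∙ u) = ⊥ := by
      rw [eq_bot_iff]
      rintro x ⟨⟨_, hx⟩, hx'⟩
      obtain ⟨c, rfl⟩ := Submodule.mem_span_singleton.mp hx'
      have := hx u (Submodule.mem_span_singleton_self u)
      rw [map_smul, h1, smul_eq_mul, mul_one] at this
      simp [this]
    have h5 := Submodule.finrank_sup_add_finrank_inf_eq (U ⊓ D.perp (K ∙ u)) (K ∙ u)
    rw [h4, finrank_bot, finrank_span_singleton hu0, ← h3] at h5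
    omega

variable (D) in
/-- number of vectors of a given norm -/
noncomputable def cnt (U : Submodule K V) (c : K) : ℕ := Nat.card {x : V // x ∈ U ∧ D.B x x = c}

theorem cnt_split (hU : D.ND U) {u : V} (hu : u ∈ U) (h1 : D.B u u = 1) (c : K) [Fintype K] :
    D.cnt U c = ∑ l : K, D.cnt (U ⊓ D.perp (K ∙ u)) (c - l * D.φ l) := by
  obtain ⟨-, -, hkey⟩ := split_one hU hu h1
  unfold cnt
  rw [← Nat.card_sigma]
  refine Nat.card_congr ⟨fun x => ⟨D.B u x.1, x.1 - D.B u x.1 • u, hkey _ x.2.1, ?_⟩,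
    fun y => ⟨y.2.1 + y.1 • u, U.add_mem y.2.2.1.1 (U.smul_mem _ hu), ?_⟩, ?_, ?_⟩
  · have hx := x.2.2
    rw [map_sub, D.B_sub_left, D.B_sub_left, map_smul, map_smul, D.B_smul_left, D.B_smul_left, h1, hx,
      D.herm u x.1]
    simp only [smul_eq_mul]; ring
  · have hy := y.2.2.1.2 u (Submodule.mem_span_singleton_self u)
    have hy' := y.2.2.2
    rw [map_add, D.B_add_left, D.B_add_left, map_smul, map_smul, D.B_smul_left, D.B_smul_left, h1, hy, hy',
      D.B_symm_zero hy]
    simp only [smul_eq_mul]; ring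
  · intro x
    ext
    simp
  · rintro ⟨l, y, hy, hy'⟩
    have h2 := hy.2 u (Submodule.mem_span_singleton_self u)
    have h3 : D.B u (y + l • u) = l := by rw [map_add, map_smul, h1, h2]; simp
    simp only
    refine Sigma.ext h3 ?_
    simp only [h3, add_sub_cancel_right]
    congr!

open Classical in
theorem cnt_formula : ∀ (N : ℕ) (U : Submodule K V), D.ND U → Module.finrank K U = N → ∀ c, D.φ c = c →
    (D.q : ℤ) * D.cnt U c = (D.q : ℤ) ^ (2 * N) + (if c = 0 then (D.q : ℤ) - 1 else -1) * (-(D.q : ℤ)) ^ N := by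
  haveI := D.fd
  haveI := Fintype.ofFinite K
  intro N
  induction N with
  | zero =>
    intro U hU h0 c hc
    rw [Submodule.finrank_eq_zero] at h0
    subst h0
    by_cases h : c = 0
    · have : D.cnt ⊥ c = 1 := by
        unfold cnt
        rw [Nat.card_eq_one_iff_exists]
        refine ⟨⟨0, by simp [h]⟩, ?_⟩
        rintro ⟨x, hx, -⟩
        ext
        simpa using hx
      rw [this]; simp [h]
    · have : D.cnt (⊥ : Submodule K V) c = 0 := by
        unfold cnt
        rw [Nat.card_eq_zero]
        left
        refine ⟨?_⟩
        rintro ⟨x, hx, hx'⟩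
        rw [Submodule.mem_bot] at hx
        subst hx
        simp at hx'
        exact h hx'.symm
      simp [this, h]
  | succ N ih =>
    intro U hU hN c hc
    obtain ⟨u, hu, h1⟩ := exists_norm_one hU (by rintro rfl; simp at hN)
    obtain ⟨hND, hfr, -⟩ := split_one hU hu h1
    rw [cnt_split hU hu h1]
    have ih' := ih _ hND (by omega)
    push_cast
    rw [Finset.mul_sum]
    have h2 : ∀ l ∈ (Finset.univ : Finset K), (D.q : ℤ) * (D.cnt (U ⊓ D.perp (K ∙ u)) (c - l * D.φ l) : ℤ) =
        ((D.q : ℤ) ^ (2 * N) - (-(D.q : ℤ)) ^ N) + (if l * D.φ l = c then (D.q : ℤ) * (-(D.q : ℤ)) ^ N else 0) := by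
      intro l _
      rw [ih' _ (by rw [map_sub, D.phi_norm, hc])]
      by_cases h : l * D.φ l = c
      · simp only [h, sub_self, if_true]; ring
      · rw [if_neg h, if_neg (by rw [sub_eq_zero]; exact fun h' => h h'.symm)]; ring
    rw [Finset.sum_congr rfl h2, Finset.sum_add_distrib, Finset.sum_const, ← Finset.sum_filter, Finset.sum_const,
      Finset.card_univ, ← Nat.card_eq_fintype_card, D.hcard]
    by_cases h : c = 0
    · subst h
      have h3 : (Finset.univ.filter fun l : K => l * D.φ l = 0).card = 1 := by
        rw [Finset.card_eq_one]
        refine ⟨0, ?_⟩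
        ext l
        simp
      rw [h3]
      simp only [if_true, nsmul_eq_mul]
      push_cast
      ring
    · have h3 : (Finset.univ.filter fun l : K => l * D.φ l = c).card = D.q + 1 := by
        rw [← D.norm_fiber h hc, Nat.card_eq_fintype_card, Fintype.card_subtype]
      rw [h3, if_neg h]
      simp only [nsmul_eq_mul]
      push_cast
      ring

theorem cnt_one (hU : D.ND U) : (D.q : ℤ) * D.cnt U 1 =
    (-(D.q : ℤ)) ^ (Module.finrank K U) * ((-(D.q : ℤ)) ^ (Module.finrank K U) - 1) := by
  rw [cnt_formula _ U hU rfl 1 (map_one _), if_neg one_ne_zero, mul_sub, ← mul_pow, pow_mul, neg_mul_neg, sq]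
  ring

variable (D) in
/-- multiplicative order of -q mod s -/
noncomputable def e (s : ℕ) : ℕ := orderOf (-(D.q : ZMod s))

theorem q_ne_zero {s : ℕ} (hs : s.Prime) (hsp : s ≠ D.p) : (D.q : ZMod s) ≠ 0 := by
  rw [Ne, ZMod.natCast_eq_zero_iff, D.hq]
  intro h
  exact hsp ((Nat.prime_dvd_prime_iff_eq hs D.hp).mp (hs.dvd_of_dvd_pow h))

theorem dvd_cnt_iff {s : ℕ} (hs : s.Prime) (hsp : s ≠ D.p) (hU : D.ND U) :
    s ∣ D.cnt U 1 ↔ D.e s ∣ Module.finrank K U := by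
  haveI : Fact s.Prime := ⟨hs⟩
  have h1 := congrArg (fun z : ℤ => (z : ZMod s)) (cnt_one hU)
  push_cast at h1
  have h2 := q_ne_zero (D := D) hs hsp
  unfold e
  rw [orderOf_dvd_iff_pow_eq_one, ← ZMod.natCast_eq_zero_iff, ← sub_eq_zero (b := (1 : ZMod s))]
  constructor
  · intro h
    rw [h, mul_zero] at h1
    exact (mul_eq_zero.mp h1.symm).resolve_left (pow_ne_zero _ (neg_ne_zero.mpr h2))
  · intro h
    rw [h, mul_zero] at h1
    exact (mul_eq_zero.mp h1).resolve_left h2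

theorem e_dvd {s : ℕ} (hs : s.Prime) (hsp : s ≠ D.p) : D.e s ∣ s - 1 := by
  haveI : Fact s.Prime := ⟨hs⟩
  unfold e
  exact orderOf_dvd_of_pow_eq_one (ZMod.pow_card_sub_one_eq_one (neg_ne_zero.mpr (q_ne_zero hs hsp)))

theorem e_pos {s : ℕ} (hs : s.Prime) (hsp : s ≠ D.p) : 0 < D.e s :=
  Nat.pos_of_dvd_of_pos (e_dvd hs hsp) (by have := hs.two_le; omega)

theorem e_lt {s : ℕ} (hs : s.Prime) (hsp : s ≠ D.p) : D.e s + 1 ≤ s := by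
  have := Nat.le_of_dvd (by have := hs.two_le; omega) (e_dvd (D := D) hs hsp)
  have := hs.two_le; omega

theorem e_eq_one_iff {s : ℕ} (hs : s.Prime) (hsp : s ≠ D.p) : D.e s = 1 ↔ s ∣ D.q + 1 := by
  unfold e
  rw [orderOf_eq_one_iff, ← ZMod.natCast_eq_zero_iff]
  push_cast
  constructor
  · intro h; rw [← h]; ring
  · intro h; linear_combination -h

/-- R -/
theorem R {s : ℕ} (hs : s.Prime) (hsp : s ≠ D.p) {g : V ≃ₗ[K] V} (hg : g ∈ D.GU) {j : ℕ}
    (hj : g ^ (s ^ j) = 1) : D.e s ∣ Module.finrank K (mv g) := by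
  haveI : Fact s.Prime := ⟨hs⟩
  haveI := D.fd
  have ho : ¬ D.p ∣ orderOf g := by
    intro h
    have := h.trans (orderOf_dvd_of_pow_eq_one hj)
    exact hsp ((Nat.prime_dvd_prime_iff_eq D.hp hs).mp (D.hp.dvd_of_dvd_pow this)).symm
  have hND := ND_mv hg ho
  rw [← dvd_cnt_iff hs hsp hND]
  have hst : ∀ h ∈ Subgroup.zpowers g, Stb h (mv g) ∧ h ∈ D.GU := by
    intro h hh
    refine ⟨?_, (Subgroup.zpowers_le.mpr hg) hh⟩
    exact (Subgroup.zpowers_le (H := stbG (mv g))).mpr (Stb_of_mv_le le_rfl) hh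
  let X := {x : V // x ∈ mv g ∧ D.B x x = 1}
  letI : MulAction (Subgroup.zpowers g) X :=
    { smul := fun h x => ⟨h.1 x.1, (hst h.1 h.2).1.mem x.2.1, by rw [D.GU_apply (hst h.1 h.2).2]; exact x.2.2⟩
      one_smul := fun x => rfl
      mul_smul := fun a b x => rfl }
  have hP : IsPGroup s (Subgroup.zpowers g) := by
    rw [IsPGroup.iff_card]
    rw [Nat.card_zpowers]
    obtain ⟨k, _, hk⟩ := (Nat.dvd_prime_pow hs).mp (orderOf_dvd_of_pow_eq_one hj)
    exact ⟨k, hk⟩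
  have h1 := hP.card_modEq_card_fixedPoints X
  have h2 : Nat.card (MulAction.fixedPoints (Subgroup.zpowers g) X) = 0 := by
    rw [Nat.card_eq_zero]
    left
    refine ⟨?_⟩
    rintro ⟨⟨x, hx, hx1⟩, hfix⟩
    have h3 : g x = x := congrArg Subtype.val (hfix ⟨g, Subgroup.mem_zpowers g⟩)
    have h4 := hND.eq_zero hx ((mem_perp_mv hg).mpr h3)
    rw [h4] at hx1
    simp at hx1
  rw [h2] at h1
  exact (Nat.modEq_zero_iff_dvd).mp h1

theorem not_p_dvd_of_pow {s : ℕ} (hs : s.Prime) (hsp : s ≠ D.p) {g : V ≃ₗ[K] V} {j : ℕ}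
    (hj : g ^ (s ^ j) = 1) : ¬ D.p ∣ orderOf g := by
  intro h
  have := h.trans (orderOf_dvd_of_pow_eq_one hj)
  exact hsp ((Nat.prime_dvd_prime_iff_eq D.hp hs).mp (D.hp.dvd_of_dvd_pow this)).symm

theorem Ro {s : ℕ} (hs : s.Prime) (hsp : s ≠ D.p) {g : V ≃ₗ[K] V} (hg : g ∈ D.GU) {j : ℕ}
    (hj : g ^ (s ^ j) = 1) (hU : D.ND U) (hst : Stb g U) : D.e s ∣ Module.finrank K (mvo g U) := by
  obtain ⟨g', hg', h1, h2⟩ := exists_res hg hU hst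
  rw [← res_mv hU h1 h2]
  exact R hs hsp hg' (res_pow hU hst h1 h2 hj)

/-- small subspaces are fixed -/
theorem Ro_triv {s : ℕ} (hs : s.Prime) (hsp : s ≠ D.p) {g : V ≃ₗ[K] V} (hg : g ∈ D.GU) {j : ℕ}
    (hj : g ^ (s ^ j) = 1) (hU : D.ND U) (hst : Stb g U) (hlt : Module.finrank K (mvo g U) < D.e s) :
    ∀ x ∈ U, g x = x := by
  haveI := D.fd
  rw [← mvo_eq_bot, ← Submodule.finrank_eq_zero (R := K)]
  exact Nat.eq_zero_of_dvd_of_lt (Ro hs hsp hg hj hU hst) hlt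

end count

end UData

namespace UData
section exist
variable {K V : Type} [Field K] [Finite K] [AddCommGroup V] [Module K V] [Finite V] {D : UData K V}
  {g h : V ≃ₗ[K] V} {U W : Submodule K V}

theorem exists_GU_of_lin (T : V →ₗ[K] V) (hT : ∀ y z, D.B (T y) (T z) = D.B y z) :
    ∃ g ∈ D.GU, ∀ y, g y = T y := by
  haveI := D.fd
  have hinj : Function.Injective T := by
    rw [← LinearMap.ker_eq_bot, LinearMap.ker_eq_bot']
    intro y hy
    apply D.nondeg
    intro z
    rw [← hT, hy, map_zero]
  refine ⟨LinearEquiv.ofInjectiveEndo T hinj, ?_, fun y => rfl⟩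
  intro y z
  exact hT y z

theorem exists_refl (x : V) (a : K) (h : a + D.φ a + a * D.φ a * D.B x x = 0) :
    ∃ g ∈ D.GU, ∀ y, g y = y + (a * D.B x y) • x := by
  obtain ⟨g, hg, h2⟩ := exists_GU_of_lin (D := D) (LinearMap.id + (a • D.B x).smulRight x) (by
    intro y z
    simp only [LinearMap.add_apply, LinearMap.id_apply, LinearMap.smulRight_apply, LinearMap.smul_apply,
      D.B_add_left, map_add, D.B_smul_left, map_smul, smul_eq_mul, map_mul]
    rw [D.herm x y]
    linear_combination (D.φ (D.B x y)) * D.B x z * h)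
  exact ⟨g, hg, fun y => by rw [h2]; rfl⟩

/-- the elements of GU acting trivially on the orthogonal of `E` -/
def GE (D : UData K V) (E : Submodule K V) : Subgroup (V ≃ₗ[K] V) where
  carrier := {g | g ∈ D.GU ∧ ∀ x ∈ D.perp E, g x = x}
  one_mem' := ⟨D.GU.one_mem, fun x _ => rfl⟩
  mul_mem' := by
    rintro a b ⟨ha, ha'⟩ ⟨hb, hb'⟩
    refine ⟨D.GU.mul_mem ha hb, fun x hx => ?_⟩
    rw [LinearEquiv.mul_apply, hb' x hx, ha' x hx]
  inv_mem' := by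
    rintro a ⟨ha, ha'⟩
    refine ⟨D.GU.inv_mem ha, fun x hx => ?_⟩
    conv_lhs => rw [← ha' x hx]
    exact inv_apply_self' a x

theorem mv_le_of_triv (hg : g ∈ D.GU) (hE : D.ND U) (h : ∀ x ∈ D.perp U, g x = x) : mv g ≤ U := by
  rw [← hE.perp_perp]
  rw [D.le_perp_comm]
  intro x hx
  rw [mem_perp_mv hg]
  exact h x hx

theorem GE_trans_aux {E : Submodule K V} {u w : V} (hu : u ∈ E) (hw : w ∈ E) (h1 : D.B u u = 1) (h2 : D.B w w = 1)
    (h3 : D.B w u ≠ 1) : ∃ g ∈ GE D E, g u = w := by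
  have h4 : D.B u w = D.φ (D.B w u) := D.herm w u
  have hc : D.B w u - 1 ≠ 0 := sub_ne_zero.mpr h3
  have hc' : D.φ (D.B w u) - 1 ≠ 0 := by
    rw [← map_one D.φ, ← map_sub]; exact (map_ne_zero D.φ).mpr hc
  obtain ⟨g, hg, hgy⟩ := exists_refl (D := D) (w - u) (1 / (D.B w u - 1)) (by
    rw [map_div₀, map_one, map_sub, map_one, D.B_sub_left, map_sub, map_sub, h1, h2, h4]
    field_simp
    ring)
  refine ⟨g, ⟨hg, ?_⟩, ?_⟩
  · intro x hx
    rw [hgy]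
    have : D.B (w - u) x = 0 := hx _ (E.sub_mem hw hu)
    simp [this]
  · rw [hgy, D.B_sub_left, h1, one_div_mul_cancel hc, one_smul, add_sub_cancel]

theorem GE_trans {E : Submodule K V} {u w : V} (hu : u ∈ E) (hw : w ∈ E) (h1 : D.B u u = 1) (h2 : D.B w w = 1) :
    ∃ g ∈ GE D E, g u = w := by
  by_cases h3 : D.B w u = 1
  · obtain ⟨η, hη, hη'⟩ := D.exists_norm_ne one_ne_zero (map_one _) 1
    have hmem : η • u ∈ E := E.smul_mem _ hu
    have hn : D.B (η • u) (η • u) = 1 := by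
      rw [D.B_smul_left, map_smul, h1, smul_eq_mul, mul_one, mul_comm]; exact hη
    obtain ⟨g, hg, hgu⟩ := GE_trans_aux (D := D) hu hmem h1 hn (by
      rw [D.B_smul_left, h1, mul_one]
      intro h; apply hη'
      have := congrArg D.φ h
      rwa [D.phi_phi, map_one] at this)
    obtain ⟨g', hg', hgu'⟩ := GE_trans_aux (D := D) hmem hw hn h2 (by
      rw [map_smul, h3, smul_eq_mul, mul_one]; exact hη')
    exact ⟨g' * g, (GE D E).mul_mem hg' hg, by rw [LinearEquiv.mul_apply, hgu, hgu']⟩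
  · exact GE_trans_aux hu hw h1 h2 h3

theorem exists_order {s : ℕ} (hs : s.Prime) (hsp : s ≠ D.p) {E : Submodule K V} (hE : D.ND E)
    (hfr : Module.finrank K E = D.e s) : ∃ g ∈ D.GU, orderOf g = s ∧ mv g = E := by
  haveI : Fact s.Prime := ⟨hs⟩
  haveI := D.fd
  have hpos := e_pos (D := D) hs hsp
  obtain ⟨u, hu, h1⟩ := exists_norm_one hE (by rintro rfl; simp at hfr; omega)
  have hc : s ∣ Nat.card (GE D E) := by
    have h2 : s ∣ D.cnt E 1 := (dvd_cnt_iff hs hsp hE).mpr hfr.symm.dvd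
    refine h2.trans ?_
    have h3 : D.cnt E 1 = (MulAction.stabilizer (GE D E) u).index := by
      rw [MulAction.index_stabilizer, cnt, ← Nat.card_coe_set_eq]
      apply Nat.card_congr
      apply Equiv.subtypeEquivRight
      intro x
      constructor
      · rintro ⟨hx, hx1⟩
        obtain ⟨g, hg, rfl⟩ := GE_trans hu hx h1 hx1
        exact ⟨⟨g, hg⟩, rfl⟩
      · rintro ⟨⟨g, hg⟩, rfl⟩
        constructor
        · have : Stb g E := Stb_of_mv_le (mv_le_of_triv hg.1 hE hg.2)
          exact this.mem hu
        · rw [← h1]; exact hg.1 u u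
    rw [h3]
    exact Subgroup.index_dvd_card _
  obtain ⟨⟨g, hg⟩, ho⟩ := exists_prime_orderOf_dvd_card' s hc
  rw [Subgroup.orderOf_mk] at ho
  refine ⟨g, hg.1, ho, ?_⟩
  have hle := mv_le_of_triv hg.1 hE hg.2
  have h5 := R hs hsp hg.1 (j := 1) (by rw [pow_one, ← ho, pow_orderOf_eq_one])
  apply Submodule.eq_of_le_of_finrank_le hle
  rw [hfr]
  apply Nat.le_of_dvd _ h5
  rw [Nat.pos_iff_ne_zero, Ne, Submodule.finrank_eq_zero, mv_eq_bot]
  rintro rfl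
  rw [orderOf_one] at ho
  exact hs.one_lt.ne ho

theorem e_le_of_dvd {s : ℕ} (hs : s.Prime) (hsp : s ≠ D.p) (h : s ∣ Nat.card D.GU) : D.e s ≤ D.n := by
  haveI : Fact s.Prime := ⟨hs⟩
  haveI := D.fd
  obtain ⟨⟨g, hg⟩, ho⟩ := exists_prime_orderOf_dvd_card' s h
  rw [Subgroup.orderOf_mk] at ho
  have h5 := R hs hsp hg (j := 1) (by rw [pow_one, ← ho, pow_orderOf_eq_one])
  have h6 : 0 < Module.finrank K (mv g) := by
    rw [Nat.pos_iff_ne_zero, Ne, Submodule.finrank_eq_zero, mv_eq_bot]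
    rintro rfl
    rw [orderOf_one] at ho
    exact hs.one_lt.ne ho
  exact (Nat.le_of_dvd h6 h5).trans ((Submodule.finrank_le _).trans D.finrank_V.le)

theorem comm_of_perp (hg : g ∈ D.GU) (hh : h ∈ D.GU) (hp : mv g ≤ D.perp (mv h)) : g * h = h * g := by
  have hp' : mv h ≤ D.perp (mv g) := (D.le_perp_comm).mp hp
  ext x
  rw [LinearEquiv.mul_apply, LinearEquiv.mul_apply]
  have h1 := (mem_perp_mv hg).mp (hp' (sub_mem_mv h x))
  have h2 := (mem_perp_mv hh).mp (hp (sub_mem_mv g x))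
  rw [map_sub] at h1 h2
  have h3 : g (h x) = h x - x + g x := by rw [← h1]; abel
  have h4 : h (g x) = g x - x + h x := by rw [← h2]; abel
  rw [h3, h4]; abel

/-- permutation matrices -/
noncomputable def pm (D : UData K V) : Equiv.Perm (Fin D.n) →* (V ≃ₗ[K] V) where
  toFun τ := D.b.equiv D.b τ
  map_one' := by
    apply D.b.ext'
    intro i
    rw [Module.Basis.equiv_apply]; rfl
  map_mul' a b := by
    apply D.b.ext'
    intro i
    rw [LinearEquiv.mul_apply, Module.Basis.equiv_apply, Module.Basis.equiv_apply, Module.Basis.equiv_apply]; rfl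

theorem pm_apply (τ : Equiv.Perm (Fin D.n)) (i : Fin D.n) : D.pm τ (D.b i) = D.b (τ i) :=
  Module.Basis.equiv_apply _ _ _ _

theorem pm_mem (τ : Equiv.Perm (Fin D.n)) : D.pm τ ∈ D.GU := by
  intro x y
  have h2 : ∀ i : Fin D.n, ∀ y, D.B (D.pm τ (D.b i)) (D.pm τ y) = D.B (D.b i) y := by
    intro i y
    have : (D.B (D.pm τ (D.b i))).comp (D.pm τ).toLinearMap = D.B (D.b i) := by
      apply D.b.ext
      intro j
      rw [LinearMap.comp_apply]
      simp only [LinearEquiv.coe_coe, pm_apply, D.orth, τ.injective.eq_iff]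
    exact LinearMap.congr_fun this y
  rw [D.herm, D.herm y x]
  congr 1
  rw [← D.b.sum_repr x, map_sum, map_sum, map_sum]
  congr 1; ext i
  rw [map_smul, map_smul, map_smul]
  congr 1
  rw [D.herm, h2, ← D.herm]

/-- embedding of blocks of size e -/
noncomputable def blk {m e N : ℕ} (h : m * e ≤ N) : Fin m × Fin e ↪ Fin N :=
  finProdFinEquiv.toEmbedding.trans (Fin.castLEEmb h)

noncomputable def blkPerm {m e N : ℕ} (h : m * e ≤ N) : Equiv.Perm (Fin m) →* Equiv.Perm (Fin N) :=
  (Equiv.Perm.extendDomainHom (Equiv.ofInjective (blk h) (blk h).injective)).comp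
    { toFun := fun τ => τ.prodCongr (Equiv.refl (Fin e))
      map_one' := by ext x <;> rfl
      map_mul' := by intro a b; ext x <;> rfl }

theorem blkPerm_apply {m e N : ℕ} (h : m * e ≤ N) (τ : Equiv.Perm (Fin m)) (i : Fin m) (j : Fin e) :
    blkPerm h τ (blk h (i, j)) = blk h (τ i, j) := by
  unfold blkPerm
  simp only [MonoidHom.comp_apply]
  rw [Equiv.Perm.extendDomainHom_apply]
  have := Equiv.Perm.extendDomain_apply_image (τ.prodCongr (Equiv.refl (Fin e)))
    (Equiv.ofInjective (blk h) (blk h).injective) (i, j)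
  exact this

theorem blkPerm_apply_not {m e N : ℕ} (h : m * e ≤ N) (τ : Equiv.Perm (Fin m)) (x : Fin N)
    (hx : x ∉ Set.range (blk h)) : blkPerm h τ x = x := by
  unfold blkPerm
  simp only [MonoidHom.comp_apply]
  rw [Equiv.Perm.extendDomainHom_apply]
  exact Equiv.Perm.extendDomain_apply_not_subtype _ _ hx

theorem ND_span (S : Set (Fin D.n)) : D.ND (Submodule.span K (D.b '' S)) := by
  classical
  apply ND_of
  intro x
  refine ⟨∑ i : Fin D.n, if i ∈ S then D.b.repr x i • D.b i else 0, ?_, ?_⟩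
  · apply Submodule.sum_mem
    intro i _
    split_ifs with hi
    · exact Submodule.smul_mem _ _ (Submodule.subset_span ⟨i, hi, rfl⟩)
    · exact Submodule.zero_mem _
  · rw [D.mem_perp]
    intro u hu
    apply D.B_symm_zero
    induction hu using Submodule.span_induction with
    | zero => simp
    | add a b _ _ ha hb => rw [map_add, ha, hb, add_zero]
    | smul c a _ ha => rw [map_smul, ha, smul_zero]
    | mem a ha =>
      obtain ⟨i, hi, rfl⟩ := ha
      apply D.B_symm_zero
      conv_lhs => rw [← D.b.sum_repr x, ← Finset.sum_sub_distrib]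
      rw [map_sum]
      apply Finset.sum_eq_zero
      intro j _
      split_ifs with hj
      · simp
      · rw [sub_zero, map_smul, D.orth, if_neg (by rintro rfl; exact hj hi), smul_zero]

theorem perp_span {S T : Set (Fin D.n)} (h : Disjoint S T) :
    Submodule.span K (D.b '' S) ≤ D.perp (Submodule.span K (D.b '' T)) := by
  rw [Submodule.span_le]
  rintro _ ⟨i, hi, rfl⟩
  show D.b i ∈ D.perp _
  rw [D.mem_perp]
  intro u hu
  apply D.B_symm_zero
  induction hu using Submodule.span_induction with
  | zero => simp
  | add a b _ _ ha hb => rw [map_add, ha, hb, add_zero]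
  | smul c a _ ha => rw [map_smul, ha, smul_zero]
  | mem a ha =>
    obtain ⟨j, hj, rfl⟩ := ha
    rw [D.orth, if_neg]
    rintro rfl
    exact Set.disjoint_left.mp h hi hj

/-- block permutation matrices -/
theorem exists_blocks {m e : ℕ} (hme : m * e ≤ D.n) :
    ∃ (Ψ : Equiv.Perm (Fin m) →* (V ≃ₗ[K] V)) (E : Fin m → Submodule K V),
      (∀ τ, Ψ τ ∈ D.GU) ∧ (∀ i, D.ND (E i)) ∧ (∀ i, Module.finrank K (E i) = e) ∧
      (∀ i j, i ≠ j → E i ≤ D.perp (E j)) ∧ (∀ τ i, (E i).map (Ψ τ).toLinearMap = E (τ i)) ∧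
      (∀ τ i, τ i = i → ∀ x ∈ E i, Ψ τ x = x) ∧
      (∀ τ, mv (Ψ τ) ≤ ⨆ i ∈ τ.support, E i) := by
  classical
  haveI := D.fd
  let S : Fin m → Set (Fin D.n) := fun i => Set.range (fun j => blk hme (i, j))
  have hE : ∀ i, Submodule.span K (D.b '' (S i)) = Submodule.span K (Set.range fun j => D.b (blk hme (i, j))) := by
    intro i
    rw [← Set.range_comp]; rfl
  refine ⟨(D.pm).comp (blkPerm hme), fun i => Submodule.span K (D.b '' (S i)), fun τ => pm_mem _, fun i => ND_span _,
    ?_, ?_, ?_, ?_, ?_⟩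
  · intro i
    show Module.finrank K ↥(Submodule.span K (D.b '' S i)) = e
    rw [hE, finrank_span_eq_card, Fintype.card_fin]
    apply D.b.linearIndependent.comp
    intro j j' h
    have := (blk hme).injective h
    simpa using this
  · intro i j hij
    apply perp_span
    rw [Set.disjoint_left]
    rintro _ ⟨a, rfl⟩ ⟨b, hb⟩
    have := (blk hme).injective hb
    simp at this
    exact hij this.1.symm
  · intro τ i
    simp only [hE, Submodule.map_span, ← Set.range_comp]
    congr 2
    ext j
    show D.pm _ (D.b _) = _
    rw [pm_apply, blkPerm_apply]
  · intro τ i hi x hx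
    simp only [hE] at hx
    induction hx using Submodule.span_induction with
    | zero => simp
    | add a b _ _ ha hb => rw [map_add, ha, hb]
    | smul c a _ ha => rw [map_smul, ha]
    | mem a ha =>
      obtain ⟨j, rfl⟩ := ha
      show D.pm _ (D.b _) = _
      rw [pm_apply, blkPerm_apply, hi]
  · intro τ
    rw [mv_le_iff]
    intro x
    rw [← D.b.sum_repr x, map_sum, ← Finset.sum_sub_distrib]
    apply Submodule.sum_mem
    intro i _
    rw [map_smul, ← smul_sub]
    apply Submodule.smul_mem
    show D.pm _ (D.b _) - _ ∈ _
    rw [pm_apply]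
    by_cases hi : i ∈ Set.range (blk hme)
    · obtain ⟨⟨k, j⟩, rfl⟩ := hi
      rw [blkPerm_apply]
      by_cases hk : τ k = k
      · rw [hk, sub_self]; exact Submodule.zero_mem _
      · have h1 : k ∈ τ.support := Equiv.Perm.mem_support.mpr hk
        have h2 : τ k ∈ τ.support := Equiv.Perm.apply_mem_support.mpr h1
        apply Submodule.sub_mem
        · refine (le_iSup₂_of_le (f := fun i (_ : i ∈ τ.support) => Submodule.span K (D.b '' (S i))) (τ k) h2 le_rfl) ?_
          exact Submodule.subset_span ⟨_, ⟨j, rfl⟩, rfl⟩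
        · refine (le_iSup₂_of_le (f := fun i (_ : i ∈ τ.support) => Submodule.span K (D.b '' (S i))) k h1 le_rfl) ?_
          exact Submodule.subset_span ⟨_, ⟨j, rfl⟩, rfl⟩
    · rw [blkPerm_apply_not hme _ _ hi, sub_self]; exact Submodule.zero_mem _

/-- commuting elements of order `s`, minimal rank, permuted by block permutations -/
theorem exists_sigma {s m : ℕ} (hs : s.Prime) (hsp : s ≠ D.p) (hm : m * D.e s ≤ D.n) :
    ∃ (Ψ : Equiv.Perm (Fin m) →* (V ≃ₗ[K] V)) (σ : Fin m → (V ≃ₗ[K] V)),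
      (∀ τ, Ψ τ ∈ D.GU) ∧ (∀ i, σ i ∈ D.GU) ∧ (∀ i, orderOf (σ i) = s) ∧
      (∀ i, Module.finrank K (mv (σ i)) = D.e s) ∧
      (∀ i j, i ≠ j → mv (σ i) ≤ D.perp (mv (σ j))) ∧
      (∀ τ i, Ψ τ * σ i * (Ψ τ)⁻¹ = σ (τ i)) := by
  obtain ⟨Ψ, E, h1, h2, h3, h4, h5, h6, h7⟩ := exists_blocks (D := D) hm
  rcases Nat.eq_zero_or_pos m with rfl | hm0
  · exact ⟨Ψ, fun i => i.elim0, h1, fun i => i.elim0, fun i => i.elim0, fun i => i.elim0, fun i => i.elim0,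
      fun τ i => i.elim0⟩
  let o : Fin m := ⟨0, hm0⟩
  obtain ⟨g, hg, hgo, hgE⟩ := exists_order hs hsp (h2 o) (h3 o)
  have hcomm : ∀ τ, τ o = o → Ψ τ * g = g * Ψ τ := by
    intro τ hτ
    apply comm_of_perp (h1 τ) hg
    rw [D.le_perp_comm, hgE]
    intro x hx
    rw [mem_perp_mv (h1 τ)]
    exact h6 τ o hτ x hx
  have hmv : ∀ i, mv (Ψ (Equiv.swap o i) * g * (Ψ (Equiv.swap o i))⁻¹) = E i := by
    intro i
    rw [mv_conj, hgE, h5, Equiv.swap_apply_left]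
  refine ⟨Ψ, fun i => Ψ (Equiv.swap o i) * g * (Ψ (Equiv.swap o i))⁻¹, h1, ?_, ?_, ?_, ?_, ?_⟩
  · intro i
    exact D.GU.mul_mem (D.GU.mul_mem (h1 _) hg) (D.GU.inv_mem (h1 _))
  · intro i
    rw [← hgo]
    have := (MulAut.conj (Ψ (Equiv.swap o i))).orderOf_eq g
    rwa [MulAut.conj_apply] at this
  · intro i
    rw [hmv, h3]
  · intro i j hij
    rw [hmv, hmv]
    exact h4 i j hij
  · intro τ i
    have h8 := hcomm ((Equiv.swap o (τ i))⁻¹ * τ * Equiv.swap o i) (by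
      simp [Equiv.Perm.mul_apply, Equiv.swap_apply_left])
    have h9 : τ * Equiv.swap o i = Equiv.swap o (τ i) * ((Equiv.swap o (τ i))⁻¹ * τ * Equiv.swap o i) := by group
    calc Ψ τ * (Ψ (Equiv.swap o i) * g * (Ψ (Equiv.swap o i))⁻¹) * (Ψ τ)⁻¹
        = Ψ (τ * Equiv.swap o i) * g * (Ψ (τ * Equiv.swap o i))⁻¹ := by rw [map_mul]; group
      _ = Ψ (Equiv.swap o (τ i)) * (Ψ ((Equiv.swap o (τ i))⁻¹ * τ * Equiv.swap o i) * g) *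
          (Ψ ((Equiv.swap o (τ i))⁻¹ * τ * Equiv.swap o i))⁻¹ * (Ψ (Equiv.swap o (τ i)))⁻¹ := by
            rw [h9, map_mul]; group
      _ = _ := by rw [h8]; group

end exist
end UData

section orbcomb

theorem orb_count {X : Type*} [Finite X] {F Y : X → X} (hc : Function.Commute F Y) {Wt : Set X}
    (hF : Set.MapsTo F Wt Wt) (hY : Set.MapsTo Y Wt Wt) {χ : X} (hχ : χ ∈ Wt) {t s j v e : ℕ} (ht : t.Prime)
    (hs : s.Prime) (hYt : ∀ x, Y^[t ^ j] x = x) (hne : Y χ ≠ χ) (ho : 0 < Function.minimalPeriod F χ)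
    (heo : e ∣ Function.minimalPeriod F χ) (hoe : Function.minimalPeriod F χ ∣ e * s ^ v) (hes : Nat.Coprime s e) :
    t * e ≤ Wt.ncard ∨ t ∣ e := by
  set o := Function.minimalPeriod F χ with hodef
  have hcit : ∀ a b, Function.Commute F^[a] Y^[b] := fun a b => hc.iterate_iterate a b
  have hper : F^[o] χ = χ := Function.isPeriodicPt_minimalPeriod F χ
  have hFit : ∀ a, Set.MapsTo F^[a] Wt Wt := fun a => hF.iterate a
  have hYit : ∀ a, Set.MapsTo Y^[a] Wt Wt := fun a => hY.iterate a
  by_cases hA : ∃ b, Y χ = F^[b] χ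
  · obtain ⟨b, hb⟩ := hA
    have h1 : ∀ k, Y^[k] χ = F^[b * k] χ := by
      intro k
      induction k with
      | zero => rfl
      | succ k ih =>
        rw [Function.iterate_succ_apply', ih, ← Function.iterate_one Y, ← (hcit (b * k) 1) χ, Function.iterate_one, hb,
          ← Function.iterate_add_apply, mul_add, mul_one]
    have h2 : o ∣ b * t ^ j := by
      apply Function.IsPeriodicPt.minimalPeriod_dvd
      show F^[b * t ^ j] χ = χ
      rw [← h1, hYt]
    have h3 : ¬ o ∣ b := by
      intro h
      apply hne
      rw [hb]
      exact (Function.isPeriodicPt_minimalPeriod F χ).trans_dvd h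
    have h4 : t ∣ o := by
      by_contra h
      apply h3
      refine Nat.Coprime.dvd_of_dvd_mul_right ?_ h2
      exact Nat.Coprime.pow_right _ ((Nat.Prime.coprime_iff_not_dvd ht).mpr h).symm
    rcases (Nat.Prime.dvd_mul ht).mp (h4.trans hoe) with h5 | h5
    · exact Or.inr h5
    · left
      have h6 : t = s := (Nat.prime_dvd_prime_iff_eq ht hs).mp (ht.dvd_of_dvd_pow h5)
      subst h6
      have h7 : t * e ∣ o := hes.mul_dvd_of_dvd_of_dvd h4 heo
      refine (Nat.le_of_dvd ho h7).trans ?_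
      have : (Set.range (fun i : Fin o => F^[i] χ)) ⊆ Wt := by
        rintro _ ⟨i, rfl⟩; exact hFit i hχ
      refine le_trans ?_ (Set.ncard_le_ncard this (Set.toFinite _))
      rw [← Nat.card_coe_set_eq, Nat.card_range_of_injective, Nat.card_fin]
      intro a b hab
      ext
      exact Function.iterate_injOn_Iio_minimalPeriod (by exact a.2) (by exact b.2) hab
  · left
    push Not at hA
    have hYinj : Function.Injective Y := by
      have : t ^ j ≠ 0 := (pow_pos ht.pos j).ne'
      obtain ⟨k, hk⟩ := Nat.exists_eq_succ_of_ne_zero this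
      intro a b hab
      rw [← hYt a, ← hYt b, hk, Function.iterate_succ_apply, Function.iterate_succ_apply, hab]
    have key : ∀ d, 0 < d → d < t → ∀ c, Y^[d] χ ≠ F^[c] χ := by
      intro d hd hdt c h
      have hcop : Nat.Coprime d (t ^ j) := Nat.Coprime.pow_right _
        ((Nat.Prime.coprime_iff_not_dvd ht).mpr (Nat.not_dvd_of_pos_of_lt hd hdt)).symm
      rcases Nat.eq_or_lt_of_le (Nat.one_le_iff_ne_zero.mpr (pow_pos ht.pos j).ne') with h1 | h1
      · apply hne
        have := hYt χ
        rw [← h1] at this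
        exact this
      obtain ⟨k, -, hk⟩ := Nat.exists_mul_mod_eq_one_of_coprime hcop h1
      have h2 : ∀ k, Y^[d * k] χ = F^[c * k] χ := by
        intro k
        induction k with
        | zero => rfl
        | succ k ih =>
          rw [mul_add, mul_one, add_comm, Function.iterate_add_apply, ih, ← (hcit (c * k) d) χ, h,
            ← Function.iterate_add_apply, mul_add, mul_one]
      apply hA (c * k)
      rw [← h2, ← Nat.mod_add_div (d * k) (t ^ j), hk, Function.iterate_add_apply, Function.iterate_one]
      congr 1
      have : ∀ r, Y^[t ^ j * r] χ = χ := by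
        intro r
        rw [Function.iterate_mul]
        induction r with
        | zero => rfl
        | succ r ih => rw [Function.iterate_succ_apply', ih, hYt]
      exact (this _).symm
    have hsub : (Set.range (fun i : Fin o × Fin t => F^[i.1] (Y^[i.2] χ))) ⊆ Wt := by
      rintro _ ⟨i, rfl⟩; exact hFit _ (hYit _ hχ)
    have hle := Set.ncard_le_ncard hsub (Set.toFinite _)
    rw [← Nat.card_coe_set_eq, Nat.card_range_of_injective, Nat.card_prod, Nat.card_fin, Nat.card_fin] at hle
    · refine le_trans ?_ hle
      rw [mul_comm]
      exact Nat.mul_le_mul_right _ (Nat.le_of_dvd ho heo)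
    have hstep : ∀ (i i' : Fin o) (a b : ℕ), a < b → b < t → F^[i] (Y^[a] χ) ≠ F^[i'] (Y^[b] χ) := by
      intro i i' a b hab hb h
      have h1 := congrArg F^[o - i'] h
      rw [← Function.iterate_add_apply, ← Function.iterate_add_apply, Nat.sub_add_cancel i'.2.le, (hcit _ _) χ,
        (hcit _ _) χ, hper] at h1
      have h2 : Y^[b] χ = Y^[a] (Y^[b - a] χ) := by
        rw [← Function.iterate_add_apply, Nat.add_sub_cancel' hab.le]
      rw [h2] at h1
      exact key (b - a) (by omega) (by omega) _ (hYinj.iterate a h1).symm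
    rintro ⟨i, a⟩ ⟨i', b⟩ h
    simp only at h
    rcases lt_trichotomy (a : ℕ) b with hab | hab | hab
    · exact absurd h (hstep i i' a b hab b.2)
    · have hab' : a = b := Fin.ext hab
      subst hab'
      rw [(hcit _ _) χ, (hcit _ _) χ] at h
      have := hYinj.iterate a h
      have h5 := Function.iterate_injOn_Iio_minimalPeriod (f := F) (x := χ) (by exact i.2) (by exact i'.2) this
      rw [Fin.ext h5]
    · exact absurd h.symm (hstep i' i b a hab a.2)

end orbcomb

section charproj
variable {A Ω ι : Type*} [CommGroup A] [Fintype A] [Field Ω] [Fintype ι] [DecidableEq ι]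
  (ρ : A →* Matrix ι ι Ω)

/-- unnormalised character projector -/
noncomputable def chP (χ : A →* Ωˣ) : Matrix ι ι Ω := ∑ a, ((χ a⁻¹ : Ωˣ) : Ω) • ρ a

variable {ρ}

theorem mul_chP (χ : A →* Ωˣ) (a : A) : ρ a * chP ρ χ = ((χ a : Ωˣ) : Ω) • chP ρ χ := by
  unfold chP
  rw [Finset.mul_sum, Finset.smul_sum]
  refine Fintype.sum_equiv (Equiv.mulLeft a) _ _ ?_
  intro b
  rw [Equiv.coe_mulLeft, map_mul, mul_smul_comm, smul_smul, ← Units.val_mul, ← map_mul]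
  congr 3
  rw [← map_mul, mul_inv, mul_inv_cancel_left]

theorem chP_mul (χ : A →* Ωˣ) (a : A) : chP ρ χ * ρ a = ((χ a : Ωˣ) : Ω) • chP ρ χ := by
  rw [← mul_chP]
  unfold chP
  rw [Finset.mul_sum, Finset.sum_mul]
  refine Finset.sum_congr rfl fun b _ => ?_
  rw [mul_smul_comm, smul_mul_assoc, ← map_mul, ← map_mul, mul_comm]

theorem chP_mul_ne {χ ψ : A →* Ωˣ} (h : ψ ≠ χ) : chP ρ ψ * chP ρ χ = 0 := by
  obtain ⟨a, ha⟩ := DFunLike.ne_iff.mp h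
  have h1 : chP ρ ψ * (ρ a * chP ρ χ) = (chP ρ ψ * ρ a) * chP ρ χ := by rw [mul_assoc]
  rw [mul_chP, chP_mul, mul_smul_comm, smul_mul_assoc, ← sub_eq_zero, ← sub_smul, smul_eq_zero] at h1
  rcases h1 with h1 | h1
  · exact absurd (Units.ext (sub_eq_zero.mp h1)).symm ha
  · exact h1

theorem chP_mul_self (χ : A →* Ωˣ) : chP ρ χ * chP ρ χ = (Fintype.card A : Ω) • chP ρ χ := by
  conv_lhs => enter [1]; unfold chP
  rw [Finset.sum_mul]
  have : ∀ a ∈ Finset.univ, (((χ a⁻¹ : Ωˣ) : Ω) • ρ a) * chP ρ χ = chP ρ χ := by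
    intro a _
    rw [smul_mul_assoc, mul_chP, smul_smul, ← Units.val_mul, ← map_mul, inv_mul_cancel, map_one, Units.val_one, one_smul]
  rw [Finset.sum_congr rfl this, Finset.sum_const, Finset.card_univ, Nat.cast_smul_eq_nsmul]

theorem chP_indep {κ : Type*} (hA : (Fintype.card A : Ω) ≠ 0) {χ : κ → (A →* Ωˣ)} (hχ : Function.Injective χ)
    {w v : κ → (ι → Ω)} (hw : ∀ i, w i = chP ρ (χ i) *ᵥ v i) (h0 : ∀ i, w i ≠ 0) : LinearIndependent Ω w := by
  classical
  rw [linearIndependent_iff']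
  intro S g hg i hi
  have h1 := congrArg (fun x => chP ρ (χ i) *ᵥ x) hg
  simp only [Matrix.mulVec_sum, Matrix.mulVec_zero] at h1
  rw [Finset.sum_eq_single_of_mem i hi] at h1
  · rw [Matrix.mulVec_smul, hw, Matrix.mulVec_mulVec, chP_mul_self, Matrix.smul_mulVec, ← hw, smul_smul,
      smul_eq_zero] at h1
    rcases h1 with h1 | h1
    · rcases mul_eq_zero.mp h1 with h1 | h1
      · exact h1
      · exact absurd h1 hA
    · exact absurd h1 (h0 i)
  · intro j _ hj
    rw [Matrix.mulVec_smul, hw, Matrix.mulVec_mulVec, chP_mul_ne (fun h => hj (hχ h).symm), Matrix.zero_mulVec, smul_zero]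

theorem sum_chP [Fintype (A →* Ωˣ)] [HasEnoughRootsOfUnity Ω (Monoid.exponent A)] :
    ∑ χ : A →* Ωˣ, chP ρ χ = (Fintype.card A : Ω) • (1 : Matrix ι ι Ω) := by
  classical
  have hsum : ∀ a : A, a ≠ 1 → ∑ χ : A →* Ωˣ, ((χ a : Ωˣ) : Ω) = 0 := by
    intro a ha
    obtain ⟨ψ, hψ⟩ := CommGroup.exists_apply_ne_one_of_hasEnoughRootsOfUnity A Ω ha
    have h1 : ((ψ a : Ωˣ) : Ω) * ∑ χ : A →* Ωˣ, ((χ a : Ωˣ) : Ω) = ∑ χ : A →* Ωˣ, ((χ a : Ωˣ) : Ω) := by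
      rw [Finset.mul_sum]
      refine Fintype.sum_equiv (Equiv.mulLeft ψ) _ _ ?_
      intro χ
      rw [Equiv.coe_mulLeft, MonoidHom.mul_apply, Units.val_mul]
    have h2 : (((ψ a : Ωˣ) : Ω) - 1) * ∑ χ : A →* Ωˣ, ((χ a : Ωˣ) : Ω) = 0 := by rw [sub_mul, h1, one_mul, sub_self]
    rcases mul_eq_zero.mp h2 with h3 | h3
    · exact absurd (Units.ext (sub_eq_zero.mp h3)) hψ
    · exact h3
  unfold chP
  rw [Finset.sum_comm, Finset.sum_eq_single_of_mem (1 : A) (Finset.mem_univ _)]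
  · rw [← Finset.sum_smul, map_one]
    congr 1
    simp only [inv_one, map_one, Units.val_one, Finset.sum_const, Finset.card_univ, nsmul_eq_mul, mul_one]
    obtain ⟨eq⟩ := CommGroup.monoidHom_mulEquiv_of_hasEnoughRootsOfUnity A Ω
    rw [Fintype.card_congr eq.toEquiv]
  · intro a _ ha
    rw [← Finset.sum_smul, hsum a⁻¹ (by simpa using ha), zero_smul]

theorem rho_eq_one [HasEnoughRootsOfUnity Ω (Monoid.exponent A)] (hA : (Fintype.card A : Ω) ≠ 0) {b : A}
    (hb : ∀ χ : A →* Ωˣ, chP ρ χ ≠ 0 → χ b = 1) : ρ b = 1 := by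
  classical
  haveI : Finite (A →* Ωˣ) := by
    obtain ⟨eq⟩ := CommGroup.monoidHom_mulEquiv_of_hasEnoughRootsOfUnity A Ω
    exact Finite.of_equiv _ eq.toEquiv.symm
  haveI := Fintype.ofFinite (A →* Ωˣ)
  have h1 := sum_chP (ρ := ρ)
  have h2 : ρ b * ∑ χ : A →* Ωˣ, chP ρ χ = ∑ χ : A →* Ωˣ, chP ρ χ := by
    rw [Finset.mul_sum]
    refine Finset.sum_congr rfl fun χ _ => ?_
    rw [mul_chP]
    by_cases h : chP ρ χ = 0
    · rw [h, smul_zero]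
    · rw [hb χ h, Units.val_one, one_smul]
  rw [h1, mul_smul_comm, mul_one] at h2
  exact smul_right_injective _ hA h2

end charproj

theorem hom_zpow {A M : Type*} [CommGroup A] [CommGroup M] (χ : A →* M) (k : ℤ) :
    (orderOf χ : ℤ) ∣ k ↔ ∀ a, (χ a) ^ k = 1 := by
  rw [orderOf_dvd_iff_zpow_eq_one]
  constructor
  · intro h a
    exact DFunLike.congr_fun h a
  · intro h
    exact MonoidHom.ext h

theorem hom_pow {A M : Type*} [CommGroup A] [CommGroup M] (χ : A →* M) (k : ℕ) :
    orderOf χ ∣ k ↔ ∀ a, (χ a) ^ k = 1 := by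
  rw [← Int.natCast_dvd_natCast, hom_zpow]
  simp only [zpow_natCast]

namespace UData
section wt
variable {K V : Type} [Field K] [Finite K] [AddCommGroup V] [Module K V] [Finite V] {D : UData K V}
  {g h : V ≃ₗ[K] V} {U W : Submodule K V}

theorem B_eq (x y : V) : D.B x y = ∑ i, D.φ (D.b.repr x i) * D.b.repr y i := by
  conv_lhs => rw [← D.b.sum_repr y, map_sum]
  refine Finset.sum_congr rfl fun i _ => ?_
  rw [map_smul, smul_eq_mul, mul_comm]
  congr 1
  rw [D.herm]
  congr 1
  conv_lhs => rw [← D.b.sum_repr x, map_sum]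
  rw [Finset.sum_eq_single_of_mem i (Finset.mem_univ i)]
  · rw [map_smul, D.orth, if_pos rfl, smul_eq_mul, mul_one]
  · intro j _ hj
    rw [map_smul, D.orth, if_neg hj.symm, smul_zero]

/-- matrix of `g` over the algebraic closure -/
noncomputable def mO (D : UData K V) : (V ≃ₗ[K] V) →* Matrix (Fin D.n) (Fin D.n) (AlgebraicClosure K) where
  toFun g := (LinearMap.toMatrix D.b D.b g.toLinearMap).map (algebraMap K (AlgebraicClosure K))
  map_one' := by
    have : ((1 : V ≃ₗ[K] V).toLinearMap) = LinearMap.id := rfl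
    rw [this, LinearMap.toMatrix_id]
    simp
  map_mul' a c := by
    have : ((a * c : V ≃ₗ[K] V).toLinearMap) = a.toLinearMap ∘ₗ c.toLinearMap := rfl
    rw [this, LinearMap.toMatrix_comp D.b D.b D.b, Matrix.map_mul]

theorem mO_inj : Function.Injective D.mO := by
  intro a c h
  have h1 := Matrix.map_injective (algebraMap K (AlgebraicClosure K)).injective h
  have h2 := (LinearMap.toMatrix D.b D.b).injective h1
  ext x
  exact LinearMap.congr_fun h2 x

noncomputable def vO (D : UData K V) (x : V) : Fin D.n → AlgebraicClosure K :=
  fun i => algebraMap K (AlgebraicClosure K) (D.b.repr x i)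

theorem mO_col (g : V ≃ₗ[K] V) (j : Fin D.n) : (D.mO g).col j = D.vO (g (D.b j)) := by
  ext i
  show (LinearMap.toMatrix D.b D.b g.toLinearMap).map (algebraMap K (AlgebraicClosure K)) i j = _
  rw [Matrix.map_apply, LinearMap.toMatrix_apply]
  rfl

noncomputable def sO (D : UData K V) (U : Submodule K V) : Submodule (AlgebraicClosure K) (Fin D.n → AlgebraicClosure K) :=
  Submodule.span _ (D.vO '' (U : Set V))

theorem finrank_sO : Module.finrank (AlgebraicClosure K) (D.sO U) ≤ Module.finrank K U := by
  haveI := D.fd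
  let c := Module.finBasis K U
  have : D.sO U ≤ Submodule.span (AlgebraicClosure K) (Set.range fun i => D.vO (c i : V)) := by
    unfold sO
    rw [Submodule.span_le]
    rintro _ ⟨x, hx, rfl⟩
    have h1 : x = ∑ i, c.repr ⟨x, hx⟩ i • (c i : V) := by
      have := congrArg U.subtype (c.sum_repr ⟨x, hx⟩)
      rw [map_sum] at this
      simp only [map_smul] at this
      exact this.symm
    have h2 : D.vO x = ∑ i, algebraMap K (AlgebraicClosure K) (c.repr ⟨x, hx⟩ i) • D.vO (c i : V) := by
      ext j
      conv_lhs => rw [h1]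
      simp [vO, Finset.sum_apply, Algebra.smul_def]
    rw [h2]
    apply Submodule.sum_mem
    intro i _
    exact Submodule.smul_mem _ _ (Submodule.subset_span ⟨i, rfl⟩)
  refine (Submodule.finrank_mono this).trans ?_
  refine (finrank_range_le_card _).trans ?_
  rw [Fintype.card_fin]

theorem mO_sub_mem (hg : mv g ≤ U) (v : Fin D.n → AlgebraicClosure K) : D.mO g *ᵥ v - v ∈ D.sO U := by
  have h1 : D.mO g *ᵥ v - v = ∑ j, v j • D.vO (g (D.b j) - D.b j) := by
    ext i
    rw [Pi.sub_apply, Matrix.mulVec, dotProduct, Finset.sum_apply]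
    have h2 : v i = ∑ j, v j * D.vO (D.b j) i := by
      rw [Finset.sum_eq_single_of_mem i (Finset.mem_univ i)]
      · simp [vO]
      · intro j _ hj
        simp [vO, Finsupp.single_apply, hj]
    conv_lhs => rw [h2]
    rw [← Finset.sum_sub_distrib]
    refine Finset.sum_congr rfl fun j _ => ?_
    have h3 := congrFun (mO_col (D := D) g j) i
    rw [Matrix.col_apply] at h3
    rw [h3]
    simp only [vO, map_sub, Finsupp.sub_apply, Pi.smul_apply, smul_eq_mul]
    ring
  rw [h1]
  apply Submodule.sum_mem
  intro j _
  exact Submodule.smul_mem _ _ (Submodule.subset_span ⟨_, hg (sub_mem_mv g _), rfl⟩)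

noncomputable def frO (D : UData K V) : AlgebraicClosure K →+* AlgebraicClosure K :=
  haveI := D.charP
  haveI : Fact D.p.Prime := ⟨D.hp⟩
  haveI : CharP (AlgebraicClosure K) D.p := charP_of_injective_algebraMap (algebraMap K _).injective D.p
  haveI : ExpChar (AlgebraicClosure K) D.p := ExpChar.prime D.hp
  iterateFrobenius (AlgebraicClosure K) D.p D.f

theorem frO_apply (x : AlgebraicClosure K) : D.frO x = x ^ D.q := by
  rw [D.hq]; rfl

theorem star_mO (hg : g ∈ D.GU) : ((D.mO g).map D.frO)ᵀ = D.mO g⁻¹ := by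
  have h1 : ((D.mO g).map D.frO)ᵀ * D.mO g = 1 := by
    ext i j
    rw [Matrix.mul_apply]
    have h3 : ∀ i j, D.mO g i j = algebraMap K _ (D.b.repr (g (D.b j)) i) := fun i j => by
      have h3 := congrFun (mO_col (D := D) g j) i
      rwa [Matrix.col_apply] at h3
    have h4 := hg (D.b i) (D.b j)
    rw [B_eq, D.orth] at h4
    have h5 := congrArg (algebraMap K (AlgebraicClosure K)) h4
    rw [map_sum] at h5
    rw [Matrix.one_apply]
    refine Eq.trans ?_ (h5.trans (by split_ifs <;> simp))
    refine Finset.sum_congr rfl fun k _ => ?_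
    rw [Matrix.transpose_apply, Matrix.map_apply, h3, h3, frO_apply, map_mul, D.hφ, map_pow]
  calc ((D.mO g).map D.frO)ᵀ = ((D.mO g).map D.frO)ᵀ * (D.mO g * D.mO g⁻¹) := by
        rw [← map_mul, mul_inv_cancel, map_one, mul_one]
    _ = _ := by rw [← mul_assoc, h1, one_mul]


/-- The weight lemma. -/
theorem Wlem {s t N j : ℕ} (hs : s.Prime) (hsp : s ≠ D.p) (ht : t.Prime) {A : Subgroup (V ≃ₗ[K] V)} (hA : A ≤ D.GU)
    (hab : ∀ a ∈ A, ∀ b ∈ A, a * b = b * a) (hpA : IsPGroup s A) {y : V ≃ₗ[K] V}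
    (hy : ∀ a ∈ A, y * a * y⁻¹ ∈ A) (hyt : y ^ (t ^ j) = 1) (hnc : ∃ a ∈ A, y * a ≠ a * y)
    (hU : ∀ a ∈ A, mv a ≤ U) (hN : Module.finrank K U ≤ N) :
    (t * D.e s ≤ N ∨ t ∣ D.e s) ∧ t ≤ Module.finrank K (mv y) + 1 := by
  classical
  haveI : Fact s.Prime := ⟨hs⟩
  haveI := D.fd
  haveI := D.charP
  haveI : CharP (AlgebraicClosure K) D.p := charP_of_injective_algebraMap (algebraMap K _).injective D.p
  letI : CommGroup A := { (inferInstance : Group A) with mul_comm := fun a b => Subtype.ext (hab a a.2 b b.2) }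
  haveI : Fintype A := Fintype.ofFinite A
  obtain ⟨w, hw⟩ := hpA.exists_card_eq
  have hcop : Nat.Coprime D.p s := (Nat.coprime_primes D.hp hs).mpr hsp.symm
  have hcardne : (Fintype.card A : AlgebraicClosure K) ≠ 0 := by
    rw [← Nat.card_eq_fintype_card, hw, Ne, CharP.cast_eq_zero_iff (AlgebraicClosure K) D.p]
    intro h
    have := D.hp.dvd_of_dvd_pow h
    exact hsp ((Nat.prime_dvd_prime_iff_eq D.hp hs).mp this).symm
  haveI : NeZero ((Monoid.exponent A : ℕ) : AlgebraicClosure K) := by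
    constructor
    intro h
    apply hcardne
    obtain ⟨c, hc⟩ := Group.exponent_dvd_nat_card (G := A)
    rw [← Nat.card_eq_fintype_card, hc, Nat.cast_mul, h, zero_mul]
  haveI : HasEnoughRootsOfUnity (AlgebraicClosure K) (Monoid.exponent A) :=
    IsSepClosed.hasEnoughRootsOfUnity _ _
  set ρ : A →* Matrix (Fin D.n) (Fin D.n) (AlgebraicClosure K) := (D.mO).comp A.subtype with hρ
  let X := A →* (AlgebraicClosure K)ˣ
  haveI : Finite X := by
    obtain ⟨eq⟩ := CommGroup.monoidHom_mulEquiv_of_hasEnoughRootsOfUnity A (AlgebraicClosure K)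
    exact Finite.of_equiv _ eq.toEquiv.symm
  -- y acts
  have hyi : ∀ a ∈ A, y⁻¹ * a * y ∈ A := by
    have h1 : ∀ k : ℕ, ∀ a ∈ A, y ^ k * a * (y ^ k)⁻¹ ∈ A := by
      intro k
      induction k with
      | zero => intro a ha; simpa using ha
      | succ k ih =>
        intro a ha
        have := hy _ (ih a ha)
        rw [pow_succ']
        have h2 : y * y ^ k * a * (y * y ^ k)⁻¹ = y * (y ^ k * a * (y ^ k)⁻¹) * y⁻¹ := by group
        rw [h2]; exact this
    intro a ha
    have h2 : y⁻¹ = y ^ (t ^ j - 1) := by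
      rw [inv_eq_iff_mul_eq_one, ← pow_succ', Nat.sub_add_cancel (Nat.one_le_iff_ne_zero.mpr (pow_pos ht.pos j).ne'), hyt]
    have := h1 (t ^ j - 1) a ha
    rw [← h2, inv_inv] at this
    exact this
  let β : A →* A :=
    { toFun := fun a => ⟨y⁻¹ * a * y, hyi a a.2⟩
      map_one' := by ext1; simp
      map_mul' := by intro a b; ext1; simp [mul_assoc] }
  have hβ : ∀ k : ℕ, ∀ a : A, ((β^[k] a : A) : V ≃ₗ[K] V) = (y ^ k)⁻¹ * a * y ^ k := by
    intro k
    induction k with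
    | zero => intro a; simp
    | succ k ih =>
      intro a
      rw [Function.iterate_succ_apply', pow_succ]
      show y⁻¹ * ((β^[k] a : A) : V ≃ₗ[K] V) * y = _
      rw [ih]; group
  let Y : X → X := fun χ => χ.comp β
  let F : X → X := fun χ => (χ ^ D.q)⁻¹
  have hYk : ∀ k : ℕ, ∀ χ : X, ∀ a, (Y^[k] χ) a = χ (β^[k] a) := by
    intro k
    induction k with
    | zero => intro χ a; rfl
    | succ k ih =>
      intro χ a
      rw [Function.iterate_succ_apply', Function.iterate_succ_apply]
      show (Y^[k] χ) (β a) = _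
      rw [ih]
  have hYt : ∀ χ, Y^[t ^ j] χ = χ := by
    intro χ
    ext a
    rw [hYk]
    congr 2
    apply Subtype.ext
    rw [hβ, hyt]; simp
  have hcomm : Function.Commute F Y := by
    intro χ
    ext a
    rfl
  let P : X → Matrix (Fin D.n) (Fin D.n) (AlgebraicClosure K) := chP ρ
  have hPY : ∀ χ, D.mO y * P χ = P (Y χ) * D.mO y := by
    intro χ
    show D.mO y * chP ρ χ = chP ρ (Y χ) * D.mO y
    unfold chP
    rw [Finset.mul_sum, Finset.sum_mul]
    let ε : A ≃ A :=
      { toFun := fun a => ⟨y * a * y⁻¹, hy a a.2⟩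
        invFun := β
        left_inv := by intro a; ext1; show y⁻¹ * (y * a * y⁻¹) * y = a; group
        right_inv := by intro a; ext1; show y * (y⁻¹ * a * y) * y⁻¹ = a; group }
    refine Fintype.sum_equiv ε _ _ ?_
    intro a
    rw [mul_smul_comm, smul_mul_assoc]
    have h1 : (Y χ) (ε a)⁻¹ = χ a⁻¹ := by
      show χ (β (ε a)⁻¹) = _
      rw [map_inv]
      congr 2
      exact ε.left_inv a
    rw [h1]
    congr 1
    show D.mO y * D.mO a = D.mO (y * a * y⁻¹) * D.mO y
    rw [← map_mul, ← map_mul, inv_mul_cancel_right]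
  have hyunit : D.mO y⁻¹ * D.mO y = 1 := by rw [← map_mul, inv_mul_cancel, map_one]
  have hyunit' : D.mO y * D.mO y⁻¹ = 1 := by rw [← map_mul, mul_inv_cancel, map_one]
  have hPY0 : ∀ χ, P χ ≠ 0 → P (Y χ) ≠ 0 := by
    intro χ h h'
    apply h
    have := hPY χ
    rw [h', zero_mul] at this
    calc P χ = D.mO y⁻¹ * (D.mO y * P χ) := by rw [← mul_assoc, hyunit, one_mul]
      _ = 0 := by rw [this, mul_zero]
  have hPF : ∀ χ, ((P χ).map D.frO)ᵀ = P (F χ) := by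
    intro χ
    show ((chP ρ χ).map D.frO)ᵀ = chP ρ (F χ)
    unfold chP
    have h1 : ((∑ a : A, ((χ a⁻¹ : (AlgebraicClosure K)ˣ) : AlgebraicClosure K) • ρ a).map D.frO)ᵀ =
        ∑ a : A, (((χ a⁻¹ : (AlgebraicClosure K)ˣ) : AlgebraicClosure K) ^ D.q) • ((ρ a).map D.frO)ᵀ := by
      ext i k
      simp only [Matrix.transpose_apply, Matrix.map_apply, Matrix.sum_apply, Matrix.smul_apply, map_sum, smul_eq_mul,
        map_mul, frO_apply]
    rw [h1]
    refine Fintype.sum_equiv (Equiv.inv A) _ _ ?_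
    intro a
    have h2 : ((ρ a).map D.frO)ᵀ = ρ a⁻¹ := star_mO (hA a.2)
    rw [h2, Equiv.inv_apply, inv_inv]
    congr 1
    show _ = (((χ ^ D.q)⁻¹ a : (AlgebraicClosure K)ˣ) : AlgebraicClosure K)
    rw [MonoidHom.inv_apply, MonoidHom.pow_apply, map_inv, ← Units.val_pow_eq_pow_val, inv_pow]
  have hPF0 : ∀ χ, P χ ≠ 0 → P (F χ) ≠ 0 := by
    intro χ h h'
    apply h
    rw [← hPF] at h'
    ext i k
    have := congrFun (congrFun h' k) i
    rw [Matrix.transpose_apply, Matrix.map_apply] at this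
    exact (map_eq_zero D.frO).mp this
  -- orders of characters
  have hXs : ∀ χ : X, ∃ v : ℕ, orderOf χ = s ^ v := by
    intro χ
    have : orderOf χ ∣ s ^ w := by
      rw [hom_pow]
      intro a
      rw [← map_pow, ← hw, pow_card_eq_one', map_one]
    obtain ⟨v, -, hv⟩ := (Nat.dvd_prime_pow hs).mp this
    exact ⟨v, hv⟩
  have hsq : Nat.Coprime s D.q := by
    rw [D.hq]
    exact Nat.Coprime.pow_right _ hcop.symm
  have hF1 : ∀ χ : X, F χ = 1 → χ = 1 := by
    intro χ h
    obtain ⟨v, hv⟩ := hXs χ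
    have h2 : orderOf χ ∣ D.q := by
      rw [hom_pow]
      intro a
      have := DFunLike.congr_fun h a
      exact inv_eq_one.mp this
    have h3 : orderOf χ = 1 := by
      rw [hv] at h2 ⊢
      have h4 : Nat.Coprime (s ^ v) D.q := Nat.Coprime.pow_left _ hsq
      exact Nat.eq_one_of_dvd_coprimes h4 dvd_rfl h2
    exact orderOf_eq_one_iff.mp h3
  have hYinj : Function.Injective Y := by
    obtain ⟨k, hk⟩ := Nat.exists_eq_succ_of_ne_zero (pow_pos ht.pos j).ne'
    intro a b hab
    rw [← hYt a, ← hYt b, hk, Function.iterate_succ_apply, Function.iterate_succ_apply, hab]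
  have hY1 : ∀ χ : X, Y χ = 1 → χ = 1 := by
    intro χ h
    apply hYinj
    rw [h]; rfl
  -- non fixed weight
  obtain ⟨χ, hχ0, hχY⟩ : ∃ χ : X, P χ ≠ 0 ∧ Y χ ≠ χ := by
    by_contra! hall
    obtain ⟨a, ha, hya⟩ := hnc
    have h1 : ρ ((⟨a, ha⟩ : A)⁻¹ * β ⟨a, ha⟩) = 1 := by
      apply rho_eq_one hcardne
      intro χ hχ
      have h2 := DFunLike.congr_fun (hall χ hχ) (⟨a, ha⟩ : A)
      rw [map_mul, map_inv]
      rw [inv_mul_eq_one]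
      exact h2.symm
    have h3 : (a⁻¹ * (y⁻¹ * a * y)) = 1 := by
      apply mO_inj (D := D)
      rw [map_one]; exact h1
    apply hya
    rw [inv_mul_eq_one] at h3
    calc y * a = y * (y⁻¹ * a * y) := by rw [← h3]
      _ = a * y := by group
  have hχ1 : χ ≠ 1 := by
    rintro rfl
    exact hχY rfl
  have hFk : ∀ i : ℕ, ∀ χ : X, ∀ a, (F^[i] χ) a = (χ a) ^ ((-(D.q : ℤ)) ^ i) := by
    intro i
    induction i with
    | zero => intro χ a; simp
    | succ i ih =>
      intro χ a
      rw [Function.iterate_succ_apply']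
      show (((F^[i] χ) a) ^ D.q)⁻¹ = _
      rw [ih, ← zpow_natCast, ← _root_.zpow_neg, ← _root_.zpow_mul, pow_succ]
  have hperiod : ∀ i : ℕ, F^[i] χ = χ ↔ ((orderOf χ : ℕ) : ℤ) ∣ (-(D.q : ℤ)) ^ i - 1 := by
    intro i
    rw [hom_zpow, DFunLike.ext_iff]
    refine forall_congr' fun a => ?_
    rw [hFk, _root_.zpow_sub, zpow_one, mul_inv_eq_one]
  obtain ⟨v, hv⟩ := hXs χ
  have hv0 : v ≠ 0 := by
    rintro rfl
    rw [pow_zero] at hv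
    exact hχ1 (orderOf_eq_one_iff.mp hv)
  obtain ⟨v', rfl⟩ := Nat.exists_eq_succ_of_ne_zero hv0
  have hcast : ∀ i : ℕ, (s : ℤ) ∣ (-(D.q : ℤ)) ^ i - 1 ↔ D.e s ∣ i := by
    intro i
    rw [← ZMod.intCast_zmod_eq_zero_iff_dvd]
    push_cast
    rw [sub_eq_zero, ← orderOf_dvd_iff_pow_eq_one]; rfl
  have heo : D.e s ∣ Function.minimalPeriod F χ := by
    rw [← hcast]
    refine dvd_trans ?_ ((hperiod _).mp (Function.isPeriodicPt_minimalPeriod F χ))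
    rw [hv]; push_cast; exact dvd_pow_self _ hv0
  have hoe : Function.minimalPeriod F χ ∣ D.e s * s ^ v' := by
    apply Function.IsPeriodicPt.minimalPeriod_dvd
    show F^[_] χ = χ
    rw [hperiod, hv, pow_mul]
    have := dvd_sub_pow_of_dvd_sub ((hcast (D.e s)).mpr dvd_rfl) v'
    rw [one_pow] at this
    push_cast; exact this
  have hepos := e_pos (D := D) hs hsp
  have ho : 0 < Function.minimalPeriod F χ :=
    Nat.pos_of_dvd_of_pos hoe (Nat.mul_pos hepos (pow_pos hs.pos _))
  have hes : Nat.Coprime s (D.e s) := by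
    rw [Nat.Prime.coprime_iff_not_dvd hs]
    have := e_lt (D := D) hs hsp
    exact Nat.not_dvd_of_pos_of_lt hepos (by omega)
  -- vectors
  have hvec : ∀ χ : X, ∃ v, P χ ≠ 0 → P χ *ᵥ v ≠ 0 := by
    intro χ
    by_cases h : P χ = 0
    · exact ⟨0, fun h' => absurd h h'⟩
    · by_contra! hcon
      apply h
      apply Matrix.ext_of_mulVec_single
      intro i
      rw [(hcon (Pi.single i 1)).2, Matrix.zero_mulVec]
  constructor
  · let Wt : Set X := {χ | P χ ≠ 0 ∧ χ ≠ 1}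
    have hkey := orb_count (F := F) (Y := Y) hcomm (Wt := Wt) (fun χ h => ⟨hPF0 χ h.1, fun h' => h.2 (hF1 χ h')⟩)
      (fun χ h => ⟨hPY0 χ h.1, fun h' => h.2 (hY1 χ h')⟩) (χ := χ) ⟨hχ0, hχ1⟩ ht hs hYt hχY ho heo hoe hes
    have hWt : Wt.ncard ≤ N := by
      choose vv hvv using hvec
      have hli : LinearIndependent (AlgebraicClosure K) (fun χ : Wt => P χ.1 *ᵥ vv χ.1) :=
        chP_indep hcardne (χ := fun χ : Wt => χ.1) Subtype.val_injective (v := fun χ => vv χ.1) (fun i => rfl)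
          (fun i => hvv _ i.2.1)
      haveI : Fintype Wt := Fintype.ofFinite _
      have h1 := finrank_span_eq_card hli
      have h2 : Submodule.span (AlgebraicClosure K) (Set.range (fun χ : Wt => P χ.1 *ᵥ vv χ.1)) ≤ D.sO U := by
        rw [Submodule.span_le]
        rintro _ ⟨ψ, rfl⟩
        obtain ⟨a, ha⟩ := DFunLike.ne_iff.mp ψ.2.2
        have h3 := mO_sub_mem (D := D) (hU a a.2) (P ψ.1 *ᵥ vv ψ.1)
        have h4 : D.mO a *ᵥ (P ψ.1 *ᵥ vv ψ.1) = ((ψ.1 a : (AlgebraicClosure K)ˣ) : AlgebraicClosure K) • (P ψ.1 *ᵥ vv ψ.1) := by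
          rw [Matrix.mulVec_mulVec, ← Matrix.smul_mulVec]
          congr 1
          exact mul_chP ψ.1 a
        rw [h4] at h3
        have h5 : (((ψ.1 a : (AlgebraicClosure K)ˣ) : AlgebraicClosure K) - 1) ≠ 0 := by
          intro h
          apply ha
          rw [MonoidHom.one_apply]
          exact Units.ext (sub_eq_zero.mp h)
        rw [← one_smul (AlgebraicClosure K) (P ψ.1 *ᵥ vv ψ.1), smul_smul, mul_one, ← sub_smul] at h3
        exact ((D.sO U).smul_mem_iff h5).mp h3
      have h6 := Submodule.finrank_mono h2
      rw [h1] at h6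
      rw [← Nat.card_coe_set_eq, Nat.card_eq_fintype_card]
      exact h6.trans (finrank_sO.trans hN)
    rcases hkey with h | h
    · exact Or.inl (h.trans hWt)
    · exact Or.inr h
  · obtain ⟨v, hv⟩ := hvec χ
    have hv := hv hχ0
    set x := P χ *ᵥ v with hx
    have hPYk : ∀ k : ℕ, D.mO (y ^ k) * P χ = P (Y^[k] χ) * D.mO (y ^ k) := by
      intro k
      induction k with
      | zero => simp
      | succ k ih =>
        rw [pow_succ', map_mul, mul_assoc, ih, ← mul_assoc, hPY, Function.iterate_succ_apply', mul_assoc]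
    have hinj : Function.Injective (fun i : Fin t => Y^[i] χ) := by
      have hdv : Function.minimalPeriod Y χ ∣ t ^ j := Function.IsPeriodicPt.minimalPeriod_dvd (hYt χ)
      obtain ⟨k, -, hk⟩ := (Nat.dvd_prime_pow ht).mp hdv
      have hk0 : k ≠ 0 := by
        rintro rfl
        rw [pow_zero] at hk
        exact hχY (Function.minimalPeriod_eq_one_iff_isFixedPt.mp hk)
      have htle : t ≤ Function.minimalPeriod Y χ := by
        rw [hk]; exact Nat.le_self_pow hk0 t
      intro a b hab
      ext
      exact Function.iterate_injOn_Iio_minimalPeriod (f := Y) (x := χ) (lt_of_lt_of_le a.2 htle)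
        (lt_of_lt_of_le b.2 htle) hab
    have hli : LinearIndependent (AlgebraicClosure K) (fun i : Fin t => D.mO (y ^ (i : ℕ)) *ᵥ x) := by
      refine chP_indep (ρ := ρ) hcardne hinj (v := fun i : Fin t => D.mO (y ^ (i : ℕ)) *ᵥ v) ?_ ?_
      · intro i
        rw [hx, Matrix.mulVec_mulVec, hPYk, ← Matrix.mulVec_mulVec]
      · intro i h
        apply hv
        have h2 := congrArg (fun z => D.mO (y ^ (i : ℕ))⁻¹ *ᵥ z) h
        simp only [Matrix.mulVec_mulVec, Matrix.mulVec_zero] at h2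
        rwa [← map_mul, inv_mul_cancel, map_one, Matrix.one_mulVec] at h2
    have h1 := finrank_span_eq_card hli
    rw [Fintype.card_fin] at h1
    rw [← h1]
    have h2 : Submodule.span (AlgebraicClosure K) (Set.range (fun i : Fin t => D.mO (y ^ (i : ℕ)) *ᵥ x)) ≤
        D.sO (mv y) ⊔ Submodule.span (AlgebraicClosure K) {x} := by
      rw [Submodule.span_le]
      rintro _ ⟨i, rfl⟩
      show D.mO (y ^ (i : ℕ)) *ᵥ x ∈ D.sO (mv y) ⊔ Submodule.span (AlgebraicClosure K) {x}
      rw [← sub_add_cancel (D.mO (y ^ (i : ℕ)) *ᵥ x) x]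
      refine Submodule.add_mem_sup (mO_sub_mem (mv_pow_le y i) x) (Submodule.mem_span_singleton_self x)
    refine (Submodule.finrank_mono h2).trans ((Submodule.finrank_add_le_finrank_add_finrank _ _).trans ?_)
    refine Nat.add_le_add finrank_sO ?_
    exact (finrank_span_le_card _).trans (by simp)

end wt
end UData

section absgrp
variable {G : Type*} [Group G]

theorem PP_aux (C : Subgroup G) : ∀ n : ℕ, 0 < n → ∀ g : G,
    (∀ k : ℕ, ∀ t j : ℕ, t.Prime → (g ^ k) ^ (t ^ j) = 1 → g ^ k ∈ C) → g ^ n = 1 → g ∈ C := by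
  intro n
  induction n using Nat.recOnPosPrimePosCoprime with
  | zero => intro h; exact absurd h (lt_irrefl _)
  | one => intro _ g _ h; rw [pow_one] at h; rw [h]; exact C.one_mem
  | prime_pow t j ht hj =>
    intro _ g hg h
    simpa using hg 1 t j ht (by simpa using h)
  | coprime a b ha hb hab iha ihb =>
    intro _ g hg h
    have h1 : g ^ a ∈ C := by
      refine ihb (by omega) (g ^ a) ?_ (by rw [← pow_mul, h])
      intro k t j ht hk
      rw [← pow_mul g] at hk ⊢
      exact hg _ t j ht hk
    have h2 : g ^ b ∈ C := by
      refine iha (by omega) (g ^ b) ?_ (by rw [← pow_mul, mul_comm, h])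
      intro k t j ht hk
      rw [← pow_mul g] at hk ⊢
      exact hg _ t j ht hk
    have h3 := Nat.gcd_eq_gcd_ab a b
    rw [hab.gcd_eq_one] at h3
    have h4 : g = (g ^ a) ^ (a.gcdA b) * (g ^ b) ^ (a.gcdB b) := by
      rw [← zpow_natCast, ← zpow_natCast, ← _root_.zpow_mul, ← _root_.zpow_mul, ← _root_.zpow_add, ← h3]
      simp
    rw [h4]
    exact C.mul_mem (C.zpow_mem h1 _) (C.zpow_mem h2 _)

theorem PP [Finite G] {N C : Subgroup G} (h : ∀ g ∈ N, ∀ t j : ℕ, t.Prime → g ^ (t ^ j) = 1 → g ∈ C) : N ≤ C := by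
  intro g hg
  refine PP_aux C (orderOf g) (orderOf_pos g) g ?_ (pow_orderOf_eq_one g)
  intro k t j ht hk
  exact h _ (N.pow_mem hg k) t j ht hk

theorem top_of_index [Finite G] (C : Subgroup G)
    (h : ∀ t : ℕ, t.Prime → ∃ T : Subgroup G, T ≤ C ∧ ¬ t ∣ T.index) : C = ⊤ := by
  rw [← Subgroup.index_eq_one]
  by_contra hne
  obtain ⟨t, ht, htd⟩ := Nat.exists_prime_and_dvd hne
  obtain ⟨T, hT, hT2⟩ := h t ht
  exact hT2 (htd.trans (Subgroup.index_dvd_of_le hT))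

theorem nonab_aux [Finite G] {t : ℕ} [Fact t.Prime] (hG : IsPGroup t G) {x y : G} (hxy : x * y ≠ y * x) :
    ∃ (A : Subgroup G) (y : G), (∀ a ∈ A, ∀ b ∈ A, a * b = b * a) ∧ (∀ a ∈ A, y * a * y⁻¹ ∈ A) ∧
      ∃ a ∈ A, y * a ≠ a * y := by
  have hnt : Nontrivial (G ⧸ Subgroup.center G) := by
    refine ⟨⟨(x : G ⧸ Subgroup.center G), 1, ?_⟩⟩
    intro h
    rw [QuotientGroup.eq_one_iff, Subgroup.mem_center_iff] at h
    exact hxy (h y).symm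
  haveI := (hG.to_quotient (Subgroup.center G)).center_nontrivial
  obtain ⟨⟨z', hz'⟩, hz1⟩ := exists_ne (1 : Subgroup.center (G ⧸ Subgroup.center G))
  obtain ⟨z, rfl⟩ := QuotientGroup.mk_surjective z'
  have hzc : z ∉ Subgroup.center G := by
    intro h
    apply hz1
    ext
    exact (QuotientGroup.eq_one_iff z).mpr h
  have hz2 : ∀ y : G, y * z * y⁻¹ * z⁻¹ ∈ Subgroup.center G := by
    intro y
    rw [← QuotientGroup.eq_one_iff]
    have := Subgroup.mem_center_iff.mp hz' y
    rw [QuotientGroup.mk_mul, QuotientGroup.mk_mul, QuotientGroup.mk_mul, this, QuotientGroup.mk_inv,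
      QuotientGroup.mk_inv]
    group
  rw [Subgroup.mem_center_iff] at hzc
  push Not at hzc
  obtain ⟨y, hy⟩ := hzc
  set A := Subgroup.closure ((Subgroup.center G : Set G) ∪ {z}) with hA
  have hcA : Subgroup.center G ≤ A := fun c hc => Subgroup.subset_closure (Or.inl hc)
  have hzA : z ∈ A := Subgroup.subset_closure (Or.inr rfl)
  refine ⟨A, y, ?_, ?_, z, hzA, hy⟩
  · have h1 : ∀ a ∈ A, a * z = z * a := by
      intro a ha
      have : A ≤ Subgroup.centralizer {z} := by
        rw [hA, Subgroup.closure_le]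
        rintro c (hc | hc)
        · rw [SetLike.mem_coe, Subgroup.mem_centralizer_singleton_iff]
          exact (Subgroup.mem_center_iff.mp hc z).symm
        · rw [Set.mem_singleton_iff] at hc; rw [hc]
          rw [SetLike.mem_coe, Subgroup.mem_centralizer_singleton_iff]
      exact (Subgroup.mem_centralizer_singleton_iff.mp (this ha))
    intro a ha b hb
    have : A ≤ Subgroup.centralizer {b} := by
      rw [hA, Subgroup.closure_le]
      rintro c (hc | hc)
      · rw [SetLike.mem_coe, Subgroup.mem_centralizer_singleton_iff]
        exact (Subgroup.mem_center_iff.mp hc b).symm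
      · rw [Set.mem_singleton_iff] at hc; rw [hc]
        rw [SetLike.mem_coe, Subgroup.mem_centralizer_singleton_iff]
        exact (h1 b hb).symm
    exact Subgroup.mem_centralizer_singleton_iff.mp (this ha)
  · intro a ha
    have : A ≤ A.comap (MulAut.conj y).toMonoidHom := by
      conv_lhs => rw [hA]
      rw [Subgroup.closure_le]
      rintro c (hc | hc)
      · show y * c * y⁻¹ ∈ A
        rw [Subgroup.mem_center_iff.mp hc y, mul_inv_cancel_right]
        exact hcA hc
      · rw [Set.mem_singleton_iff] at hc; rw [hc]
        show y * z * y⁻¹ ∈ A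
        have := A.mul_mem (hcA (hz2 y)) hzA
        simpa using this
    exact this ha

theorem BURN_abs [Finite G] {s : ℕ} [Fact s.Prime] (hN : ∀ P : Sylow s G, ∀ y, (∀ a ∈ P, y * a * y⁻¹ ∈ P) → ∀ t j : ℕ, t.Prime → t ∣ Nat.card G →
      y ^ (t ^ j) = 1 → ∀ a ∈ P, y * a = a * y) :
    ∃ M : Subgroup G, M.Normal ∧ ¬ s ∣ Nat.card M ∧ (∀ x : G, (orderOf x).Coprime s → x ∈ M) ∧
      ∀ t : ℕ, t.Prime → t ≠ s → ¬ t ∣ M.index := by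
  obtain ⟨P⟩ := (inferInstance : Nonempty (Sylow s G))
  have hle : Subgroup.normalizer (P : Set G) ≤ Subgroup.centralizer (P : Set G) := by
    apply PP
    intro y hy t j ht hyt
    rw [Subgroup.mem_centralizer_iff]
    intro a ha
    by_cases htc : t ∣ Nat.card G
    · refine (hN P y ?_ t j ht htc hyt a ha).symm
      intro b hb
      exact (Subgroup.mem_normalizer_iff.mp hy b).mp hb
    · have h1 : orderOf y ∣ t ^ j := orderOf_dvd_of_pow_eq_one hyt
      obtain ⟨k, -, hk⟩ := (Nat.dvd_prime_pow ht).mp h1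
      rcases Nat.eq_zero_or_pos k with rfl | hk0
      · rw [pow_zero, orderOf_eq_one_iff] at hk
        rw [hk]; simp
      · exact absurd ((dvd_pow_self t hk0.ne').trans (hk ▸ orderOf_dvd_natCard y)) htc
  refine ⟨(MonoidHom.transferSylow P hle).ker, inferInstance, MonoidHom.not_dvd_card_ker_transferSylow P hle, ?_, ?_⟩
  · intro x hx
    rw [MonoidHom.mem_ker]
    obtain ⟨k, hk⟩ := IsPGroup.iff_orderOf.mp P.2 (MonoidHom.transferSylow P hle x)
    have h1 : orderOf (MonoidHom.transferSylow P hle x) ∣ orderOf x := orderOf_map_dvd _ x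
    rw [hk] at h1
    have h2 : s ^ k = 1 := by
      have h3 : (s ^ k).Coprime (orderOf x) := (hx.symm.pow_left k)
      exact Nat.Coprime.eq_one_of_dvd h3 h1
    rw [h2, orderOf_eq_one_iff] at hk
    exact hk
  · intro t ht hts h
    rw [Subgroup.index_ker] at h
    have h2 := h.trans (Subgroup.card_subgroup_dvd_card (MonoidHom.transferSylow P hle).range)
    obtain ⟨k, hk⟩ := IsPGroup.iff_card.mp P.2
    rw [show Nat.card (P : Subgroup G) = s ^ k from hk] at h2
    exact hts ((Nat.prime_dvd_prime_iff_eq ht Fact.out).mp (ht.dvd_of_dvd_pow h2))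

theorem Z_abs [Finite G] {s : ℕ} [Fact s.Prime] {σ : G} (hσ : IsPGroup s (Subgroup.zpowers σ))
    (hN : ∀ P : Sylow s G, ∀ y, (∀ a ∈ P, y * a * y⁻¹ ∈ P) → ∀ t j : ℕ, t.Prime → t ∣ Nat.card G →
      y ^ (t ^ j) = 1 → ∀ a ∈ P, y * a = a * y) :
    (∀ x, σ * x = x * σ) ∨ ∃ t, t.Prime ∧ t ≠ s ∧ t ∣ Nat.card G ∧ ∃ S : Subgroup G, IsPGroup t S ∧
      (∀ a ∈ S, σ * a * σ⁻¹ ∈ S) ∧ ∃ a ∈ S, σ * a ≠ a * σ := by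
  by_contra! hcon
  obtain ⟨⟨x0, hx0⟩, hcon⟩ := hcon
  obtain ⟨M, hMn, hMs, hM1, hM2⟩ := BURN_abs hN
  have htop : Subgroup.centralizer {σ} = (⊤ : Subgroup G) := by
    apply top_of_index
    intro t ht
    by_cases hts : t = s
    · subst hts
      obtain ⟨P, hP⟩ := hσ.exists_le_sylow
      refine ⟨P, ?_, P.not_dvd_index⟩
      intro x hx
      rw [Subgroup.mem_centralizer_singleton_iff]
      have hσP : σ ∈ P := hP (Subgroup.mem_zpowers σ)
      obtain ⟨j, hj⟩ := hσ ⟨σ, Subgroup.mem_zpowers σ⟩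
      by_cases htc : t ∣ Nat.card G
      · refine (hN P σ ?_ t j ht htc ?_ x hx).symm
        · intro a ha
          exact P.mul_mem (P.mul_mem hσP ha) (P.inv_mem hσP)
        · exact congrArg Subtype.val hj
      · have : Nat.card P = 1 := by
          obtain ⟨k, hk⟩ := IsPGroup.iff_card.mp P.2
          rcases Nat.eq_zero_or_pos k with rfl | hk0
          · simpa using hk
          · exact absurd ((dvd_pow_self t hk0.ne').trans (hk ▸ Subgroup.card_subgroup_dvd_card _)) htc
        have h1 : (P : Subgroup G) = ⊥ := Subgroup.card_eq_one.mp this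
        have h2 : x ∈ (P : Subgroup G) := hx
        rw [h1, Subgroup.mem_bot] at h2
        rw [h2]; simp
    · haveI : Fact t.Prime := ⟨ht⟩
      set c : MulAut M := MulAut.conjNormal σ with hc
      have hcp : IsPGroup s (Subgroup.zpowers c) := by
        have : Subgroup.zpowers c = (Subgroup.zpowers σ).map (MulAut.conjNormal : G →* MulAut M) := by
          rw [MonoidHom.map_zpowers]
        rw [this]
        exact hσ.map _
      have hnd : ¬ s ∣ Nat.card (Sylow t M) := by
        obtain ⟨T⟩ := (inferInstance : Nonempty (Sylow t M))
        intro h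
        exact hMs (h.trans (T.card_dvd_index.trans (Subgroup.index_dvd_card _)))
      obtain ⟨T, hT⟩ := hcp.nonempty_fixed_point_of_prime_not_dvd_card (Sylow t M) hnd
      have hT2 : c • T = T := hT ⟨c, Subgroup.mem_zpowers c⟩
      refine ⟨(T : Subgroup M).map M.subtype, ?_, ?_⟩
      · by_contra hle
        obtain ⟨x, hx, hx2⟩ := SetLike.not_le_iff_exists.mp hle
        rw [Subgroup.mem_centralizer_singleton_iff] at hx2
        refine hx2 (hcon t ht hts ?_ ((T : Subgroup M).map M.subtype) (T.2.map _) ?_ x hx).symm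
        · by_contra htc
          have : Nat.card T = 1 := by
            obtain ⟨k, hk⟩ := IsPGroup.iff_card.mp T.2
            rcases Nat.eq_zero_or_pos k with rfl | hk0
            · simpa using hk
            · exact absurd ((dvd_pow_self t hk0.ne').trans (hk ▸ (Subgroup.card_subgroup_dvd_card _).trans
                (Subgroup.card_subgroup_dvd_card M))) htc
          have h1 : (T : Subgroup M) = ⊥ := Subgroup.card_eq_one.mp this
          rw [h1, Subgroup.map_bot, Subgroup.mem_bot] at hx
          rw [hx] at hx2; simp at hx2
        · rintro _ ⟨a, ha, rfl⟩
          refine ⟨c a, ?_, MulAut.conjNormal_apply σ a⟩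
          have : c a ∈ c • T := Subgroup.smul_mem_pointwise_smul a c (T : Subgroup M) ha
          rwa [hT2] at this
      · rw [Subgroup.index_map_subtype]
        intro h
        rcases (Nat.Prime.dvd_mul ht).mp h with h | h
        · exact T.not_dvd_index h
        · exact hM2 t ht hts h
  have := (htop.symm ▸ Subgroup.mem_top x0 : x0 ∈ Subgroup.centralizer {σ})
  exact hx0 (Subgroup.mem_centralizer_singleton_iff.mp this).symm

end absgrp

namespace UData
section zz
variable {K V : Type} [Field K] [Finite K] [AddCommGroup V] [Module K V] [Finite V] {D : UData K V}
  {g h : V ≃ₗ[K] V} {U W : Submodule K V}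

theorem not_dvd_e {t : ℕ} (ht : t.Prime) (htp : t ≠ D.p) : ¬ t ∣ D.e t := by
  intro h
  have := Nat.le_of_dvd (e_pos ht htp) h
  have := e_lt (D := D) ht htp
  omega

theorem AB {t N : ℕ} (ht : t.Prime) (htp : t ≠ D.p) {A : Subgroup (V ≃ₗ[K] V)} (hA : A ≤ D.GU) (hpA : IsPGroup t A)
    (hU : ∀ a ∈ A, mv a ≤ U) (hN : Module.finrank K U ≤ N) (hlt : N < t * D.e t) :
    ∀ a ∈ A, ∀ b ∈ A, a * b = b * a := by
  haveI : Fact t.Prime := ⟨ht⟩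
  by_contra! hcon
  obtain ⟨a, ha, b, hb, hab⟩ := hcon
  obtain ⟨A', y, h1, h2, c, hc, hyc⟩ := nonab_aux hpA (x := ⟨a, ha⟩) (y := ⟨b, hb⟩)
    (fun h => hab (congrArg Subtype.val h))
  obtain ⟨j, hj⟩ := hpA y
  have := (Wlem (D := D) (U := U) (N := N) (j := j) ht htp ht (A := A'.map A.subtype) (y := (y : V ≃ₗ[K] V)) ?_ ?_ ?_ ?_ ?_ ?_ ?_ hN).1
  · rcases this with h | h
    · omega
    · exact not_dvd_e ht htp h
  · rintro _ ⟨x, -, rfl⟩; exact hA x.2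
  · rintro _ ⟨x, hx, rfl⟩ _ ⟨z, hz, rfl⟩
    exact congrArg Subtype.val (h1 x hx z hz)
  · exact (hpA.to_subgroup A').map _
  · rintro _ ⟨x, hx, rfl⟩
    exact ⟨y * x * y⁻¹, h2 x hx, rfl⟩
  · exact congrArg Subtype.val hj
  · exact ⟨c, ⟨c, hc, rfl⟩, fun h => hyc (Subtype.ext h)⟩
  · rintro _ ⟨x, -, rfl⟩; exact hU x x.2

theorem hN_of {s N : ℕ} (hs : s.Prime) (hsp : s ≠ D.p) {L : Subgroup (V ≃ₗ[K] V)} (hL : L ≤ D.GU)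
    (hU : ∀ a ∈ L, mv a ≤ U) (hN : Module.finrank K U ≤ N) (hlt : N < s * D.e s)
    (h1 : ∀ t : ℕ, t.Prime → t ∣ Nat.card L → N < t * D.e s ∧ ¬ t ∣ D.e s) :
    ∀ P : Sylow s L, ∀ y, (∀ a ∈ P, y * a * y⁻¹ ∈ P) → ∀ t j : ℕ, t.Prime → t ∣ Nat.card L →
      y ^ (t ^ j) = 1 → ∀ a ∈ P, y * a = a * y := by
  intro P y hy t j ht htL hyt a ha
  by_contra hne
  have hle : (P : Subgroup L).map L.subtype ≤ L := by
    rintro _ ⟨x, -, rfl⟩; exact x.2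
  have hpg : IsPGroup s ((P : Subgroup L).map L.subtype) := P.2.map _
  have := (Wlem (D := D) (U := U) (N := N) (j := j) hs hsp ht (A := (P : Subgroup L).map L.subtype)
    (y := (y : V ≃ₗ[K] V)) (hle.trans hL) ?_ hpg ?_ ?_ ?_ ?_ hN).1
  · rcases this with h | h
    · have := (h1 t ht htL).1; omega
    · exact (h1 t ht htL).2 h
  · exact AB hs hsp (hle.trans hL) hpg (fun a ha => hU a (hle ha)) hN hlt
  · rintro _ ⟨x, hx, rfl⟩
    exact ⟨y * x * y⁻¹, hy x hx, rfl⟩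
  · exact congrArg Subtype.val hyt
  · exact ⟨a, ⟨a, ha, rfl⟩, fun h => hne (Subtype.ext h)⟩
  · intro a ha; exact hU a (hle ha)

theorem BURN {s N : ℕ} (hs : s.Prime) (hsp : s ≠ D.p) {L : Subgroup (V ≃ₗ[K] V)} (hL : L ≤ D.GU)
    (hU : ∀ a ∈ L, mv a ≤ U) (hN : Module.finrank K U ≤ N) (hlt : N < s * D.e s)
    (h1 : ∀ t : ℕ, t.Prime → t ∣ Nat.card L → N < t * D.e s ∧ ¬ t ∣ D.e s) :
    ∃ M : Subgroup (V ≃ₗ[K] V), M ≤ L ∧ (∀ l ∈ L, ∀ m ∈ M, l * m * l⁻¹ ∈ M) ∧ ¬ s ∣ Nat.card M ∧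
      ∀ x ∈ L, (orderOf x).Coprime s → x ∈ M := by
  haveI : Fact s.Prime := ⟨hs⟩
  obtain ⟨M, hM, hM1, hM2, -⟩ := BURN_abs (hN_of hs hsp hL hU hN hlt h1)
  refine ⟨M.map L.subtype, ?_, ?_, ?_, ?_⟩
  · rintro _ ⟨x, -, rfl⟩; exact x.2
  · rintro l hl _ ⟨x, hx, rfl⟩
    exact ⟨_, hM.conj_mem x hx ⟨l, hl⟩, rfl⟩
  · rwa [Subgroup.card_subtype]
  · intro x hx hxs
    exact ⟨⟨x, hx⟩, hM2 _ (by rwa [Subgroup.orderOf_mk]), rfl⟩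

theorem Zlem {s N : ℕ} (hs : s.Prime) (hsp : s ≠ D.p) {L : Subgroup (V ≃ₗ[K] V)} (hL : L ≤ D.GU)
    (hU : ∀ a ∈ L, mv a ≤ U) (hN : Module.finrank K U ≤ N) (hlt : N < s * D.e s)
    (h1 : ∀ t : ℕ, t.Prime → t ∣ Nat.card L → N < t * D.e s ∧ ¬ t ∣ D.e s)
    (h2 : ∀ t : ℕ, t.Prime → t ∣ Nat.card L → t ≠ s → t ≠ D.p ∧ N < t * D.e t)
    {σ : V ≃ₗ[K] V} (hσ : σ ∈ L) (hσs : σ ^ s = 1) :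
    (∀ x ∈ L, σ * x = x * σ) ∨ ∃ t, t.Prime ∧ t ≠ s ∧ t ∣ Nat.card L ∧ t ≠ D.p ∧
      ((s * D.e t ≤ N ∨ s ∣ D.e t) ∧ s ≤ Module.finrank K (mv σ) + 1) ∧
      ∃ S : Subgroup (V ≃ₗ[K] V), S ≤ L ∧ IsPGroup t S ∧ (∀ a ∈ S, ∀ b ∈ S, a * b = b * a) ∧
      (∀ a ∈ S, σ * a * σ⁻¹ ∈ S) ∧ ∃ a ∈ S, σ * a ≠ a * σ := by
  haveI : Fact s.Prime := ⟨hs⟩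
  have hσ2 : IsPGroup s (Subgroup.zpowers (⟨σ, hσ⟩ : L)) := by
    rw [IsPGroup.iff_card]
    have : orderOf (⟨σ, hσ⟩ : L) ∣ s ^ 1 := by
      rw [Subgroup.orderOf_mk, pow_one]; exact orderOf_dvd_of_pow_eq_one hσs
    obtain ⟨k, -, hk⟩ := (Nat.dvd_prime_pow hs).mp this
    exact ⟨k, by rw [Nat.card_zpowers, hk]⟩
  rcases Z_abs hσ2 (hN_of hs hsp hL hU hN hlt h1) with h | ⟨t, ht, hts, htL, S, hS1, hS2, a, ha, haσ⟩
  · left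
    intro x hx
    exact congrArg Subtype.val (h ⟨x, hx⟩)
  · right
    have htp := (h2 t ht htL hts).1
    have hSL : S.map L.subtype ≤ L := by rintro _ ⟨x, -, rfl⟩; exact x.2
    have hSp : IsPGroup t (S.map L.subtype) := hS1.map _
    have hSab := AB ht htp (hSL.trans hL) hSp (fun a ha => hU a (hSL ha)) hN (h2 t ht htL hts).2
    have hS2' : ∀ a ∈ S.map L.subtype, σ * a * σ⁻¹ ∈ S.map L.subtype := by
      rintro _ ⟨x, hx, rfl⟩; exact ⟨_, hS2 x hx, rfl⟩
    have hnc : ∃ a ∈ S.map L.subtype, σ * a ≠ a * σ :=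
      ⟨a, ⟨a, ha, rfl⟩, fun h => haσ (Subtype.ext h)⟩
    refine ⟨t, ht, hts, htL, htp, ?_, S.map L.subtype, hSL, hSp, hSab, hS2', hnc⟩
    exact Wlem (D := D) (j := 1) ht htp hs (hSL.trans hL) hSab hSp hS2' (by rwa [pow_one]) hnc
      (fun a ha => hU a (hSL ha)) hN

end zz
end UData

section absgrp2
variable {G : Type*} [Group G]

theorem comm_closure {S : Set G} (hS : ∀ a ∈ S, ∀ b ∈ S, a * b = b * a) :
    ∀ a ∈ Subgroup.closure S, ∀ b ∈ Subgroup.closure S, a * b = b * a := by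
  have h1 : ∀ a ∈ S, ∀ b ∈ Subgroup.closure S, a * b = b * a := by
    intro a ha b hb
    have : Subgroup.closure S ≤ Subgroup.centralizer {a} := by
      rw [Subgroup.closure_le]
      intro c hc
      rw [SetLike.mem_coe, Subgroup.mem_centralizer_singleton_iff]
      exact hS c hc a ha
    exact (Subgroup.mem_centralizer_singleton_iff.mp (this hb)).symm
  intro a ha b hb
  have : Subgroup.closure S ≤ Subgroup.centralizer {b} := by
    rw [Subgroup.closure_le]
    intro c hc
    rw [SetLike.mem_coe, Subgroup.mem_centralizer_singleton_iff]
    exact h1 c hc b hb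
  exact (Subgroup.mem_centralizer_singleton_iff.mp (this ha))

theorem pgroup_closure {S : Set G} {t : ℕ} (hS : ∀ a ∈ S, ∀ b ∈ S, a * b = b * a) (ht : ∀ a ∈ S, a ^ t = 1) :
    IsPGroup t (Subgroup.closure S) := by
  rintro ⟨x, hx⟩
  refine ⟨1, ?_⟩
  ext
  show x ^ (t ^ 1) = 1
  rw [pow_one]
  have hx' := hx
  induction hx using Subgroup.closure_induction with
  | mem x hx => exact ht x hx
  | one => exact one_pow t
  | mul x y hx hy ihx ihy =>
    have : Commute x y := comm_closure hS x hx y hy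
    rw [this.mul_pow, ihx hx, ihy hy, one_mul]
  | inv x hx ih => rw [inv_pow, ih hx, inv_one]

theorem prime_of_pow [Finite G] {H : Subgroup G} {y : G} (hy : y ∈ H) {t j : ℕ} (ht : t.Prime) (h : y ^ (t ^ j) = 1)
    (h1 : y ≠ 1) : t ∣ Nat.card H := by
  have hd : orderOf y ∣ t ^ j := orderOf_dvd_of_pow_eq_one h
  obtain ⟨k, -, hk⟩ := (Nat.dvd_prime_pow ht).mp hd
  rcases Nat.eq_zero_or_pos k with rfl | hk0
  · rw [pow_zero, orderOf_eq_one_iff] at hk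
    exact absurd hk h1
  · refine (dvd_pow_self t hk0.ne').trans ?_
    rw [← hk, ← Subgroup.orderOf_mk y hy]
    exact orderOf_dvd_natCard _

theorem exists_prime_pow [Finite G] {y : G} (h1 : y ≠ 1) : ∃ t m : ℕ, t.Prime ∧ orderOf (y ^ m) = t := by
  have : orderOf y ≠ 1 := fun h => h1 (orderOf_eq_one_iff.mp h)
  obtain ⟨t, ht, m, hm⟩ := Nat.exists_prime_and_dvd this
  refine ⟨t, m, ht, ?_⟩
  have hm0 : m ≠ 0 := by
    rintro rfl
    have := orderOf_pos y
    omega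
  rw [orderOf_pow_of_dvd hm0 ⟨t, by rw [hm, mul_comm]⟩, hm]
  exact Nat.mul_div_cancel _ (by omega)

end absgrp2

namespace UData
section fr
variable {K V : Type} [Field K] [Finite K] [AddCommGroup V] [Module K V] [Finite V] {D : UData K V}
  {g h : V ≃ₗ[K] V} {U W : Submodule K V}

/-- generic dichotomy -/
theorem mvo_dich {s j : ℕ} (hs : s.Prime) (hsp : s ≠ D.p) (hh : h ∈ D.GU) (hj : h ^ (s ^ j) = 1) (hU : D.ND U)
    (hst : Stb h U) (hr : Module.finrank K U ≤ D.e s) : mvo h U = ⊥ ∨ (mvo h U = U ∧ Module.finrank K U = D.e s) := by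
  haveI := D.fd
  have h1 := Ro hs hsp hh hj hU hst
  have h2 := Submodule.finrank_mono (mvo_le hst)
  rcases Nat.eq_zero_or_pos (Module.finrank K (mvo h U)) with h3 | h3
  · left; exact Submodule.finrank_eq_zero.mp h3
  · right
    have h4 := Nat.le_of_dvd h3 h1
    exact ⟨Submodule.eq_of_le_of_finrank_le (mvo_le hst) (by omega), by omega⟩

theorem orth_of_triv (hh : h ∈ D.GU) (ht : ∀ x ∈ U, h x = x) : U ≤ D.perp (mv h) :=
  fun x hx => (mem_perp_mv hh).mpr (ht x hx)

theorem triv_of_orth (hh : h ∈ D.GU) (ht : U ≤ D.perp (mv h)) : ∀ x ∈ U, h x = x :=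
  fun x hx => (mem_perp_mv hh).mp (ht hx)

theorem Clem {s : ℕ} (hs : s.Prime) (hsp : s ≠ D.p) (hg : g ∈ D.GU) (hh : h ∈ D.GU) (hgs : g ^ s = 1) (hhs : h ^ s = 1)
    (hgr : Module.finrank K (mv g) = D.e s) (hhr : Module.finrank K (mv h) = D.e s) (hc : g * h = h * g) :
    mv g = mv h ∨ mv g ≤ D.perp (mv h) := by
  haveI := D.fd
  have hND : D.ND (mv g) := ND_mv hg (not_p_dvd_of_pow hs hsp (j := 1) (by rwa [pow_one]))
  rcases mvo_dich hs hsp hh (j := 1) (by rwa [pow_one]) hND (mv_conj_of_comm hc.symm) hgr.le with h1 | h1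
  · right
    exact orth_of_triv hh (mvo_eq_bot.mp h1)
  · left
    have h2 : mv g ≤ mv h := by rw [← h1.1]; exact mvo_le_mv
    exact Submodule.eq_of_le_of_finrank_eq h2 (by rw [hgr, hhr])

/-- an element commuting with `g` and stabilizing its block moves all or nothing -/
theorem free_dich {s : ℕ} (hs : s.Prime) (hsp : s ≠ D.p) (hg : g ∈ D.GU) (hh : h ∈ D.GU) (hgs : g ^ s = 1)
    (hgr : Module.finrank K (mv g) = D.e s) (hhp : ¬ D.p ∣ orderOf h) (hc : h * g = g * h) :
    mvo h (mv g) = ⊥ ∨ mvo h (mv g) = mv g := by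
  haveI := D.fd
  have hgs' : g ^ (s ^ 1) = 1 := by rwa [pow_one]
  have hND : D.ND (mv g) := ND_mv hg (not_p_dvd_of_pow hs hsp (j := 1) hgs')
  have hst : Stb h (mv g) := mv_conj_of_comm hc
  have hst' : Stb g (mv g) := mv_conj_of_comm rfl
  have hND2 : D.ND (mvo h (mv g)) := ND_mvo hh hhp hND hst
  have hle := mvo_le hst
  have hst2 : Stb g (mvo h (mv g)) := mvo_stb_of_comm hc.symm hst'
  rcases mvo_dich hs hsp hg hgs' hND2 hst2 ((Submodule.finrank_mono hle).trans hgr.le) with h1 | h1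
  · left
    rw [eq_bot_iff]
    intro x hx
    rw [Submodule.mem_bot]
    refine hND.eq_zero (hle hx) ?_
    exact (mem_perp_mv hg).mpr (mvo_eq_bot.mp h1 x hx)
  · right
    exact Submodule.eq_of_le_of_finrank_eq hle (by rw [h1.2, hgr])

theorem free_fix {s : ℕ} (hs : s.Prime) (hsp : s ≠ D.p) (hg : g ∈ D.GU) (hh : h ∈ D.GU) (hgs : g ^ s = 1)
    (hgr : Module.finrank K (mv g) = D.e s) (hhp : ¬ D.p ∣ orderOf h) (hc : h * g = g * h) {u : V} (hu : u ∈ mv g)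
    (hu0 : u ≠ 0) (hfix : h u = u) : ∀ x ∈ mv g, h x = x := by
  have hgs' : g ^ (s ^ 1) = 1 := by rwa [pow_one]
  have hND : D.ND (mv g) := ND_mv hg (not_p_dvd_of_pow hs hsp (j := 1) hgs')
  rcases free_dich hs hsp hg hh hgs hgr hhp hc with h1 | h1
  · exact mvo_eq_bot.mp h1
  · exfalso
    apply hu0
    refine hND.eq_zero hu ?_
    intro x hx
    have : x ∈ mv h := mvo_le_mv (h1.symm ▸ hx)
    exact (mem_perp_mv hh).mpr hfix x this

end fr

/-- Hall-type hypotheses -/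
structure HallData {K V : Type} [Field K] [Finite K] [AddCommGroup V] [Module K V] [Finite V] (D : UData K V)
    (H : Subgroup (V ≃ₗ[K] V)) (Pi : Set ℕ) : Prop where
  le : H ≤ D.GU
  pr : ∀ t ∈ Pi, t.Prime
  odd : ∀ t ∈ Pi, t ≠ 2
  ne : ∀ t ∈ Pi, t ≠ D.p
  dvd : ∀ t ∈ Pi, t ∣ Nat.card D.GU
  sub : ∀ t : ℕ, t.Prime → t ∣ Nat.card H → t ∈ Pi
  conj : ∀ t ∈ Pi, ∀ P : Subgroup (V ≃ₗ[K] V), P ≤ D.GU → IsPGroup t P → ∃ g ∈ D.GU, ∀ x ∈ P, g * x * g⁻¹ ∈ H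
  two : ∃ t ∈ Pi, ∃ s ∈ Pi, t ≠ s
  hn : 3 ≤ D.n

section hall
variable {K V : Type} [Field K] [Finite K] [AddCommGroup V] [Module K V] [Finite V] {D : UData K V}
  {g h : V ≃ₗ[K] V} {U W : Submodule K V} {H : Subgroup (V ≃ₗ[K] V)} {Pi : Set ℕ}

theorem HallData.mem_pi (hH : HallData D H Pi) (hh : h ∈ H) {t j : ℕ} (ht : t.Prime) (hj : h ^ (t ^ j) = 1)
    (h1 : h ≠ 1) : t ∈ Pi := hH.sub t ht (prime_of_pow hh ht hj h1)

theorem HallData.orderOf_pi (hH : HallData D H Pi) (hh : h ∈ H) {t : ℕ} (ht : t.Prime) (hd : t ∣ orderOf h) : t ∈ Pi := by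
  refine hH.sub t ht (hd.trans ?_)
  rw [← Subgroup.orderOf_mk h hh]
  exact orderOf_dvd_natCard _

theorem HallData.p' (hH : HallData D H Pi) (hh : h ∈ H) : ¬ D.p ∣ orderOf h :=
  fun hd => hH.ne _ (hH.orderOf_pi hh D.hp hd) rfl

theorem HallData.ND (hH : HallData D H Pi) (hh : h ∈ H) : D.ND (mv h) := ND_mv (hH.le hh) (hH.p' hh)

theorem HallData.e_pos (hH : HallData D H Pi) {t : ℕ} (ht : t ∈ Pi) : 0 < D.e t :=
  UData.e_pos (hH.pr t ht) (hH.ne t ht)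

theorem HallData.e_lt (hH : HallData D H Pi) {t : ℕ} (ht : t ∈ Pi) : D.e t + 1 ≤ t :=
  UData.e_lt (hH.pr t ht) (hH.ne t ht)

theorem HallData.e_le (hH : HallData D H Pi) {t : ℕ} (ht : t ∈ Pi) : D.e t ≤ D.n :=
  e_le_of_dvd (hH.pr t ht) (hH.ne t ht) (hH.dvd t ht)

theorem HallData.exists_prime (hH : HallData D H Pi) (hh : h ∈ H) (h1 : h ≠ 1) :
    ∃ t ∈ Pi, ∃ m : ℕ, orderOf (h ^ m) = t ∧ D.e t ∣ Module.finrank K (mv (h ^ m)) ∧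
      D.e t ≤ Module.finrank K (mv (h ^ m)) := by
  haveI := D.fd
  obtain ⟨t, m, ht, hm⟩ := exists_prime_pow h1
  have htP : t ∈ Pi := hH.orderOf_pi (H.pow_mem hh m) ht (by rw [hm])
  have hR := R (D := D) ht (hH.ne t htP) (hH.le (H.pow_mem hh m)) (j := 1) (by rw [pow_one, ← hm, pow_orderOf_eq_one])
  refine ⟨t, htP, m, hm, hR, Nat.le_of_dvd ?_ hR⟩
  rw [Nat.pos_iff_ne_zero, Ne, Submodule.finrank_eq_zero, mv_eq_bot]
  intro h2
  rw [h2, orderOf_one] at hm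
  exact ht.one_lt.ne hm

/-- conjugates of `k` under its block stabilizer commute: then elements of the stabilizer not commuting with `k` are special -/
theorem HallData.stab_comm (hH : HallData D H Pi) {s : ℕ} (hs : s ∈ Pi) {k : V ≃ₗ[K] V} (hk : k ∈ H) (hks : k ^ s = 1)
    (hkr : Module.finrank K (mv k) = D.e s)
    (hc : ∀ a ∈ H, ∀ b ∈ H, Stb a (mv k) → Stb b (mv k) → (a * k * a⁻¹) * (b * k * b⁻¹) = (b * k * b⁻¹) * (a * k * a⁻¹))
    {y : V ≃ₗ[K] V} (hy : y ∈ H) (hyst : Stb y (mv k)) {t j : ℕ} (ht : t.Prime) (hyt : y ^ (t ^ j) = 1)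
    (hyk : y * k ≠ k * y) : t ∈ Pi ∧ t ∣ D.e s ∧ t ≤ Module.finrank K (mv y) + 1 := by
  have hy1 : y ≠ 1 := by rintro rfl; simp at hyk
  refine ⟨hH.mem_pi hy ht hyt hy1, ?_⟩
  set S : Set (V ≃ₗ[K] V) := {x | ∃ a ∈ H, Stb a (mv k) ∧ x = a * k * a⁻¹} with hS
  have hSc : ∀ a ∈ S, ∀ b ∈ S, a * b = b * a := by
    rintro _ ⟨a, ha, ha2, rfl⟩ _ ⟨b, hb, hb2, rfl⟩
    exact hc a ha b hb ha2 hb2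
  have hSs : ∀ a ∈ S, a ^ s = 1 := by
    rintro _ ⟨a, ha, ha2, rfl⟩
    rw [conj_pow, hks, mul_one, mul_inv_cancel]
  have hSH : S ⊆ H := by
    rintro _ ⟨a, ha, ha2, rfl⟩
    exact H.mul_mem (H.mul_mem ha hk) (H.inv_mem ha)
  have hSm : ∀ a ∈ S, mv a ≤ mv k := by
    rintro _ ⟨a, ha, ha2, rfl⟩
    rw [conj_mv_stb ha2]
  have hkS : k ∈ S := ⟨1, H.one_mem, Stb_one, by simp⟩
  have := Wlem (D := D) (U := mv k) (N := D.e s) (j := j) (hH.pr s hs) (hH.ne s hs) ht (A := Subgroup.closure S) (y := y)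
    (((Subgroup.closure_le H).mpr hSH).trans hH.le) (comm_closure hSc) (pgroup_closure hSc hSs) ?_ hyt
    ⟨k, Subgroup.subset_closure hkS, hyk⟩ (mv_closure_le hSm) hkr.le
  · refine ⟨this.1.resolve_left ?_, this.2⟩
    intro h
    have h1 := hH.e_pos hs
    have h2 := ht.two_le
    nlinarith
  · intro a ha
    have : Subgroup.closure S ≤ (Subgroup.closure S).comap (MulAut.conj y).toMonoidHom := by
      rw [Subgroup.closure_le]
      rintro _ ⟨a, ha, ha2, rfl⟩
      apply Subgroup.subset_closure
      refine ⟨y * a, H.mul_mem hy ha, hyst.mul ha2, ?_⟩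
      show y * (a * k * a⁻¹) * y⁻¹ = _
      group
    exact this ha

/-- FREE-BLOCK -/
theorem HallData.free_block (hH : HallData D H Pi) {s : ℕ} (hs : s ∈ Pi) (hmin : ∀ t ∈ Pi, D.e s ≤ D.e t)
    {k : V ≃ₗ[K] V} (hk : k ∈ H) (hks : k ^ s = 1) (hkr : Module.finrank K (mv k) = D.e s)
    (hc : ∀ a ∈ H, ∀ b ∈ H, Stb a (mv k) → Stb b (mv k) → (a * k * a⁻¹) * (b * k * b⁻¹) = (b * k * b⁻¹) * (a * k * a⁻¹)) :
    ∀ y ∈ H, Stb y (mv k) → y * k = k * y := by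
  have : H ⊓ stbG (mv k) ≤ Subgroup.centralizer {k} := by
    apply PP
    rintro y ⟨hy, hy2⟩ t j ht hyt
    rw [Subgroup.mem_centralizer_singleton_iff]
    by_contra hne
    obtain ⟨h1, h2, -⟩ := hH.stab_comm hs hk hks hkr hc hy hy2 ht hyt hne
    have h3 := Nat.le_of_dvd (hH.e_pos hs) h2
    have h4 := hmin t h1
    have h5 := hH.e_lt h1
    omega
  intro y hy hy2
  exact Subgroup.mem_centralizer_singleton_iff.mp (this ⟨hy, hy2⟩)

/-- wreath subgroups inside H -/
theorem HallData.exists_wreath (hH : HallData D H Pi) {t m : ℕ} (ht : t ∈ Pi) (hm : m * D.e t ≤ D.n)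
    (Q : Subgroup (Equiv.Perm (Fin m))) (hQ : IsPGroup t Q) :
    ∃ (Ψ : Equiv.Perm (Fin m) →* (V ≃ₗ[K] V)) (σ : Fin m → (V ≃ₗ[K] V)),
      (∀ τ ∈ Q, Ψ τ ∈ H) ∧ (∀ i, σ i ∈ H) ∧ (∀ i, orderOf (σ i) = t) ∧
      (∀ i, Module.finrank K (mv (σ i)) = D.e t) ∧
      (∀ i j, i ≠ j → mv (σ i) ≤ D.perp (mv (σ j))) ∧
      (∀ τ i, Ψ τ * σ i * (Ψ τ)⁻¹ = σ (τ i)) := by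
  obtain ⟨Ψ, σ, h1, h2, h3, h4, h5, h6⟩ := exists_sigma (D := D) (hH.pr t ht) (hH.ne t ht) hm
  have hcomm : ∀ a ∈ Set.range σ, ∀ b ∈ Set.range σ, a * b = b * a := by
    rintro _ ⟨i, rfl⟩ _ ⟨j, rfl⟩
    by_cases hij : i = j
    · rw [hij]
    · exact comm_of_perp (h2 i) (h2 j) (h5 i j hij)
  have hA : IsPGroup t (Subgroup.closure (Set.range σ)) := by
    refine pgroup_closure hcomm ?_
    rintro _ ⟨i, rfl⟩
    rw [← h3 i, pow_orderOf_eq_one]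
  have hnorm : Q.map Ψ ≤ Subgroup.normalizer (Subgroup.closure (Set.range σ) : Set _) := by
    have key : ∀ τ, ∀ a ∈ Subgroup.closure (Set.range σ), Ψ τ * a * (Ψ τ)⁻¹ ∈ Subgroup.closure (Set.range σ) := by
      intro τ a ha
      have : Subgroup.closure (Set.range σ) ≤ (Subgroup.closure (Set.range σ)).comap (MulAut.conj (Ψ τ)).toMonoidHom := by
        rw [Subgroup.closure_le]
        rintro _ ⟨i, rfl⟩
        apply Subgroup.subset_closure
        exact ⟨τ i, (h6 τ i).symm⟩
      exact this ha
    rintro _ ⟨τ, hτ, rfl⟩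
    rw [Subgroup.mem_normalizer_iff]
    intro a
    refine ⟨key τ a, fun ha => ?_⟩
    have := key τ⁻¹ _ ha
    rw [map_inv] at this
    simpa [mul_assoc] using this
  have hP : IsPGroup t (Q.map Ψ ⊔ Subgroup.closure (Set.range σ) : Subgroup _) :=
    IsPGroup.to_sup_of_normal_right' (hQ.map Ψ) hA hnorm
  obtain ⟨g, hg, hgH⟩ := hH.conj t ht _ (sup_le (by rintro _ ⟨τ, -, rfl⟩; exact h1 τ)
    ((Subgroup.closure_le _).mpr (by rintro _ ⟨i, rfl⟩; exact h2 i))) hP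
  refine ⟨(MulAut.conj g).toMonoidHom.comp Ψ, fun i => g * σ i * g⁻¹, ?_, ?_, ?_, ?_, ?_, ?_⟩
  · intro τ hτ
    exact hgH _ ((le_sup_left : Q.map Ψ ≤ _) ⟨τ, hτ, rfl⟩)
  · intro i
    exact hgH _ ((le_sup_right : Subgroup.closure (Set.range σ) ≤ _) (Subgroup.subset_closure ⟨i, rfl⟩))
  · intro i
    rw [← h3 i]
    exact (MulAut.conj g).orderOf_eq (σ i)
  · intro i
    rw [mv_conj, finrank_map_equiv, h4]
  · intro i j hij
    rw [mv_conj, mv_conj]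
    rintro _ ⟨x, hx, rfl⟩
    rintro _ ⟨y, hy, rfl⟩
    exact (GU_apply D hg y x).trans (h5 i j hij hx y hy)
  · intro τ i
    show g * Ψ τ * g⁻¹ * (g * σ i * g⁻¹) * (g * Ψ τ * g⁻¹)⁻¹ = g * σ (τ i) * g⁻¹
    rw [← h6]
    group

theorem HallData.exists_star (hH : HallData D H Pi) {t m : ℕ} (ht : t ∈ Pi) (hm : m * D.e t ≤ D.n) :
    ∃ (σ : Fin m → (V ≃ₗ[K] V)), (∀ i, σ i ∈ H) ∧ (∀ i, orderOf (σ i) = t) ∧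
      (∀ i, Module.finrank K (mv (σ i)) = D.e t) ∧ (∀ i j, i ≠ j → mv (σ i) ≤ D.perp (mv (σ j))) := by
  haveI : Fact t.Prime := ⟨hH.pr t ht⟩
  obtain ⟨Ψ, σ, h1, h2, h3, h4, h5, h6⟩ := hH.exists_wreath ht hm ⊥ IsPGroup.of_bot
  exact ⟨σ, h2, h3, h4, h5⟩

end hall
end UData

section lemJ
open MulAction

theorem two_trans_even {α : Type*} [Finite α] {B : Subgroup (Equiv.Perm α)} (hodd : Odd (Nat.card B))
    (h2 : IsMultiplyPretransitive B α 2) {a b : α} (hab : a ≠ b) : False := by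
  rw [is_two_pretransitive_iff] at h2
  obtain ⟨g, h3, h4⟩ := h2 hab hab.symm
  have ho : Odd (orderOf g) := Odd.of_dvd_nat hodd (orderOf_dvd_natCard g)
  obtain ⟨k, hk⟩ := ho
  have h5 : ∀ j : ℕ, (g ^ (2 * j)) • a = a := by
    intro j
    induction j with
    | zero => simp
    | succ j ih => rw [mul_add, pow_add, mul_smul, mul_one, sq, mul_smul, h3, h4, ih]
  have h6 : (g ^ orderOf g) • a = b := by
    rw [hk, pow_succ', mul_smul, h5, h3]
  rw [pow_orderOf_eq_one, one_smul] at h6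
  exact hab h6

theorem J_main {α : Type*} [Fintype α] [DecidableEq α] {B : Subgroup (Equiv.Perm α)} (hodd : Odd (Nat.card B))
    {c ρ : Equiv.Perm α} (hc : c ∈ B) (hρ : ρ ∈ B) (hcc : c.IsCycle) (hρc : ρ.IsCycle) {t s : ℕ}
    (hct : c.support.card = t) (hρs : ρ.support.card = s) (hs : s.Prime) (hts : t < s)
    (hmeet : ∃ x, x ∈ c.support ∧ x ∈ ρ.support) (hun : ∀ x, x ∈ c.support ∨ x ∈ ρ.support) : False := by
  obtain ⟨x0, hx0, hx0'⟩ := hmeet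
  have hcard : Fintype.card α + 1 ≤ t + s := by
    have h1 : c.support ∪ ρ.support = Finset.univ := by
      ext x; simpa using hun x
    have h2 := Finset.card_union_add_card_inter c.support ρ.support
    rw [h1, Finset.card_univ, hct, hρs] at h2
    have h3 : 0 < (c.support ∩ ρ.support).card := Finset.card_pos.mpr ⟨x0, Finset.mem_inter.mpr ⟨hx0, hx0'⟩⟩
    omega
  have ht2 : 2 ≤ t := hct ▸ hcc.two_le_card_support
  have hsle : s ≤ Fintype.card α := hρs ▸ Finset.card_le_univ _
  have key : ∀ x, ∃ g : B, g • x0 = x := by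
    intro x
    rcases hun x with h | h
    · obtain ⟨i, hi⟩ := hcc.sameCycle (Equiv.Perm.mem_support.mp hx0) (Equiv.Perm.mem_support.mp h)
      exact ⟨⟨c ^ i, B.zpow_mem hc i⟩, hi⟩
    · obtain ⟨i, hi⟩ := hρc.sameCycle (Equiv.Perm.mem_support.mp hx0') (Equiv.Perm.mem_support.mp h)
      exact ⟨⟨ρ ^ i, B.zpow_mem hρ i⟩, hi⟩
  haveI : IsPretransitive B α := by
    refine ⟨fun x y => ?_⟩
    obtain ⟨g, hg⟩ := key x
    obtain ⟨g', hg'⟩ := key y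
    exact ⟨g' * g⁻¹, by rw [mul_smul, ← hg, inv_smul_smul, hg']⟩
  haveI hprim : IsPreprimitive B α := by
    have h1 := Equiv.Perm.isPretransitive_of_isCycle_mem hρc hρ
    have hset : ((SubMulAction.ofFixingSubgroup B ((ρ.support : Set α)ᶜ) : SubMulAction _ _) : Set α) = (ρ.support : Set α) := by
      ext x; simp [SubMulAction.mem_ofFixingSubgroup_iff]
    have h2 : Nat.card (SubMulAction.ofFixingSubgroup B ((ρ.support : Set α)ᶜ)) = s := by
      rw [← hρs, ← Set.ncard_coe_finset]
      exact congrArg Set.ncard hset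
    haveI := IsPreprimitive.of_prime_card (G := fixingSubgroup B ((ρ.support : Set α)ᶜ))
      (X := SubMulAction.ofFixingSubgroup B ((ρ.support : Set α)ᶜ)) (by rw [h2]; exact hs)
    let f : (SubMulAction.ofFixingSubgroup B ((ρ.support : Set α)ᶜ)) →ₑ[(fixingSubgroup B ((ρ.support : Set α)ᶜ)).subtype] α :=
      { toFun := Subtype.val, map_smul' := fun _ _ => rfl }
    refine IsPreprimitive.of_card_lt (f := f) ?_
    have h3 : Set.range f = (ρ.support : Set α) := by
      exact Subtype.range_val.trans hset
    rw [h3, Set.ncard_coe_finset, hρs, Nat.card_eq_fintype_card]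
    omega
  have hcs : ((c.support : Set α)ᶜ).ncard = (Fintype.card α - t - 1) + 1 := by
    have := Set.ncard_add_ncard_compl (c.support : Set α)
    rw [Set.ncard_coe_finset, hct, Nat.card_eq_fintype_card] at this
    omega
  have h2 := hprim.is_two_pretransitive hcs (by rw [Nat.card_eq_fintype_card]; omega)
    (Equiv.Perm.isPretransitive_of_isCycle_mem hcc hc)
  have : c x0 ≠ x0 := Equiv.Perm.mem_support.mp hx0
  exact two_trans_even hodd h2 this

theorem lemJ {α : Type*} [Fintype α] [DecidableEq α] {B : Subgroup (Equiv.Perm α)} (hodd : Odd (Nat.card B))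
    {c ρ : Equiv.Perm α} (hc : c ∈ B) (hρ : ρ ∈ B) (hcc : c.IsCycle) (hρc : ρ.IsCycle) {t s : ℕ}
    (hct : c.support.card = t) (hρs : ρ.support.card = s) (hs : s.Prime) (hts : t < s)
    (hmeet : ∃ x, x ∈ c.support ∧ x ∈ ρ.support) : False := by
  let P : α → Prop := fun x => x ∈ c.support ∨ x ∈ ρ.support
  have hPc : ∀ x, P (c x) ↔ P x := by
    intro x
    show (c x ∈ c.support ∨ c x ∈ ρ.support) ↔ (x ∈ c.support ∨ x ∈ ρ.support)
    rw [Equiv.Perm.apply_mem_support]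
    by_cases h : x ∈ c.support
    · simp [h]
    · rw [Equiv.Perm.notMem_support.mp h]
  have hPρ : ∀ x, P (ρ x) ↔ P x := by
    intro x
    show (ρ x ∈ c.support ∨ ρ x ∈ ρ.support) ↔ (x ∈ c.support ∨ x ∈ ρ.support)
    rw [Equiv.Perm.apply_mem_support]
    by_cases h : x ∈ ρ.support
    · simp [h]
    · rw [Equiv.Perm.notMem_support.mp h]
  have hoc : Equiv.Perm.ofSubtype (c.subtypePerm hPc) = c :=
    Equiv.Perm.ofSubtype_subtypePerm hPc (fun x hx => Or.inl (Equiv.Perm.mem_support.mpr hx))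
  have hoρ : Equiv.Perm.ofSubtype (ρ.subtypePerm hPρ) = ρ :=
    Equiv.Perm.ofSubtype_subtypePerm hPρ (fun x hx => Or.inr (Equiv.Perm.mem_support.mpr hx))
  have hcyc : ∀ (g : Equiv.Perm α) (hg : ∀ x, P (g x) ↔ P x), g.IsCycle → (∀ x ∈ g.support, P x) →
      (g.subtypePerm hg).IsCycle := by
    intro g hg hgc hsup
    obtain ⟨x, hx, hx2⟩ := hgc
    refine ⟨⟨x, hsup x (Equiv.Perm.mem_support.mpr hx)⟩, ?_, ?_⟩
    · intro h; exact hx (congrArg Subtype.val h)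
    · intro y hy
      rw [Equiv.Perm.sameCycle_subtypePerm]
      exact hx2 (fun h => hy (Subtype.ext h))
  have hcc' := hcyc c hPc hcc (fun x hx => Or.inl hx)
  have hρc' := hcyc ρ hPρ hρc (fun x hx => Or.inr hx)
  have hord : ∀ g : Equiv.Perm {x // P x}, orderOf (Equiv.Perm.ofSubtype g) = orderOf g :=
    fun g => orderOf_injective Equiv.Perm.ofSubtype Equiv.Perm.ofSubtype_injective g
  obtain ⟨x0, h0, h0'⟩ := hmeet
  refine J_main (α := {x // P x}) (B := B.comap Equiv.Perm.ofSubtype) (t := t) (s := s) ?_ (c := c.subtypePerm hPc)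
    (ρ := ρ.subtypePerm hPρ) (by rw [Subgroup.mem_comap, hoc]; exact hc) (by rw [Subgroup.mem_comap, hoρ]; exact hρ)
    hcc' hρc' ?_ ?_ hs hts ⟨⟨x0, Or.inl h0⟩, ?_, ?_⟩ ?_
  · refine Odd.of_dvd_nat hodd ?_
    exact Subgroup.card_comap_dvd_of_injective B _ Equiv.Perm.ofSubtype_injective
  · rw [← hcc'.orderOf, ← hord, hoc, hcc.orderOf, hct]
  · rw [← hρc'.orderOf, ← hord, hoρ, hρc.orderOf, hρs]
  · rw [Equiv.Perm.mem_support] at h0 ⊢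
    intro h; exact h0 (congrArg Subtype.val h)
  · rw [Equiv.Perm.mem_support] at h0' ⊢
    intro h; exact h0' (congrArg Subtype.val h)
  · rintro ⟨x, hx | hx⟩
    · left
      rw [Equiv.Perm.mem_support] at hx ⊢
      intro h; exact hx (congrArg Subtype.val h)
    · right
      rw [Equiv.Perm.mem_support] at hx ⊢
      intro h; exact hx (congrArg Subtype.val h)

theorem color {Γ α : Type*} [Group Γ] [Finite Γ] [MulAction Γ α] [Finite α] {r : ℕ} [Fact r.Prime] (hr : r ≠ 2) :
    ∀ n : ℕ, ∀ (G : Subgroup Γ) (hG : IsPGroup r G) (S : Set α), S.ncard ≤ n → (∀ g ∈ G, ∀ x ∈ S, g • x ∈ S) →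
      ∃ D ⊆ S, ∀ g ∈ G, (∀ x, g • x ∈ D ↔ x ∈ D) → ∀ x ∈ S, g • x = x := by
  intro n
  induction n with
  | zero =>
    intro G hG S hS hinv
    have : S = ∅ := by rwa [Nat.le_zero, Set.ncard_eq_zero] at hS
    exact ⟨∅, by simp, by simp [this]⟩
  | succ n ih =>
    intro G hG S hS hinv
    by_cases hT : ∃ T ⊂ S, T.Nonempty ∧ ∀ g ∈ G, ∀ x ∈ T, g • x ∈ T
    · obtain ⟨T, hTS, hTn, hTinv⟩ := hT
      have h1 : T.ncard < S.ncard := Set.ncard_lt_ncard hTS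
      have h2 : (S \ T).ncard < S.ncard := by
        refine Set.ncard_lt_ncard ?_ (Set.toFinite _)
        refine ⟨Set.diff_subset, fun h => ?_⟩
        obtain ⟨x, hx⟩ := hTn
        exact (h (hTS.1 hx)).2 hx
      have hTi : ∀ g ∈ G, ∀ x, g • x ∈ T ↔ x ∈ T := by
        intro g hg x
        refine ⟨fun h => ?_, hTinv g hg x⟩
        have := hTinv g⁻¹ (G.inv_mem hg) _ h
        rwa [inv_smul_smul] at this
      obtain ⟨D1, hD1, hf1⟩ := ih G hG T (by omega) hTinv
      obtain ⟨D2, hD2, hf2⟩ := ih G hG (S \ T) (by omega) (fun g hg x hx =>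
        ⟨hinv g hg x hx.1, fun h => hx.2 ((hTi g hg x).mp h)⟩)
      refine ⟨D1 ∪ D2, Set.union_subset (hD1.trans hTS.1) (hD2.trans Set.diff_subset), ?_⟩
      intro g hg hD x hx
      have e1 : ∀ x, x ∈ D1 ↔ x ∈ D1 ∪ D2 ∧ x ∈ T := by
        intro x
        constructor
        · intro h; exact ⟨Or.inl h, hD1 h⟩
        · rintro ⟨h | h, h'⟩
          · exact h
          · exact absurd h' (hD2 h).2
      have e2 : ∀ x, x ∈ D2 ↔ x ∈ D1 ∪ D2 ∧ x ∉ T := by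
        intro x
        constructor
        · intro h; exact ⟨Or.inr h, (hD2 h).2⟩
        · rintro ⟨h | h, h'⟩
          · exact absurd (hD1 h) h'
          · exact h
      by_cases hxT : x ∈ T
      · exact hf1 g hg (fun y => by rw [e1, e1 y, hD, hTi g hg]) x hxT
      · exact hf2 g hg (fun y => by rw [e2, e2 y, hD, hTi g hg]) x ⟨hx, hxT⟩
    · by_cases hSe : S = ∅
      · exact ⟨∅, by simp, by simp [hSe]⟩
      obtain ⟨x, hx⟩ := Set.nonempty_iff_ne_empty.mpr hSe
      let P : Subgroup G := stabilizer G x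
      rcases eq_top_or_exists_le_coatom P with hP | ⟨M, hM, hPM⟩
      · refine ⟨∅, by simp, fun g hg _ y hy => ?_⟩
        by_contra hne
        apply hT
        refine ⟨{x}, ⟨by simpa using hx, fun h => hne ?_⟩, ⟨x, rfl⟩, ?_⟩
        · have : (⟨g, hg⟩ : G) ∈ P := by rw [hP]; trivial
          rw [h hy]
          exact this
        · rintro g hg _ rfl
          have : (⟨g, hg⟩ : G) ∈ P := by rw [hP]; trivial
          exact this
      · haveI : Group.IsNilpotent G := hG.isNilpotent
        have hMn : M.Normal := Subgroup.NormalizerCondition.normal_of_coatom M Group.normalizerCondition_of_isNilpotent hM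
        set J : Set α := orbit M x with hJ
        have hJM : ∀ g : G, g • x ∈ J → g ∈ M := by
          rintro g ⟨m, hm⟩
          have h1 : (m : G)⁻¹ * g ∈ P := by
            show ((m : G)⁻¹ * g) • x = x
            rw [mul_smul, ← hm]
            exact inv_smul_smul (m : G) x
          have := M.mul_mem m.2 (hPM h1)
          rwa [mul_inv_cancel_left] at this
        have hMJ : ∀ g ∈ M, ∀ y, g • y ∈ J ↔ y ∈ J := by
          intro g hg y
          have h1 : ∀ g ∈ M, ∀ y ∈ J, g • y ∈ J := by
            rintro g hg _ ⟨m, rfl⟩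
            exact ⟨⟨g, hg⟩ * m, mul_smul _ _ _⟩
          refine ⟨fun h => ?_, h1 g hg y⟩
          have := h1 g⁻¹ (M.inv_mem hg) _ h
          rwa [inv_smul_smul] at this
        have hJM' : ∀ g : G, ∀ j ∈ J, g • j ∈ J → g ∈ M := by
          rintro g _ ⟨m, rfl⟩ h
          have h1 : (g * (m : G)) • x ∈ J := by rw [mul_smul]; exact h
          exact (M.mul_mem_cancel_right m.2).mp (hJM _ h1)
        have hJS : J ⊆ S := by
          rintro _ ⟨m, rfl⟩
          exact hinv _ m.1.2 x hx
        have hJlt : J.ncard < S.ncard := by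
          refine Set.ncard_lt_ncard ?_ (Set.toFinite _)
          refine ⟨hJS, fun h => hM.1 ?_⟩
          rw [eq_top_iff]
          intro g _
          exact hJM g (h (hinv _ g.2 x hx))
        have hMp : IsPGroup r M := hG.to_subgroup M
        have hodd : Odd J.ncard := by
          obtain ⟨k, hk⟩ := hMp.card_orbit x
          rw [hJ, ← Nat.card_coe_set_eq, hk]
          exact ((Fact.out : r.Prime).odd_of_ne_two hr).pow
        obtain ⟨D1, hD1, hf⟩ := ih (M.map G.subtype) (hMp.map G.subtype) J (by omega) (by
          rintro _ ⟨m, hm, rfl⟩ y hy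
          exact (hMJ m hm y).mpr hy)
        set D : Set α := {y | ∃ c : G ⧸ M, ∃ j ∈ J, y = c.out • j ∧ (c = 1 ↔ j ∈ D1)} with hD
        have hblock : ∀ c : G ⧸ M, ∀ j ∈ J, (c.out • j ∈ D ↔ (c = 1 ↔ j ∈ D1)) := by
          intro c j hj
          constructor
          · rintro ⟨c', j', hj', h1, h2⟩
            have hcc : c = c' := by
              rw [← c.out_eq', ← c'.out_eq']
              refine QuotientGroup.eq.mpr (hJM' _ j' hj' ?_)
              rw [mul_smul, ← h1, inv_smul_smul]
              exact hj
            subst hcc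
            have : j = j' := by
              have := congrArg (fun y => c.out⁻¹ • y) h1
              simpa using this
            rwa [this]
          · intro h
            exact ⟨c, j, hj, rfl, h⟩
        refine ⟨D, ?_, ?_⟩
        · rintro _ ⟨c, j, hj, rfl, -⟩
          exact hinv _ c.out.2 j (hJS hj)
        · intro g hg hgD
          set γ : G := ⟨g, hg⟩ with hγ
          have hγD : ∀ y, γ • y ∈ D ↔ y ∈ D := hgD
          have hgM : γ ∈ M := by
            by_contra hgM
            set c0 : G ⧸ M := 1
            set c1 : G ⧸ M := (γ : G ⧸ M)
            have hc1 : c1 ≠ 1 := fun h => hgM ((QuotientGroup.eq_one_iff γ).mp h)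
            have ho : c0.out ∈ M := (QuotientGroup.eq_one_iff _).mp c0.out_eq'
            set m : G := c1.out⁻¹ * (γ * c0.out) with hm
            have hmM : m ∈ M := by
              have h1 : c1.out⁻¹ * γ ∈ M := QuotientGroup.eq.mp c1.out_eq'
              rw [hm, ← mul_assoc]
              exact M.mul_mem h1 ho
            have hiff : ∀ j ∈ J, (j ∈ D1 ↔ m • j ∉ D1) := by
              intro j hj
              have h1 := hblock c0 j hj
              have h2 := hblock c1 (m • j) ((hMJ m hmM j).mpr hj)
              have h3 : c1.out • m • j = γ • c0.out • j := by
                rw [hm, ← mul_smul, mul_inv_cancel_left, mul_smul]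
              rw [h3, hγD] at h2
              have : c0 = 1 := rfl
              tauto
            have himg : (fun j => m • j) '' D1 = J \ D1 := by
              ext y
              constructor
              · rintro ⟨j, hj, rfl⟩
                exact ⟨(hMJ m hmM j).mpr (hD1 hj), (hiff j (hD1 hj)).mp hj⟩
              · rintro ⟨hy, hy'⟩
                have h1 : m⁻¹ • y ∈ J := (hMJ _ (M.inv_mem hmM) y).mpr hy
                refine ⟨m⁻¹ • y, (hiff _ h1).mpr (by rwa [smul_inv_smul]), smul_inv_smul _ _⟩
            have h1 := Set.ncard_image_of_injective D1 (MulAction.injective m)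
            have h2 : (J \ D1).ncard = D1.ncard := by rw [← himg]; exact h1
            have h3 := Set.ncard_diff_add_ncard_of_subset hD1 (Set.toFinite _)
            rw [h2] at h3
            rw [← h3] at hodd
            exact (Nat.not_odd_iff_even.mpr ⟨_, rfl⟩) hodd
          have hfix : ∀ c : G ⧸ M, ∀ j ∈ J, γ • c.out • j = c.out • j := by
            intro c j hj
            set m : G := c.out⁻¹ * γ * c.out with hm
            have hmM : m ∈ M := by
              have := hMn.conj_mem γ hgM c.out⁻¹
              rwa [inv_inv] at this
            have h3 : ∀ j : α, c.out • m • j = γ • c.out • j := by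
              intro j
              rw [hm, ← mul_smul, ← mul_assoc, mul_inv_cancel_left, mul_smul]
            have hiff : ∀ j, (m • j ∈ D1 ↔ j ∈ D1) := by
              intro j
              by_cases hj : j ∈ J
              · have h1 := hblock c j hj
                have h2 := hblock c (m • j) ((hMJ m hmM j).mpr hj)
                rw [h3, hγD] at h2
                tauto
              · exact iff_of_false (fun h => hj ((hMJ m hmM j).mp (hD1 h))) (fun h => hj (hD1 h))
            have h4 := hf (m : Γ) ⟨m, hmM, rfl⟩ hiff j hj
            rw [← h3]
            exact congrArg (fun y => c.out • y) h4
          have horb : ∀ y ∈ S, ∃ a : G, a • x = y := by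
            intro y hy
            by_contra hne
            apply hT
            refine ⟨orbit G x, ⟨?_, fun h => hne (h hy)⟩, ⟨x, mem_orbit_self x⟩, ?_⟩
            · rintro _ ⟨a, rfl⟩
              exact hinv _ a.2 x hx
            · rintro g hg _ ⟨a, rfl⟩
              exact ⟨⟨g, hg⟩ * a, mul_smul _ _ _⟩
          intro y hy
          obtain ⟨a, rfl⟩ := horb y hy
          have h1 : (a : G ⧸ M).out⁻¹ * a ∈ M := QuotientGroup.eq.mp (a : G ⧸ M).out_eq'
          have h2 := hfix (a : G ⧸ M) (((a : G ⧸ M).out⁻¹ * a) • x) ⟨⟨_, h1⟩, rfl⟩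
          have h5 : (a : G ⧸ M).out • ((a : G ⧸ M).out⁻¹ * a) • x = a • x := by
            rw [← mul_smul, mul_inv_cancel_left]
          rw [h5] at h2
          exact h2

end lemJ

namespace UData
section blocks
variable {K V : Type} [Field K] [Finite K] [AddCommGroup V] [Module K V] [Finite V] {D : UData K V}
  {g h : V ≃ₗ[K] V} {U W : Submodule K V} {H : Subgroup (V ≃ₗ[K] V)} {Pi : Set ℕ}

theorem finite_sub : Finite (Submodule K V) := Finite.of_injective _ SetLike.coe_injective

theorem orth_iSup {ι : Type*} {E : ι → Submodule K V} {S : Finset ι} {Y : Submodule K V} (h : ∀ i ∈ S, E i ≤ D.perp Y) :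
    (⨆ i ∈ S, E i) ≤ D.perp Y := iSup₂_le h

theorem orth_fam {ι : Type*} {E : ι → Submodule K V} (S : Finset ι) (hE : ∀ i ∈ S, D.ND (E i))
    (ho : ∀ i ∈ S, ∀ j ∈ S, i ≠ j → E i ≤ D.perp (E j)) :
    D.ND (⨆ i ∈ S, E i) ∧ Module.finrank K (⨆ i ∈ S, E i : Submodule K V) = ∑ i ∈ S, Module.finrank K (E i) := by
  classical
  haveI := D.fd
  induction S using Finset.induction_on with
  | empty => simp [ND_bot]
  | insert a S ha ih =>
    obtain ⟨h1, h2⟩ := ih (fun i hi => hE i (Finset.mem_insert_of_mem hi))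
      (fun i hi j hj => ho i (Finset.mem_insert_of_mem hi) j (Finset.mem_insert_of_mem hj))
    have h3 : (⨆ i ∈ S, E i) ≤ D.perp (E a) := orth_iSup fun i hi =>
      ho i (Finset.mem_insert_of_mem hi) a (Finset.mem_insert_self _ _) (fun h => ha (h ▸ hi))
    have h4 : E a ≤ D.perp (⨆ i ∈ S, E i) := D.le_perp_comm.mp h3
    rw [Finset.iSup_insert, Finset.sum_insert ha]
    refine ⟨ND.sup (hE a (Finset.mem_insert_self _ _)) h1 h4, ?_⟩
    have h5 := Submodule.finrank_sup_add_finrank_inf_eq (E a) (⨆ i ∈ S, E i)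
    have h6 : E a ⊓ (⨆ i ∈ S, E i) = ⊥ := by
      rw [eq_bot_iff]
      rintro x ⟨hx, hx'⟩
      exact ND.eq_zero (hE a (Finset.mem_insert_self _ _)) hx (h3 hx')
    rw [h6, finrank_bot, h2] at h5
    omega

theorem orth_fam_le {ι : Type*} {E : ι → Submodule K V} (S : Finset ι) (hE : ∀ i ∈ S, D.ND (E i))
    (ho : ∀ i ∈ S, ∀ j ∈ S, i ≠ j → E i ≤ D.perp (E j)) : ∑ i ∈ S, Module.finrank K (E i) ≤ D.n := by
  haveI := D.fd
  rw [← (orth_fam S hE ho).2, ← D.finrank_V]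
  exact Submodule.finrank_le _

/-- moving a block by an element of prime order is expensive -/
theorem mover {t : ℕ} (ht : t.Prime) {I : Set (Submodule K V)} (hnd : ∀ Y ∈ I, D.ND Y)
    (ho : ∀ Y ∈ I, ∀ Y' ∈ I, Y ≠ Y' → Y ≤ D.perp Y') (hinv : ∀ Y ∈ I, Y.map g.toLinearMap ∈ I) (hgt : g ^ t = 1)
    {Y : Submodule K V} (hY : Y ∈ I) (hm : ¬ Stb g Y) : (t - 1) * Module.finrank K Y ≤ Module.finrank K (mv g) := by
  haveI := D.fd
  have hpI : ∀ i : ℕ, Y.map (g ^ i).toLinearMap ∈ I := by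
    intro i
    induction i with
    | zero => rw [pow_zero]; convert hY using 1; exact Submodule.map_id Y
    | succ i ih =>
      have := hinv _ ih
      rw [← Submodule.map_comp] at this
      rw [pow_succ']
      exact this
  have hdist : ∀ i < t, ∀ j < t, i ≠ j → Y.map (g ^ i).toLinearMap ≠ Y.map (g ^ j).toLinearMap := by
    have key : ∀ i j, i < j → j < t → Y.map (g ^ i).toLinearMap ≠ Y.map (g ^ j).toLinearMap := by
      intro i j hij hj heq
      apply hm
      have h1 : Stb (g ^ (j - i)) Y := by
        have h2 := congrArg (fun Z => Submodule.map ((g ^ i)⁻¹).toLinearMap Z) heq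
        simp only [← Submodule.map_comp] at h2
        have e1 : ((g ^ i)⁻¹).toLinearMap ∘ₗ (g ^ i).toLinearMap = LinearMap.id := by
          ext x; exact inv_apply_self' (g ^ i) x
        have e2 : ((g ^ i)⁻¹).toLinearMap ∘ₗ (g ^ j).toLinearMap = (g ^ (j - i)).toLinearMap := by
          have : (g ^ i)⁻¹ * g ^ j = g ^ (j - i) := by
            rw [inv_mul_eq_iff_eq_mul, ← pow_add]; congr 1; omega
          rw [← this]; rfl
        rw [e1, e2, Submodule.map_id] at h2
        exact h2.symm
      have hcop : Nat.Coprime (j - i) (orderOf g) := by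
        refine Nat.Coprime.coprime_dvd_right (orderOf_dvd_of_pow_eq_one hgt) ?_
        refine ((Nat.Prime.coprime_iff_not_dvd ht).mpr fun hd => ?_).symm
        have := Nat.le_of_dvd (by omega) hd
        omega
      obtain ⟨m, hm'⟩ := exists_pow_eq_self_of_coprime hcop
      rw [← hm']
      exact Stb.pow h1 m
    intro i hi j hj hij
    rcases lt_or_gt_of_ne hij with h | h
    · exact key i j h hj
    · exact (key j i h hi).symm
  have hfam := (orth_fam (D := D) (E := fun i => Y.map (g ^ i).toLinearMap) (Finset.range t) (fun i _ => hnd _ (hpI i))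
    (fun i hi j hj hij => ho _ (hpI i) _ (hpI j) (hdist i (Finset.mem_range.mp hi) j (Finset.mem_range.mp hj) hij))).2
  have hle : (⨆ i ∈ Finset.range t, Y.map (g ^ i).toLinearMap) ≤ mv g ⊔ Y := by
    refine iSup₂_le fun i _ => ?_
    rintro _ ⟨y, hy, rfl⟩
    have : (g ^ i) y = ((g ^ i) y - y) + y := by abel
    show (g ^ i) y ∈ _
    rw [this]
    exact Submodule.add_mem_sup (mv_pow_le g i (sub_mem_mv (g ^ i) y)) hy
  have h1 := Submodule.finrank_mono hle
  have h2 := Submodule.finrank_add_le_finrank_add_finrank (mv g) Y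
  simp only [finrank_map_equiv, Finset.sum_const, Finset.card_range, smul_eq_mul] at hfam
  rw [hfam] at h1
  have h3 : (t - 1) * Module.finrank K Y + Module.finrank K Y = t * Module.finrank K Y := by
    have : t = (t - 1) + 1 := by have := ht.one_lt; omega
    conv_rhs => rw [this, add_mul, one_mul]
  omega

/-- action on a set of blocks -/
def permH (H : Subgroup (V ≃ₗ[K] V)) (I : Set (Submodule K V)) (hinv : ∀ h ∈ H, ∀ Y ∈ I, Y.map h.toLinearMap ∈ I) :
    H →* Equiv.Perm I where
  toFun h :=
    { toFun := fun Y => ⟨Y.1.map h.1.toLinearMap, hinv _ h.2 _ Y.2⟩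
      invFun := fun Y => ⟨Y.1.map (h.1⁻¹).toLinearMap, hinv _ (H.inv_mem h.2) _ Y.2⟩
      left_inv := by
        intro Y
        apply Subtype.ext
        show (Y.1.map h.1.toLinearMap).map (h.1⁻¹).toLinearMap = Y.1
        rw [← Submodule.map_comp]
        convert Submodule.map_id Y.1
        ext x; exact inv_apply_self' h.1 x
      right_inv := by
        intro Y
        apply Subtype.ext
        show (Y.1.map (h.1⁻¹).toLinearMap).map h.1.toLinearMap = Y.1
        rw [← Submodule.map_comp]
        convert Submodule.map_id Y.1
        ext x; exact apply_inv_self' h.1 x }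
  map_one' := by
    ext1 Y
    exact Subtype.ext (Submodule.map_id Y.1)
  map_mul' a b := by
    ext1 Y
    exact Subtype.ext (Submodule.map_comp _ _ _)

theorem permH_apply {I : Set (Submodule K V)} (hinv : ∀ h ∈ H, ∀ Y ∈ I, Y.map h.toLinearMap ∈ I) (h : H) (Y : I) :
    ((permH H I hinv h Y : I) : Submodule K V) = Y.1.map h.1.toLinearMap := rfl

theorem color_of {I : Set (Submodule K V)} (hinv : ∀ h ∈ H, ∀ Y ∈ I, Y.map h.toLinearMap ∈ I) {r : ℕ} (hr : r.Prime)
    (hr2 : r ≠ 2) (htr : ∀ h ∈ H, ∀ t j : ℕ, t.Prime → t ≠ r → h ^ (t ^ j) = 1 → ∀ Y ∈ I, Stb h Y) :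
    ∃ S ⊆ I, ∀ h ∈ H, (∀ Y ∈ I, Y.map h.toLinearMap ∈ S ↔ Y ∈ S) → ∀ Y ∈ I, Stb h Y := by
  haveI : Fact r.Prime := ⟨hr⟩
  haveI := finite_sub (K := K) (V := V)
  haveI := finite_lequiv (K := K) (V := V)
  have hP : IsPGroup r (permH H I hinv).range := by
    rintro ⟨_, ⟨h, rfl⟩⟩
    obtain ⟨a, m, hm, ho⟩ := Nat.exists_eq_pow_mul_and_not_dvd (orderOf_pos h.1).ne' r hr.ne_one
    refine ⟨a, ?_⟩
    have hsub : Subgroup.zpowers (h.1 ^ r ^ a) ≤ H ⊓ ⨅ Y : I, stbG Y.1 := by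
      apply PP
      intro g hg t j ht hgt
      have hgH : g ∈ H := (Subgroup.zpowers_le.mpr (H.pow_mem h.2 _)) hg
      refine ⟨hgH, ?_⟩
      show g ∈ (⨅ Y : I, stbG Y.1)
      rw [Subgroup.mem_iInf]
      rintro ⟨Y, hY⟩
      rw [mem_stbG]
      by_cases htr' : t = r
      · subst htr'
        have h1 : orderOf g ∣ t ^ j := orderOf_dvd_of_pow_eq_one hgt
        have h2 : orderOf g ∣ m := by
          apply orderOf_dvd_of_pow_eq_one
          obtain ⟨z, rfl⟩ := hg
          show ((h.1 ^ t ^ a) ^ z) ^ m = 1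
          rw [← zpow_natCast, ← _root_.zpow_mul, mul_comm z, _root_.zpow_mul, zpow_natCast, ← pow_mul, ← ho, pow_orderOf_eq_one, _root_.one_zpow]
        have h3 : Nat.Coprime (t ^ j) m := Nat.Coprime.pow_left _ ((Nat.Prime.coprime_iff_not_dvd hr).mpr hm)
        have h4 : orderOf g = 1 := Nat.eq_one_of_dvd_coprimes h3 h1 h2
        rw [orderOf_eq_one_iff.mp h4]
        exact Stb_one
      · exact htr g hgH t j ht htr' hgt Y hY
    apply Subtype.ext
    show (permH H I hinv h) ^ (r ^ a) = 1
    rw [← map_pow]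
    ext1 Y
    apply Subtype.ext
    have h5 : h.1 ^ r ^ a ∈ (⨅ Y : I, stbG Y.1) := (hsub (Subgroup.mem_zpowers _)).2
    rw [Subgroup.mem_iInf] at h5
    exact (mem_stbG.mp (h5 Y))
  obtain ⟨S, hS, hcol⟩ := color hr2 (Nat.card I) (permH H I hinv).range hP Set.univ
    (by rw [Set.ncard_univ]) (fun _ _ _ _ => trivial)
  refine ⟨Subtype.val '' S, ?_, ?_⟩
  · rintro _ ⟨Y, _, rfl⟩; exact Y.2
  · intro h hh hst Y hY
    have := hcol (permH H I hinv ⟨h, hh⟩) ⟨_, rfl⟩ (by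
      rintro ⟨Z, hZ⟩
      have := hst Z hZ
      rw [Subtype.val_injective.mem_set_image.symm, Subtype.val_injective.mem_set_image.symm]
      exact this) ⟨Y, hY⟩ trivial
    exact congrArg Subtype.val this

/-- elements with orthogonal support move disjoint sets of blocks -/
theorem moved_disjoint {I : Set (Submodule K V)} (hnd : ∀ Y ∈ I, D.ND Y)
    (ho : ∀ Y ∈ I, ∀ Y' ∈ I, Y ≠ Y' → Y ≤ D.perp Y') (hne : ∀ Y ∈ I, Y ≠ ⊥)
    (hg : ∀ Y ∈ I, Y.map g.toLinearMap ∈ I) (hg' : ∀ Y ∈ I, Y.map (g⁻¹).toLinearMap ∈ I)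
    (hh : ∀ Y ∈ I, Y.map h.toLinearMap ∈ I)
    (hodd : Odd (orderOf g)) (hgh : mv g ≤ D.perp (mv h)) {Y : Submodule K V} (hY : Y ∈ I) (h1 : ¬ Stb g Y)
    (h2 : ¬ Stb h Y) : False := by
  have key : ∀ g' : V ≃ₗ[K] V, mv g' ≤ D.perp (mv h) → Y.map g'.toLinearMap ∈ I → Y.map g'.toLinearMap ≠ Y →
      Y.map g'.toLinearMap = Y.map h.toLinearMap := by
    intro g' h3 h4 h5
    by_contra h6
    apply hne Y hY
    rw [eq_bot_iff]
    intro y hy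
    refine ND.eq_zero (hnd Y hY) hy ?_
    intro w hw
    have e1 := h3 (sub_mem_mv g' y) _ (sub_mem_mv h w)
    have e2 : D.B (h w) (g' y) = 0 := ho _ h4 _ (hh _ hY) h6 ⟨y, hy, rfl⟩ _ ⟨w, hw, rfl⟩
    have e3 : D.B w (g' y) = 0 := ho _ h4 _ hY h5 ⟨y, hy, rfl⟩ _ hw
    have e4 : D.B (h w) y = 0 := ho _ hY _ (hh _ hY) (fun h7 => h2 h7.symm) hy _ ⟨w, hw, rfl⟩
    rw [B_sub_left, map_sub, map_sub, e2, e3, e4] at e1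
    simpa using e1
  have k1 := key g hgh (hg Y hY) h1
  have k2 := key g⁻¹ (mv_inv_le hgh) (hg' Y hY) (fun h3 => h1 (by have := Stb.inv (g := g⁻¹) h3; rwa [inv_inv] at this))
  apply h1
  have h3 : Stb (g ^ 2) Y := by
    have h4 := congrArg (fun Z => Submodule.map g.toLinearMap Z) (k1.trans k2.symm)
    simp only [← Submodule.map_comp] at h4
    have e1 : g.toLinearMap ∘ₗ (g⁻¹).toLinearMap = LinearMap.id := by
      ext x; exact apply_inv_self' g x
    rw [e1, Submodule.map_id] at h4
    rw [sq]; exact h4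
  obtain ⟨k, hk⟩ := hodd
  have h5 : g = ((g ^ 2) ^ k)⁻¹ := by
    rw [eq_inv_iff_mul_eq_one, ← pow_mul, ← pow_succ', ← hk, pow_orderOf_eq_one]
  rw [h5]
  exact (Stb.pow h3 k).inv

end blocks
end UData

section cyc
theorem cyc_meet {α : Type*} [Fintype α] [DecidableEq α] {t k : ℕ} (ht : t.Prime) (c : Fin k → Equiv.Perm α)
    (hc : ∀ i, c i ^ t = 1) (hne : ∀ i, c i ≠ 1) (hd : ∀ i j, i ≠ j → Disjoint (c i).support (c j).support)
    (hk : Fintype.card α < (k + 1) * t) (A : Finset α) (hA : t ≤ A.card) :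
    ∃ i, (c i).IsCycle ∧ (c i).support.card = t ∧ ∃ x ∈ A, x ∈ (c i).support := by
  have hord : ∀ i, orderOf (c i) = t := fun i => orderOf_eq_prime (hc i) (hne i) (hp := ⟨ht⟩)
  have hcard : ∀ i, ∃ n : ℕ, (c i).support.card = (n + 1) * t := by
    intro i
    obtain ⟨n, hn⟩ := Equiv.Perm.cycleType_prime_order (σ := c i) (by rw [hord]; exact ht)
    refine ⟨n, ?_⟩
    rw [← Equiv.Perm.sum_cycleType, hn, Multiset.sum_replicate, hord]
    simp
  have hsum : ∑ i, (c i).support.card ≤ Fintype.card α := by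
    rw [← Finset.card_biUnion (fun i _ j _ hij => hd i j hij)]
    exact Finset.card_le_univ _
  have hge : ∀ i, t ≤ (c i).support.card := by
    intro i
    obtain ⟨n, hn⟩ := hcard i
    rw [hn]
    nlinarith
  have heq : ∀ i, (c i).support.card = t := by
    intro i
    obtain ⟨n, hn⟩ := hcard i
    by_contra hne'
    have hn1 : 1 ≤ n := by
      rcases Nat.eq_zero_or_pos n with h | h
      · rw [h] at hn; omega
      · exact h
    have h1 : t + ∑ j : Fin k, t ≤ ∑ j, (c j).support.card := by
      rw [← Finset.add_sum_erase _ _ (Finset.mem_univ i), ← Finset.add_sum_erase _ (fun j => (c j).support.card) (Finset.mem_univ i), ← add_assoc]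
      refine add_le_add ?_ (Finset.sum_le_sum fun j _ => hge j)
      rw [hn]; nlinarith
    simp only [Finset.sum_const, Finset.card_univ, Fintype.card_fin, smul_eq_mul] at h1
    rw [add_mul] at hk
    omega
  by_contra hcon
  push Not at hcon
  have hdis : Disjoint A (Finset.univ.biUnion fun i => (c i).support) := by
    rw [Finset.disjoint_left]
    intro x hx hx'
    obtain ⟨i, -, hi⟩ := Finset.mem_biUnion.mp hx'
    refine hcon i ?_ (heq i) x hx hi
    apply Equiv.Perm.isCycle_of_prime_order
    · rw [hord]; exact ht
    · rw [hord, heq]; have := ht.pos; omega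
  have h1 := Finset.card_union_of_disjoint hdis
  rw [Finset.card_biUnion (fun i _ j _ hij => hd i j hij)] at h1
  simp only [heq, Finset.sum_const, Finset.card_univ, Fintype.card_fin, smul_eq_mul] at h1
  have h2 := Finset.card_le_univ (A ∪ Finset.univ.biUnion fun i => (c i).support)
  rw [add_mul] at hk
  omega

theorem cyc_exist (m : ℕ) {t : ℕ} (ht : t.Prime) :
    ∃ c : Fin (m / t) → Equiv.Perm (Fin m), (∀ i, c i ^ t = 1) ∧ (∀ i, c i ≠ 1) ∧
      (∀ i j, i ≠ j → Disjoint (c i).support (c j).support) := by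
  obtain ⟨g, hg⟩ := (Equiv.Perm.exists_with_cycleType_iff (α := Fin m) (m := Multiset.replicate (m / t) t)).mpr (by
    constructor
    · rw [Multiset.sum_replicate, Fintype.card_fin, smul_eq_mul]
      exact Nat.div_mul_le_self m t
    · intro a ha
      rw [Multiset.eq_of_mem_replicate ha]
      exact ht.two_le)
  have hcard : g.cycleFactorsFinset.card = m / t := by
    have := congrArg Multiset.card hg
    rw [Equiv.Perm.cycleType_def, Multiset.card_map, Multiset.card_replicate] at this
    exact this
  have hsup : ∀ c ∈ g.cycleFactorsFinset, c.support.card = t := by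
    intro c hc
    have : c.support.card ∈ g.cycleType := by
      rw [Equiv.Perm.cycleType_def]
      exact Multiset.mem_map_of_mem (Finset.card ∘ Equiv.Perm.support) hc
    rw [hg] at this
    exact Multiset.eq_of_mem_replicate this
  let eqv := (g.cycleFactorsFinset.equivFinOfCardEq hcard).symm
  refine ⟨fun i => (eqv i).1, ?_, ?_, ?_⟩
  · intro i
    have h1 := (Equiv.Perm.mem_cycleFactorsFinset_iff.mp (eqv i).2).1.orderOf
    rw [hsup _ (eqv i).2] at h1
    have h2 := pow_orderOf_eq_one (eqv i).1
    rwa [h1] at h2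
  · intro i
    exact (Equiv.Perm.mem_cycleFactorsFinset_iff.mp (eqv i).2).1.ne_one
  · intro i j hij
    rw [← Equiv.Perm.disjoint_iff_disjoint_support]
    exact g.cycleFactorsFinset_pairwise_disjoint (eqv i).2 (eqv j).2 (fun h => hij (eqv.injective (Subtype.ext h)))

theorem perm_comm {α : Type*} [Fintype α] [DecidableEq α] {k : ℕ} {c : Fin k → Equiv.Perm α}
    (hd : ∀ i j, i ≠ j → Disjoint (c i).support (c j).support) :
    ∀ a ∈ Set.range c, ∀ b ∈ Set.range c, a * b = b * a := by
  rintro _ ⟨i, rfl⟩ _ ⟨j, rfl⟩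
  by_cases h : i = j
  · rw [h]
  · exact (Equiv.Perm.disjoint_iff_disjoint_support.mpr (hd i j h)).commute
end cyc

namespace UData
section caseI
variable {K V : Type} [Field K] [Finite K] [AddCommGroup V] [Module K V] [Finite V] {D : UData K V}
  {g h : V ≃ₗ[K] V} {U W : Submodule K V} {H : Subgroup (V ≃ₗ[K] V)} {Pi : Set ℕ}

theorem stb_of_small {I : Set (Submodule K V)} (hinv : ∀ h ∈ H, ∀ Y ∈ I, Y.map h.toLinearMap ∈ I) (hg : g ∈ H) {t j : ℕ}
    (ht : t.Prime) (hgt : g ^ (t ^ j) = 1) (hI : I.ncard < t) : ∀ Y ∈ I, Stb g Y := by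
  classical
  haveI := finite_sub (K := K) (V := V)
  haveI : Fintype I := Fintype.ofFinite _
  set π := permH H I hinv ⟨g, hg⟩ with hπ
  have h1 : orderOf π ∣ t ^ j := by
    apply orderOf_dvd_of_pow_eq_one
    have h5 : (⟨g, hg⟩ : H) ^ (t ^ j) = 1 := Subtype.ext hgt
    rw [hπ, ← map_pow, h5, map_one]
  have h2 : orderOf π ∣ I.ncard.factorial := by
    have := orderOf_dvd_card (x := π)
    rwa [Fintype.card_perm, ← Nat.card_eq_fintype_card, Nat.card_coe_set_eq] at this
  have h3 : Nat.Coprime (t ^ j) I.ncard.factorial := by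
    apply Nat.Coprime.pow_left
    rw [Nat.Prime.coprime_iff_not_dvd ht, ht.dvd_factorial]
    omega
  have h4 : π = 1 := orderOf_eq_one_iff.mp (Nat.eq_one_of_dvd_coprimes h3 h1 h2)
  intro Y hY
  exact congrArg (fun f : Equiv.Perm I => ((f ⟨Y, hY⟩ : I) : Submodule K V)) h4

def TT (D : UData K V) (H : Subgroup (V ≃ₗ[K] V)) (r : ℕ) : Set (V ≃ₗ[K] V) :=
  {k | k ∈ H ∧ k ^ r = 1 ∧ Module.finrank K (mv k) = D.e r}

theorem TT_conj {r : ℕ} {k : V ≃ₗ[K] V} (hk : k ∈ TT D H r) (hh : h ∈ H) : h * k * h⁻¹ ∈ TT D H r := by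
  refine ⟨H.mul_mem (H.mul_mem hh hk.1) (H.inv_mem hh), ?_, ?_⟩
  · rw [conj_pow, hk.2.1, mul_one, mul_inv_cancel]
  · rw [mv_conj, finrank_map_equiv, hk.2.2]

structure CaseI (D : UData K V) (H : Subgroup (V ≃ₗ[K] V)) (Pi : Set ℕ) (r : ℕ) : Prop where
  hall : HallData D H Pi
  hr : r ∈ Pi
  hmin : ∀ t ∈ Pi, D.e r ≤ D.e t
  comm : ∀ k ∈ TT D H r, ∀ k' ∈ TT D H r, k * k' = k' * k

namespace CaseI
variable {r : ℕ}

theorem nd (h : CaseI D H Pi r) : ∀ Y ∈ mv '' TT D H r, D.ND Y := by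
  rintro _ ⟨k, hk, rfl⟩
  exact h.hall.ND hk.1

theorem dim (h : CaseI D H Pi r) : ∀ Y ∈ mv '' TT D H r, Module.finrank K Y = D.e r := by
  rintro _ ⟨k, hk, rfl⟩
  exact hk.2.2

theorem ne (h : CaseI D H Pi r) : ∀ Y ∈ mv '' TT D H r, Y ≠ ⊥ := by
  rintro Y hY rfl
  have := h.dim _ hY
  rw [finrank_bot] at this
  exact (h.hall.e_pos h.hr).ne this

theorem inv (h : CaseI D H Pi r) : ∀ g ∈ H, ∀ Y ∈ mv '' TT D H r, Y.map g.toLinearMap ∈ mv '' TT D H r := by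
  rintro g hg _ ⟨k, hk, rfl⟩
  exact ⟨_, TT_conj hk hg, mv_conj k g⟩

theorem orth (h : CaseI D H Pi r) : ∀ Y ∈ mv '' TT D H r, ∀ Y' ∈ mv '' TT D H r, Y ≠ Y' → Y ≤ D.perp Y' := by
  rintro _ ⟨k, hk, rfl⟩ _ ⟨k', hk', rfl⟩ hne
  exact (Clem (h.hall.pr r h.hr) (h.hall.ne r h.hr) (h.hall.le hk.1) (h.hall.le hk'.1) hk.2.1 hk'.2.1 hk.2.2 hk'.2.2
    (h.comm k hk k' hk')).resolve_left hne

theorem card (h : CaseI D H Pi r) : (mv '' TT D H r).ncard = D.n / D.e r := by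
  haveI := finite_sub (K := K) (V := V)
  have he := h.hall.e_pos h.hr
  apply le_antisymm
  · rw [Nat.le_div_iff_mul_le he]
    have hf : (mv '' TT D H r).Finite := Set.toFinite _
    have := orth_fam_le (D := D) (E := id) hf.toFinset (fun Y hY => h.nd Y (hf.mem_toFinset.mp hY))
      (fun Y hY Y' hY' hne => h.orth Y (hf.mem_toFinset.mp hY) Y' (hf.mem_toFinset.mp hY') hne)
    rw [Finset.sum_congr rfl (f := fun Y : Submodule K V => Module.finrank K (id Y : Submodule K V)) (g := fun _ => D.e r) (fun Y hY => h.dim Y (hf.mem_toFinset.mp hY)), Finset.sum_const,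
      smul_eq_mul, ← Set.ncard_eq_toFinset_card _ hf] at this
    exact this
  · obtain ⟨σ, h1, h2, h3, h4⟩ := h.hall.exists_star h.hr (Nat.div_mul_le_self D.n (D.e r))
    have hinj : Function.Injective (fun i => mv (σ i)) := by
      intro i j hij
      by_contra hne
      have h5 : ∀ k : V ≃ₗ[K] V, k = σ i → False := by
        intro k hk
        have h6 := h.nd (mv (σ i)) ⟨σ i, ⟨h1 i, by rw [← h2 i, pow_orderOf_eq_one], h3 i⟩, rfl⟩
        apply h.ne (mv (σ i)) ⟨σ i, ⟨h1 i, by rw [← h2 i, pow_orderOf_eq_one], h3 i⟩, rfl⟩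
        rw [eq_bot_iff]
        intro x hx
        refine ND.eq_zero h6 hx ?_
        have := h4 i j hne
        rw [show mv (σ j) = mv (σ i) from hij.symm] at this
        exact this hx
      exact h5 _ rfl
    have h5 : (Set.range fun i => mv (σ i)).ncard = D.n / D.e r := by
      rw [← Set.image_univ, Set.ncard_image_of_injective _ hinj, Set.ncard_univ, Nat.card_fin]
    rw [← h5]
    refine Set.ncard_le_ncard ?_ (Set.toFinite _)
    rintro _ ⟨i, rfl⟩
    exact ⟨σ i, ⟨h1 i, by rw [← h2 i, pow_orderOf_eq_one], h3 i⟩, rfl⟩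

theorem triv (h : CaseI D H Pi r) (hg : g ∈ H) (ht : ∀ Y ∈ mv '' TT D H r, ∀ x ∈ Y, g x = x) : g = 1 := by
  haveI := finite_sub (K := K) (V := V)
  haveI := D.fd
  by_contra hne
  have hf : (mv '' TT D H r).Finite := Set.toFinite _
  obtain ⟨h1, h2⟩ := orth_fam (D := D) (E := id) hf.toFinset (fun Y hY => h.nd Y (hf.mem_toFinset.mp hY))
      (fun Y hY Y' hY' hne => h.orth Y (hf.mem_toFinset.mp hY) Y' (hf.mem_toFinset.mp hY') hne)
  rw [Finset.sum_congr rfl (f := fun Y : Submodule K V => Module.finrank K (id Y : Submodule K V)) (g := fun _ => D.e r) (fun Y hY => h.dim Y (hf.mem_toFinset.mp hY)), Finset.sum_const,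
      smul_eq_mul, ← Set.ncard_eq_toFinset_card _ hf, h.card] at h2
  set X : Submodule K V := ⨆ i ∈ hf.toFinset, id i
  have h3 : X ≤ D.perp (mv g) := by
    refine iSup₂_le fun Y hY => ?_
    exact orth_of_triv (h.hall.le hg) (ht Y (hf.mem_toFinset.mp hY))
  have h4 : mv g ≤ D.perp X := D.le_perp_comm.mp h3
  have h5 := Submodule.finrank_mono h4
  have h6 := ND.finrank h1
  obtain ⟨t, htP, m, -, -, h7⟩ := h.hall.exists_prime hg hne
  have h8 := Submodule.finrank_mono (mv_pow_le g m)
  have h9 := h.hmin t htP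
  have h10 := h.hall.e_pos h.hr
  have h11 := Nat.div_add_mod D.n (D.e r)
  have h12 := Nat.mod_lt D.n h10
  have h13 := mul_comm (D.n / D.e r) (D.e r)
  omega

theorem stcomm (h : CaseI D H Pi r) {k : V ≃ₗ[K] V} (hk : k ∈ TT D H r) (hg : g ∈ H) (hst : Stb g (mv k)) : g * k = k * g :=
  h.hall.free_block h.hr h.hmin hk.1 hk.2.1 hk.2.2
    (fun a ha b hb _ _ => h.comm _ (TT_conj hk ha) _ (TT_conj hk hb)) g hg hst

theorem dich (h : CaseI D H Pi r) (hg : g ∈ H) {Y : Submodule K V} (hY : Y ∈ mv '' TT D H r) (hst : Stb g Y) :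
    mvo g Y = ⊥ ∨ mvo g Y = Y := by
  obtain ⟨k, hk, rfl⟩ := hY
  exact free_dich (h.hall.pr r h.hr) (h.hall.ne r h.hr) (h.hall.le hk.1) (h.hall.le hg) hk.2.1 hk.2.2 (h.hall.p' hg)
    (h.stcomm hk hg hst)

theorem fix (h : CaseI D H Pi r) (hg : g ∈ H) {Y : Submodule K V} (hY : Y ∈ mv '' TT D H r) (hst : Stb g Y)
    {u : V} (hu : u ∈ Y) (hu0 : u ≠ 0) (hfix : g u = u) : ∀ x ∈ Y, g x = x := by
  obtain ⟨k, hk, rfl⟩ := hY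
  exact free_fix (h.hall.pr r h.hr) (h.hall.ne r h.hr) (h.hall.le hk.1) (h.hall.le hg) hk.2.1 hk.2.2 (h.hall.p' hg)
    (h.stcomm hk hg hst) hu hu0 hfix

theorem exists_full (h : CaseI D H Pi r) (hg : g ∈ H) (hg1 : g ≠ 1) (hst : ∀ Y ∈ mv '' TT D H r, Stb g Y) :
    ∃ Y ∈ mv '' TT D H r, mvo g Y = Y := by
  by_contra hcon
  push Not at hcon
  apply hg1
  apply h.triv hg
  intro Y hY
  exact mvo_eq_bot.mp ((h.dich hg hY (hst Y hY)).resolve_right (hcon Y hY))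

/-- for every prime in `Pi` there are many cycles -/
theorem moving (h : CaseI D H Pi r) {t : ℕ} (ht : t ∈ Pi) : ∃ c : Fin ((mv '' TT D H r).ncard / t) → (V ≃ₗ[K] V),
    (∀ i, c i ∈ H) ∧ (∀ i, c i ^ t = 1) ∧ (∀ i, ∃ Y ∈ mv '' TT D H r, ¬ Stb (c i) Y) ∧
    (∀ i j, i ≠ j → ∀ Y ∈ mv '' TT D H r, ¬ Stb (c i) Y → ¬ Stb (c j) Y → False) := by
  haveI := finite_sub (K := K) (V := V)
  haveI := D.fd
  have htp := h.hall.pr t ht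
  have ht3 : 3 ≤ t := by have := htp.two_le; have := h.hall.odd t ht; omega
  have he := h.hall.e_pos h.hr
  rw [h.card]
  set m := D.n / D.e r with hm
  have hmn : m * D.e r ≤ D.n := Nat.div_mul_le_self _ _
  obtain ⟨c, hc1, hc2, hc3⟩ := cyc_exist m htp
  have hQ : IsPGroup t (Subgroup.closure (Set.range c)) := pgroup_closure (perm_comm hc3) (by rintro _ ⟨i, rfl⟩; exact hc1 i)
  by_cases hte : D.e t = D.e r
  · obtain ⟨Ψ, σ, h1, h2, h3, h4, h5, h6⟩ := h.hall.exists_wreath ht (m := m) (by rw [hte]; exact hmn) _ hQ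
    have hσt : ∀ i, σ i ^ t = 1 := fun i => by rw [← h3 i, pow_orderOf_eq_one]
    have hσ1 : ∀ i, σ i ≠ 1 := fun i h7 => by
      have := h3 i
      rw [h7, orderOf_one] at this
      exact htp.one_lt.ne this
    have hst : ∀ i, ∀ Y ∈ mv '' TT D H r, Stb (σ i) Y := by
      intro i Y hY
      by_contra hns
      have h7 := mover htp h.nd h.orth (h.inv _ (h2 i)) (hσt i) hY hns
      rw [h4, h.dim Y hY, hte] at h7
      have : 2 * D.e r ≤ (t - 1) * D.e r := Nat.mul_le_mul_right _ (by omega)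
      omega
    have hmem : ∀ i, mv (σ i) ∈ mv '' TT D H r := by
      intro i
      obtain ⟨Y, hY, h7⟩ := h.exists_full (h2 i) (hσ1 i) (hst i)
      have h8 : Y ≤ mv (σ i) := h7 ▸ mvo_le_mv
      have h9 : Y = mv (σ i) := Submodule.eq_of_le_of_finrank_eq h8 (by rw [h4, h.dim Y hY, hte])
      exact h9 ▸ hY
    have hinj : Function.Injective (fun i => mv (σ i)) := by
      intro i j hij
      by_contra hne
      apply h.ne _ (hmem i)
      rw [eq_bot_iff]
      intro x hx
      refine ND.eq_zero (h.nd _ (hmem i)) hx ?_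
      have h7 := h5 i j hne
      rw [show mv (σ j) = mv (σ i) from hij.symm] at h7
      exact h7 hx
    have hsurj : ∀ Y ∈ mv '' TT D H r, ∃ i, mv (σ i) = Y := by
      have h7 : (Set.range fun i => mv (σ i)) = mv '' TT D H r := by
        refine Set.eq_of_subset_of_ncard_le ?_ ?_ (Set.toFinite _)
        · rintro _ ⟨i, rfl⟩; exact hmem i
        · rw [← Set.image_univ, Set.ncard_image_of_injective _ hinj, Set.ncard_univ, Nat.card_fin, h.card]
      intro Y hY
      rw [← h7] at hY
      exact hY
    have hiff : ∀ τ i, Stb (Ψ τ) (mv (σ i)) ↔ τ i = i := by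
      intro τ i
      show (mv (σ i)).map (Ψ τ).toLinearMap = mv (σ i) ↔ _
      rw [← mv_conj, h6]
      exact ⟨fun h7 => hinj h7, fun h7 => by rw [h7]⟩
    refine ⟨fun j => Ψ (c j), fun j => h1 _ (Subgroup.subset_closure ⟨j, rfl⟩), fun j => by rw [← map_pow, hc1, map_one], ?_, ?_⟩
    · intro j
      by_contra hcon
      push Not at hcon
      apply hc2 j
      ext1 i
      exact (hiff _ i).mp (hcon _ (hmem i))
    · intro i j hij Y hY h7 h8
      obtain ⟨a, rfl⟩ := hsurj Y hY
      rw [hiff] at h7 h8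
      exact Finset.disjoint_left.mp (hc3 i j hij) (Equiv.Perm.mem_support.mpr h7) (Equiv.Perm.mem_support.mpr h8)
  · obtain ⟨Ψ, E, h1, h2, h3, h4, h5, h6, h7⟩ := exists_blocks (D := D) hmn
    obtain ⟨a, ha, haH⟩ := h.hall.conj t ht ((Subgroup.closure (Set.range c)).map Ψ)
      (by rintro _ ⟨τ, -, rfl⟩; exact h1 τ) (hQ.map Ψ)
    have hgH : ∀ j, a * Ψ (c j) * a⁻¹ ∈ H := fun j => haH _ ⟨_, Subgroup.subset_closure ⟨j, rfl⟩, rfl⟩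
    have hgt : ∀ j, (a * Ψ (c j) * a⁻¹) ^ t = 1 := fun j => by
      rw [conj_pow, ← map_pow, hc1, map_one, mul_one, mul_inv_cancel]
    have hg1 : ∀ j, a * Ψ (c j) * a⁻¹ ≠ 1 := by
      intro j h8
      rw [mul_inv_eq_one, mul_eq_left] at h8
      apply hc2 j
      ext1 i
      by_contra h9
      have h10 := h5 (c j) i
      rw [h8] at h10
      have h11 : E i = E (c j i) := (Submodule.map_id (E i)).symm.trans h10
      have h12 := h4 i (c j i) (fun h => h9 h.symm)
      rw [← h11] at h12
      have h13 : E i = ⊥ := by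
        rw [eq_bot_iff]
        intro x hx
        exact ND.eq_zero (h2 i) hx (h12 hx)
      have h14 := h3 i
      rw [h13, finrank_bot] at h14
      omega
    refine ⟨fun j => a * Ψ (c j) * a⁻¹, hgH, hgt, ?_, ?_⟩
    · intro j
      by_contra hcon
      push Not at hcon
      obtain ⟨Y, hY, h8⟩ := h.exists_full (hgH j) (hg1 j) hcon
      have h9 := Ro htp (h.hall.ne t ht) (h.hall.le (hgH j)) (j := 1) (by rw [pow_one]; exact hgt j) (h.nd Y hY) (hcon Y hY)
      rw [h8, h.dim Y hY] at h9
      have h10 := Nat.le_of_dvd he h9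
      have h11 := h.hmin t ht
      omega
    · intro i j hij Y hY h8 h9
      refine moved_disjoint h.nd h.orth h.ne (h.inv _ (hgH i)) (h.inv _ (H.inv_mem (hgH i))) (h.inv _ (hgH j)) ?_ ?_ hY h8 h9
      · exact Odd.of_dvd_nat (htp.odd_of_ne_two (h.hall.odd t ht)) (orderOf_dvd_of_pow_eq_one (hgt i))
      · rw [mv_conj, mv_conj]
        rintro _ ⟨x, hx, rfl⟩
        rintro _ ⟨y, hy, rfl⟩
        refine (GU_apply D ha y x).trans ?_
        have h10 : mv (Ψ (c i)) ≤ D.perp (mv (Ψ (c j))) := by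
          refine (h7 (c i)).trans ?_
          refine (iSup₂_le fun u hu => ?_)
          refine le_trans ?_ (D.perp_anti (h7 (c j)))
          refine D.le_perp_comm.mp (iSup₂_le fun v hv => ?_)
          refine h4 v u (fun huv => ?_)
          subst huv
          exact Finset.disjoint_left.mp (hc3 i j hij) hu hv
        exact h10 hx y hy

theorem odd_card (h : CaseI D H Pi r) : Odd (Nat.card (permH H _ h.inv).range) := by
  haveI := finite_lequiv (K := K) (V := V)
  rw [← Nat.not_even_iff_odd, even_iff_two_dvd]
  intro h2
  exact h.hall.odd 2 (h.hall.sub 2 Nat.prime_two (h2.trans (Subgroup.card_range_dvd _))) rfl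

theorem cyc (h : CaseI D H Pi r) [Fintype (mv '' TT D H r)] [DecidableEq (mv '' TT D H r)] {t : ℕ} (ht : t ∈ Pi)
    (A : Finset (mv '' TT D H r)) (hA : t ≤ A.card) :
    ∃ c ∈ (permH H _ h.inv).range, c.IsCycle ∧ c.support.card = t ∧ ∃ x ∈ A, x ∈ c.support := by
  obtain ⟨c, h1, h2, h3, h4⟩ := h.moving ht
  have hsup : ∀ i (Y : mv '' TT D H r), Y ∈ (permH H _ h.inv ⟨c i, h1 i⟩).support ↔ ¬ Stb (c i) Y.1 := by
    intro i Y
    rw [Equiv.Perm.mem_support, ← Subtype.coe_injective.ne_iff]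
    exact Iff.rfl
  have htp := h.hall.pr t ht
  have k1 : ∀ i, (fun i => permH H _ h.inv ⟨c i, h1 i⟩) i ^ t = 1 := by
    intro i
    have h5 : (⟨c i, h1 i⟩ : H) ^ t = 1 := Subtype.ext (h2 i)
    show (permH H _ h.inv ⟨c i, h1 i⟩) ^ t = 1
    rw [← map_pow, h5, map_one]
  have k2 : ∀ i, (fun i => permH H _ h.inv ⟨c i, h1 i⟩) i ≠ 1 := by
    intro i h5
    obtain ⟨Y, hY, h6⟩ := h3 i
    apply h6
    have := congrArg (fun f => ((f ⟨Y, hY⟩ : mv '' TT D H r) : Submodule K V)) h5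
    exact this
  have k3 : ∀ i j, i ≠ j → Disjoint ((fun i => permH H _ h.inv ⟨c i, h1 i⟩) i).support ((fun i => permH H _ h.inv ⟨c i, h1 i⟩) j).support := by
    intro i j hij
    rw [Finset.disjoint_left]
    intro Y hY hY'
    exact h4 i j hij Y.1 Y.2 ((hsup i Y).mp hY) ((hsup j Y).mp hY')
  have k4 : Fintype.card (mv '' TT D H r) < ((mv '' TT D H r).ncard / t + 1) * t := by
    rw [← Nat.card_eq_fintype_card, Nat.card_coe_set_eq]
    have h5 := Nat.div_add_mod (mv '' TT D H r).ncard t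
    have h6 := Nat.mod_lt (mv '' TT D H r).ncard htp.pos
    rw [add_mul, one_mul, mul_comm]
    omega
  obtain ⟨i, h5, h6, h7⟩ := cyc_meet htp (fun i => permH H _ h.inv ⟨c i, h1 i⟩) k1 k2 k3 k4 A hA
  exact ⟨_, ⟨⟨c i, h1 i⟩, rfl⟩, h5, h6, h7⟩

/-- at most one prime of `Pi` is at most the number of blocks -/
theorem unique (h : CaseI D H Pi r) {t s : ℕ} (ht : t ∈ Pi) (hs : s ∈ Pi) (hts : t < s) (hsm : s ≤ D.n / D.e r) : False := by
  classical
  haveI := finite_sub (K := K) (V := V)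
  haveI : Fintype (mv '' TT D H r) := Fintype.ofFinite _
  obtain ⟨ρ, hρ, h1, h2, -⟩ := h.cyc hs Finset.univ (by
    rw [Finset.card_univ, ← Nat.card_eq_fintype_card, Nat.card_coe_set_eq, h.card]; exact hsm)
  obtain ⟨c, hc, h3, h4, x, hx, hx'⟩ := h.cyc ht ρ.support (by omega)
  exact lemJ h.odd_card hc hρ h3 h1 h4 h2 (h.hall.pr s hs) hts ⟨x, hx', hx⟩

theorem le_of_moved (h : CaseI D H Pi r) (hg : g ∈ H) {t j : ℕ} (ht : t.Prime) (hgt : g ^ (t ^ j) = 1)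
    {Y : Submodule K V} (hY : Y ∈ mv '' TT D H r) (hns : ¬ Stb g Y) : t ≤ D.n / D.e r := by
  by_contra hlt
  exact hns (stb_of_small h.inv hg ht hgt (by rw [h.card]; omega) Y hY)

theorem color (h : CaseI D H Pi r) : ∃ S ⊆ mv '' TT D H r, ∀ g ∈ H,
    (∀ Y ∈ mv '' TT D H r, Y.map g.toLinearMap ∈ S ↔ Y ∈ S) → ∀ Y ∈ mv '' TT D H r, Stb g Y := by
  have key : ∀ r' ∈ Pi, (∀ t ∈ Pi, t ≠ r' → ¬ t ≤ D.n / D.e r) → ∃ S ⊆ mv '' TT D H r, ∀ g ∈ H,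
      (∀ Y ∈ mv '' TT D H r, Y.map g.toLinearMap ∈ S ↔ Y ∈ S) → ∀ Y ∈ mv '' TT D H r, Stb g Y := by
    intro r' hr' hall
    refine color_of h.inv (h.hall.pr r' hr') (h.hall.odd r' hr') ?_
    intro g hg t j ht htr hgt Y hY
    by_contra hns
    have h1 : g ≠ 1 := by rintro rfl; exact hns Stb_one
    exact hall t (h.hall.mem_pi hg ht hgt h1) htr (h.le_of_moved hg ht hgt hY hns)
  by_cases hex : ∃ r' ∈ Pi, r' ≤ D.n / D.e r
  · obtain ⟨r', hr', hle⟩ := hex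
    refine key r' hr' fun t ht hne hle' => ?_
    rcases lt_or_gt_of_ne hne with h1 | h1
    · exact h.unique ht hr' h1 hle
    · exact h.unique hr' ht h1 hle'
  · push Not at hex
    exact key r h.hr fun t ht _ => (hex t ht).not_ge

end CaseI
end caseI
end UData

namespace UData
section caseII
variable {K V : Type} [Field K] [Finite K] [AddCommGroup V] [Module K V] [Finite V] {D : UData K V}
  {g h : V ≃ₗ[K] V} {U W : Submodule K V} {H : Subgroup (V ≃ₗ[K] V)} {Pi : Set ℕ}

/-- dimension of orthogonal nondegenerate subspaces inside a common space -/
theorem orth_dim (hU : D.ND U) (ho : W ≤ D.perp U) {X : Submodule K V} (h1 : U ≤ X) (h2 : W ≤ X) :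
    Module.finrank K U + Module.finrank K W ≤ Module.finrank K X := by
  haveI := D.fd
  have h3 : U ⊓ W = ⊥ := by
    rw [eq_bot_iff]
    rintro x ⟨hx, hx'⟩
    exact ND.eq_zero hU hx (ho hx')
  have h4 := Submodule.finrank_sup_add_finrank_inf_eq U W
  rw [h3, finrank_bot] at h4
  have h5 := Submodule.finrank_mono (sup_le h1 h2)
  omega

theorem HallData.sub_pi (hH : HallData D H Pi) {L : Subgroup (V ≃ₗ[K] V)} (hL : L ≤ H) {t : ℕ} (ht : t.Prime)
    (htL : t ∣ Nat.card L) : t ∈ Pi := hH.sub t ht (htL.trans (Subgroup.card_dvd_of_le hL))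

theorem HallData.three_le (hH : HallData D H Pi) {t : ℕ} (ht : t ∈ Pi) : 3 ≤ t := by
  have := (hH.pr t ht).two_le
  have := hH.odd t ht
  omega

theorem HallData.parity (hH : HallData D H Pi) {t s : ℕ} (ht : t ∈ Pi) (hs : s ∈ Pi) : t ≠ s + 1 := by
  have h1 := (hH.pr t ht).odd_of_ne_two (hH.odd t ht)
  have h2 := (hH.pr s hs).odd_of_ne_two (hH.odd s hs)
  rintro rfl
  rcases h1 with ⟨a, ha⟩
  rcases h2 with ⟨b, hb⟩
  omega

theorem HallData.extr (hH : HallData D H Pi) {r : ℕ} (hr : r ∈ Pi) (hmin : ∀ t ∈ Pi, D.e r ≤ D.e t)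
    {k k' : V ≃ₗ[K] V} (hk : k ∈ TT D H r) (hk' : k' ∈ TT D H r) (hne : k * k' ≠ k' * k) :
    D.e r + 1 = r ∧ ∃ t ∈ Pi, t ≠ r ∧ D.e t = r ∧ ∃ σ ∈ H, σ ^ t = 1 ∧ Module.finrank K (mv σ) = r ∧ mv k ≤ mv σ := by
  haveI := D.fd
  haveI := finite_lequiv (K := K) (V := V)
  have hr3 := hH.three_le hr
  have he := hH.e_pos hr
  have hLH : Subgroup.closure {k, k'} ≤ H := by
    rw [Subgroup.closure_le]
    rintro x (rfl | rfl)
    · exact hk.1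
    · exact hk'.1
  have hU : ∀ a ∈ Subgroup.closure {k, k'}, mv a ≤ mv k ⊔ mv k' := by
    apply mv_closure_le
    rintro x (rfl | rfl)
    · exact le_sup_left
    · exact le_sup_right
  have hN : Module.finrank K (mv k ⊔ mv k' : Submodule K V) ≤ 2 * D.e r := by
    have := Submodule.finrank_add_le_finrank_add_finrank (mv k) (mv k')
    rw [hk.2.2, hk'.2.2] at this
    omega
  have hkL : k ∈ Subgroup.closure {k, k'} := Subgroup.subset_closure (by simp)
  have hkL' : k' ∈ Subgroup.closure {k, k'} := Subgroup.subset_closure (by simp)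
  have c1 : ∀ t : ℕ, t.Prime → t ∣ Nat.card (Subgroup.closure {k, k'}) → 2 * D.e r < t * D.e r ∧ ¬ t ∣ D.e r := by
    intro t ht htL
    have htP := hH.sub_pi hLH ht htL
    have h1 := hH.three_le htP
    have h2 := hH.e_lt htP
    have h3 := hmin t htP
    refine ⟨by nlinarith, fun hd => ?_⟩
    have := Nat.le_of_dvd he hd
    omega
  have c2 : ∀ t : ℕ, t.Prime → t ∣ Nat.card (Subgroup.closure {k, k'}) → t ≠ r → t ≠ D.p ∧ 2 * D.e r < t * D.e t := by
    intro t ht htL _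
    have htP := hH.sub_pi hLH ht htL
    have h1 := hH.three_le htP
    have h3 := hmin t htP
    exact ⟨hH.ne t htP, by nlinarith⟩
  rcases Zlem (hH.pr r hr) (hH.ne r hr) (hLH.trans hH.le) hU hN (by nlinarith) c1 c2 hkL hk.2.1 with h1 | h1
  · exact absurd (h1 k' hkL') hne
  · obtain ⟨t, ht, htr, htL, htp, ⟨h2, h3⟩, S, hSL, hSt, hSab, hSn, a, ha, hka⟩ := h1
    have htP := hH.sub_pi hLH ht htL
    have h4 := hH.e_lt hr
    have h5 := hmin t htP
    rw [hk.2.2] at h3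
    have h6 : D.e r + 1 = r := by omega
    have h7 : r ∣ D.e t := h2.resolve_left (by nlinarith)
    obtain ⟨c, hc⟩ := h7
    have het := hH.e_pos htP
    have hSH : S ≤ H := hSL.trans hLH
    have hrank : ∀ x ∈ S, x ≠ 1 → Module.finrank K (mv x) = r ∧ D.e t = r := by
      intro x hx hx1
      obtain ⟨j, hj⟩ := hSt ⟨x, hx⟩
      obtain ⟨d, hd⟩ := R (D := D) ht htp (hH.le (hSH hx)) (j := j) (congrArg Subtype.val hj)
      have h8 := (Submodule.finrank_mono (hU x (hSL hx))).trans hN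
      have h9 : Module.finrank K (mv x) ≠ 0 := by
        intro h; apply hx1; rw [← mv_eq_bot]; exact Submodule.finrank_eq_zero.mp h
      have hcd : c * d = 1 := by
        have h10 : c * d < 2 := by
          by_contra hge
          have : r * 2 ≤ r * (c * d) := Nat.mul_le_mul_left _ (by omega)
          rw [← mul_assoc, ← hc, ← hd] at this
          omega
        have h11 : c * d ≠ 0 := by
          intro h; apply h9; rw [hd, hc, mul_assoc, h, mul_zero]
        omega
      have hc1 := Nat.eq_one_of_mul_eq_one_right hcd
      have hd1 := Nat.eq_one_of_mul_eq_one_left hcd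
      subst hc1 hd1
      omega
    have ha1 : a ≠ 1 := by rintro rfl; simp at hka
    obtain ⟨b, hb, hb1, hbt⟩ : ∃ b ∈ S, b ≠ 1 ∧ b ^ t = 1 := by
      obtain ⟨t', m, ht', hm⟩ := exists_prime_pow ha1
      have hne1 : a ^ m ≠ 1 := by
        intro h; rw [h, orderOf_one] at hm; exact ht'.one_lt.ne hm
      obtain ⟨j, hj⟩ := hSt ⟨a, ha⟩
      have hj' : a ^ (t ^ j) = 1 := congrArg Subtype.val hj
      have : t' ∣ t ^ j := by
        rw [← hm]
        apply orderOf_dvd_of_pow_eq_one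
        rw [← pow_mul, mul_comm, pow_mul, hj', one_pow]
      have := (Nat.prime_dvd_prime_iff_eq ht' ht).mp (ht'.dvd_of_dvd_pow this)
      subst this
      exact ⟨a ^ m, S.pow_mem ha m, hne1, by conv_lhs => rw [← hm, pow_orderOf_eq_one]⟩
    have hbr := hrank b hb hb1
    have hNDb := hH.ND (hSH hb)
    have hsame : ∀ x ∈ S, x ≠ 1 → mv x = mv b := by
      intro x hx hx1
      obtain ⟨j, hj⟩ := hSt ⟨x, hx⟩
      have hst : Stb x (mv b) := mv_conj_of_comm (hSab x hx b hb)
      rcases mvo_dich ht htp (hH.le (hSH hx)) (j := j) (congrArg Subtype.val hj) hNDb hst (by rw [hbr.1, hbr.2]) with h8 | h8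
      · exfalso
        have h9 := orth_of_triv (hH.le (hSH hx)) (mvo_eq_bot.mp h8)
        have h10 := orth_dim hNDb (D.le_perp_comm.mp h9) (hU b (hSL hb)) (hU x (hSL hx))
        rw [hbr.1, (hrank x hx hx1).1] at h10
        omega
      · symm
        apply Submodule.eq_of_le_of_finrank_le
        · rw [← h8.1]; exact mvo_le_mv
        · rw [hbr.1, (hrank x hx hx1).1]
    refine ⟨h6, t, htP, htr, hbr.2, b, hSH hb, hbt, hbr.1, ?_⟩
    have hstk : Stb k (mv b) := by
      show (mv b).map k.toLinearMap = mv b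
      rw [← mv_conj]
      apply hsame _ (hSn b hb)
      intro h; apply hb1
      rwa [mul_inv_eq_one, mul_eq_left] at h
    have h8 := Ro (hH.pr r hr) (hH.ne r hr) (hH.le hk.1) (j := 1) (by rw [pow_one]; exact hk.2.1) hNDb hstk
    have h9 := Submodule.finrank_mono (mvo_le_mv (g := k) (U := mv b))
    rw [hk.2.2] at h9
    rcases Nat.eq_zero_or_pos (Module.finrank K (mvo k (mv b))) with h10 | h10
    · exfalso
      have h11 := orth_of_triv (hH.le hk.1) (mvo_eq_bot.mp (Submodule.finrank_eq_zero.mp h10))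
      rw [← hsame a ha ha1] at h11
      exact hka (comm_of_perp (hH.le hk.1) (hH.le (hSH ha)) (D.le_perp_comm.mp h11))
    · have h11 := Nat.le_of_dvd h10 h8
      rw [← Submodule.eq_of_le_of_finrank_le (mvo_le_mv (g := k) (U := mv b)) (by rw [hk.2.2]; exact h11)]
      exact mvo_le hstk

/-- type elements -/
def TS (D : UData K V) (H : Subgroup (V ≃ₗ[K] V)) (Pi : Set ℕ) (r : ℕ) : Set (V ≃ₗ[K] V) :=
  {σ | σ ∈ H ∧ Module.finrank K (mv σ) = r ∧ ∃ s ∈ Pi, s ≠ r ∧ D.e s = r ∧ σ ^ s = 1}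

structure CaseII (D : UData K V) (H : Subgroup (V ≃ₗ[K] V)) (Pi : Set ℕ) (r : ℕ) : Prop where
  hall : HallData D H Pi
  hr : r ∈ Pi
  her : D.e r + 1 = r
  hbig : ∀ t ∈ Pi, t ≠ r → r ≤ D.e t
  ncomm : ∃ k ∈ TT D H r, ∃ k' ∈ TT D H r, k * k' ≠ k' * k

theorem case_split (hH : HallData D H Pi) : (∃ r, CaseI D H Pi r) ∨ ∃ r, CaseII D H Pi r := by
  classical
  obtain ⟨t0, ht0, -⟩ := hH.two
  have hex : ∃ n, ∃ t ∈ Pi, D.e t = n := ⟨_, t0, ht0, rfl⟩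
  obtain ⟨r, hr, hre⟩ := Nat.find_spec hex
  have hmin : ∀ t ∈ Pi, D.e r ≤ D.e t := by
    intro t ht
    rw [hre]
    exact Nat.find_min' hex ⟨t, ht, rfl⟩
  by_cases hI : ∃ r, CaseI D H Pi r
  · exact Or.inl hI
  right
  have key : ∀ t ∈ Pi, D.e t = D.e r → ∃ k ∈ TT D H t, ∃ k' ∈ TT D H t, k * k' ≠ k' * k := by
    intro t ht hte
    by_contra hcon
    push Not at hcon
    exact hI ⟨t, hH, ht, fun u hu => hte ▸ hmin u hu, hcon⟩
  have key2 : ∀ t ∈ Pi, D.e t = D.e r → D.e t + 1 = t := by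
    intro t ht hte
    obtain ⟨k, hk, k', hk', hne⟩ := key t ht hte
    exact (hH.extr ht (fun u hu => hte ▸ hmin u hu) hk hk' hne).1
  refine ⟨r, hH, hr, key2 r hr rfl, ?_, key r hr rfl⟩
  intro t ht htr
  by_contra hlt
  have h1 := key2 r hr rfl
  have h2 := hmin t ht
  have h3 : D.e t = D.e r := by omega
  have h4 := key2 t ht h3
  omega

end caseII
end UData

namespace UData
section caseII2
variable {K V : Type} [Field K] [Finite K] [AddCommGroup V] [Module K V] [Finite V] {D : UData K V}
  {g h : V ≃ₗ[K] V} {U W : Submodule K V} {H : Subgroup (V ≃ₗ[K] V)} {Pi : Set ℕ} {r : ℕ}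

theorem TS_conj {σ : V ≃ₗ[K] V} (hσ : σ ∈ TS D H Pi r) (hh : h ∈ H) : h * σ * h⁻¹ ∈ TS D H Pi r := by
  obtain ⟨h1, h2, s, h3, h4, h5, h6⟩ := hσ
  refine ⟨H.mul_mem (H.mul_mem hh h1) (H.inv_mem hh), ?_, s, h3, h4, h5, ?_⟩
  · rw [mv_conj, finrank_map_equiv, h2]
  · rw [conj_pow, h6, mul_one, mul_inv_cancel]

def XX (D : UData K V) (H : Subgroup (V ≃ₗ[K] V)) (Pi : Set ℕ) (r : ℕ) : Set (Submodule K V) :=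
  {X | ∃ σ ∈ TS D H Pi r, X = mv σ ∧ ∃ k ∈ TT D H r, mv k ≤ mv σ}

def JJ (D : UData K V) (H : Subgroup (V ≃ₗ[K] V)) (Pi : Set ℕ) (r : ℕ) : Set (Submodule K V) :=
  {Y | ∃ k ∈ TT D H r, Y = mv k ∧ ∀ X ∈ XX D H Pi r, mv k ≤ D.perp X}

namespace CaseII

theorem three (c : CaseII D H Pi r) : 3 ≤ r := c.hall.three_le c.hr

theorem le (c : CaseII D H Pi r) {t : ℕ} (ht : t ∈ Pi) : r ≤ t := by
  by_cases h : t = r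
  · omega
  · have := c.hbig t ht h
    have := c.hall.e_lt ht
    omega

theorem le2 (c : CaseII D H Pi r) {t : ℕ} (ht : t ∈ Pi) (hne : t ≠ r) : r + 2 ≤ t := by
  have h1 := c.hbig t ht hne
  have h2 := c.hall.e_lt ht
  have h3 := c.hall.parity ht c.hr
  omega

theorem min (c : CaseII D H Pi r) : ∀ t ∈ Pi, D.e r ≤ D.e t := by
  intro t ht
  by_cases h : t = r
  · rw [h]
  · have := c.hbig t ht h
    have := c.her
    omega

theorem not_dvd (c : CaseII D H Pi r) {t : ℕ} (ht : t ∈ Pi) : ¬ t ∣ D.e r := by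
  intro h
  have h1 := Nat.le_of_dvd (c.hall.e_pos c.hr) h
  have h2 := c.le ht
  have h3 := c.her
  omega

/-- central argument for r'-groups of small support -/
theorem central (c : CaseII D H Pi r) {M : Subgroup (V ≃ₗ[K] V)} (hM : M ≤ H) (hrM : ¬ r ∣ Nat.card M) {N : ℕ}
    (hU : ∀ a ∈ M, mv a ≤ U) (hN : Module.finrank K U ≤ N) (hN2 : N < 2 * r) {σ : V ≃ₗ[K] V} (hσ : σ ∈ TS D H Pi r)
    (hσM : σ ∈ M) : ∀ x ∈ M, σ * x = x * σ := by
  obtain ⟨h1, h2, s, hs, hsr, hse, h6⟩ := hσ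
  have hr3 := c.three
  have hs2 := c.le2 hs hsr
  have c1 : ∀ t : ℕ, t.Prime → t ∣ Nat.card M → N < t * D.e s ∧ ¬ t ∣ D.e s := by
    intro t ht htL
    have htP := c.hall.sub_pi hM ht htL
    have htr : t ≠ r := by rintro rfl; exact hrM htL
    rw [hse]
    refine ⟨by have := c.le htP; nlinarith, fun hd => htr ?_⟩
    exact (Nat.prime_dvd_prime_iff_eq ht (c.hall.pr r c.hr)).mp hd
  have c2 : ∀ t : ℕ, t.Prime → t ∣ Nat.card M → t ≠ s → t ≠ D.p ∧ N < t * D.e t := by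
    intro t ht htL _
    have htP := c.hall.sub_pi hM ht htL
    have htr : t ≠ r := by rintro rfl; exact hrM htL
    have := c.hbig t htP htr
    have := c.le htP
    exact ⟨c.hall.ne t htP, by nlinarith⟩
  rcases Zlem (c.hall.pr s hs) (c.hall.ne s hs) (hM.trans c.hall.le) hU hN (by rw [hse]; nlinarith) c1 c2 hσM h6 with h | h
  · exact h
  · obtain ⟨t, ht, htr, htL, htp, ⟨h2', h3⟩, -⟩ := h
    rw [h2] at h3
    omega

/-- the key lemma D -/
theorem D_lem (c : CaseII D H Pi r) {σ k : V ≃ₗ[K] V} (hσ : σ ∈ TS D H Pi r) (hk : k ∈ TT D H r) :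
    mv k ≤ mv σ ∨ mv k ≤ D.perp (mv σ) := by
  haveI := D.fd
  haveI := finite_lequiv (K := K) (V := V)
  have hσ0 := hσ
  obtain ⟨h1, h2, s, hs, hsr, hse, h6⟩ := hσ
  have hr3 := c.three
  have her := c.her
  have hLH : Subgroup.closure {σ, k} ≤ H := by
    rw [Subgroup.closure_le]
    rintro x (rfl | rfl)
    · exact h1
    · exact hk.1
  have hU : ∀ a ∈ Subgroup.closure {σ, k}, mv a ≤ mv σ ⊔ mv k := by
    apply mv_closure_le
    rintro x (rfl | rfl)
    · exact le_sup_left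
    · exact le_sup_right
  have hN : Module.finrank K (mv σ ⊔ mv k : Submodule K V) ≤ 2 * r - 1 := by
    have := Submodule.finrank_add_le_finrank_add_finrank (mv σ) (mv k)
    rw [hk.2.2, h2] at this
    omega
  have hσL : σ ∈ Subgroup.closure {σ, k} := Subgroup.subset_closure (by simp)
  have hkL : k ∈ Subgroup.closure {σ, k} := Subgroup.subset_closure (by simp)
  have he2 : 2 ≤ D.e r := by omega
  have c1 : ∀ t : ℕ, t.Prime → t ∣ Nat.card (Subgroup.closure {σ, k}) → 2 * r - 1 < t * D.e r ∧ ¬ t ∣ D.e r := by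
    intro t ht htL
    have htP := c.hall.sub_pi hLH ht htL
    have := c.le htP
    refine ⟨?_, c.not_dvd htP⟩
    have : r * 2 ≤ t * D.e r := Nat.mul_le_mul this he2
    omega
  obtain ⟨M, hML, hMn, hrM, hM⟩ := BURN (c.hall.pr r c.hr) (c.hall.ne r c.hr) (hLH.trans c.hall.le) hU hN
    (by have : r * 2 ≤ r * D.e r := Nat.mul_le_mul le_rfl he2
        omega) c1
  have hσM : σ ∈ M := by
    apply hM σ hσL
    refine Nat.Coprime.coprime_dvd_left (orderOf_dvd_of_pow_eq_one h6) ?_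
    exact (Nat.coprime_primes (c.hall.pr s hs) (c.hall.pr r c.hr)).mpr hsr
  have hcen := c.central (hML.trans hLH) hrM (fun a ha => hU a (hML ha)) hN (by omega) hσ0 hσM
  have hσ' := TS_conj hσ0 hk.1
  have h7 : mv σ = mv (k * σ * k⁻¹) := by
    rcases Clem (c.hall.pr s hs) (c.hall.ne s hs) (c.hall.le h1) (c.hall.le hσ'.1) h6 (by rw [conj_pow, h6, mul_one, mul_inv_cancel])
      (by rw [h2, hse]) (by rw [hσ'.2.1, hse]) (hcen _ (hMn k hkL σ hσM)) with h | h
    · exact h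
    · exfalso
      have h8 := orth_dim (c.hall.ND hσ'.1) h (hU _ (hML (hMn k hkL σ hσM))) (hU _ hσL)
      rw [h2, hσ'.2.1] at h8
      omega
  have hst : Stb k (mv σ) := by
    show (mv σ).map k.toLinearMap = mv σ
    rw [← mv_conj, ← h7]
  have h8 := Ro (c.hall.pr r c.hr) (c.hall.ne r c.hr) (c.hall.le hk.1) (j := 1) (by rw [pow_one]; exact hk.2.1) (c.hall.ND h1) hst
  have h9 := Submodule.finrank_mono (mvo_le_mv (g := k) (U := mv σ))
  rw [hk.2.2] at h9
  rcases Nat.eq_zero_or_pos (Module.finrank K (mvo k (mv σ))) with h10 | h10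
  · right
    exact D.le_perp_comm.mp (orth_of_triv (c.hall.le hk.1) (mvo_eq_bot.mp (Submodule.finrank_eq_zero.mp h10)))
  · left
    have h11 := Nat.le_of_dvd h10 h8
    rw [← Submodule.eq_of_le_of_finrank_le (mvo_le_mv (g := k) (U := mv σ)) (by rw [hk.2.2]; exact h11)]
    exact mvo_le hst

theorem X_dich (c : CaseII D H Pi r) {X : Submodule K V} (hX : X ∈ XX D H Pi r) {σ' : V ≃ₗ[K] V} (hσ' : σ' ∈ TS D H Pi r) :
    X = mv σ' ∨ X ≤ D.perp (mv σ') := by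
  haveI := D.fd
  obtain ⟨σ, hσ, rfl, k, hk, hkσ⟩ := hX
  have hσ0 := hσ
  obtain ⟨h1, h2, s, hs, hsr, hse, h6⟩ := hσ
  have hr3 := c.three
  have her := c.her
  have hk' := TT_conj (D := D) hk h1
  have hst : Stb σ (mv σ) := mv_conj_of_comm rfl
  have hk's : mv (σ * k * σ⁻¹) ≤ mv σ := by
    rw [mv_conj]
    rintro _ ⟨x, hx, rfl⟩
    exact hst.mem (hkσ hx)
  have hne : mv k ≠ mv (σ * k * σ⁻¹) := by
    intro h
    rw [mv_conj] at h
    have hst2 : Stb σ (mv k) := h.symm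
    have h3 := Ro_triv (c.hall.pr s hs) (c.hall.ne s hs) (c.hall.le h1) (j := 1) (by rw [pow_one]; exact h6) (c.hall.ND hk.1) hst2 (by
      have := Submodule.finrank_mono (mvo_le hst2)
      rw [hk.2.2] at this
      omega)
    have h4 := orth_of_triv (c.hall.le h1) h3
    have h5 : mv k = ⊥ := by
      rw [eq_bot_iff]
      intro x hx
      exact ND.eq_zero (c.hall.ND h1) (hkσ hx) (h4 hx)
    have := hk.2.2
    rw [h5, finrank_bot] at this
    omega
  have hsup : mv k ⊔ mv (σ * k * σ⁻¹) = mv σ := by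
    apply Submodule.eq_of_le_of_finrank_le (sup_le hkσ hk's)
    have h3 : mv k < mv k ⊔ mv (σ * k * σ⁻¹) := by
      refine lt_of_le_of_ne le_sup_left (fun h => hne ?_)
      symm
      apply Submodule.eq_of_le_of_finrank_le
      · rw [h]; exact le_sup_right
      · rw [hk.2.2, hk'.2.2]
    have h4 := Submodule.finrank_lt_finrank_of_lt h3
    rw [hk.2.2] at h4
    rw [h2]
    omega
  have hmix : ¬ mv k ≤ D.perp (mv (σ * k * σ⁻¹)) := by
    intro h
    have := orth_dim (c.hall.ND hk'.1) h hk's hkσ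
    rw [hk.2.2, hk'.2.2, h2] at this
    omega
  rcases c.D_lem hσ' hk with h3 | h3 <;> rcases c.D_lem hσ' hk' with h4 | h4
  · left
    apply Submodule.eq_of_le_of_finrank_le
    · rw [← hsup]; exact sup_le h3 h4
    · rw [h2, hσ'.2.1]
  · exact absurd (h3.trans (D.le_perp_comm.mp h4)) hmix
  · exact absurd (h3.trans (D.perp_anti h4)) hmix
  · right
    rw [← hsup]; exact sup_le h3 h4

theorem X_orth (c : CaseII D H Pi r) : ∀ X ∈ XX D H Pi r, ∀ X' ∈ XX D H Pi r, X ≠ X' → X ≤ D.perp X' := by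
  rintro X hX _ ⟨σ', hσ', rfl, -⟩ hne
  exact (c.X_dich hX hσ').resolve_left hne

theorem J_comm (c : CaseII D H Pi r) {k k' : V ≃ₗ[K] V} (hk : k ∈ TT D H r) (hk' : k' ∈ TT D H r)
    (h : ∀ X ∈ XX D H Pi r, mv k ≤ D.perp X) : k * k' = k' * k := by
  haveI := D.fd
  by_contra hne
  obtain ⟨-, t, ht, htr, hte, σ, hσ, hσt, hσr, hkσ⟩ := c.hall.extr c.hr c.min hk hk' hne
  have h1 := h (mv σ) ⟨σ, ⟨hσ, hσr, t, ht, htr, hte, hσt⟩, rfl, k, hk, hkσ⟩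
  have h5 : mv k = ⊥ := by
    rw [eq_bot_iff]
    intro x hx
    exact ND.eq_zero (c.hall.ND hσ) (hkσ hx) (h1 hx)
  have := hk.2.2
  have h6 := c.hall.e_pos c.hr
  rw [h5, finrank_bot] at this
  omega

theorem X_ne (c : CaseII D H Pi r) : (XX D H Pi r).Nonempty := by
  obtain ⟨k, hk, k', hk', hne⟩ := c.ncomm
  obtain ⟨-, t, ht, htr, hte, σ, hσ, hσt, hσr, hkσ⟩ := c.hall.extr c.hr c.min hk hk' hne
  exact ⟨mv σ, ⟨σ, ⟨hσ, hσr, t, ht, htr, hte, hσt⟩, rfl, k, hk, hkσ⟩⟩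

theorem J_orth (c : CaseII D H Pi r) : ∀ Y ∈ JJ D H Pi r, ∀ Y' ∈ JJ D H Pi r, Y ≠ Y' → Y ≤ D.perp Y' := by
  rintro _ ⟨k, hk, rfl, h⟩ _ ⟨k', hk', rfl, h'⟩ hne
  exact (Clem (c.hall.pr r c.hr) (c.hall.ne r c.hr) (c.hall.le hk.1) (c.hall.le hk'.1) hk.2.1 hk'.2.1 hk.2.2 hk'.2.2
    (c.J_comm hk hk' h)).resolve_left hne

theorem X_nd (c : CaseII D H Pi r) : ∀ X ∈ XX D H Pi r, D.ND X := by
  rintro _ ⟨σ, hσ, rfl, -⟩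
  exact c.hall.ND hσ.1

theorem J_nd (c : CaseII D H Pi r) : ∀ X ∈ JJ D H Pi r, D.ND X := by
  rintro _ ⟨k, hk, rfl, -⟩
  exact c.hall.ND hk.1

theorem X_dim (c : CaseII D H Pi r) : ∀ X ∈ XX D H Pi r, Module.finrank K X = r := by
  rintro _ ⟨σ, hσ, rfl, -⟩
  exact hσ.2.1

theorem J_dim (c : CaseII D H Pi r) : ∀ X ∈ JJ D H Pi r, Module.finrank K X = D.e r := by
  rintro _ ⟨k, hk, rfl, -⟩
  exact hk.2.2

theorem X_inv (c : CaseII D H Pi r) : ∀ g ∈ H, ∀ X ∈ XX D H Pi r, X.map g.toLinearMap ∈ XX D H Pi r := by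
  rintro g hg _ ⟨σ, hσ, rfl, k, hk, hkσ⟩
  refine ⟨_, TS_conj hσ hg, (mv_conj σ g).symm, _, TT_conj hk hg, ?_⟩
  rw [mv_conj, mv_conj]
  exact Submodule.map_mono hkσ

theorem J_inv (c : CaseII D H Pi r) : ∀ g ∈ H, ∀ X ∈ JJ D H Pi r, X.map g.toLinearMap ∈ JJ D H Pi r := by
  rintro g hg _ ⟨k, hk, rfl, h⟩
  refine ⟨_, TT_conj hk hg, (mv_conj k g).symm, ?_⟩
  intro X hX
  have h1 := h _ (c.X_inv g⁻¹ (H.inv_mem hg) X hX)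
  rw [mv_conj]
  rintro _ ⟨x, hx, rfl⟩ y hy
  have h2 := h1 hx _ (Submodule.mem_map_of_mem hy)
  have h3 := GU_apply D (c.hall.le hg) (g⁻¹ y) x
  rw [apply_inv_self'] at h3
  exact h3.trans h2

/-- the blocks -/
def II (D : UData K V) (H : Subgroup (V ≃ₗ[K] V)) (Pi : Set ℕ) (r : ℕ) : Set (Submodule K V) := XX D H Pi r ∪ JJ D H Pi r

theorem nd (c : CaseII D H Pi r) : ∀ X ∈ II D H Pi r, D.ND X := by
  rintro X (hX | hX)
  · exact c.X_nd X hX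
  · exact c.J_nd X hX

theorem XJ (c : CaseII D H Pi r) {X Y : Submodule K V} (hX : X ∈ XX D H Pi r) (hY : Y ∈ JJ D H Pi r) : Y ≤ D.perp X := by
  obtain ⟨k, hk, rfl, h⟩ := hY
  exact h X hX

theorem orth (c : CaseII D H Pi r) : ∀ Y ∈ II D H Pi r, ∀ Y' ∈ II D H Pi r, Y ≠ Y' → Y ≤ D.perp Y' := by
  rintro X (hX | hX) Y (hY | hY) hne
  · exact c.X_orth X hX Y hY hne
  · exact D.le_perp_comm.mp (c.XJ hX hY)
  · exact c.XJ hY hX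
  · exact c.J_orth X hX Y hY hne

theorem inv (c : CaseII D H Pi r) : ∀ g ∈ H, ∀ X ∈ II D H Pi r, X.map g.toLinearMap ∈ II D H Pi r := by
  rintro g hg X (hX | hX)
  · exact Or.inl (c.X_inv g hg X hX)
  · exact Or.inr (c.J_inv g hg X hX)

theorem dim (c : CaseII D H Pi r) : ∀ Y ∈ II D H Pi r, D.e r ≤ Module.finrank K Y ∧ Module.finrank K Y ≤ r := by
  have := c.her
  rintro X (hX | hX)
  · rw [c.X_dim X hX]; omega
  · rw [c.J_dim X hX]; omega

/-- every `k` lies in a block -/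
theorem in_block (c : CaseII D H Pi r) {k : V ≃ₗ[K] V} (hk : k ∈ TT D H r) : ∃ Y ∈ II D H Pi r, mv k ≤ Y := by
  by_cases h : ∃ X ∈ XX D H Pi r, mv k ≤ X
  · obtain ⟨X, hX, h⟩ := h
    exact ⟨X, Or.inl hX, h⟩
  · push Not at h
    refine ⟨mv k, Or.inr ⟨k, hk, rfl, ?_⟩, le_rfl⟩
    rintro _ hX
    have h2 := h _ hX
    obtain ⟨σ, hσ, rfl, -⟩ := hX
    exact (c.D_lem hσ hk).resolve_left h2

end CaseII
end caseII2
end UData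

namespace UData
section caseII3
variable {K V : Type} [Field K] [Finite K] [AddCommGroup V] [Module K V] [Finite V] {D : UData K V}
  {g h : V ≃ₗ[K] V} {U W : Submodule K V} {H : Subgroup (V ≃ₗ[K] V)} {Pi : Set ℕ} {r : ℕ}

/-- minimal rank -/
theorem HallData.rank_ge (hH : HallData D H Pi) {e : ℕ} (hmin : ∀ t ∈ Pi, e ≤ D.e t) (hg : g ∈ H) (hg1 : g ≠ 1) :
    e ≤ Module.finrank K (mv g) := by
  haveI := D.fd
  obtain ⟨t, htP, m, -, -, h7⟩ := hH.exists_prime hg hg1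
  have h8 := Submodule.finrank_mono (mv_pow_le g m)
  have h9 := hmin t htP
  omega

/-- an element fixing two independent vectors -/
theorem rank_two_fix (hst : Stb g U) {u v : V} (hu : u ∈ U) (hv : v ∈ U) (huv : LinearIndependent K ![u, v])
    (hgu : g u = u) (hgv : g v = v) : Module.finrank K (mvo g U) + 2 ≤ Module.finrank K U := by
  haveI : FiniteDimensional K V := Module.Finite.of_finite
  set f : U →ₗ[K] V := (g.toLinearMap - LinearMap.id) ∘ₗ U.subtype with hf
  have h1 : LinearMap.range f = mvo g U := by
    ext y
    rw [LinearMap.mem_range, mem_mvo]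
    constructor
    · rintro ⟨x, rfl⟩; exact ⟨x.1, x.2, rfl⟩
    · rintro ⟨x, hx, rfl⟩; exact ⟨⟨x, hx⟩, rfl⟩
  have h2 := LinearMap.finrank_range_add_finrank_ker f
  rw [h1] at h2
  have h3 : 2 ≤ Module.finrank K (LinearMap.ker f) := by
    have h4 : LinearIndependent K ![(⟨⟨u, hu⟩, by simp [hf, hgu]⟩ : LinearMap.ker f), ⟨⟨v, hv⟩, by simp [hf, hgv]⟩] := by
      apply LinearIndependent.of_comp (U.subtype ∘ₗ (LinearMap.ker f).subtype)
      convert huv using 1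
      ext i
      fin_cases i <;> rfl
    have := h4.fintype_card_le_finrank
    simpa using this
  omega

namespace CaseII

theorem count (c : CaseII D H Pi r) : ∃ V0 : Submodule K V,
    (∀ g ∈ H, (∀ Y ∈ II D H Pi r, ∀ x ∈ Y, g x = x) → mv g ≤ V0) ∧
    (XX D H Pi r).ncard + Module.finrank K V0 + 2 ≤ r ∧
    r * (XX D H Pi r).ncard + D.e r * (JJ D H Pi r).ncard + Module.finrank K V0 = D.n := by
  classical
  haveI := D.fd
  haveI := finite_sub (K := K) (V := V)
  have hf : (II D H Pi r).Finite := Set.toFinite _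
  have hfX : (XX D H Pi r).Finite := Set.toFinite _
  have hfJ : (JJ D H Pi r).Finite := Set.toFinite _
  have hr3 := c.three
  have her := c.her
  obtain ⟨h1, h2⟩ := orth_fam (D := D) (E := id) hf.toFinset (fun Y hY => c.nd Y (hf.mem_toFinset.mp hY))
      (fun Y hY Y' hY' hne => c.orth Y (hf.mem_toFinset.mp hY) Y' (hf.mem_toFinset.mp hY') hne)
  have hS : hf.toFinset = hfX.toFinset ∪ hfJ.toFinset := by
    ext Y; simp [II]
  have hdis : Disjoint hfX.toFinset hfJ.toFinset := by
    rw [Finset.disjoint_left]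
    intro Y hY hY'
    have h3 := c.X_dim Y (hfX.mem_toFinset.mp hY)
    have h4 := c.J_dim Y (hfJ.mem_toFinset.mp hY')
    omega
  have hcard : hf.toFinset.card = (XX D H Pi r).ncard + (JJ D H Pi r).ncard := by
    rw [hS, Finset.card_union_of_disjoint hdis, ← Set.ncard_eq_toFinset_card _ hfX, ← Set.ncard_eq_toFinset_card _ hfJ]
  have hsum : ∑ Y ∈ hf.toFinset, Module.finrank K (id Y : Submodule K V) = r * (XX D H Pi r).ncard + D.e r * (JJ D H Pi r).ncard := by
    simp only [id]
    rw [hS, Finset.sum_union hdis, Finset.sum_congr rfl (g := fun _ => r) (fun Y hY => c.X_dim Y (hfX.mem_toFinset.mp hY)),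
      Finset.sum_congr rfl (s₁ := hfJ.toFinset) (g := fun _ => D.e r) (fun Y hY => c.J_dim Y (hfJ.mem_toFinset.mp hY)),
      Finset.sum_const, Finset.sum_const, smul_eq_mul, smul_eq_mul, ← Set.ncard_eq_toFinset_card _ hfX,
      ← Set.ncard_eq_toFinset_card _ hfJ, mul_comm, mul_comm (D.e r)]
  rw [hsum] at h2
  set X : Submodule K V := ⨆ i ∈ hf.toFinset, id i with hX
  have h6 := ND.finrank h1
  obtain ⟨σ, k1, k2, k3, k4⟩ := c.hall.exists_star c.hr (Nat.div_mul_le_self D.n (D.e r))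
  have hTT : ∀ i, σ i ∈ TT D H r := fun i => ⟨k1 i, by rw [← k2 i, pow_orderOf_eq_one], k3 i⟩
  choose F hF1 hF2 using fun i => c.in_block (hTT i)
  have hinj : Function.Injective F := by
    intro i j hij
    by_contra hne
    have h7 := orth_dim (c.hall.ND (k1 j)) (k4 i j hne) (hij ▸ hF2 j : mv (σ j) ≤ F i) (hF2 i)
    have h8 := (c.dim _ (hF1 i)).2
    rw [k3, k3] at h7
    omega
  have hm : D.n / D.e r ≤ hf.toFinset.card := by
    have := Finset.card_le_card_of_injOn (s := Finset.univ) (t := hf.toFinset) F (fun i _ => hf.mem_toFinset.mpr (hF1 i)) hinj.injOn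
    rwa [Finset.card_univ, Fintype.card_fin] at this
  refine ⟨D.perp X, ?_, ?_, by omega⟩
  · intro g hg ht
    apply D.le_perp_comm.mp
    refine iSup₂_le fun Y hY => ?_
    exact orth_of_triv (c.hall.le hg) (ht Y (hf.mem_toFinset.mp hY))
  · have h11 := Nat.div_add_mod D.n (D.e r)
    have h12 := Nat.mod_lt D.n (c.hall.e_pos c.hr)
    have h13 : D.e r * (D.n / D.e r) ≤ D.e r * ((XX D H Pi r).ncard + (JJ D H Pi r).ncard) :=
      Nat.mul_le_mul_left _ (hcard ▸ hm)
    have h14 : r * (XX D H Pi r).ncard = D.e r * (XX D H Pi r).ncard + (XX D H Pi r).ncard := by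
      rw [← her, add_mul, one_mul, her]
    rw [mul_add] at h13
    omega

theorem triv (c : CaseII D H Pi r) (hg : g ∈ H) (ht : ∀ Y ∈ II D H Pi r, ∀ x ∈ Y, g x = x) : g = 1 := by
  haveI := D.fd
  obtain ⟨V0, h1, h2, -⟩ := c.count
  by_contra hne
  have h3 := c.hall.rank_ge c.min hg hne
  have h4 := Submodule.finrank_mono (h1 g hg ht)
  have := c.her
  omega

theorem X_stb (c : CaseII D H Pi r) (hg : g ∈ H) {X : Submodule K V} (hX : X ∈ XX D H Pi r) : Stb g X := by
  haveI := finite_lequiv (K := K) (V := V)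
  have : H ≤ stbG X := by
    apply PP
    intro y hy t j ht hyt
    rw [mem_stbG]
    by_cases hy1 : y = 1
    · rw [hy1]; exact Stb_one
    have htP := c.hall.mem_pi hy ht hyt hy1
    obtain ⟨V0, h1, h2, -⟩ := c.count
    exact stb_of_small c.X_inv hy ht hyt (by have := c.le htP; omega) X hX
  exact mem_stbG.mp (this hg)

theorem J_small (c : CaseII D H Pi r) {t : ℕ} (ht : t ∈ Pi) (htr : t ≠ r) : (JJ D H Pi r).ncard < t := by
  classical
  haveI := D.fd
  haveI := finite_sub (K := K) (V := V)
  have hr3 := c.three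
  have her := c.her
  have hb := c.hbig t ht htr
  have hlt := c.hall.e_lt ht
  obtain ⟨σ, k1, k2, k3, k4⟩ := c.hall.exists_star ht (Nat.div_mul_le_self D.n (D.e t))
  have hst : ∀ i, (σ i) ^ t = 1 := fun i => by rw [← k2 i, pow_orderOf_eq_one]
  have htriv : ∀ i, ∀ Y ∈ JJ D H Pi r, ∀ x ∈ Y, σ i x = x := by
    intro i Y hY
    have hY2 : Stb (σ i) Y := by
      by_contra hns
      have h1 := mover (c.hall.pr t ht) c.J_nd c.J_orth (c.J_inv _ (k1 i)) (hst i) hY hns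
      rw [k3, c.J_dim Y hY] at h1
      have : (t - 1) * 2 ≤ (t - 1) * D.e r := Nat.mul_le_mul_left _ (by omega)
      omega
    apply Ro_triv (c.hall.pr t ht) (c.hall.ne t ht) (c.hall.le (k1 i)) (j := 1) (by rw [pow_one]; exact hst i) (c.J_nd Y hY) hY2
    have := Submodule.finrank_mono (mvo_le hY2)
    rw [c.J_dim Y hY] at this
    omega
  have hfJ : (JJ D H Pi r).Finite := Set.toFinite _
  obtain ⟨h1, h2⟩ := orth_fam (D := D) (E := id) hfJ.toFinset (fun Y hY => c.J_nd Y (hfJ.mem_toFinset.mp hY))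
      (fun Y hY Y' hY' hne => c.J_orth Y (hfJ.mem_toFinset.mp hY) Y' (hfJ.mem_toFinset.mp hY') hne)
  rw [Finset.sum_congr rfl (f := fun Y : Submodule K V => Module.finrank K (id Y : Submodule K V)) (g := fun _ => D.e r) (fun Y hY => c.J_dim Y (hfJ.mem_toFinset.mp hY)),
    Finset.sum_const, smul_eq_mul, ← Set.ncard_eq_toFinset_card _ hfJ] at h2
  set X : Submodule K V := ⨆ i ∈ hfJ.toFinset, id i with hX
  obtain ⟨h3, h4⟩ := orth_fam (D := D) (E := fun i => mv (σ i)) Finset.univ (fun i _ => c.hall.ND (k1 i))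
    (fun i _ j _ hij => k4 i j hij)
  rw [Finset.sum_congr rfl (g := fun _ => D.e t) (fun i _ => k3 i), Finset.sum_const, smul_eq_mul, Finset.card_univ,
    Fintype.card_fin] at h4
  set Z : Submodule K V := ⨆ i ∈ (Finset.univ : Finset (Fin (D.n / D.e t))), mv (σ i) with hZ
  have h5 : Z ≤ D.perp X := by
    refine iSup₂_le fun i _ => ?_
    apply D.le_perp_comm.mp
    refine iSup₂_le fun Y hY => ?_
    exact orth_of_triv (c.hall.le (k1 i)) (htriv i Y (hfJ.mem_toFinset.mp hY))
  have h6 := orth_dim h1 h5 le_top le_top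
  rw [finrank_top, D.finrank_V, h2, h4] at h6
  have h11 := Nat.div_add_mod D.n (D.e t)
  have h12 := Nat.mod_lt D.n (c.hall.e_pos ht)
  have h13 := mul_comm (D.n / D.e t) (D.e t)
  have h14 : (JJ D H Pi r).ncard * 1 ≤ (JJ D H Pi r).ncard * D.e r := Nat.mul_le_mul_left _ (by omega)
  omega

theorem color (c : CaseII D H Pi r) : ∃ S ⊆ II D H Pi r, ∀ g ∈ H,
    (∀ Y ∈ II D H Pi r, Y.map g.toLinearMap ∈ S ↔ Y ∈ S) → ∀ Y ∈ II D H Pi r, Stb g Y := by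
  refine color_of c.inv (c.hall.pr r c.hr) (c.hall.odd r c.hr) ?_
  rintro g hg t j ht htr hgt Y (hY | hY)
  · exact c.X_stb hg hY
  · by_cases hy1 : g = 1
    · rw [hy1]; exact Stb_one
    have htP := c.hall.mem_pi hg ht hgt hy1
    exact stb_of_small c.J_inv hg ht hgt (c.J_small htP htr) Y hY

/-- r'-elements centralize the type elements of a block -/
theorem X_cent (c : CaseII D H Pi r) {σ : V ≃ₗ[K] V} (hσ : σ ∈ TS D H Pi r) (hX : mv σ ∈ XX D H Pi r)
    (hg : g ∈ H) {t j : ℕ} (ht : t.Prime) (htr : t ≠ r) (hgt : g ^ (t ^ j) = 1) : g * σ = σ * g := by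
  haveI := D.fd
  haveI := finite_lequiv (K := K) (V := V)
  have hr3 := c.three
  have her := c.her
  obtain ⟨h1, h2, s, hs, hsr, hse, h6⟩ := id hσ
  set S : Set (V ≃ₗ[K] V) := {x | ∃ a ∈ H, x = a * σ * a⁻¹} with hS
  have hSH : S ⊆ H := by
    rintro _ ⟨a, ha, rfl⟩
    exact H.mul_mem (H.mul_mem ha h1) (H.inv_mem ha)
  have hAH : Subgroup.closure S ≤ H := (Subgroup.closure_le H).mpr hSH
  have hSm : ∀ a ∈ S, mv a ≤ mv σ := by
    rintro _ ⟨a, ha, rfl⟩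
    rw [conj_mv_stb (c.X_stb ha hX)]
  have hU := mv_closure_le hSm
  have hSs : ∀ a ∈ S, a ^ s = 1 := by
    rintro _ ⟨a, ha, rfl⟩
    rw [conj_pow, h6, mul_one, mul_inv_cancel]
  have c1 : ∀ t : ℕ, t.Prime → t ∣ Nat.card (Subgroup.closure S) → r < t * D.e r ∧ ¬ t ∣ D.e r := by
    intro t ht htL
    have htP := c.hall.sub_pi hAH ht htL
    refine ⟨?_, c.not_dvd htP⟩
    have := c.le htP
    have : r * 2 ≤ t * D.e r := Nat.mul_le_mul this (by omega)
    omega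
  obtain ⟨M, hML, hMn, hrM, hM⟩ := BURN (c.hall.pr r c.hr) (c.hall.ne r c.hr) (hAH.trans c.hall.le) hU h2.le
    (by have : r * 2 ≤ r * D.e r := Nat.mul_le_mul le_rfl (by omega)
        omega) c1
  have hSM : ∀ a ∈ S, a ∈ M := by
    intro a ha
    apply hM a (Subgroup.subset_closure ha)
    refine Nat.Coprime.coprime_dvd_left (orderOf_dvd_of_pow_eq_one (hSs a ha)) ?_
    exact (Nat.coprime_primes (c.hall.pr s hs) (c.hall.pr r c.hr)).mpr hsr
  have hSc : ∀ a ∈ S, ∀ b ∈ S, a * b = b * a := by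
    intro a ha b hb
    have ha' : a ∈ TS D H Pi r := by
      obtain ⟨x, hx, rfl⟩ := ha
      exact TS_conj hσ hx
    exact c.central (hML.trans hAH) hrM (fun a ha => hU a (hML ha)) h2.le (by omega) ha' (hSM a ha) b (hSM b hb)
  by_contra hne
  have hσS : σ ∈ S := ⟨1, H.one_mem, by simp⟩
  have hnorm : ∀ a ∈ Subgroup.closure S, g * a * g⁻¹ ∈ Subgroup.closure S := by
    intro a ha
    have : Subgroup.closure S ≤ (Subgroup.closure S).comap (MulAut.conj g).toMonoidHom := by
      rw [Subgroup.closure_le]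
      rintro _ ⟨a, ha, rfl⟩
      apply Subgroup.subset_closure
      refine ⟨g * a, H.mul_mem hg ha, ?_⟩
      show g * (a * σ * a⁻¹) * g⁻¹ = _
      group
    exact this ha
  have := (Wlem (D := D) (U := mv σ) (N := r) (j := j) (c.hall.pr s hs) (c.hall.ne s hs) ht (A := Subgroup.closure S) (y := g)
    (hAH.trans c.hall.le) (comm_closure hSc) (pgroup_closure hSc hSs) hnorm hgt
    ⟨σ, Subgroup.subset_closure hσS, hne⟩ hU h2.le).1
  rw [hse] at this
  rcases this with h | h
  · have := ht.two_le
    have : 2 * r ≤ t * r := Nat.mul_le_mul_right _ this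
    omega
  · exact htr ((Nat.prime_dvd_prime_iff_eq ht (c.hall.pr r c.hr)).mp h)

/-- subgroup of elements trivial on a subspace -/
def fixG (U : Submodule K V) : Subgroup (V ≃ₗ[K] V) where
  carrier := {g | ∀ x ∈ U, g x = x}
  one_mem' := fun x _ => rfl
  mul_mem' := by
    intro a b ha hb x hx
    rw [LinearEquiv.mul_apply, hb x hx, ha x hx]
  inv_mem' := by
    intro a ha x hx
    have := congrArg (fun y => (a⁻¹ : V ≃ₗ[K] V) y) (ha x hx)
    rw [inv_apply_self'] at this
    exact this.symm

theorem fix (c : CaseII D H Pi r) (hg : g ∈ H) {Y : Submodule K V} (hY : Y ∈ II D H Pi r) (hst : Stb g Y)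
    {u v : V} (hu : u ∈ Y) (hv : v ∈ Y) (huv : LinearIndependent K ![u, v]) (hgu : g u = u) (hgv : g v = v) :
    ∀ x ∈ Y, g x = x := by
  haveI := finite_lequiv (K := K) (V := V)
  have hr3 := c.three
  have her := c.her
  have hu0 : u ≠ 0 := huv.ne_zero 0
  rcases hY with hY | hY
  · have : Subgroup.zpowers g ≤ fixG Y := by
      apply PP
      intro y hy t j ht hyt
      have hyH : y ∈ H := (Subgroup.zpowers_le.mpr hg) hy
      obtain ⟨m, rfl⟩ := (Submonoid.mem_powers_iff _ _).mp ((mem_powers_iff_mem_zpowers (x := g)).mpr hy)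
      have hyu : (g ^ m) u = u := pow_fix_of hgu m
      have hyv : (g ^ m) v = v := pow_fix_of hgv m
      by_cases htr : t = r
      · subst htr
        have hst' := c.X_stb hyH hY
        apply Ro_triv ht (c.hall.ne t c.hr) (c.hall.le hyH) hyt (c.X_nd Y hY) hst'
        have := rank_two_fix hst' hu hv huv hyu hyv
        rw [c.X_dim Y hY] at this
        omega
      · have hY' := hY
        obtain ⟨σ, hσ, rfl, -⟩ := hY
        obtain ⟨h1, h2, s, hs, hsr, hse, h6⟩ := id hσ
        exact free_fix (c.hall.pr s hs) (c.hall.ne s hs) (c.hall.le h1) (c.hall.le hyH) h6 (by rw [h2, hse]) (c.hall.p' hyH)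
          (c.X_cent hσ hY' hyH ht htr hyt) hu hu0 hyu
    exact this (Subgroup.mem_zpowers g)
  · obtain ⟨k, hk, rfl, hkX⟩ := hY
    refine free_fix (c.hall.pr r c.hr) (c.hall.ne r c.hr) (c.hall.le hk.1) (c.hall.le hg) hk.2.1 hk.2.2 (c.hall.p' hg) ?_ hu hu0 hgu
    refine c.hall.free_block c.hr c.min hk.1 hk.2.1 hk.2.2 ?_ g hg hst
    intro a ha b hb ha2 hb2
    refine c.J_comm (TT_conj hk ha) (TT_conj hk hb) ?_
    rw [conj_mv_stb ha2]
    exact hkX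

theorem rank_two (c : CaseII D H Pi r) (hg : g ∈ H) (h2 : Module.finrank K (mv g) = 2) : ∃ Y ∈ II D H Pi r, mv g ≤ Y := by
  haveI := D.fd
  have hr3 := c.three
  have her := c.her
  have hg1 : g ≠ 1 := by
    rintro rfl
    rw [mv_one, finrank_bot] at h2
    omega
  obtain ⟨t, htP, m, h3, h4, h5⟩ := c.hall.exists_prime hg hg1
  have h6 := Submodule.finrank_mono (mv_pow_le g m)
  have h7 : t = r := by
    by_contra hne
    have := c.hbig t htP hne
    omega
  subst h7
  have h8 : mv (g ^ m) = mv g := Submodule.eq_of_le_of_finrank_le (mv_pow_le g m) (by omega)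
  rw [← h8]
  exact c.in_block ⟨H.pow_mem hg m, by conv_lhs => rw [← h3, pow_orderOf_eq_one], by omega⟩

end CaseII
end caseII3
end UData

namespace UData
section tv
variable {K V : Type} [Field K] [Finite K] [AddCommGroup V] [Module K V] [Finite V] {D : UData K V}
  {g h : V ≃ₗ[K] V} {U W : Submodule K V} {H : Subgroup (V ≃ₗ[K] V)} {Pi : Set ℕ} {r : ℕ}

def IsTv (D : UData K V) (x : V ≃ₗ[K] V) : Prop :=
  x ∈ D.GU ∧ ∃ (v : V) (a : K), D.B v v = 0 ∧ a + D.φ a = 0 ∧ ∀ y, x y = y + (a * D.B v y) • v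

def Goal (D : UData K V) (H : Subgroup (V ≃ₗ[K] V)) : Prop :=
  ∃ x y z, IsTv D x ∧ IsTv D y ∧ IsTv D z ∧ ∀ h ∈ H, x * h * x⁻¹ ∈ H → y * h * y⁻¹ ∈ H → z * h * z⁻¹ ∈ H →
    ∃ c : K, ∀ v, h v = c • v

theorem exists_unit_dual {v : V} (hv : v ≠ 0) : ∃ y, D.B v y = 1 := by
  by_contra hne
  apply hv
  apply D.nondeg
  intro y
  by_contra hy
  apply hne
  have h1 : D.B v y ≠ 0 := fun h => hy (D.B_symm_zero h)
  refine ⟨(D.B v y)⁻¹ • y, ?_⟩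
  rw [map_smul, smul_eq_mul, inv_mul_cancel₀ h1]

theorem tv_inv {x : V ≃ₗ[K] V} {v : V} {a : K} (hv : D.B v v = 0) (hx : ∀ y, x y = y + (a * D.B v y) • v) (y : V) :
    (x⁻¹ : V ≃ₗ[K] V) y = y - (a * D.B v y) • v := by
  have : x (y - (a * D.B v y) • v) = y := by
    rw [hx, map_sub, map_smul, hv, smul_zero, sub_zero]; abel
  conv_lhs => rw [← this]
  exact inv_apply_self' _ _

theorem tv_comm_apply {x : V ≃ₗ[K] V} {v : V} {a : K} (hv : D.B v v = 0) (hx : ∀ y, x y = y + (a * D.B v y) • v)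
    (hh : h ∈ D.GU) (y : V) : (h⁻¹ * (x * h * x⁻¹)) y = y - (a * D.B v y) • v +
      (a * (D.B ((h⁻¹ : V ≃ₗ[K] V) v) y - a * D.B v y * D.B ((h⁻¹ : V ≃ₗ[K] V) v) v)) • (h⁻¹ : V ≃ₗ[K] V) v := by
  have e1 : ∀ z, D.B v (h z) = D.B ((h⁻¹ : V ≃ₗ[K] V) v) z := by
    intro z
    conv_rhs => rw [← D.GU_apply hh]
    rw [apply_inv_self']
  simp only [LinearEquiv.mul_apply, tv_inv hv hx]
  rw [hx, map_add, map_smul, inv_apply_self', e1, map_sub, map_smul, smul_eq_mul]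

theorem tv_dich (hH : HallData D H Pi) {x : V ≃ₗ[K] V} {v : V} {a : K} (hv : D.B v v = 0) (hv0 : v ≠ 0) (ha : a ≠ 0)
    (hx : ∀ y, x y = y + (a * D.B v y) • v) (hh : h ∈ H) (hxh : x * h * x⁻¹ ∈ H) :
    (∃ c : K, h v = c • v ∧ c * D.φ c = 1) ∨
    (Module.finrank K (mv (h⁻¹ * (x * h * x⁻¹))) = 2 ∧ v ∈ mv (h⁻¹ * (x * h * x⁻¹)) ∧
      (h⁻¹ : V ≃ₗ[K] V) v ∈ mv (h⁻¹ * (x * h * x⁻¹)) ∧ ¬ ∃ c : K, h v = c • v) := by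
  haveI := D.fd
  have hk := tv_comm_apply hv hx (hH.le hh)
  have hkH : h⁻¹ * (x * h * x⁻¹) ∈ H := H.mul_mem (H.inv_mem hh) hxh
  set k := h⁻¹ * (x * h * x⁻¹) with hkdef
  set w := (h⁻¹ : V ≃ₗ[K] V) v with hw
  have hhw : h w = v := apply_inv_self' _ _
  obtain ⟨y0, hy0⟩ := exists_unit_dual (D := D) hv0
  have hle : mv k ≤ Submodule.span K {v, w} := by
    rw [mv_le_iff]
    intro y
    rw [hk, show ∀ s t u : V, s - t + u - s = u - t by intros; abel]
    exact Submodule.sub_mem _ (Submodule.smul_mem _ _ (Submodule.subset_span (by simp)))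
      (Submodule.smul_mem _ _ (Submodule.subset_span (by simp)))
  by_cases hμ : ∃ c : K, w = c • v
  · left
    obtain ⟨μ, hμ⟩ := hμ
    have hle2 : ∀ y ∈ mv k, ∃ c : K, y = c • v := by
      intro y hy
      obtain ⟨s, t, rfl⟩ := Submodule.mem_span_pair.mp (hle hy)
      exact ⟨s + t * μ, by rw [hμ, add_smul, mul_smul]⟩
    have hbot : mv k = ⊥ := by
      rw [eq_bot_iff]
      intro y hy
      have : y ∈ D.perp (mv k) := by
        intro u hu
        obtain ⟨c, rfl⟩ := hle2 y hy
        obtain ⟨d, rfl⟩ := hle2 u hu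
        rw [B_smul_left, map_smul, hv, smul_zero, mul_zero]
      exact (Submodule.mem_bot K).mpr (ND.eq_zero (hH.ND hkH) hy this)
    have hk1 := mv_eq_bot.mp hbot
    have h1 := hk y0
    have hwv : D.B w v = 0 := by rw [hμ, B_smul_left, hv, mul_zero]
    have hwy : D.B w y0 = D.φ μ := by rw [hμ, B_smul_left, hy0, mul_one]
    rw [hk1, hwv, hwy, hy0, hμ] at h1
    have h2 : (a * (D.φ μ * μ - 1)) • v = 0 := by
      have h3 : ((1 : V ≃ₗ[K] V) y0) = y0 := rfl
      rw [h3] at h1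
      have h4 : y0 = y0 + (a * (D.φ μ * μ - 1)) • v := by
        conv_lhs => rw [h1]
        module
      simpa using h4
    rcases smul_eq_zero.mp h2 with h2 | h2
    · have h3 : D.φ μ * μ = 1 := by
        rcases mul_eq_zero.mp h2 with h2 | h2
        · exact absurd h2 ha
        · exact sub_eq_zero.mp h2
      have hμ0 : μ ≠ 0 := by rintro rfl; simp at h3
      refine ⟨μ⁻¹, ?_, ?_⟩
      · have : μ • h v = v := by rw [← map_smul, ← hμ, hhw]
        conv_rhs => rw [← this]
        rw [smul_smul, inv_mul_cancel₀ hμ0, one_smul]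
      · rw [map_inv₀, ← mul_inv, mul_comm, h3, inv_one]
    · exact absurd h2 hv0
  · right
    have hli : LinearIndependent K ![v, w] := by
      rw [LinearIndependent.pair_iff' hv0]
      intro c hc
      exact hμ ⟨c, hc.symm⟩
    have hex : ∃ y, D.B v y = 0 ∧ D.B w y ≠ 0 := by
      by_contra hne
      push Not at hne
      apply hμ
      refine ⟨D.φ (D.B w y0), ?_⟩
      rw [← sub_eq_zero]
      apply D.nondeg
      intro y
      apply D.B_symm_zero
      rw [D.B_sub_left, D.B_smul_left, D.phi_phi]
      have h1 := hne (y - D.B v y • y0) (by rw [map_sub, map_smul, hy0, smul_eq_mul, mul_one, sub_self])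
      rw [map_sub, map_smul, smul_eq_mul] at h1
      rw [← h1]; ring
    obtain ⟨y1, hy1, hy2⟩ := hex
    have hwm : w ∈ mv k := by
      have h1 := sub_mem_mv k y1
      rw [hk, hy1] at h1
      have h2 : y1 - (a * 0) • v + (a * (D.B w y1 - a * 0 * D.B w v)) • w - y1 = (a * D.B w y1) • w := by
        module
      rw [h2] at h1
      exact (Submodule.smul_mem_iff _ (mul_ne_zero ha hy2)).mp h1
    have hvm : v ∈ mv k := by
      have h1 := sub_mem_mv k y0
      rw [hk, hy0] at h1
      have h2 : v = (-a⁻¹) • ((y0 - (a * 1) • v + (a * (D.B w y0 - a * 1 * D.B w v)) • w - y0) - (a * (D.B w y0 - a * 1 * D.B w v)) • w) := by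
        rw [show ∀ s t u : V, s - t + u - s - u = - t by intros; abel]
        rw [smul_neg, neg_smul, neg_neg, smul_smul, mul_one, inv_mul_cancel₀ ha, one_smul]
      rw [h2]
      exact Submodule.smul_mem _ _ (Submodule.sub_mem _ h1 (Submodule.smul_mem _ _ hwm))
    refine ⟨?_, hvm, hwm, ?_⟩
    · have e : mv k = Submodule.span K {v, w} := by
        apply le_antisymm hle
        rw [Submodule.span_le]
        rintro z (rfl | rfl)
        · exact hvm
        · exact hwm
      rw [e]
      have := finrank_span_eq_card hli
      rw [Matrix.range_cons, Matrix.range_cons, Matrix.range_empty, Set.union_empty, Set.singleton_union] at this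
      simpa using this
    · rintro ⟨c, hc⟩
      have hc0 : c ≠ 0 := by
        rintro rfl
        rw [zero_smul] at hc
        exact hv0 ((LinearEquiv.map_eq_zero_iff h).mp hc)
      apply hμ
      refine ⟨c⁻¹, ?_⟩
      have h1 := congrArg (fun y => (h⁻¹ : V ≃ₗ[K] V) y) hc
      simp only [inv_apply_self', map_smul] at h1
      rw [hw, h1, smul_smul, inv_mul_cancel₀, one_smul]
      · simp only [hw] at *
        rw [← h1]
      · exact hc0

theorem exists_skew (D : UData K V) : ∃ a : K, a ≠ 0 ∧ a + D.φ a = 0 := by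
  obtain ⟨x, hx⟩ : ∃ x : K, D.φ x ≠ x := by
    by_contra hne
    push Not at hne
    have h1 := D.norm_fiber one_ne_zero (map_one _)
    have h2 : ∀ x : {x : K // x * D.φ x = 1}, x.1 ∈ ({1, -1} : Set K) := by
      intro x
      have := x.2
      rw [hne] at this
      exact mul_self_eq_one_iff.mp this
    have h3 : Nat.card {x : K // x * D.φ x = 1} ≤ Nat.card ({1, -1} : Set K) :=
      Nat.card_le_card_of_injective (fun x => (⟨x.1, h2 x⟩ : ({1, -1} : Set K))) (fun x y hxy => by
        simpa [Subtype.ext_iff] using hxy)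
    have h4 : Nat.card ({1, -1} : Set K) ≤ 2 := by
      have := Set.ncard_insert_le (1 : K) {-1}
      rw [Set.ncard_singleton] at this
      exact this
    have := D.two_le_q
    omega
  refine ⟨x - D.φ x, sub_ne_zero.mpr (Ne.symm hx), ?_⟩
  rw [map_sub, D.phi_phi]; ring

theorem exists_tv {v : V} {a : K} (hv : D.B v v = 0) (ha : a + D.φ a = 0) :
    ∃ x, IsTv D x ∧ ∀ y, x y = y + (a * D.B v y) • v := by
  obtain ⟨x, hx, hx2⟩ := D.exists_refl v a (by rw [hv, mul_zero, add_zero, ha])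
  exact ⟨x, ⟨hx, v, a, hv, ha, hx2⟩, hx2⟩

theorem final_A (hH : HallData D H Pi) {v : Fin 3 → V} (hv0 : ∀ i, v i ≠ 0) (hv : ∀ i, D.B (v i) (v i) = 0)
    (h2 : ∀ k ∈ H, Module.finrank K (mv k) = 2 → ∀ i, v i ∉ mv k)
    (h3 : ∀ h ∈ H, (∀ i, ∃ c : K, h (v i) = c • v i ∧ c * D.φ c = 1) → ∃ c : K, ∀ y, h y = c • y) : Goal D H := by
  obtain ⟨a, ha, ha2⟩ := D.exists_skew
  have h4 : ∀ i, ∃ x, IsTv D x ∧ ∀ y, x y = y + (a * D.B (v i) y) • v i := fun i => exists_tv (hv i) ha2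
  choose x hx hx2 using h4
  refine ⟨x 0, x 1, x 2, hx 0, hx 1, hx 2, fun h hh k0 k1 k2 => h3 h hh ?_⟩
  have key : ∀ i, x i * h * (x i)⁻¹ ∈ H → ∃ c : K, h (v i) = c • v i ∧ c * D.φ c = 1 := by
    intro i hi
    rcases tv_dich hH (hv i) (hv0 i) ha (hx2 i) hh hi with h5 | ⟨h5, h6, -⟩
    · exact h5
    · exact absurd h6 (h2 _ (H.mul_mem (H.inv_mem hh) hi) h5 i)
  intro i
  fin_cases i
  · exact key 0 k0
  · exact key 1 k1
  · exact key 2 k2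

/-- eigenvalues in the unit circle are trivial unless some e is one -/
theorem eig_one (hH : HallData D H Pi) (he : ∀ t ∈ Pi, 2 ≤ D.e t) (hh : h ∈ H) {v : V} (hv0 : v ≠ 0) {c : K}
    (hc : h v = c • v) (hc1 : c * D.φ c = 1) : c = 1 := by
  haveI := finite_lequiv (K := K) (V := V)
  have hp : ∀ m : ℕ, (h ^ m) v = c ^ m • v := by
    intro m
    induction m with
    | zero => simp
    | succ m ih => rw [pow_succ, LinearEquiv.mul_apply, hc, map_smul, ih, smul_smul, pow_succ, mul_comm]
  have h1 : c ^ orderOf h = 1 := by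
    have := hp (orderOf h)
    rw [pow_orderOf_eq_one] at this
    have h2 : (c ^ orderOf h - 1) • v = 0 := by
      rw [sub_smul, ← this, one_smul]; exact sub_self v
    rcases smul_eq_zero.mp h2 with h2 | h2
    · exact sub_eq_zero.mp h2
    · exact absurd h2 hv0
  have h2 : c ^ (D.q + 1) = 1 := by rw [pow_succ, mul_comm, ← D.hφ, hc1]
  have h3 : Nat.Coprime (orderOf h) (D.q + 1) := by
    apply Nat.Coprime.symm
    rw [Nat.coprime_iff_gcd_eq_one]
    by_contra hne
    obtain ⟨t, ht, htd⟩ := Nat.exists_prime_and_dvd hne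
    have htP := hH.orderOf_pi hh ht (htd.trans (Nat.gcd_dvd_right _ _))
    have := he t htP
    have := (e_eq_one_iff (D := D) ht (hH.ne t htP)).mpr (htd.trans (Nat.gcd_dvd_left _ _))
    omega
  have h4 := Nat.dvd_gcd (orderOf_dvd_of_pow_eq_one h1) (orderOf_dvd_of_pow_eq_one h2)
  rw [h3] at h4
  exact orderOf_eq_one_iff.mp (Nat.dvd_one.mp h4)

end tv
end UData

namespace UData
section blk
variable {K V : Type} [Field K] [Finite K] [AddCommGroup V] [Module K V] [Finite V] {D : UData K V}
  {g h : V ≃ₗ[K] V} {U W : Submodule K V} {H : Subgroup (V ≃ₗ[K] V)} {Pi : Set ℕ} {r : ℕ} {I : Set (Submodule K V)}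

theorem proj_sum {F : Finset (Submodule K V)} (ho : ∀ Y ∈ F, ∀ Y' ∈ F, Y ≠ Y' → Y ≤ D.perp Y')
    {u : Submodule K V → V} (hu : ∀ Y ∈ F, u Y ∈ Y) {Y : Submodule K V} (hY : Y ∈ F) {z : V} (hz : z ∈ Y) :
    D.B z (∑ Y ∈ F, u Y) = D.B z (u Y) := by
  rw [map_sum]
  apply Finset.sum_eq_single_of_mem Y hY
  intro Y' hY' hne
  exact ho Y' hY' Y hY hne (hu Y' hY') z hz

theorem sum_iso {F : Finset (Submodule K V)} (ho : ∀ Y ∈ F, ∀ Y' ∈ F, Y ≠ Y' → Y ≤ D.perp Y')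
    {u : Submodule K V → V} (hu : ∀ Y ∈ F, u Y ∈ Y) :
    D.B (∑ Y ∈ F, u Y) (∑ Y ∈ F, u Y) = ∑ Y ∈ F, D.B (u Y) (u Y) := by
  rw [D.B_sum_left]
  apply Finset.sum_congr rfl
  intro Y hY
  rw [proj_sum ho hu hY (hu Y hY)]

theorem sum_ne {F : Finset (Submodule K V)} (hnd : ∀ Y ∈ F, D.ND Y) (ho : ∀ Y ∈ F, ∀ Y' ∈ F, Y ≠ Y' → Y ≤ D.perp Y')
    {u : Submodule K V → V} (hu : ∀ Y ∈ F, u Y ∈ Y) {Y : Submodule K V} (hY : Y ∈ F) (hu0 : u Y ≠ 0) :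
    ∑ Y ∈ F, u Y ≠ 0 := by
  intro h0
  apply hu0
  refine ND.eq_zero (hnd Y hY) (hu Y hY) ?_
  intro z hz
  rw [← proj_sum ho hu hY hz, h0, map_zero]

theorem sum_nmem {F : Finset (Submodule K V)} (hnd : ∀ Y ∈ F, D.ND Y) (ho : ∀ Y ∈ F, ∀ Y' ∈ F, Y ≠ Y' → Y ≤ D.perp Y')
    {u : Submodule K V → V} (hu : ∀ Y ∈ F, u Y ∈ Y) {Y : Submodule K V} (hY : Y ∈ F) (hu0 : u Y ≠ 0)
    (hW : W ≤ D.perp Y) : ∑ Y ∈ F, u Y ∉ W := by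
  intro h0
  apply hu0
  refine ND.eq_zero (hnd Y hY) (hu Y hY) ?_
  intro z hz
  rw [← proj_sum ho hu hY hz]
  exact hW h0 z hz

theorem perm_sum {F : Finset (Submodule K V)} (hnd : ∀ Y ∈ F, D.ND Y) (ho : ∀ Y ∈ F, ∀ Y' ∈ F, Y ≠ Y' → Y ≤ D.perp Y')
    (hinv : ∀ Y ∈ F, Y.map h.toLinearMap ∈ F)
    {u w : Submodule K V → V} (hu : ∀ Y ∈ F, u Y ∈ Y) (hw : ∀ Y ∈ F, w Y ∈ Y)
    (he : h (∑ Y ∈ F, u Y) = ∑ Y ∈ F, w Y) {Y : Submodule K V} (hY : Y ∈ F) : h (u Y) = w (Y.map h.toLinearMap) := by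
  rw [← sub_eq_zero]
  have hm : ∀ Z ∈ F, h (u Z) ∈ Z.map h.toLinearMap := fun Z hZ => ⟨u Z, hu Z hZ, rfl⟩
  have hYF := hinv Y hY
  refine ND.eq_zero (hnd _ hYF) (Submodule.sub_mem _ (hm Y hY) (hw _ hYF)) ?_
  intro z hz
  rw [map_sub, ← proj_sum ho hw hYF hz, ← he, map_sum, map_sum, sub_eq_zero]
  symm
  apply Finset.sum_eq_single_of_mem Y hY
  intro Y' hY' hne
  refine ho _ (hinv Y' hY') _ hYF ?_ (hm Y' hY') z hz
  intro heq
  exact hne (Submodule.map_injective_of_injective h.injective heq)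

theorem exists_iso_pair (hU : D.ND U) (h2 : 2 ≤ Module.finrank K U) : ∃ u ∈ U, ∃ u' ∈ U,
    D.B u u = 0 ∧ D.B u' u' = 0 ∧ LinearIndependent K ![u, u'] := by
  haveI := D.fd
  have hne : U ≠ ⊥ := by rintro rfl; rw [finrank_bot] at h2; omega
  obtain ⟨y1, hy1, h11⟩ := exists_norm_one hU hne
  obtain ⟨hN, hr, -⟩ := split_one hU hy1 h11
  have hne2 : U ⊓ D.perp (K ∙ y1) ≠ ⊥ := by intro h; rw [h, finrank_bot] at hr; omega
  obtain ⟨y2, hy2, h22⟩ := exists_norm_one hN hne2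
  have h12 : D.B y1 y2 = 0 := hy2.2 y1 (Submodule.mem_span_singleton_self y1)
  have h21 : D.B y2 y1 = 0 := D.B_symm_zero h12
  have hm : D.φ (-1) = -1 := by simp
  obtain ⟨c, hc⟩ := D.exists_norm hm
  obtain ⟨c', hc', hcc⟩ := D.exists_norm_ne (neg_ne_zero.mpr one_ne_zero) hm c
  have hiso : ∀ c : K, c * D.φ c = -1 → D.B (y1 + c • y2) (y1 + c • y2) = 0 := by
    intro c hc
    rw [D.B_add_left, D.B_smul_left, map_add, map_add, map_smul, map_smul, h11, h12, h21, h22]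
    simp only [smul_eq_mul, mul_zero, add_zero, zero_add, mul_one]
    rw [mul_comm, hc]; ring
  refine ⟨y1 + c • y2, U.add_mem hy1 (U.smul_mem _ hy2.1), y1 + c' • y2, U.add_mem hy1 (U.smul_mem _ hy2.1), hiso c hc, hiso c' hc', ?_⟩
  rw [LinearIndependent.pair_iff]
  intro s t hst
  have e1 := congrArg (D.B y1) hst
  have e2 := congrArg (D.B y2) hst
  simp only [map_add, map_smul, h11, h12, h21, h22, smul_eq_mul, map_zero, mul_zero, mul_one, add_zero, zero_add] at e1 e2
  have e3 : t * (c' - c) = 0 := by linear_combination e2 - c * e1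
  rcases mul_eq_zero.mp e3 with e3 | e3
  · rw [e3] at e1 ⊢; simpa using e1
  · exact absurd (sub_eq_zero.mp e3) hcc

theorem exists_third (D : UData K V) : ∃ c : K, c ≠ 0 ∧ c ≠ 1 := by
  obtain ⟨c, h1, h2⟩ := D.exists_norm_ne one_ne_zero (map_one _) 1
  refine ⟨c, ?_, h2⟩
  rintro rfl
  simp at h1

theorem final_blk (hH : HallData D H Pi) (he : ∀ t ∈ Pi, 2 ≤ D.e t) (hne : I.Nonempty) (hnd : ∀ Y ∈ I, D.ND Y)
    (hd : ∀ Y ∈ I, 2 ≤ Module.finrank K Y) (ho : ∀ Y ∈ I, ∀ Y' ∈ I, Y ≠ Y' → Y ≤ D.perp Y')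
    (hinv : ∀ g ∈ H, ∀ Y ∈ I, Y.map g.toLinearMap ∈ I)
    (hcol : ∃ S ⊆ I, ∀ g ∈ H, (∀ Y ∈ I, Y.map g.toLinearMap ∈ S ↔ Y ∈ S) → ∀ Y ∈ I, Stb g Y)
    (hfix : ∀ g ∈ H, ∀ Y ∈ I, Stb g Y → ∀ u ∈ Y, ∀ v ∈ Y, LinearIndependent K ![u, v] → g u = u → g v = v → ∀ x ∈ Y, g x = x)
    (htriv : ∀ g ∈ H, (∀ Y ∈ I, ∀ x ∈ Y, g x = x) → g = 1)
    (h2 : ∀ k ∈ H, Module.finrank K (mv k) = 2 → ∃ Y ∈ I, ∃ Y' ∈ I, Y ≠ Y' ∧ mv k ≤ Y) : Goal D H := by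
  classical
  haveI := D.fd
  haveI := finite_sub (K := K) (V := V)
  have hf : I.Finite := Set.toFinite _
  set F := hf.toFinset with hF
  have hmF : ∀ Y, Y ∈ F ↔ Y ∈ I := fun Y => hf.mem_toFinset
  obtain ⟨S, hS, hcol⟩ := hcol
  have hnd' : ∀ Y ∈ F, D.ND Y := fun Y hY => hnd Y ((hmF Y).mp hY)
  have ho' : ∀ Y ∈ F, ∀ Y' ∈ F, Y ≠ Y' → Y ≤ D.perp Y' := fun Y hY Y' hY' => ho Y ((hmF Y).mp hY) Y' ((hmF Y').mp hY')
  have hex : ∀ Y : Submodule K V, ∃ u u' : V, Y ∈ I → u ∈ Y ∧ u' ∈ Y ∧ D.B u u = 0 ∧ D.B u' u' = 0 ∧ LinearIndependent K ![u, u'] := by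
    intro Y
    by_cases hY : Y ∈ I
    · obtain ⟨u, hu, u', hu', h⟩ := exists_iso_pair (hnd Y hY) (hd Y hY)
      exact ⟨u, u', fun _ => ⟨hu, hu', h⟩⟩
    · exact ⟨0, 0, fun h => absurd h hY⟩
  choose u u' huu using hex
  obtain ⟨ε, hε0, hε1⟩ := D.exists_third
  obtain ⟨Y0, hY0⟩ := hne
  set c : Submodule K V → K := fun Y => if Y ∈ S then ε else 1 with hc
  have hc0 : ∀ Y, c Y ≠ 0 := by
    intro Y; simp only [hc]; split_ifs
    · exact hε0
    · exact one_ne_zero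
  -- the three families
  set w : Fin 3 → Submodule K V → V := ![u, fun Y => c Y • u Y, u'] with hw
  have hwm : ∀ i, ∀ Y ∈ F, w i Y ∈ Y := by
    intro i Y hY
    have := huu Y ((hmF Y).mp hY)
    fin_cases i
    · exact this.1
    · exact Y.smul_mem _ this.1
    · exact this.2.1
  have hw0 : ∀ i, ∀ Y ∈ F, w i Y ≠ 0 := by
    intro i Y hY
    have := (huu Y ((hmF Y).mp hY)).2.2.2.2
    fin_cases i
    · exact this.ne_zero 0
    · exact smul_ne_zero (hc0 Y) (this.ne_zero 0)
    · exact this.ne_zero 1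
  have hwi : ∀ i, ∀ Y ∈ F, D.B (w i Y) (w i Y) = 0 := by
    intro i Y hY
    have := (huu Y ((hmF Y).mp hY))
    fin_cases i
    · exact this.2.2.1
    · show D.B (c Y • u Y) (c Y • u Y) = 0
      rw [D.B_smul_left, map_smul, this.2.2.1, smul_zero, mul_zero]
    · exact this.2.2.2.1
  have hv0 : ∀ i, (∑ Y ∈ F, w i Y) ≠ 0 := fun i => sum_ne hnd' ho' (hwm i) ((hmF Y0).mpr hY0) (hw0 i Y0 ((hmF Y0).mpr hY0))
  refine final_A hH (v := fun i => ∑ Y ∈ F, w i Y) hv0 ?_ ?_ ?_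
  · intro i
    rw [sum_iso ho' (hwm i)]
    exact Finset.sum_eq_zero (hwi i)
  · intro k hk hk2 i hi
    obtain ⟨Y, hY, Y', hY', hne, hle⟩ := h2 k hk hk2
    exact sum_nmem hnd' ho' (hwm i) ((hmF Y').mpr hY') (hw0 i Y' ((hmF Y').mpr hY')) (ho Y hY Y' hY' hne) (hle hi)
  · intro h hh hfx
    have hinv' : ∀ Y ∈ F, Y.map h.toLinearMap ∈ F := fun Y hY => (hmF _).mpr (hinv h hh Y ((hmF Y).mp hY))
    have key : ∀ i, ∀ Y ∈ I, h (w i Y) = w i (Y.map h.toLinearMap) := by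
      intro i Y hY
      obtain ⟨d, hd1, hd2⟩ := hfx i
      have hd3 := eig_one hH he hh (hv0 i) hd1 hd2
      rw [hd3, one_smul] at hd1
      exact perm_sum hnd' ho' hinv' (hwm i) (hwm i) hd1 ((hmF Y).mpr hY)
    have hst := hcol h hh (fun Y hY => by
      have k0 : h (u Y) = u (Y.map h.toLinearMap) := key 0 Y hY
      have k1 : h (c Y • u Y) = c (Y.map h.toLinearMap) • u (Y.map h.toLinearMap) := key 1 Y hY
      rw [map_smul, k0] at k1
      have hYF := hinv' Y ((hmF Y).mpr hY)
      have hu0 : u (Y.map h.toLinearMap) ≠ 0 := hw0 0 _ hYF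
      have hcc := smul_left_injective K hu0 k1
      simp only [hc] at hcc
      by_cases a1 : Y ∈ S <;> by_cases a2 : Y.map h.toLinearMap ∈ S
      · simp [a1, a2]
      · rw [if_pos a1, if_neg a2] at hcc; exact absurd hcc hε1
      · rw [if_neg a1, if_pos a2] at hcc; exact absurd hcc.symm hε1
      · simp [a1, a2])
    have h1 : h = 1 := by
      apply htriv h hh
      intro Y hY
      have := huu Y hY
      have k0 : h (u Y) = u (Y.map h.toLinearMap) := key 0 Y hY
      have k2 : h (u' Y) = u' (Y.map h.toLinearMap) := key 2 Y hY
      have hs : Y.map h.toLinearMap = Y := hst Y hY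
      rw [hs] at k0 k2
      exact hfix h hh Y hY (hst Y hY) _ this.1 _ this.2.1 this.2.2.2.2 k0 k2
    exact ⟨1, fun y => by rw [h1, one_smul]; rfl⟩

end blk
end UData

namespace UData
section fin2
variable {K V : Type} [Field K] [Finite K] [AddCommGroup V] [Module K V] [Finite V] {D : UData K V}
  {g h : V ≃ₗ[K] V} {U W : Submodule K V} {H : Subgroup (V ≃ₗ[K] V)} {Pi : Set ℕ} {r : ℕ}

theorem CaseI.rank_two (c : CaseI D H Pi r) (he : 2 ≤ D.e r) (hg : g ∈ H) (h2 : Module.finrank K (mv g) = 2) :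
    mv g ∈ mv '' TT D H r := by
  haveI := D.fd
  have hg1 : g ≠ 1 := by rintro rfl; rw [mv_one, finrank_bot] at h2; omega
  obtain ⟨t, htP, m, h5, h6, h7⟩ := c.hall.exists_prime hg hg1
  have hmin := c.hmin t htP
  have hle := mv_pow_le g m
  have h8 := Submodule.finrank_mono hle
  have heq : mv (g ^ m) = mv g := Submodule.eq_of_le_of_finrank_le hle (by omega)
  have hgm : g ^ m ∈ H := H.pow_mem hg m
  have ht3 := c.hall.three_le htP
  have hst : ∀ Y ∈ mv '' TT D H r, Stb (g ^ m) Y := by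
    intro Y hY
    by_contra hns
    have h9 := mover (c.hall.pr t htP) c.nd c.orth (c.inv _ hgm) (by rw [← h5]; exact pow_orderOf_eq_one _) hY hns
    rw [c.dim Y hY, heq, h2] at h9
    have : 2 * 2 ≤ (t - 1) * D.e r := Nat.mul_le_mul (by omega) he
    omega
  have hgm1 : g ^ m ≠ 1 := by
    intro h; rw [h, mv_one, finrank_bot] at h7; omega
  obtain ⟨Y, hY, hfull⟩ := c.exists_full hgm hgm1 hst
  have h10 : Y ≤ mv g := by rw [← heq, ← hfull]; exact mvo_le_mv
  have h11 : Y = mv g := Submodule.eq_of_le_of_finrank_le h10 (by rw [h2, c.dim Y hY]; omega)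
  rw [← h11]; exact hY

theorem CaseI.goal_two (c : CaseI D H Pi r) (he : 2 ≤ D.e r) : Goal D H := by
  haveI := D.fd
  haveI := finite_sub (K := K) (V := V)
  have hall2 : ∀ t ∈ Pi, 2 ≤ D.e t := fun t ht => he.trans (c.hmin t ht)
  have hen := c.hall.e_le c.hr
  have hn := c.hall.hn
  have hcard := c.card
  have hpos : 0 < D.n / D.e r := Nat.div_pos hen (by omega)
  have hne : (mv '' TT D H r).Nonempty := by
    rw [← Set.ncard_pos (Set.toFinite _), hcard]; exact hpos
  have hfix : ∀ g ∈ H, ∀ Y ∈ mv '' TT D H r, Stb g Y → ∀ u ∈ Y, ∀ v ∈ Y, LinearIndependent K ![u, v] → g u = u → g v = v → ∀ x ∈ Y, g x = x :=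
    fun g hg Y hY hst u hu v hv hl hgu hgv => c.fix hg hY hst hu (hl.ne_zero 0) hgu
  by_cases hcs : 3 ≤ D.e r ∨ 2 ≤ D.n / D.e r
  · refine final_blk c.hall hall2 hne c.nd (fun Y hY => by rw [c.dim Y hY]; exact he) c.orth c.inv c.color hfix (fun g hg => c.triv hg) ?_
    intro k hk hk2
    have hk1 : k ≠ 1 := by rintro rfl; rw [mv_one, finrank_bot] at hk2; omega
    have := c.hall.rank_ge c.hmin hk hk1
    have hY := c.rank_two he hk hk2
    have h2 : 1 < (mv '' TT D H r).ncard := by rw [hcard]; omega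
    obtain ⟨Y', hY', hne'⟩ := Set.exists_ne_of_one_lt_ncard h2 (mv k)
    exact ⟨mv k, hY, Y', hY', hne'.symm, le_rfl⟩
  · push Not at hcs
    obtain ⟨Y, hIY⟩ := Set.ncard_eq_one.mp (show (mv '' TT D H r).ncard = 1 by omega)
    have hY : Y ∈ mv '' TT D H r := by rw [hIY]; rfl
    have hnd := c.nd Y hY
    have hdim := c.dim Y hY
    have hsum := hnd.finrank
    have hne' : D.perp Y ≠ ⊥ := by
      intro h0
      rw [h0, finrank_bot] at hsum
      have := D.finrank_V
      omega
    have hYne := c.ne Y hY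
    obtain ⟨y, hy, hy1⟩ := exists_norm_one hnd hYne
    obtain ⟨z, hz, hz1⟩ := exists_norm_one hnd.perp hne'
    have hyz : D.B y z = 0 := hz y hy
    have hzy := D.B_symm_zero hyz
    have hm : D.φ (-1) = -1 := by simp
    obtain ⟨d, hd⟩ := D.exists_norm hm
    have hd0 : d ≠ 0 := by rintro rfl; simp at hd
    have hz0 : z ≠ 0 := by rintro rfl; simp at hz1
    have hy0 : y ≠ 0 := by rintro rfl; simp at hy1
    have hnm : y + d • z ∉ Y := by
      intro hmem
      have h1 : z ∈ Y := by
        rw [← Submodule.smul_mem_iff _ hd0]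
        have := Y.sub_mem hmem hy
        rwa [add_sub_cancel_left] at this
      exact hz0 (ND.eq_zero hnd h1 hz)
    have hv0 : y + d • z ≠ 0 := fun h0 => hnm (by rw [h0]; exact Y.zero_mem)
    refine final_A c.hall (v := fun _ => y + d • z) (fun _ => hv0) (fun _ => ?_) ?_ ?_
    · rw [D.B_add_left, D.B_smul_left, map_add, map_add, map_smul, map_smul, hy1, hyz, hzy, hz1]
      simp only [smul_eq_mul, mul_zero, add_zero, zero_add, mul_one]
      rw [mul_comm, hd]; ring
    · intro k hk hk2 i hi
      have := c.rank_two he hk hk2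
      rw [hIY] at this
      rw [Set.mem_singleton_iff.mp this] at hi
      exact hnm hi
    · intro h hh hfx
      obtain ⟨c1, hc1, hc2⟩ := hfx 0
      have hc3 := eig_one c.hall hall2 hh hv0 hc1 hc2
      rw [hc3, one_smul, map_add, map_smul] at hc1
      have hst : Stb h Y := by
        have := c.inv h hh Y hY
        rw [hIY] at this
        exact this
      have h1 : h y - y ∈ Y := Y.sub_mem (hst.mem hy) hy
      have hstp := perp_stb (c.hall.le hh) hst
      have h2 : h y - y ∈ D.perp Y := by
        have e : h y - y = d • z - d • h z := by
          have := congrArg (fun x => x - d • h z - y) hc1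
          rw [← sub_eq_zero] at this ⊢
          rw [← this]; abel
        rw [e]
        exact Submodule.sub_mem _ (Submodule.smul_mem _ _ hz) (Submodule.smul_mem _ _ (hstp.mem hz))
      have h3 := sub_eq_zero.mp (ND.eq_zero hnd h1 h2)
      have h4 : h = 1 := by
        apply c.triv hh
        intro Y' hY'
        rw [hIY] at hY'
        rw [Set.mem_singleton_iff.mp hY']
        exact c.fix hh hY hst hy hy0 h3
      exact ⟨1, fun y => by rw [h4, one_smul]; rfl⟩

theorem CaseII.goal_big (c : CaseII D H Pi r) (hn : D.n ≠ 3) : Goal D H := by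
  haveI := D.fd
  haveI := finite_sub (K := K) (V := V)
  have hr3 := c.three
  have her := c.her
  have hall2 : ∀ t ∈ Pi, 2 ≤ D.e t := fun t ht => by have := c.min t ht; omega
  have hne : (II D H Pi r).Nonempty := c.X_ne.mono Set.subset_union_left
  refine final_blk c.hall hall2 hne c.nd (fun Y hY => by have := (c.dim Y hY).1; omega) c.orth c.inv c.color
    (fun g hg Y hY hst u hu v hv hl hgu hgv => c.fix hg hY hst hu hv hl hgu hgv) (fun g hg => c.triv hg) ?_
  intro k hk hk2
  have hk1 : k ≠ 1 := by rintro rfl; rw [mv_one, finrank_bot] at hk2; omega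
  have h4 := c.hall.rank_ge c.min hk hk1
  obtain ⟨Y, hY, hkY⟩ := c.rank_two hk hk2
  obtain ⟨V0, -, h1, h2⟩ := c.count
  have h3 : 1 ≤ (XX D H Pi r).ncard := (Set.ncard_pos (Set.toFinite _)).mpr c.X_ne
  have hr : r = 3 := by omega
  have h5 : (XX D H Pi r).ncard = 1 := by omega
  rw [h5] at h2 h1
  have h6 : (JJ D H Pi r).ncard ≠ 0 := by
    intro h6; rw [h6] at h2; omega
  obtain ⟨X, hX⟩ := c.X_ne
  obtain ⟨J, hJ⟩ := (Set.ncard_pos (Set.toFinite _)).mp (Nat.pos_of_ne_zero h6)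
  have hXJ : X ≠ J := by
    intro h
    have a1 := c.X_dim X hX
    have a2 := c.J_dim J hJ
    rw [h] at a1; omega
  by_cases hYX : Y = X
  · exact ⟨Y, hY, J, Or.inr hJ, by rw [hYX]; exact hXJ, hkY⟩
  · exact ⟨Y, hY, X, Or.inl hX, hYX, hkY⟩

end fin2
end UData

theorem card_le_of_fib {G : Type} [Group G] [Finite G] {A B : Subgroup G} (hBA : B ≤ A) {α : Type} {T : Set α} (hT : T.Finite)
    (θ : G → α) (hθ : ∀ a ∈ A, θ a ∈ T) (h : ∀ a ∈ A, ∀ a' ∈ A, θ a = θ a' → a⁻¹ * a' ∈ B) :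
    Nat.card A ≤ T.ncard * Nat.card B := by
  have h1 := (B.subgroupOf A).card_eq_card_quotient_mul_card_subgroup
  have h2 : Nat.card (B.subgroupOf A) = Nat.card B := Nat.card_congr (Subgroup.subgroupOfEquivOfLe hBA).toEquiv
  rw [h1, h2]
  apply Nat.mul_le_mul_right
  haveI := hT.to_subtype
  refine Nat.card_le_card_of_injective (β := T) (fun x => ⟨θ (Quotient.out x : A).1, hθ _ (Quotient.out x : A).2⟩) ?_
  intro x y hxy
  have h3 := h _ (Quotient.out x : A).2 _ (Quotient.out y : A).2 (by simpa using hxy)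
  rw [← Quotient.out_eq x, ← Quotient.out_eq y]
  exact QuotientGroup.eq.mpr h3

namespace UData
section frame
variable {K V : Type} [Field K] [Finite K] [AddCommGroup V] [Module K V] [Finite V] {D : UData K V}
  {g h : V ≃ₗ[K] V} {U W : Submodule K V} {H : Subgroup (V ≃ₗ[K] V)} {Pi : Set ℕ} {r : ℕ}

def scal (K V : Type) [Field K] [AddCommGroup V] [Module K V] : Subgroup (V ≃ₗ[K] V) where
  carrier := {g | ∃ c : K, ∀ v, g v = c • v}
  mul_mem' := by
    rintro a b ⟨c, hc⟩ ⟨d, hd⟩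
    exact ⟨c * d, fun v => by rw [LinearEquiv.mul_apply, hd, hc, smul_smul]⟩
  one_mem' := ⟨1, fun v => by rw [one_smul]; rfl⟩
  inv_mem' := by
    rintro a ⟨c, hc⟩
    refine ⟨c⁻¹, fun v => ?_⟩
    by_cases hc0 : c = 0
    · have : v = 0 := by
        apply a.injective
        rw [hc, hc0, zero_smul, map_zero]
      rw [this, map_zero, smul_zero]
    · apply a.injective
      rw [apply_inv_self', hc, smul_smul, mul_inv_cancel₀ hc0, one_smul]

def cj (H : Subgroup (V ≃ₗ[K] V)) (x : V ≃ₗ[K] V) : Subgroup (V ≃ₗ[K] V) := H.comap (MulAut.conj x).toMonoidHom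

theorem mem_cj {x : V ≃ₗ[K] V} : h ∈ cj H x ↔ x * h * x⁻¹ ∈ H := Iff.rfl

theorem final_B (hH : HallData D H Pi) {x : V ≃ₗ[K] V} (hx : IsTv D x)
    (hc : Nat.card (H ⊓ cj H x : Subgroup (V ≃ₗ[K] V)) ≤ 9 * Nat.card (H ⊓ cj H x ⊓ scal K V : Subgroup (V ≃ₗ[K] V)))
    (hkill : ∀ h ∈ H, h ∉ scal K V → ∃ y, IsTv D y ∧ y * h * y⁻¹ ∉ H) : Goal D H := by
  haveI := finite_lequiv (K := K) (V := V)
  have hodd : ∀ E E' : Subgroup (V ≃ₗ[K] V), E ≤ H → E' < E → 3 * Nat.card E' ≤ Nat.card E := by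
    intro E E' hE hlt
    obtain ⟨d, hd⟩ := Subgroup.card_dvd_of_le hlt.le
    have hpos : 0 < Nat.card E := Nat.card_pos
    have hd0 : d ≠ 0 := by rintro rfl; omega
    have hd1 : d ≠ 1 := by
      rintro rfl
      exact hlt.ne (Subgroup.eq_of_le_of_card_ge hlt.le (by omega))
    have hd2 : d ≠ 2 := by
      rintro rfl
      have h2 : 2 ∣ Nat.card H := (Dvd.intro_left _ hd.symm).trans (Subgroup.card_dvd_of_le hE)
      exact hH.odd 2 (hH.sub 2 Nat.prime_two h2) rfl
    rw [hd, mul_comm]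
    exact Nat.mul_le_mul_left _ (by omega)
  have hsc : ∀ y : V ≃ₗ[K] V, ∀ h ∈ H, h ∈ scal K V → h ∈ cj H y := by
    rintro y h hh ⟨c, hc⟩
    rw [mem_cj]
    have : y * h * y⁻¹ = h := by
      ext v
      rw [LinearEquiv.mul_apply, LinearEquiv.mul_apply, hc, map_smul, apply_inv_self', hc]
    rwa [this]
  by_cases h0 : H ⊓ cj H x ≤ scal K V
  · exact ⟨x, x, x, hx, hx, hx, fun h hh h1 _ _ => h0 ⟨hh, h1⟩⟩
  obtain ⟨a, ha, ha'⟩ := SetLike.not_le_iff_exists.mp h0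
  obtain ⟨y, hy, hya⟩ := hkill a ha.1 ha'
  by_cases h1 : H ⊓ cj H x ⊓ cj H y ≤ scal K V
  · exact ⟨x, y, y, hx, hy, hy, fun h hh h2 h3 _ => h1 ⟨⟨hh, h2⟩, h3⟩⟩
  obtain ⟨b, hb, hb'⟩ := SetLike.not_le_iff_exists.mp h1
  obtain ⟨z, hz, hzb⟩ := hkill b hb.1.1 hb'
  have l1 := hodd (H ⊓ cj H x) (H ⊓ cj H x ⊓ cj H y) inf_le_left
    (lt_of_le_of_ne inf_le_left (fun e => hya (by rw [← e] at ha; exact ha.2)))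
  have l2 := hodd (H ⊓ cj H x ⊓ cj H y) (H ⊓ cj H x ⊓ cj H y ⊓ cj H z) (inf_le_left.trans inf_le_left)
    (lt_of_le_of_ne inf_le_left (fun e => hzb (by rw [← e] at hb; exact hb.2)))
  have hle : H ⊓ cj H x ⊓ scal K V ≤ H ⊓ cj H x ⊓ cj H y ⊓ cj H z := by
    rintro h ⟨h1, h2⟩
    exact ⟨⟨h1, hsc y h h1.1 h2⟩, hsc z h h1.1 h2⟩
  have heq := Subgroup.eq_of_le_of_card_ge hle (by omega)
  refine ⟨x, y, z, hx, hy, hz, fun h hh h2 h3 h4 => ?_⟩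
  have hm : h ∈ H ⊓ cj H x ⊓ cj H y ⊓ cj H z := ⟨⟨⟨hh, h2⟩, h3⟩, h4⟩
  rw [← heq] at hm
  exact hm.2

structure Frame (D : UData K V) {ι : Type} [Fintype ι] (f : ι → V) : Prop where
  one : ∀ i, D.B (f i) (f i) = 1
  orth : ∀ i j, i ≠ j → D.B (f i) (f j) = 0
  span : ∀ y, y = ∑ i, D.B (f i) y • f i

namespace Frame
variable {ι : Type} [Fintype ι] {f : ι → V}

theorem coef (F : Frame D f) (a : ι → K) (i : ι) : D.B (f i) (∑ j, a j • f j) = a i := by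
  classical
  rw [map_sum, Finset.sum_eq_single_of_mem i (Finset.mem_univ i)]
  · rw [map_smul, F.one, smul_eq_mul, mul_one]
  · intro j _ hj
    rw [map_smul, F.orth i j (Ne.symm hj), smul_zero]

theorem norm (F : Frame D f) (a : ι → K) : D.B (∑ j, a j • f j) (∑ j, a j • f j) = ∑ j, a j * D.φ (a j) := by
  rw [D.B_sum_left]
  apply Finset.sum_congr rfl
  intro i _
  rw [D.B_smul_left, F.coef, mul_comm]

theorem ne_zero (F : Frame D f) (i : ι) : f i ≠ 0 := by
  intro h
  have := F.one i
  rw [h, map_zero] at this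
  exact zero_ne_one this

theorem ext (F : Frame D f) {x y : V} (h : ∀ i, D.B (f i) x = D.B (f i) y) : x = y := by
  rw [F.span x, F.span y]
  simp only [h]

end Frame

theorem skew_three (D : UData K V) (hq : 4 ≤ D.q) : ∃ a b c : K, (a ≠ 0 ∧ D.φ a = a) ∧ (b ≠ 0 ∧ D.φ b = b) ∧ (c ≠ 0 ∧ D.φ c = c) ∧
    a ≠ b ∧ a ≠ c ∧ b ≠ c := by
  have h1 : ({a : K | a ≠ 0 ∧ D.φ a = a}).ncard = D.q - 1 := D.norm_aux.2
  have h2 : 2 < ({a : K | a ≠ 0 ∧ D.φ a = a}).ncard := by omega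
  obtain ⟨a, b, c, ha, hb, hc, h3⟩ := (Set.two_lt_ncard_iff (Set.toFinite _)).mp h2
  exact ⟨a, b, c, ha, hb, hc, h3⟩

/-- full support isotropic vectors -/
theorem exists_full_coef (D : UData K V) {ι : Type} [Fintype ι] (hι : 2 ≤ Fintype.card ι) (hq : 4 ≤ D.q) :
    ∃ a : ι → K, (∀ i, a i ≠ 0) ∧ ∑ i, a i * D.φ (a i) = 0 := by
  classical
  obtain ⟨i, j, hij⟩ := Fintype.one_lt_card_iff.mp (show 1 < Fintype.card ι by omega)
  set s : K := ∑ k ∈ (Finset.univ.erase i).erase j, 1 with hs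
  have hsf : D.φ s = s := by rw [hs, map_sum]; simp
  obtain ⟨x, hx0, hxf, hxs⟩ : ∃ x : K, x ≠ 0 ∧ D.φ x = x ∧ x + s ≠ 0 := by
    obtain ⟨a, b, c, ha, hb, hc, hab, -⟩ := D.skew_three hq
    by_cases h : a + s = 0
    · refine ⟨b, hb.1, hb.2, fun h' => hab ?_⟩
      linear_combination h - h'
    · exact ⟨a, ha.1, ha.2, h⟩
  set c : ι → K := fun k => if k = i then x else if k = j then - (x + s) else 1 with hc
  have hcf : ∀ k, D.φ (c k) = c k := by
    intro k; simp only [hc]; split_ifs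
    · exact hxf
    · rw [map_neg, map_add, hxf, hsf]
    · exact map_one _
  have hc0 : ∀ k, c k ≠ 0 := by
    intro k; simp only [hc]; split_ifs
    · exact hx0
    · exact neg_ne_zero.mpr hxs
    · exact one_ne_zero
  choose a ha using fun k => D.exists_norm (hcf k)
  refine ⟨a, fun k h0 => hc0 k ?_, ?_⟩
  · rw [← ha, h0, zero_mul]
  · simp only [ha]
    rw [← Finset.add_sum_erase _ _ (Finset.mem_univ i), ← Finset.add_sum_erase _ _ (Finset.mem_erase.mpr ⟨Ne.symm hij, Finset.mem_univ j⟩)]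
    have h1 : ∑ k ∈ (Finset.univ.erase i).erase j, c k = s := by
      apply Finset.sum_congr rfl
      intro k hk
      simp only [Finset.mem_erase] at hk
      simp only [hc, if_neg hk.1, if_neg hk.2.1]
    rw [h1]
    simp only [hc, if_pos, if_neg (Ne.symm hij)]
    ring

theorem eig3 {u d : V} {l m m' s s' : K} (hud : LinearIndependent K ![u, d]) (hs : s ≠ 0) (hs' : s' ≠ 0) (hss : s ≠ s')
    (h1 : h u = l • u) (h2 : h (u + s • d) = m • (u + s • d)) (h3 : h (u + s' • d) = m' • (u + s' • d)) : h d = l • d := by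
  rw [LinearIndependent.pair_iff] at hud
  rw [map_add, map_smul, h1] at h2 h3
  have e1 : s • h d = (m - l) • u + (m * s) • d := by
    rw [← sub_eq_zero] at h2 ⊢
    rw [← h2]; module
  have e2 : s' • h d = (m' - l) • u + (m' * s') • d := by
    rw [← sub_eq_zero] at h3 ⊢
    rw [← h3]; module
  have e3 : (s' * (m - l) - s * (m' - l)) • u + (s' * (m * s) - s * (m' * s')) • d = 0 := by
    have : s' • (s • h d) - s • (s' • h d) = 0 := by module
    rw [e1, e2] at this
    rw [← this]; module
  obtain ⟨e4, e5⟩ := hud _ _ e3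
  have e6 : m = m' := by
    have : s * s' * (m - m') = 0 := by linear_combination e5
    rcases mul_eq_zero.mp this with h | h
    · exact absurd h (mul_ne_zero hs hs')
    · exact sub_eq_zero.mp h
  subst e6
  have e7 : m = l := by
    have : (s' - s) * (m - l) = 0 := by linear_combination e4
    rcases mul_eq_zero.mp this with h | h
    · exact absurd (sub_eq_zero.mp h).symm hss
    · exact sub_eq_zero.mp h
  subst e7
  rw [sub_self, zero_smul, zero_add, mul_comm, mul_smul] at e1
  exact smul_right_injective V hs e1

theorem norm_three (D : UData K V) : ∃ a b : K, a * D.φ a = 1 ∧ b * D.φ b = 1 ∧ a ≠ 1 ∧ b ≠ 1 ∧ a ≠ b := by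
  have h1 : ({a : K | a * D.φ a = 1}).ncard = D.q + 1 := D.norm_fiber one_ne_zero (map_one _)
  have := D.two_le_q
  have h2 : 2 < ({a : K | a * D.φ a = 1}).ncard := by omega
  obtain ⟨a, b, c, ha, hb, hc, h3⟩ := (Set.two_lt_ncard_iff (Set.toFinite _)).mp h2
  by_cases e1 : a = 1
  · exact ⟨b, c, hb, hc, fun e => h3.1 (e1.trans e.symm), fun e => h3.2.1 (e1.trans e.symm), h3.2.2⟩
  · by_cases e2 : b = 1
    · exact ⟨a, c, ha, hc, e1, fun e => h3.2.2 (e2.trans e.symm), h3.2.1⟩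
    · exact ⟨a, b, ha, hb, e1, e2, h3.1⟩

namespace Frame
variable {ι : Type} [Fintype ι] {f : ι → V}

theorem non_eig (F : Frame D f) (hι : 2 ≤ Fintype.card ι) (hq : 4 ≤ D.q) (hs : h ∉ scal K V) :
    ∃ v, D.B v v = 0 ∧ (∀ i, D.B (f i) v ≠ 0) ∧ ¬ ∃ c : K, h v = c • v := by
  classical
  by_contra hne
  push Not at hne
  obtain ⟨a, ha, ha0⟩ := D.exists_full_coef hι hq
  have key : ∀ b : ι → K, (∀ i, b i * D.φ (b i) = 1) → ∃ c : K, h (∑ i, (b i * a i) • f i) = c • ∑ i, (b i * a i) • f i := by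
    intro b hb
    apply hne
    · rw [F.norm, ← ha0]
      apply Finset.sum_congr rfl
      intro i _
      rw [map_mul]
      linear_combination (a i * D.φ (a i)) * hb i
    · intro i
      rw [F.coef]
      refine mul_ne_zero (fun h0 => ?_) (ha i)
      have := hb i
      rw [h0, zero_mul] at this
      exact zero_ne_one this
  obtain ⟨l, hl⟩ := key (fun _ => 1) (fun i => by rw [map_one, mul_one])
  obtain ⟨x, y, hx, hy, hx1, hy1, hxy⟩ := D.norm_three
  set u := ∑ i, ((1 : K) * a i) • f i with hu
  have hdiag : ∀ j, h (f j) = l • f j := by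
    intro j
    have hvar : ∀ x : K, x * D.φ x = 1 → ∃ c : K, h (u + ((x - 1) * a j) • f j) = c • (u + ((x - 1) * a j) • f j) := by
      intro x hx
      obtain ⟨c, hc⟩ := key (fun i => if i = j then x else 1) (fun i => by
        split_ifs
        · exact hx
        · rw [map_one, mul_one])
      have : ∑ i, ((if i = j then x else 1) * a i) • f i = u + ((x - 1) * a j) • f j := by
        apply F.ext
        intro k
        rw [F.coef, map_add, hu, F.coef, map_smul]
        by_cases hk : k = j
        · subst hk; rw [F.one]; simp only [if_pos, smul_eq_mul]; ring
        · rw [F.orth k j hk, if_neg hk]; simp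
      rw [this] at hc
      exact ⟨c, hc⟩
    obtain ⟨m, hm⟩ := hvar x hx
    obtain ⟨m', hm'⟩ := hvar y hy
    obtain ⟨j', hj'⟩ := Fintype.exists_ne_of_one_lt_card (show 1 < Fintype.card ι by omega) j
    refine eig3 ?_ (mul_ne_zero (sub_ne_zero.mpr hx1) (ha j)) (mul_ne_zero (sub_ne_zero.mpr hy1) (ha j)) ?_ hl hm hm'
    · rw [LinearIndependent.pair_iff]
      intro s t hst
      have e1 := congrArg (D.B (f j')) hst
      have e2 := congrArg (D.B (f j)) hst
      rw [map_add, map_smul, map_smul, hu, F.coef, F.orth j' j hj', smul_zero, add_zero, map_zero, smul_eq_mul, one_mul] at e1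
      rw [map_add, map_smul, map_smul, hu, F.coef, F.one, map_zero, smul_eq_mul, smul_eq_mul, mul_one] at e2
      have hs0 : s = 0 := (mul_eq_zero.mp e1).resolve_right (ha j')
      rw [hs0, zero_mul, zero_add] at e2
      exact ⟨hs0, e2⟩
    · intro e
      apply hxy
      have := mul_right_cancel₀ (ha j) e
      linear_combination this
  apply hs
  refine ⟨l, fun v => ?_⟩
  conv_lhs => rw [F.span v]
  conv_rhs => rw [F.span v]
  rw [map_sum, Finset.smul_sum]
  apply Finset.sum_congr rfl
  intro i _
  rw [map_smul, hdiag, smul_comm]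

theorem kill (F : Frame D f) (hH : HallData D H Pi) (hι : 2 ≤ Fintype.card ι) (hq : 4 ≤ D.q)
    (hK : ∀ k1 ∈ H, ∀ k2 ∈ H, ∀ k3 ∈ H, Module.finrank K (mv k1) = 2 → mv k2 = mv k1 → mv k3 = mv k1 →
      (∃ v ∈ mv k1, ∀ i, D.B (f i) v ≠ 0) → k1 = k2 ∨ k1 = k3 ∨ k2 = k3) (hh : h ∈ H) (hs : h ∉ scal K V) :
    ∃ y, IsTv D y ∧ y * h * y⁻¹ ∉ H := by
  haveI := D.fd
  by_contra hne
  push Not at hne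
  obtain ⟨v, hv, hfull, hneig⟩ := F.non_eig hι hq hs
  obtain ⟨i0⟩ : Nonempty ι := Fintype.card_pos_iff.mp (by omega)
  have hv0 : v ≠ 0 := by rintro rfl; exact hfull i0 (map_zero _)
  obtain ⟨s, hs0, hs1⟩ := D.exists_skew
  set w := (h⁻¹ : V ≃ₗ[K] V) v with hw
  have hli : LinearIndependent K ![v, w] := by
    rw [LinearIndependent.pair_iff' hv0]
    intro c hc
    have e1 : v = c • h v := by rw [← map_smul, hc, hw, apply_inv_self']
    have hc0 : c ≠ 0 := by rintro rfl; rw [zero_smul] at e1; exact hv0 e1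
    apply hneig
    refine ⟨c⁻¹, ?_⟩
    conv_rhs => rw [e1]
    rw [smul_smul, inv_mul_cancel₀ hc0, one_smul]
  have hsp : Module.finrank K (Submodule.span K {v, w}) = 2 := by
    have := finrank_span_eq_card hli
    rw [Matrix.range_cons, Matrix.range_cons, Matrix.range_empty, Set.union_empty, Set.singleton_union] at this
    simpa using this
  obtain ⟨y0, hy0⟩ := exists_unit_dual (D := D) hv0
  have key : ∀ a : K, a ≠ 0 ∧ D.φ a = a → ∃ k ∈ H, Module.finrank K (mv k) = 2 ∧ mv k = Submodule.span K {v, w} ∧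
      ∀ y, k y = y - ((s * a) * D.B v y) • v + ((s * a) * (D.B w y - (s * a) * D.B v y * D.B w v)) • w := by
    rintro a ⟨ha0, ha1⟩
    have hsk : s * a + D.φ (s * a) = 0 := by rw [map_mul, ha1, ← add_mul, hs1, zero_mul]
    obtain ⟨x, hx, hx2⟩ := exists_tv hv hsk
    have hxh := hne x hx
    rcases tv_dich hH hv hv0 (mul_ne_zero hs0 ha0) hx2 hh hxh with ⟨c, hc, -⟩ | ⟨h1, h2, h3, h4⟩
    · exact absurd ⟨c, hc⟩ hneig
    · refine ⟨_, H.mul_mem (H.inv_mem hh) hxh, h1, ?_, tv_comm_apply hv hx2 (hH.le hh)⟩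
      symm
      apply Submodule.eq_of_le_of_finrank_le
      · rw [Submodule.span_le]
        rintro z (rfl | rfl)
        · exact h2
        · exact h3
      · rw [h1, hsp]
  have hdist : ∀ (a b : K) (k k' : V ≃ₗ[K] V),
      (∀ y, k y = y - ((s * a) * D.B v y) • v + ((s * a) * (D.B w y - (s * a) * D.B v y * D.B w v)) • w) →
      (∀ y, k' y = y - ((s * b) * D.B v y) • v + ((s * b) * (D.B w y - (s * b) * D.B v y * D.B w v)) • w) → k = k' → a = b := by
    rintro a b k k' e1 e2 rfl
    have e3 := (e1 y0).symm.trans (e2 y0)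
    rw [hy0] at e3
    rw [LinearIndependent.pair_iff] at hli
    have e4 := hli (s * b - s * a) ((s * a) * (D.B w y0 - (s * a) * 1 * D.B w v) - (s * b) * (D.B w y0 - (s * b) * 1 * D.B w v)) (by
      rw [← sub_eq_zero] at e3
      rw [← e3]; module)
    have e5 : s * (b - a) = 0 := by linear_combination e4.1
    exact (sub_eq_zero.mp ((mul_eq_zero.mp e5).resolve_left hs0)).symm
  obtain ⟨a, b, c, ha, hb, hc, hab, hac, hbc⟩ := D.skew_three hq
  obtain ⟨k1, m1, r1, s1, f1⟩ := key a ha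
  obtain ⟨k2, m2, r2, s2, f2⟩ := key b hb
  obtain ⟨k3, m3, r3, s3, f3⟩ := key c hc
  rcases hK k1 m1 k2 m2 k3 m3 r1 (s2.trans s1.symm) (s3.trans s1.symm)
    ⟨v, by rw [s1]; exact Submodule.subset_span (by simp), hfull⟩ with e | e | e
  · exact hab (hdist _ _ _ _ f1 f2 e)
  · exact hac (hdist _ _ _ _ f1 f3 e)
  · exact hbc (hdist _ _ _ _ f2 f3 e)

end Frame
end frame
end UData

namespace UData
section c23
variable {K V : Type} [Field K] [Finite K] [AddCommGroup V] [Module K V] [Finite V] {D : UData K V}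
  {g h : V ≃ₗ[K] V} {U W : Submodule K V} {H : Subgroup (V ≃ₗ[K] V)} {Pi : Set ℕ} {r : ℕ}

theorem frame_b (D : UData K V) : Frame D (fun i => D.b i) where
  one i := by rw [D.orth, if_pos rfl]
  orth i j h := by rw [D.orth, if_neg h]
  span y := by
    have : ∀ i, D.B (D.b i) y = D.b.repr y i := by
      intro i
      conv_lhs => rw [← D.b.sum_repr y, map_sum]
      rw [Finset.sum_eq_single_of_mem i (Finset.mem_univ i)]
      · rw [map_smul, D.orth, if_pos rfl, smul_eq_mul, mul_one]
      · intro j _ hj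
        rw [map_smul, D.orth, if_neg (Ne.symm hj), smul_zero]
    simp only [this]
    exact (D.b.sum_repr y).symm

/-- cubic relation -/
def Cub (a b c : K) (T : V ≃ₗ[K] V) : Prop := ∀ v, T (T (T v)) + a • T (T v) + b • T v + c • v = 0

theorem exists_cub (hV : Module.finrank K V = 3) (T : V ≃ₗ[K] V) : ∃ a b c : K, Cub a b c T := by
  haveI : FiniteDimensional K V := Module.Finite.of_finite
  have h1 := LinearMap.aeval_self_charpoly T.toLinearMap
  rw [Polynomial.aeval_eq_sum_range, LinearMap.charpoly_natDegree, hV] at h1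
  have h3 : T.toLinearMap.charpoly.coeff 3 = 1 := by
    have := T.toLinearMap.charpoly_monic
    rw [Polynomial.Monic, Polynomial.leadingCoeff, LinearMap.charpoly_natDegree, hV] at this
    exact this
  simp only [Finset.sum_range_succ, Finset.sum_range_zero, h3] at h1
  refine ⟨T.toLinearMap.charpoly.coeff 2, T.toLinearMap.charpoly.coeff 1, T.toLinearMap.charpoly.coeff 0, fun v => ?_⟩
  have h4 := congrArg (fun A : V →ₗ[K] V => A v) h1
  simp only [LinearMap.add_apply, LinearMap.smul_apply, pow_succ, pow_zero, one_mul, Module.End.mul_apply, LinearMap.zero_apply,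
    Module.End.one_apply, LinearEquiv.coe_coe, one_smul] at h4
  rw [← h4]; abel

theorem Cub.conj {a b c : K} {T : V ≃ₗ[K] V} (hT : Cub a b c T) (x : V ≃ₗ[K] V) : Cub a b c (x * T * x⁻¹) := by
  intro v
  have := congrArg x (hT ((x⁻¹ : V ≃ₗ[K] V) v))
  simp only [map_add, map_smul, map_zero, apply_inv_self'] at this
  simp only [LinearEquiv.mul_apply, inv_apply_self']
  exact this

theorem cub_card {a b c : K} {S : Set (V ≃ₗ[K] V)} (hS : ∀ x ∈ S, Cub a b c x) (hc : ∀ x ∈ S, ∀ y ∈ S, ∀ v, x (y v) = y (x v))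
    (hf : ∀ x ∈ S, ∀ y ∈ S, x ≠ y → ∀ v, x v = y v → v = 0) : S.ncard ≤ 3 := by
  classical
  haveI := finite_lequiv (K := K) (V := V)
  by_contra hlt
  have h2 : 2 < S.ncard := by omega
  obtain ⟨x, y, z, hx, hy, hz, hxy, hxz, hyz⟩ := (Set.two_lt_ncard_iff (Set.toFinite _)).mp h2
  have hQ : ∀ x ∈ S, ∀ y ∈ S, x ≠ y → ∀ v, x (x v) + x (y v) + y (y v) + a • (x v + y v) + b • v = 0 := by
    intro x hx y hy hxy v
    apply hf x hx y hy hxy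
    have e1 := hS x hx v
    have e2 := hS y hy v
    simp only [map_add, map_smul]
    have c1 := hc x hx y hy v
    have c2 := hc x hx y hy (x v)
    have c3 := hc x hx y hy (y v)
    have c4 : x (x (y v)) = y (x (x v)) := by rw [c1, c2]
    have c5 : x (y (y v)) = y (x (y v)) := c3
    rw [← sub_eq_zero]
    rw [c4, c5, c1]
    rw [← sub_eq_zero] at e1 e2
    have e3 := e1.trans e2.symm
    rw [← sub_eq_zero] at e3
    rw [← e3]
    module
  have hL : ∀ z ∈ S, x ≠ z → y ≠ z → ∀ v, x v + y v + z v + a • v = 0 := by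
    intro z hz hxz hyz v
    apply hf y hy z hz hyz
    have e1 := hQ x hx y hy hxy v
    have e2 := hQ x hx z hz hxz v
    simp only [map_add, map_smul]
    rw [← hc x hx y hy v, ← hc x hx z hz v, hc z hz y hy v]
    rw [← sub_eq_zero]
    have e3 := e1.trans e2.symm
    rw [← sub_eq_zero] at e3
    rw [← e3]
    module
  apply hlt
  have hsub : S ⊆ ({x, y, z} : Finset (V ≃ₗ[K] V)) := by
    intro w hw
    by_contra hne
    simp only [Finset.coe_insert, Finset.coe_singleton, Set.mem_insert_iff, Set.mem_singleton_iff, not_or] at hne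
    apply hne.2.2
    ext v
    have e1 := hL z hz hxz hyz v
    have e2 := hL w hw (Ne.symm hne.1) (Ne.symm hne.2.1) v
    have e3 := e1.trans e2.symm
    rw [← sub_eq_zero] at e3 ⊢
    have e4 : w v - z v = - (x v + y v + z v + a • v - (x v + y v + w v + a • v)) := by abel
    rw [e4, e3, neg_zero]
  calc S.ncard ≤ (({x, y, z} : Finset (V ≃ₗ[K] V)) : Set (V ≃ₗ[K] V)).ncard := Set.ncard_le_ncard hsub (Set.toFinite _)
    _ = ({x, y, z} : Finset (V ≃ₗ[K] V)).card := Set.ncard_coe_finset _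
    _ ≤ 3 := Finset.card_le_three

theorem CaseII.goal_three (c : CaseII D H Pi r) (hn : D.n = 3) : Goal D H := by
  classical
  haveI := D.fd
  haveI := finite_sub (K := K) (V := V)
  haveI := finite_lequiv (K := K) (V := V)
  have hr3 := c.three
  have her := c.her
  have hH := c.hall
  have hall2 : ∀ t ∈ Pi, 2 ≤ D.e t := fun t ht => by have := c.min t ht; omega
  obtain ⟨V0, -, -, h2⟩ := c.count
  have h3 : 1 ≤ (XX D H Pi r).ncard := (Set.ncard_pos (Set.toFinite _)).mpr c.X_ne
  have hr : r = 3 := by nlinarith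
  subst hr
  obtain ⟨X, hX⟩ := c.X_ne
  obtain ⟨σ, hσ, hXσ, -⟩ := id hX
  rw [hXσ] at hX
  have hmv : mv σ = ⊤ := by
    apply Submodule.eq_top_of_finrank_eq
    rw [hσ.2.1, D.finrank_V, hn]
  obtain ⟨hσH, hσr, s, hs, hs3, hes, hσs⟩ := id hσ
  have hsp := hH.pr s hs
  have h3p := hH.pr 3 c.hr
  -- centralizer acts freely
  have hfree : ∀ g ∈ H, g * σ = σ * g → ∀ u : V, u ≠ 0 → g u = u → g = 1 := by
    intro g hg hgc u hu0 hgu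
    have := free_fix hsp (hH.ne s hs) (hH.le hσH) (hH.le hg) hσs (hσr.trans hes.symm) (hH.p' hg) hgc
      (by rw [hmv]; trivial) hu0 hgu
    ext x
    exact this x (by rw [hmv]; trivial)
  have hperp : ∀ k ∈ H, Module.finrank K (mv k) < 3 → ∃ y : V, y ≠ 0 ∧ k y = y := by
    intro k hk hlt
    have h4 := (hH.ND hk).finrank
    have h5 : D.perp (mv k) ≠ ⊥ := by
      intro h; rw [h, finrank_bot] at h4; omega
    obtain ⟨y, hy, hy0⟩ := Submodule.exists_mem_ne_zero_of_ne_bot h5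
    exact ⟨y, hy0, (mem_perp_mv (hH.le hk)).mp hy⟩
  have hC3 : ∀ g ∈ H, g * σ = σ * g → ¬ 3 ∣ orderOf g := by
    intro g hg hgc h3d
    obtain ⟨m, hm⟩ := h3d
    have ho : orderOf (g ^ m) = 3 := by
      have hm0 : m ≠ 0 := by rintro rfl; have := orderOf_pos g; omega
      rw [orderOf_pow_of_dvd hm0 ⟨3, by rw [hm, mul_comm]⟩, hm, Nat.mul_div_cancel _ (Nat.pos_of_ne_zero hm0)]
    have hgm := H.pow_mem hg m
    have hgm1 : g ^ m ≠ 1 := by intro h; rw [h, orderOf_one] at ho; omega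
    obtain ⟨t, ht, m', h5, h6, h7⟩ := hH.exists_prime hgm hgm1
    have h8 : t ∣ 3 := by rw [← h5, ← ho]; exact orderOf_pow_dvd m'
    have h9 : t = 3 := (Nat.prime_dvd_prime_iff_eq (hH.pr t ht) h3p).mp h8
    subst h9
    have h10 : Module.finrank K (mv ((g ^ m) ^ m')) ≤ 3 := by
      rw [← hn, ← D.finrank_V]; exact Submodule.finrank_le _
    have h11 : D.e 3 = 2 := by omega
    rw [h11] at h6
    have h12 := H.pow_mem hgm m'
    obtain ⟨y, hy0, hy⟩ := hperp _ h12 (by omega)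
    have hcm : (g ^ m) ^ m' * σ = σ * (g ^ m) ^ m' := by
      have : Commute g σ := hgc
      exact ((this.pow_left m).pow_left m')
    have := hfree _ h12 hcm y hy0 hy
    rw [this, orderOf_one] at h5
    omega
  have h3C : ∀ g ∈ H, ¬ 3 ∣ orderOf g → g * σ = σ * g := by
    intro g hg h3d
    have : Subgroup.zpowers g ≤ Subgroup.centralizer {σ} := by
      apply PP
      intro x hx t j ht hxt
      rw [Subgroup.mem_centralizer_singleton_iff]
      have hxH : x ∈ H := (Subgroup.zpowers_le.mpr hg) hx
      by_cases ht3 : t = 3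
      · have h5 : orderOf x ∣ 3 ^ j := by rw [← ht3]; exact orderOf_dvd_of_pow_eq_one hxt
        have h6 : orderOf x ∣ orderOf g := orderOf_dvd_of_mem_zpowers hx
        have h7 : Nat.Coprime (3 ^ j) (orderOf g) := Nat.Coprime.pow_left _ ((Nat.Prime.coprime_iff_not_dvd h3p).mpr h3d)
        have h8 : orderOf x = 1 := Nat.eq_one_of_dvd_coprimes h7 h5 h6
        rw [orderOf_eq_one_iff.mp h8, one_mul, mul_one]
      · exact c.X_cent hσ hX hxH ht ht3 hxt
    exact Subgroup.mem_centralizer_singleton_iff.mp (this (Subgroup.mem_zpowers g))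
  -- conjugates of σ
  set S : Set (V ≃ₗ[K] V) := {x | ∃ a ∈ H, x = a * σ * a⁻¹} with hS
  obtain ⟨ca, cb, cc, hcub⟩ := exists_cub (by rw [D.finrank_V, hn]) σ
  have hSH : ∀ x ∈ S, x ∈ H := by
    rintro x ⟨a, ha, rfl⟩
    exact H.mul_mem (H.mul_mem ha hσH) (H.inv_mem ha)
  have hSs : ∀ x ∈ S, x ^ s = 1 := by
    rintro x ⟨a, ha, rfl⟩
    rw [conj_pow, hσs, mul_one, mul_inv_cancel]
  have hScomm : ∀ x ∈ S, ∀ y ∈ S, x * y = y * x := by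
    intro x hx y hy
    have hxs : x ^ (s ^ 1) = 1 := by rw [pow_one]; exact hSs x hx
    obtain ⟨a, ha, rfl⟩ := hy
    refine c.X_cent (TS_conj hσ ha) ?_ (hSH x hx) hsp hs3 hxs
    rw [mv_conj]
    exact c.X_inv a ha _ hX
  have hScard : S.ncard ≤ 3 := by
    refine cub_card (a := ca) (b := cb) (c := cc) ?_ ?_ ?_
    · rintro x ⟨a, ha, rfl⟩
      exact hcub.conj a
    · intro x hx y hy v
      have := congrArg (fun z : V ≃ₗ[K] V => z v) (hScomm x hx y hy)
      exact this
    · intro x hx y hy hxy v hv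
      by_contra hv0
      apply hxy
      have hσS : σ ∈ S := ⟨1, H.one_mem, by simp⟩
      have e1 : (y⁻¹ * x) v = v := by rw [LinearEquiv.mul_apply, hv, inv_apply_self']
      have c1 : Commute x σ := hScomm x hx σ hσS
      have c2 : Commute y σ := hScomm y hy σ hσS
      have := hfree _ (H.mul_mem (H.inv_mem (hSH y hy)) (hSH x hx)) (c2.inv_left.mul_left c1) v hv0 e1
      exact (inv_mul_eq_one.mp this).symm
  have hθ : ∀ a b : V ≃ₗ[K] V, a * σ * a⁻¹ = b * σ * b⁻¹ → (a⁻¹ * b) * σ = σ * (a⁻¹ * b) := by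
    intro a b hab
    have : b * σ = a * σ * a⁻¹ * b := by rw [hab]; group
    rw [mul_assoc, this]; group
  -- isotropic vector
  obtain ⟨v, -, vv, -, hv, -, hvl⟩ := exists_iso_pair (D := D) (U := ⊤) D.ND_top (by rw [finrank_top, D.finrank_V]; omega)
  have hv0 : v ≠ 0 := hvl.ne_zero 0
  have hq4 : 4 ≤ D.q := by
    have h2 := D.two_le_q
    have he3 := hall2 3 c.hr
    have h32 : D.q ≠ 2 := by
      intro h
      have := (e_eq_one_iff (D := D) h3p (hH.ne 3 c.hr)).mpr (by rw [h])
      omega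
    have h33 : D.q ≠ 3 := by
      intro h
      have h5 : D.p ∣ 3 := by
        rw [← h, D.hq]; exact dvd_pow_self _ (by have := D.hf; omega)
      exact hH.ne 3 c.hr ((Nat.prime_dvd_prime_iff_eq D.hp h3p).mp h5).symm
    omega
  obtain ⟨a0, ha0, ha02⟩ := D.exists_skew
  obtain ⟨x, hx, hxv⟩ := exists_tv hv ha02
  have hEC : ∀ e ∈ H, x * e * x⁻¹ ∈ H → e * σ = σ * e → e = 1 := by
    intro e he hxe hec
    have ho : orderOf (x * e * x⁻¹) = orderOf e := (MulAut.conj x).orderOf_eq e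
    have hxc := h3C _ hxe (by rw [ho]; exact hC3 e he hec)
    have hkc : (e⁻¹ * (x * e * x⁻¹)) * σ = σ * (e⁻¹ * (x * e * x⁻¹)) := by
      have c1 : Commute e σ := hec
      have c2 : Commute (x * e * x⁻¹) σ := hxc
      exact c1.inv_left.mul_left c2
    rcases tv_dich hH hv hv0 ha0 hxv he hxe with ⟨d, hd, hd1⟩ | ⟨h5, -⟩
    · have := eig_one hH hall2 he hv0 hd hd1
      rw [this, one_smul] at hd
      exact hfree e he hec v hv0 hd
    · have hk := H.mul_mem (H.inv_mem he) hxe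
      obtain ⟨y, hy0, hy⟩ := hperp _ hk (by omega)
      have := hfree _ hk hkc y hy0 hy
      rw [this, mv_one, finrank_bot] at h5
      omega
  refine final_B hH hx ?_ ?_
  · have h5 := card_le_of_fib (A := H ⊓ cj H x) (B := ⊥) bot_le (T := S) (Set.toFinite _) (fun a => a * σ * a⁻¹)
      (fun a ha => ⟨a, ha.1, rfl⟩) (fun a ha a' ha' hh => by
        have hm := (H ⊓ cj H x).mul_mem ((H ⊓ cj H x).inv_mem ha) ha'
        rw [Subgroup.mem_bot]
        exact hEC _ hm.1 hm.2 (hθ _ _ hh))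
    rw [Subgroup.card_bot, mul_one] at h5
    have h6 : 0 < Nat.card (H ⊓ cj H x ⊓ scal K V : Subgroup (V ≃ₗ[K] V)) := Nat.card_pos
    omega
  · intro h hh hs
    refine D.frame_b.kill hH (by rw [Fintype.card_fin]; omega) hq4 ?_ hh hs
    intro k1 hk1 k2 hk2 k3 hk3 hr2 he2 he3 _
    obtain ⟨y, hy0, hy⟩ := hperp k1 hk1 (by omega)
    have hy2 : k2 y = y := by
      rw [← mem_perp_mv (hH.le hk2), he2, mem_perp_mv (hH.le hk1)]; exact hy
    have hy3 : k3 y = y := by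
      rw [← mem_perp_mv (hH.le hk3), he3, mem_perp_mv (hH.le hk1)]; exact hy
    have hne : ∀ k : V ≃ₗ[K] V, mv k = mv k1 → k ≠ 1 := by
      rintro k h1 rfl
      rw [← h1, mv_one, finrank_bot] at hr2
      omega
    have n1 := hne k1 rfl
    have n2 := hne k2 he2
    have n3 := hne k3 he3
    by_contra hall
    push Not at hall
    obtain ⟨h12, h13, h23⟩ := hall
    have hcard : ({1, k1, k2, k3} : Finset (V ≃ₗ[K] V)).card = 4 := by
      rw [Finset.card_insert_of_notMem, Finset.card_insert_of_notMem, Finset.card_insert_of_notMem, Finset.card_singleton]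
      · simpa using h23
      · simpa using ⟨h12, h13⟩
      · simpa using ⟨n1.symm, n2.symm, n3.symm⟩
    have hmem : ∀ k ∈ ({1, k1, k2, k3} : Finset (V ≃ₗ[K] V)), k ∈ H ∧ k y = y := by
      intro k hk
      simp only [Finset.mem_insert, Finset.mem_singleton] at hk
      rcases hk with rfl | rfl | rfl | rfl
      · exact ⟨H.one_mem, rfl⟩
      · exact ⟨hk1, hy⟩
      · exact ⟨hk2, hy2⟩
      · exact ⟨hk3, hy3⟩
    have h7 := Set.ncard_le_ncard_of_injOn (s := (({1, k1, k2, k3} : Finset (V ≃ₗ[K] V)) : Set (V ≃ₗ[K] V))) (t := S)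
      (fun a => a * σ * a⁻¹) (fun a ha => ⟨a, (hmem a ha).1, rfl⟩) (by
        intro a ha b hb hab
        have hma := hmem a ha
        have hmb := hmem b hb
        have hfx : (a⁻¹ * b) y = y := by
          rw [LinearEquiv.mul_apply, hmb.2]
          conv_lhs => rw [← hma.2]
          exact inv_apply_self' _ _
        exact inv_mul_eq_one.mp (hfree _ (H.mul_mem (H.inv_mem hma.1) hmb.1) (hθ _ _ hab) y hy0 hfx)) (Set.toFinite _)
    rw [Set.ncard_coe_finset, hcard] at h7
    omega

end c23
end UData

namespace UData
section mono
variable {K V : Type} [Field K] [Finite K] [AddCommGroup V] [Module K V] [Finite V] {D : UData K V}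
  {g h : V ≃ₗ[K] V} {U W : Submodule K V} {H : Subgroup (V ≃ₗ[K] V)} {Pi : Set ℕ} {r : ℕ}

theorem CaseI.q_ge (c : CaseI D H Pi r) (he : D.e r = 1) : 4 ≤ D.q := by
  haveI := finite_lequiv (K := K) (V := V)
  haveI := D.fd
  have hH := c.hall
  have h2 := D.two_le_q
  have hrp := hH.pr r c.hr
  have hr3 := hH.three_le c.hr
  have hd := (e_eq_one_iff (D := D) hrp (hH.ne r c.hr)).mp he
  have h33 : D.q ≠ 3 := by
    intro h
    rw [h] at hd
    have : r ∣ 2 ^ 2 := hd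
    have := (Nat.prime_dvd_prime_iff_eq hrp Nat.prime_two).mp (hrp.dvd_of_dvd_pow this)
    omega
  have h32 : D.q ≠ 2 := by
    intro h
    rw [h] at hd
    have hr : r = 3 := (Nat.prime_dvd_prime_iff_eq hrp Nat.prime_three).mp hd
    obtain ⟨t, ht, ht3⟩ : ∃ t ∈ Pi, t ≠ 3 := by
      obtain ⟨t, ht, s, hs, hts⟩ := hH.two
      by_cases h3 : t = 3
      · exact ⟨s, hs, fun h4 => hts (h3.trans h4.symm)⟩
      · exact ⟨t, ht, h3⟩
    have htp := hH.pr t ht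
    haveI : Fact t.Prime := ⟨htp⟩
    have ht3' := hH.three_le ht
    obtain ⟨⟨g0, hg0⟩, ho⟩ := exists_prime_orderOf_dvd_card' t (hH.dvd t ht)
    rw [Subgroup.orderOf_mk] at ho
    have hpg : IsPGroup t (Subgroup.zpowers g0) := by
      apply IsPGroup.of_card (n := 1)
      rw [Nat.card_zpowers, ho, pow_one]
    obtain ⟨y, hy, hyc⟩ := hH.conj t ht (Subgroup.zpowers g0) (Subgroup.zpowers_le.mpr hg0) hpg
    have hgH := hyc g0 (Subgroup.mem_zpowers g0)
    have ho' : orderOf (y * g0 * y⁻¹) = t := by rw [← ho]; exact (MulAut.conj y).orderOf_eq g0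
    set g := y * g0 * y⁻¹ with hg
    have hg1 : g ≠ 1 := by intro h; rw [h, orderOf_one] at ho'; omega
    have hgt : g ^ t = 1 := by rw [← ho']; exact pow_orderOf_eq_one g
    have hmoved : ∃ Y ∈ mv '' TT D H r, ¬ Stb g Y := by
      by_contra hall
      push Not at hall
      obtain ⟨Y, hY, hYf⟩ := c.exists_full hgH hg1 hall
      obtain ⟨u, hu, hu1⟩ := exists_norm_one (c.nd Y hY) (c.ne Y hY)
      have hu0 : u ≠ 0 := by rintro rfl; rw [map_zero] at hu1; exact zero_ne_one hu1
      have hgu : g u ∈ Y := (hall Y hY).mem hu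
      have hdim := c.dim Y hY
      rw [he] at hdim
      obtain ⟨d, hd'⟩ := (finrank_eq_one_iff_of_nonzero' (⟨u, hu⟩ : Y) (by simpa using hu0)).mp hdim ⟨g u, hgu⟩
      have hgd : g u = d • u := (congrArg Subtype.val hd').symm
      have hn1 : d * D.φ d = 1 := by
        have := D.GU_apply (hH.le hgH) u u
        rw [hgd, D.B_smul_left, map_smul, hu1, smul_eq_mul, mul_one] at this
        rw [mul_comm]; exact this
      have h3 : d ^ 3 = 1 := by
        rw [D.hφ, h] at hn1
        rw [← hn1]; ring
      have hp : ∀ m : ℕ, (g ^ m) u = d ^ m • u := by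
        intro m
        induction m with
        | zero => simp
        | succ m ih => rw [pow_succ, LinearEquiv.mul_apply, hgd, map_smul, ih, smul_smul, pow_succ, mul_comm]
      have ht1 : d ^ t = 1 := by
        have := hp t
        rw [hgt] at this
        have h2 : (d ^ t - 1) • u = 0 := by
          rw [sub_smul, ← this, one_smul]; exact sub_self u
        exact sub_eq_zero.mp ((smul_eq_zero.mp h2).resolve_right hu0)
      have hd1 : d = 1 := by
        have hc : Nat.Coprime t 3 := (Nat.coprime_primes htp Nat.prime_three).mpr ht3
        exact orderOf_eq_one_iff.mp
          (Nat.eq_one_of_dvd_coprimes hc (orderOf_dvd_of_pow_eq_one ht1) (orderOf_dvd_of_pow_eq_one h3))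
      rw [hd1, one_smul] at hgd
      have hfix := c.fix hgH hY (hall Y hY) hu hu0 hgd
      have := mvo_eq_bot.mpr hfix
      rw [hYf] at this
      exact c.ne Y hY this
    obtain ⟨Y, hY, hYs⟩ := hmoved
    have hle := c.le_of_moved hgH htp (j := 1) (by rw [pow_one]; exact hgt) hY hYs
    exact c.unique c.hr ht (by omega) hle
  omega

structure Mono (D : UData K V) (H : Subgroup (V ≃ₗ[K] V)) (Pi : Set ℕ) {ι : Type} [Fintype ι] (f : ι → V) : Prop where
  frame : Frame D f
  hall : HallData D H Pi
  card : Fintype.card ι = D.n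
  q4 : 4 ≤ D.q
  mono : ∀ g ∈ H, ∀ i, ∃ j, ∃ c : K, g (f i) = c • f j
  color : ∃ S : Set ι, ∀ g ∈ H, (∀ i j, ∀ c : K, g (f i) = c • f j → (j ∈ S ↔ i ∈ S)) → ∀ i, ∃ c : K, g (f i) = c • f i

theorem CaseI.exists_mono (c : CaseI D H Pi r) (he : D.e r = 1) :
    ∃ (ι : Type) (_ : Fintype ι) (f : ι → V), Mono D H Pi f := by
  classical
  haveI := finite_sub (K := K) (V := V)
  haveI := D.fd
  haveI : Fintype (mv '' TT D H r) := Fintype.ofFinite _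
  have hex : ∀ Y : (mv '' TT D H r), ∃ u ∈ Y.1, D.B u u = 1 := fun Y => exists_norm_one (c.nd Y.1 Y.2) (c.ne Y.1 Y.2)
  choose f hf hf1 using hex
  have hf0 : ∀ Y, f Y ≠ 0 := by
    intro Y h0
    have := hf1 Y
    rw [h0, map_zero] at this
    exact zero_ne_one this
  have hline : ∀ Y : (mv '' TT D H r), ∀ x ∈ Y.1, ∃ d : K, x = d • f Y := by
    intro Y x hx
    have hdim := c.dim Y.1 Y.2
    rw [he] at hdim
    have h0 : (⟨f Y, hf Y⟩ : Y.1) ≠ 0 := by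
      intro h0; exact hf0 Y (congrArg Subtype.val h0)
    obtain ⟨d, hd⟩ := (finrank_eq_one_iff_of_nonzero' (⟨f Y, hf Y⟩ : Y.1) h0).mp hdim ⟨x, hx⟩
    exact ⟨d, (congrArg Subtype.val hd).symm⟩
  have horth : ∀ i j, i ≠ j → D.B (f i) (f j) = 0 := by
    intro i j hij
    have := c.orth j.1 j.2 i.1 i.2 (fun h => hij (Subtype.ext h.symm)) (hf j)
    exact this (f i) (hf i)
  have hcard : Fintype.card (mv '' TT D H r) = D.n := by
    rw [← Nat.card_eq_fintype_card, Nat.card_coe_set_eq, c.card, he, Nat.div_one]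
  have hcoef : ∀ (a : (mv '' TT D H r) → K) (i : (mv '' TT D H r)), D.B (f i) (∑ j, a j • f j) = a i := by
    intro a i
    rw [map_sum, Finset.sum_eq_single_of_mem i (Finset.mem_univ i)]
    · rw [map_smul, hf1, smul_eq_mul, mul_one]
    · intro j _ hj
      rw [map_smul, horth i j (Ne.symm hj), smul_zero]
  have hli : LinearIndependent K f := by
    rw [Fintype.linearIndependent_iff]
    intro a ha i
    rw [← hcoef a i, ha, map_zero]
  have hspan : ⊤ ≤ Submodule.span K (Set.range f) := by
    apply le_of_eq
    symm
    exact hli.span_eq_top_of_card_eq_finrank' (by rw [hcard, D.finrank_V])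
  refine ⟨(mv '' TT D H r), inferInstance, f, ⟨hf1, horth, ?_⟩, c.hall, hcard, c.q_ge he, ?_, ?_⟩
  · intro y
    obtain ⟨a, ha⟩ := (Submodule.mem_span_range_iff_exists_fun K).mp (hspan (Submodule.mem_top (x := y)))
    rw [← ha]
    simp only [hcoef]
  · intro g hg i
    obtain ⟨d, hd⟩ := hline ⟨_, c.inv g hg i.1 i.2⟩ (g (f i)) (Submodule.mem_map_of_mem (hf i))
    exact ⟨_, d, hd⟩
  · obtain ⟨S, -, hS⟩ := c.color
    refine ⟨{i | i.1 ∈ S}, fun g hg hgi i => ?_⟩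
    have hst := hS g hg (by
      intro Y hY
      obtain ⟨d, hd⟩ := hline ⟨_, c.inv g hg Y hY⟩ (g (f ⟨Y, hY⟩)) (Submodule.mem_map_of_mem (hf ⟨Y, hY⟩))
      exact hgi ⟨Y, hY⟩ _ d hd) i.1 i.2
    exact hline i _ (hst.mem (hf i))

namespace Mono
variable {ι : Type} [Fintype ι] {f : ι → V}

/-- the monomial action -/
theorem act (M : Mono D H Pi f) (hg : g ∈ H) : ∃ (τ : ι → ι) (x : ι → K), (∀ i, g (f i) = x i • f (τ i)) ∧
    (∀ i, x i * D.φ (x i) = 1) ∧ Function.Injective τ := by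
  have h := M.mono g hg
  choose τ x hx using h
  have hn : ∀ i, x i * D.φ (x i) = 1 := by
    intro i
    have := D.GU_apply (M.hall.le hg) (f i) (f i)
    rw [hx, D.B_smul_left, map_smul, M.frame.one, M.frame.one, smul_eq_mul, mul_one] at this
    rw [mul_comm]; exact this
  refine ⟨τ, x, hx, hn, ?_⟩
  intro i j hij
  by_contra hne
  have := D.GU_apply (M.hall.le hg) (f i) (f j)
  rw [hx, hx, ← hij, D.B_smul_left, map_smul, M.frame.one, M.frame.orth i j hne, smul_eq_mul, mul_one] at this
  rcases mul_eq_zero.mp this with h0 | h0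
  · have := hn i
    rw [h0, mul_zero] at this
    exact zero_ne_one this
  · have := hn j
    rw [h0, zero_mul] at this
    exact zero_ne_one this

theorem uniq (M : Mono D H Pi f) {i j : ι} {c d : K} (hd : d ≠ 0) (h : c • f i = d • f j) : i = j := by
  by_contra hne
  have := congrArg (D.B (f j)) h
  rw [map_smul, map_smul, M.frame.one, M.frame.orth j i (Ne.symm hne), smul_zero, smul_eq_mul, mul_one] at this
  exact hd this.symm

theorem coord (M : Mono D H Pi f) (hg : g ∈ H) {i j : ι} {c : K} (hc : g (f i) = c • f j) (y : V) :
    D.B (f j) (g y) = c * D.B (f i) y := by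
  have h1 : c * D.φ c = 1 := by
    have := D.GU_apply (M.hall.le hg) (f i) (f i)
    rw [hc, D.B_smul_left, map_smul, M.frame.one, M.frame.one, smul_eq_mul, mul_one] at this
    rw [mul_comm]; exact this
  have := D.GU_apply (M.hall.le hg) (f i) y
  rw [hc, D.B_smul_left] at this
  rw [← this, ← mul_assoc, h1, one_mul]

theorem step (M : Mono D H Pi f) (hg : g ∈ H) {i j : ι} {c d : K} (hij : i ≠ j) (hc : g (f i) = c • f j)
    (hd : g (f j) = d • f i) : False := by
  haveI := finite_lequiv (K := K) (V := V)
  have hodd : ¬ 2 ∣ orderOf g := fun h2 => M.hall.odd 2 (M.hall.orderOf_pi hg Nat.prime_two h2) rfl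
  obtain ⟨m, hm⟩ : ∃ m, orderOf g = 2 * m + 1 := ⟨orderOf g / 2, by omega⟩
  have hp : ∀ m : ℕ, ∃ b : K, (g ^ (2 * m)) (f i) = b • f i := by
    intro m
    induction m with
    | zero => exact ⟨1, by simp⟩
    | succ m ih =>
      obtain ⟨b, hb⟩ := ih
      refine ⟨c * (d * b), ?_⟩
      rw [show 2 * (m + 1) = 2 * m + 1 + 1 by ring, pow_succ, pow_succ, LinearEquiv.mul_apply, LinearEquiv.mul_apply, hc,
        map_smul, hd, map_smul, map_smul, hb, smul_smul, smul_smul, mul_assoc]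
  obtain ⟨b, hb⟩ := hp m
  have h1 : (g ^ (2 * m + 1)) (f i) = f i := by rw [← hm, pow_orderOf_eq_one]; rfl
  rw [pow_succ', LinearEquiv.mul_apply, hb, map_smul, hc, smul_smul] at h1
  exact hij (M.uniq (c := b * c) (d := 1) one_ne_zero (by rw [h1, one_smul])).symm

theorem top_of (M : Mono D H Pi f) (h : ∀ i, f i ∈ U) : U = ⊤ := by
  rw [eq_top_iff]
  intro y _
  rw [M.frame.span y]
  exact Submodule.sum_mem _ (fun i _ => Submodule.smul_mem _ _ (h i))

/-- a diagonal element of rank two has a fixed frame vector -/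
theorem diag_fix (M : Mono D H Pi f) (h2 : Module.finrank K (mv g) = 2) (hd : ∀ i, ∃ c : K, g (f i) = c • f i) :
    ∃ m, g (f m) = f m := by
  by_contra hne
  push Not at hne
  have : mv g = ⊤ := by
    apply M.top_of
    intro i
    obtain ⟨c, hc⟩ := hd i
    have h1 := sub_mem_mv g (f i)
    have hc1 : c - 1 ≠ 0 := by
      intro h; apply hne i
      rw [hc, sub_eq_zero.mp h, one_smul]
    have h3 : g (f i) - f i = (c - 1) • f i := by rw [hc, sub_smul, one_smul]
    rw [h3] at h1
    exact (Submodule.smul_mem_iff _ hc1).mp h1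
  rw [this, finrank_top, D.finrank_V] at h2
  have := M.hall.hn
  omega

theorem not_full (M : Mono D H Pi f) (hg : g ∈ H) {v : V} (hv : v ∈ mv g) (hfull : ∀ i, D.B (f i) v ≠ 0) {m : ι} (hm : g (f m) = f m) :
    False := by
  have h1 : f m ∈ D.perp (mv g) := (mem_perp_mv (M.hall.le hg)).mpr hm
  exact hfull m (D.B_symm_zero (h1 v hv))

theorem rank_fix (M : Mono D H Pi f) (h4 : 4 ≤ D.n) (hg : g ∈ H) (h2 : Module.finrank K (mv g) = 2) :
    ∃ m, g (f m) = f m := by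
  classical
  haveI := D.fd
  by_cases hd : ∀ i, ∃ c : K, g (f i) = c • f i
  · exact M.diag_fix h2 hd
  push Not at hd
  obtain ⟨i, hi⟩ := hd
  obtain ⟨τ, x, hx, hn, hinj⟩ := M.act hg
  have hx0 : ∀ i, x i ≠ 0 := by
    intro i h0; have := hn i; rw [h0, zero_mul] at this; exact zero_ne_one this
  have hij : τ i ≠ i := by intro h; apply hi (x i); rw [hx, h]
  have hjl : τ (τ i) ≠ τ i := fun h => hij (hinj h)
  have hil : τ (τ i) ≠ i := by
    intro h
    refine M.step hg (Ne.symm hij) (hx i) (d := x (τ i)) ?_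
    rw [hx, h]
  obtain ⟨m, hm⟩ : ∃ m, m ∉ ({i, τ i, τ (τ i)} : Finset ι) := by
    by_contra hall
    push Not at hall
    have : Fintype.card ι ≤ ({i, τ i, τ (τ i)} : Finset ι).card := Finset.card_le_card (fun a _ => hall a)
    have h3 : ({i, τ i, τ (τ i)} : Finset ι).card ≤ 3 := Finset.card_le_three
    rw [M.card] at this
    omega
  simp only [Finset.mem_insert, Finset.mem_singleton, not_or] at hm
  obtain ⟨m1, m2, m3⟩ := hm
  refine ⟨m, ?_⟩
  by_contra hmf
  have hli : LinearIndependent K ![g (f i) - f i, g (f (τ i)) - f (τ i), g (f m) - f m] := by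
    rw [Fintype.linearIndependent_iff]
    intro s hs
    rw [Fin.sum_univ_three] at hs
    replace hs : s 0 • (g (f i) - f i) + s 1 • (g (f (τ i)) - f (τ i)) + s 2 • (g (f m) - f m) = 0 := hs
    have e3 : s 2 = 0 := by
      have := congrArg (D.B (f m)) hs
      simp only [map_add, map_sub, map_smul, map_zero, hx, M.frame.orth m (τ i) m2, M.frame.orth m i m1,
        M.frame.orth m (τ (τ i)) m3, smul_zero, sub_zero, zero_add, smul_eq_mul, mul_zero, M.frame.one] at this
      by_cases hmm : τ m = m
      · rw [hmm, M.frame.one] at this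
        rcases mul_eq_zero.mp this with h | h
        · exact h
        · exfalso; apply hmf
          rw [hx, hmm, show x m = 1 by linear_combination h, one_smul]
      · rw [M.frame.orth m (τ m) (Ne.symm hmm)] at this
        simpa using this
    rw [e3, zero_smul, add_zero] at hs
    have e1 : s 0 = 0 := by
      have := congrArg (D.B (f i)) hs
      simp only [map_add, map_sub, map_smul, map_zero, hx, M.frame.orth i (τ i) (Ne.symm hij),
        M.frame.orth i (τ (τ i)) (Ne.symm hil), smul_zero, sub_zero, zero_sub, add_zero, smul_eq_mul, M.frame.one] at this
      simpa using this
    have e2 : s 1 = 0 := by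
      rw [e1, zero_smul, zero_add] at hs
      have := congrArg (D.B (f (τ i))) hs
      simp only [map_add, map_sub, map_smul, map_zero, hx, M.frame.orth (τ i) (τ (τ i)) (Ne.symm hjl),
        smul_zero, sub_zero, zero_sub, add_zero, smul_eq_mul, M.frame.one] at this
      simpa using this
    intro k
    fin_cases k
    · exact e1
    · exact e2
    · exact e3
  have h5 := finrank_span_eq_card hli
  have h6 : Submodule.span K (Set.range ![g (f i) - f i, g (f (τ i)) - f (τ i), g (f m) - f m]) ≤ mv g := by
    rw [Submodule.span_le]
    rintro _ ⟨k, rfl⟩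
    fin_cases k
    · exact sub_mem_mv g _
    · exact sub_mem_mv g _
    · exact sub_mem_mv g _
  have h7 := Submodule.finrank_mono h6
  rw [h5, h2, Fintype.card_fin] at h7
  omega

theorem scalar_of (M : Mono D H Pi f) {c : K} (h : ∀ i, g (f i) = c • f i) (y : V) : g y = c • y := by
  conv_lhs => rw [M.frame.span y]
  conv_rhs => rw [M.frame.span y]
  rw [map_sum, Finset.smul_sum]
  apply Finset.sum_congr rfl
  intro i _
  rw [map_smul, h, smul_comm]

theorem goal_four (M : Mono D H Pi f) (h4 : 4 ≤ D.n) : Goal D H := by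
  classical
  have hcard := M.card
  obtain ⟨a, ha0, ha⟩ := D.exists_full_coef (ι := ι) (by omega) M.q4
  obtain ⟨η, hη, hη2⟩ : ∃ η : K, η * D.φ η = 1 ∧ η ^ 2 ≠ 1 := by
    obtain ⟨b, d, hb, hd, hb1, hd1, hbd⟩ := D.norm_three
    by_contra hall
    push Not at hall
    have key : ∀ y : K, y ≠ 1 → y ^ 2 = 1 → y = -1 := by
      intro y hy hy2
      have : (y - 1) * (y + 1) = 0 := by linear_combination hy2
      have := (mul_eq_zero.mp this).resolve_left (sub_ne_zero.mpr hy)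
      linear_combination this
    exact hbd ((key b hb1 (hall b hb)).trans (key d hd1 (hall d hd)).symm)
  obtain ⟨S, hS⟩ := M.color
  set δ : ι → K := fun i => if i ∈ S then η else 1 with hδ
  have hδn : ∀ i, δ i * D.φ (δ i) = 1 := by
    intro i; simp only [hδ]; split_ifs
    · exact hη
    · rw [map_one, one_mul]
  have hδ0 : ∀ i, δ i ≠ 0 := by
    intro i h0; have := hδn i; rw [h0, zero_mul] at this; exact zero_ne_one this
  have hfull : ∀ b : ι → K, (∀ i, b i ≠ 0) → ∀ i, D.B (f i) (∑ j, b j • f j) ≠ 0 := by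
    intro b hb i; rw [M.frame.coef]; exact hb i
  have hb0 : ∀ i, δ i * a i ≠ 0 := fun i => mul_ne_zero (hδ0 i) (ha0 i)
  have hbn : ∑ i, (δ i * a i) * D.φ (δ i * a i) = 0 := by
    rw [← ha]
    apply Finset.sum_congr rfl
    intro i _
    rw [map_mul]
    linear_combination (a i * D.φ (a i)) * hδn i
  have hι : Nonempty ι := Fintype.card_pos_iff.mp (by omega)
  obtain ⟨i0⟩ := hι
  set v1 := ∑ j, a j • f j with hv1
  set v2 := ∑ j, (δ j * a j) • f j with hv2
  have hf1 := hfull a ha0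
  have hf2 := hfull _ hb0
  have hv : ∀ i : Fin 3, (∀ j, D.B (f j) ((![v1, v2, v1] : Fin 3 → V) i) ≠ 0) ∧
      D.B ((![v1, v2, v1] : Fin 3 → V) i) ((![v1, v2, v1] : Fin 3 → V) i) = 0 := by
    intro i
    fin_cases i
    · exact ⟨hf1, (M.frame.norm a).trans ha⟩
    · exact ⟨hf2, (M.frame.norm _).trans hbn⟩
    · exact ⟨hf1, (M.frame.norm a).trans ha⟩
  refine final_A M.hall (v := ![v1, v2, v1]) ?_ (fun i => (hv i).2) ?_ ?_
  · intro i h0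
    apply (hv i).1 i0
    rw [h0, map_zero]
  · intro k hk h2 i hi
    obtain ⟨m, hm⟩ := M.rank_fix h4 hk h2
    exact M.not_full hk hi (hv i).1 hm
  · intro h hh hall
    obtain ⟨c, hc, hcn⟩ := hall 0
    obtain ⟨d, hd, hdn⟩ := hall 1
    replace hc : h v1 = c • v1 := hc
    replace hd : h v2 = d • v2 := hd
    have hc0 : c ≠ 0 := by intro h0; rw [h0, zero_mul] at hcn; exact zero_ne_one hcn
    have hd0 : d ≠ 0 := by intro h0; rw [h0, zero_mul] at hdn; exact zero_ne_one hdn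
    obtain ⟨τ, x, hx, hn, hinj⟩ := M.act hh
    have E1 : ∀ i, c * a (τ i) = x i * a i := by
      intro i
      have := M.coord hh (hx i) v1
      rw [hc, map_smul, smul_eq_mul, hv1, M.frame.coef, M.frame.coef] at this
      exact this
    have E2 : ∀ i, d * (δ (τ i) * a (τ i)) = x i * (δ i * a i) := by
      intro i
      have := M.coord hh (hx i) v2
      rw [hd, map_smul, smul_eq_mul, hv2, M.frame.coef, M.frame.coef] at this
      exact this
    have E3 : ∀ i, d * δ (τ i) = c * δ i := by
      intro i
      apply mul_right_cancel₀ (ha0 (τ i))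
      linear_combination E2 i - δ i * E1 i
    have hcd : c = d := by
      by_contra hcd
      have hne : ∀ i, δ (τ i) ≠ δ i := by
        intro i hi
        have := E3 i
        rw [hi] at this
        exact hcd (mul_right_cancel₀ (hδ0 i) this).symm
      have hval : ∀ i, δ i = η ∨ δ i = 1 := by
        intro i; simp only [hδ]; split_ifs
        · exact Or.inl rfl
        · exact Or.inr rfl
      have n1 := hne i0
      have n2 := hne (τ i0)
      have hE1 := E3 i0
      have hE2 := E3 (τ i0)
      have key : ∀ A B C : K, A ≠ B → C ≠ B → (A = η ∨ A = 1) → (B = η ∨ B = 1) → (C = η ∨ C = 1) → d * B = c * A → d * C = c * B → False := by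
        intro A B C hAB hCB hA hB hC e1 e2
        have hCA : C = A := by
          rcases hA with rfl | rfl <;> rcases hB with rfl | rfl <;> rcases hC with rfl | rfl <;> tauto
        subst hCA
        have hsq : C ^ 2 = B ^ 2 := by
          apply mul_left_cancel₀ (mul_ne_zero hc0 hd0)
          linear_combination (c * C) * e2 - (c * B) * e1
        rcases hA with rfl | rfl <;> rcases hB with rfl | rfl
        · exact hAB rfl
        · apply hη2; rw [hsq, one_pow]
        · apply hη2; rw [← hsq, one_pow]
        · exact hAB rfl
      exact key _ _ _ n1.symm n2 (hval _) (hval _) (hval _) hE1 hE2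
    subst hcd
    have hη1 : η ≠ 1 := by rintro rfl; exact hη2 (one_pow 2)
    have hdiag := hS h hh (by
      intro i j b hb
      have hjt : j = τ i := by
        refine M.uniq (c := b) (d := x i) ?_ (by rw [← hb, hx])
        intro h0; have := hn i; rw [h0, zero_mul] at this; exact zero_ne_one this
      have h5 := mul_left_cancel₀ hc0 (E3 i)
      rw [← hjt] at h5
      simp only [hδ] at h5
      by_cases hi : i ∈ S <;> by_cases hj : j ∈ S
      · exact ⟨fun _ => hi, fun _ => hj⟩
      · rw [if_pos hi, if_neg hj] at h5; exact absurd h5.symm hη1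
      · rw [if_neg hi, if_pos hj] at h5; exact absurd h5 hη1
      · exact ⟨fun h => absurd h hj, fun h => absurd h hi⟩)
    refine ⟨c, M.scalar_of (fun i => ?_)⟩
    obtain ⟨b, hb⟩ := hdiag i
    have h6 := M.coord hh hb v1
    rw [hc, map_smul, smul_eq_mul] at h6
    rw [hb, mul_right_cancel₀ (hf1 i) h6]

end Mono
end mono
end UData

namespace UData
section mono3
variable {K V : Type} [Field K] [Finite K] [AddCommGroup V] [Module K V] [Finite V] {D : UData K V}
  {g h : V ≃ₗ[K] V} {U W : Submodule K V} {H : Subgroup (V ≃ₗ[K] V)} {Pi : Set ℕ} {r : ℕ}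

/-- the diagonal group of a family of vectors -/
def dg {ι : Type} (f : ι → V) : Subgroup (V ≃ₗ[K] V) where
  carrier := {g | ∀ i, ∃ c : K, g (f i) = c • f i}
  mul_mem' := by
    intro a b ha hb i
    obtain ⟨c, hc⟩ := ha i
    obtain ⟨d, hd⟩ := hb i
    exact ⟨d * c, by rw [LinearEquiv.mul_apply, hd, map_smul, hc, smul_smul]⟩
  one_mem' := fun i => ⟨1, by rw [one_smul]; rfl⟩
  inv_mem' := by
    intro a ha i
    obtain ⟨c, hc⟩ := ha i
    refine ⟨c⁻¹, ?_⟩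
    by_cases hc0 : c = 0
    · have : f i = 0 := by
        apply a.injective
        rw [hc, hc0, zero_smul, map_zero]
      rw [this, map_zero, smul_zero]
    · apply a.injective
      rw [apply_inv_self', map_smul, hc, smul_smul, inv_mul_cancel₀ hc0, one_smul]

theorem mem_dg {ι : Type} {f : ι → V} : g ∈ (dg f : Subgroup (V ≃ₗ[K] V)) ↔ ∀ i, ∃ c : K, g (f i) = c • f i := Iff.rfl

namespace Mono
variable {ι : Type} [Fintype ι] {f : ι → V}

/-- the trace with respect to the frame -/
def tr (D : UData K V) (f : ι → V) (g : V ≃ₗ[K] V) : K := ∑ i, D.B (f i) (g (f i))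

theorem tr_comm (M : Mono D H Pi f) (a b : V ≃ₗ[K] V) : tr D f (a * b) = tr D f (b * a) := by
  have key : ∀ a b : V ≃ₗ[K] V, tr D f (a * b) = ∑ i, ∑ j, D.B (f j) (b (f i)) * D.B (f i) (a (f j)) := by
    intro a b
    unfold tr
    apply Finset.sum_congr rfl
    intro i _
    rw [LinearEquiv.mul_apply]
    conv_lhs => rw [M.frame.span (b (f i))]
    rw [map_sum, map_sum]
    apply Finset.sum_congr rfl
    intro j _
    rw [map_smul, map_smul, smul_eq_mul]
  rw [key, key, Finset.sum_comm]
  apply Finset.sum_congr rfl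
  intro i _
  apply Finset.sum_congr rfl
  intro j _
  rw [mul_comm]

theorem tr_conj (M : Mono D H Pi f) (a b : V ≃ₗ[K] V) : tr D f (a * b * a⁻¹) = tr D f b := by
  rw [M.tr_comm, ← mul_assoc, inv_mul_cancel, one_mul]

/-- a nondiagonal element is a three-cycle -/
theorem cyc3 (M : Mono D H Pi f) (h3 : D.n = 3) (hg : g ∈ H) (hd : g ∉ (dg f : Subgroup (V ≃ₗ[K] V))) {τ : ι → ι} {x : ι → K}
    (hx : ∀ i, g (f i) = x i • f (τ i)) (hinj : Function.Injective τ) :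
    ∀ i, τ i ≠ i ∧ ∀ k, k = i ∨ k = τ i ∨ k = τ (τ i) := by
  classical
  have hcard := M.card
  rw [mem_dg] at hd
  push Not at hd
  obtain ⟨i, hi⟩ := hd
  have hij : τ i ≠ i := by intro h; apply hi (x i); rw [hx, h]
  have hjl : τ (τ i) ≠ τ i := fun h => hij (hinj h)
  have hil : τ (τ i) ≠ i := by
    intro h
    refine M.step hg (Ne.symm hij) (hx i) (d := x (τ i)) ?_
    rw [hx, h]
  have hc3 : ({i, τ i, τ (τ i)} : Finset ι).card = 3 := by
    rw [Finset.card_insert_of_notMem, Finset.card_insert_of_notMem, Finset.card_singleton]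
    · simpa using hjl.symm
    · simpa using ⟨hij.symm, hil.symm⟩
  have huniv : ({i, τ i, τ (τ i)} : Finset ι) = Finset.univ := Finset.eq_univ_of_card _ (by rw [hc3, hcard, h3])
  have hall : ∀ k, k = i ∨ k = τ i ∨ k = τ (τ i) := by
    intro k
    have := Finset.mem_univ k
    rw [← huniv] at this
    simpa using this
  have hli : τ (τ (τ i)) = i := by
    rcases hall (τ (τ (τ i))) with h | h | h
    · exact h
    · exact absurd (hinj h) hil
    · exact absurd (hinj h) hjl
  intro m
  rcases hall m with rfl | rfl | rfl
  · exact ⟨hij, hall⟩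
  · refine ⟨hjl, fun k => ?_⟩
    rw [hli]; have := hall k; tauto
  · refine ⟨by rw [hli]; exact hil.symm, fun k => ?_⟩
    rw [hli]; have := hall k; tauto

theorem tr_zero (M : Mono D H Pi f) (h3 : D.n = 3) (hg : g ∈ H) (hd : g ∉ (dg f : Subgroup (V ≃ₗ[K] V))) : tr D f g = 0 := by
  obtain ⟨τ, x, hx, hn, hinj⟩ := M.act hg
  have hc := M.cyc3 h3 hg hd hx hinj
  unfold tr
  apply Finset.sum_eq_zero
  intro i _
  rw [hx, map_smul, M.frame.orth i (τ i) (hc i).1.symm, smul_zero]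

theorem nondiag (M : Mono D H Pi f) (hg : g ∈ H) (h2 : Module.finrank K (mv g) = 2) {v : V} (hv : v ∈ mv g)
    (hfull : ∀ i, D.B (f i) v ≠ 0) : g ∉ (dg f : Subgroup (V ≃ₗ[K] V)) := by
  intro hd
  obtain ⟨m, hm⟩ := M.diag_fix h2 hd
  exact M.not_full hg hv hfull hm

theorem eq_of_line (M : Mono D H Pi f) (h3 : D.n = 3) {k k' : V ≃ₗ[K] V} (hk : k ∈ H) (hk' : k' ∈ H)
    (h2 : Module.finrank K (mv k) = 2) (he : mv k' = mv k) (hd : k ∉ (dg f : Subgroup (V ≃ₗ[K] V)))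
    {i j : ι} {c d : K} (hc : k (f i) = c • f j) (hd' : k' (f i) = d • f j) : k = k' := by
  haveI := D.fd
  have hm : k⁻¹ * k' ∈ H := H.mul_mem (H.inv_mem hk) hk'
  have hc0 : c ≠ 0 := by
    rintro rfl
    rw [zero_smul] at hc
    exact M.frame.ne_zero i (k.injective (by rw [hc, map_zero]))
  have hmi : (k⁻¹ * k') (f i) = (d * c⁻¹) • f i := by
    rw [LinearEquiv.mul_apply, hd']
    apply k.injective
    rw [apply_inv_self', map_smul, hc, smul_smul, mul_assoc, inv_mul_cancel₀ hc0, mul_one]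
  obtain ⟨τ, x, hx, hn, hinj⟩ := M.act hk
  obtain ⟨ρ, z, hz, hzn, hzinj⟩ := M.act hm
  have hmd : k⁻¹ * k' ∈ (dg f : Subgroup (V ≃ₗ[K] V)) := by
    by_contra hmd
    apply (M.cyc3 h3 hm hmd hz hzinj i).1
    refine (M.uniq (c := d * c⁻¹) (d := z i) ?_ (by rw [← hmi, hz])).symm
    intro h0; have := hzn i; rw [h0, zero_mul] at this; exact zero_ne_one this
  obtain ⟨y, hy0, hy⟩ : ∃ y : V, y ≠ 0 ∧ k y = y := by
    have h4 := (M.hall.ND hk).finrank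
    have h5 : D.perp (mv k) ≠ ⊥ := by
      intro h; rw [h, finrank_bot] at h4; omega
    obtain ⟨y, hy, hy0⟩ := Submodule.exists_mem_ne_zero_of_ne_bot h5
    exact ⟨y, hy0, (mem_perp_mv (M.hall.le hk)).mp hy⟩
  have hy' : k' y = y := by
    rw [← mem_perp_mv (M.hall.le hk'), he, mem_perp_mv (M.hall.le hk)]; exact hy
  have hmy : (k⁻¹ * k') y = y := by
    rw [LinearEquiv.mul_apply, hy']
    conv_lhs => rw [← hy]
    exact inv_apply_self' _ _
  have hprop : ∀ i, D.B (f i) y = 0 → D.B (f (τ i)) y = 0 := by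
    intro i h0
    have := M.coord hk (hx i) y
    rwa [hy, h0, mul_zero] at this
  have hne : ∀ i, D.B (f i) y ≠ 0 := by
    intro i h0
    apply hy0
    apply M.frame.ext
    intro m
    rw [map_zero]
    rcases (M.cyc3 h3 hk hd hx hinj i).2 m with rfl | rfl | rfl
    · exact h0
    · exact hprop _ h0
    · exact hprop _ (hprop _ h0)
  have h1 : k⁻¹ * k' = 1 := by
    ext y'
    have : ∀ i, (k⁻¹ * k') (f i) = (1 : K) • f i := by
      intro i
      obtain ⟨b, hb⟩ := hmd i
      have := M.coord hm hb y
      rw [hmy] at this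
      have hb1 : b = 1 := mul_right_cancel₀ (hne i) (by rw [one_mul]; exact this.symm)
      rw [hb, hb1]
    rw [M.scalar_of this, one_smul]; rfl
  exact inv_mul_eq_one.mp h1

theorem goal_three (M : Mono D H Pi f) (h3 : D.n = 3) : Goal D H := by
  classical
  haveI := finite_lequiv (K := K) (V := V)
  have hcard := M.card
  have hH := M.hall
  obtain ⟨a, ha0, ha⟩ := D.exists_full_coef (ι := ι) (by omega) M.q4
  obtain ⟨a0, ha1, ha2⟩ := D.exists_skew
  set v := ∑ j, a j • f j with hvdef
  have hv : D.B v v = 0 := (M.frame.norm a).trans ha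
  have hfull : ∀ i, D.B (f i) v ≠ 0 := by intro i; rw [hvdef, M.frame.coef]; exact ha0 i
  obtain ⟨x, hx, hxv⟩ := exists_tv hv ha2
  obtain ⟨i0, i1, i2, hi01, hi02, hi12, huniv⟩ := Finset.card_eq_three.mp (show (Finset.univ : Finset ι).card = 3 by
    rw [Finset.card_univ, hcard, h3])
  have hv0 : v ≠ 0 := by intro h0; apply hfull i0; rw [h0, map_zero]
  have hcover : ∀ k, k = i0 ∨ k = i1 ∨ k = i2 := by
    intro k
    have := Finset.mem_univ k
    rw [huniv] at this
    simpa using this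
  have hsum : ∀ F : ι → K, ∑ i, F i = F i0 + (F i1 + F i2) := by
    intro F
    rw [huniv, Finset.sum_insert, Finset.sum_insert, Finset.sum_singleton]
    · simpa using hi12
    · simpa using ⟨hi01, hi02⟩
  -- eigenvalues of diagonal elements
  have hb0 : ∀ h : V ≃ₗ[K] V, ∀ i, ∀ c : K, h (f i) = c • f i → c ≠ 0 := by
    rintro h i c hc rfl
    rw [zero_smul] at hc
    exact M.frame.ne_zero i (h.injective (by rw [hc, map_zero]))
  have htr : ∀ h ∈ H, x * h * x⁻¹ ∈ H → h ∈ (dg f : Subgroup (V ≃ₗ[K] V)) → h ∉ scal K V → tr D f h = 0 := by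
    intro h hh hxh hd hs
    rw [← M.tr_conj x h]
    apply M.tr_zero h3 hxh
    intro hxd
    rcases tv_dich hH hv hv0 ha1 hxv hh hxh with ⟨c, hc, -⟩ | ⟨h5, h6, -⟩
    · apply hs
      refine ⟨c, M.scalar_of (fun i => ?_)⟩
      obtain ⟨b, hb⟩ := hd i
      have := M.coord hh hb v
      rw [hc, map_smul, smul_eq_mul] at this
      rw [hb, mul_right_cancel₀ (hfull i) this]
    · exact M.nondiag (H.mul_mem (H.inv_mem hh) hxh) h5 h6 hfull (Subgroup.mul_mem _ (Subgroup.inv_mem _ hd) hxd)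
  have hclaim : ∀ h ∈ H ⊓ cj H x ⊓ (dg f : Subgroup (V ≃ₗ[K] V)), ∀ c0 c1 c2 : K, h (f i0) = c0 • f i0 → h (f i1) = c1 • f i1 →
      h (f i2) = c2 • f i2 → h ∈ scal K V ∨ (c0 + c1 + c2 = 0 ∧ c0 * c1 + c0 * c2 + c1 * c2 = 0) := by
    intro h hh c0 c1 c2 e0 e1 e2
    by_cases hs : h ∈ scal K V
    · exact Or.inl hs
    right
    have t1 := htr h hh.1.1 hh.1.2 hh.2 hs
    have hi := Subgroup.inv_mem _ hh
    have t2 := htr h⁻¹ hi.1.1 hi.1.2 hi.2 (fun hc => hs (by have := (scal K V).inv_mem hc; rwa [inv_inv] at this))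
    have n0 := hb0 h i0 c0 e0
    have n1 := hb0 h i1 c1 e1
    have n2 := hb0 h i2 c2 e2
    have hinv : ∀ i, ∀ c : K, c ≠ 0 → h (f i) = c • f i → (h⁻¹ : V ≃ₗ[K] V) (f i) = c⁻¹ • f i := by
      intro i c hc e
      apply h.injective
      rw [apply_inv_self', map_smul, e, smul_smul, inv_mul_cancel₀ hc, one_smul]
    unfold tr at t1 t2
    rw [hsum, e0, e1, e2] at t1
    rw [hsum, hinv i0 c0 n0 e0, hinv i1 c1 n1 e1, hinv i2 c2 n2 e2] at t2
    simp only [map_smul, M.frame.one, smul_eq_mul, mul_one] at t1 t2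
    refine ⟨by linear_combination t1, ?_⟩
    field_simp at t2
    linear_combination t2
  have hsc : ∀ h : V ≃ₗ[K] V, ∀ c : K, h (f i0) = c • f i0 → h (f i1) = c • f i1 → h (f i2) = c • f i2 → h ∈ scal K V := by
    intro h c e0 e1 e2
    refine ⟨c, M.scalar_of (fun i => ?_)⟩
    rcases hcover i with rfl | rfl | rfl
    · exact e0
    · exact e1
    · exact e2
  refine final_B hH hx ?_ ?_
  · have hτ : ∀ h : V ≃ₗ[K] V, ∃ j, h ∈ H → ∃ c : K, h (f i0) = c • f j := by
      intro h
      by_cases hh : h ∈ H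
      · obtain ⟨j, c, hc⟩ := M.mono h hh i0
        exact ⟨j, fun _ => ⟨c, hc⟩⟩
      · exact ⟨i0, fun h' => absurd h' hh⟩
    choose θ hθ using hτ
    have c1 := card_le_of_fib (A := H ⊓ cj H x) (B := H ⊓ cj H x ⊓ (dg f : Subgroup (V ≃ₗ[K] V))) inf_le_left
      (T := (Set.univ : Set ι)) (Set.toFinite _) θ (fun _ _ => Set.mem_univ _) (by
        intro u hu w hw huw
        have hm := (H ⊓ cj H x).mul_mem ((H ⊓ cj H x).inv_mem hu) hw
        refine ⟨hm, ?_⟩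
        by_contra hmd
        obtain ⟨c, hc⟩ := hθ u hu.1
        obtain ⟨d, hd⟩ := hθ w hw.1
        rw [← huw] at hd
        have hc0 : c ≠ 0 := by
          rintro rfl
          rw [zero_smul] at hc
          exact M.frame.ne_zero i0 (u.injective (by rw [hc, map_zero]))
        have hmi : (u⁻¹ * w) (f i0) = (d * c⁻¹) • f i0 := by
          rw [LinearEquiv.mul_apply, hd]
          apply u.injective
          rw [apply_inv_self', map_smul, hc, smul_smul, mul_assoc, inv_mul_cancel₀ hc0, mul_one]
        obtain ⟨ρ, z, hz, hzn, hzinj⟩ := M.act hm.1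
        apply (M.cyc3 h3 hm.1 hmd hz hzinj i0).1
        refine (M.uniq (c := d * c⁻¹) (d := z i0) ?_ (by rw [← hmi, hz])).symm
        intro h0; have := hzn i0; rw [h0, zero_mul] at this; exact zero_ne_one this)
    have hco : ∀ h : V ≃ₗ[K] V, ∀ i, ∀ c : K, h (f i) = c • f i → D.B (f i) (h (f i)) = c := by
      intro h i c hc
      rw [hc, map_smul, M.frame.one, smul_eq_mul, mul_one]
    have c2 := card_le_of_fib (A := H ⊓ cj H x ⊓ (dg f : Subgroup (V ≃ₗ[K] V))) (B := H ⊓ cj H x ⊓ scal K V)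
      (le_inf inf_le_left (fun h hh i => by obtain ⟨c, hc⟩ := hh.2; exact ⟨c, hc _⟩))
      (T := {c : K | c ^ 3 = 1}) (Set.toFinite _) (fun h => D.B (f i1) (h (f i1)) / D.B (f i0) (h (f i0))) (by
        intro h hh
        obtain ⟨c0, e0⟩ := hh.2 i0
        obtain ⟨c1, e1⟩ := hh.2 i1
        obtain ⟨c2, e2⟩ := hh.2 i2
        have n0 := hb0 h i0 c0 e0
        show (D.B (f i1) (h (f i1)) / D.B (f i0) (h (f i0))) ^ 3 = 1
        rw [hco h i0 c0 e0, hco h i1 c1 e1, div_pow, div_eq_one_iff_eq (pow_ne_zero _ n0)]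
        rcases hclaim h hh c0 c1 c2 e0 e1 e2 with ⟨c, hc⟩ | ⟨s1, s2⟩
        · have a0 := hco h i0 c (hc _)
          have a1 := hco h i1 c (hc _)
          rw [hco h i0 c0 e0] at a0
          rw [hco h i1 c1 e1] at a1
          rw [a0, a1]
        · linear_combination (c1 - c0) * ((c0 + c1) * s1 - s2)) (by
        intro u hu w hw huw
        have hm := (H ⊓ cj H x ⊓ (dg f : Subgroup (V ≃ₗ[K] V))).mul_mem
          ((H ⊓ cj H x ⊓ (dg f : Subgroup (V ≃ₗ[K] V))).inv_mem hu) hw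
        refine ⟨hm.1, ?_⟩
        obtain ⟨u0, eu0⟩ := hu.2 i0
        obtain ⟨u1, eu1⟩ := hu.2 i1
        obtain ⟨w0, ew0⟩ := hw.2 i0
        obtain ⟨w1, ew1⟩ := hw.2 i1
        have nu0 := hb0 u i0 u0 eu0
        have nu1 := hb0 u i1 u1 eu1
        have nw0 := hb0 w i0 w0 ew0
        have nw1 := hb0 w i1 w1 ew1
        simp only [hco u i0 u0 eu0, hco u i1 u1 eu1, hco w i0 w0 ew0, hco w i1 w1 ew1] at huw
        obtain ⟨c0, e0⟩ := hm.2 i0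
        obtain ⟨c1, e1⟩ := hm.2 i1
        obtain ⟨c2, e2⟩ := hm.2 i2
        have r0 : c0 * u0 = w0 := by
          have := congrArg u e0
          rw [LinearEquiv.mul_apply, apply_inv_self', ew0, map_smul, eu0, smul_smul] at this
          have := congrArg (D.B (f i0)) this
          rw [map_smul, map_smul, M.frame.one, smul_eq_mul, smul_eq_mul, mul_one, mul_one] at this
          exact this.symm
        have r1 : c1 * u1 = w1 := by
          have := congrArg u e1
          rw [LinearEquiv.mul_apply, apply_inv_self', ew1, map_smul, eu1, smul_smul] at this
          have := congrArg (D.B (f i1)) this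
          rw [map_smul, map_smul, M.frame.one, smul_eq_mul, smul_eq_mul, mul_one, mul_one] at this
          exact this.symm
        have hcc : c0 = c1 := by
          rw [div_eq_div_iff nu0 nw0, ← r0, ← r1] at huw
          apply mul_right_cancel₀ (mul_ne_zero nu0 nu1)
          linear_combination huw
        subst hcc
        rcases hclaim _ hm c0 c0 c2 e0 e1 e2 with hs | ⟨s1, s2⟩
        · exact hs
        · have n0 := hb0 _ i0 c0 e0
          have h30 : (3 : K) = 0 := by
            have : c0 ^ 2 * (3 : K) = 0 := by linear_combination (2 * c0) * s1 - s2
            exact (mul_eq_zero.mp this).resolve_left (pow_ne_zero _ n0)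
          have hc2 : c2 = c0 := by linear_combination s1 - c0 * h30
          rw [hc2] at e2
          exact hsc _ c0 e0 e1 e2)
    have n1 : (Set.univ : Set ι).ncard = 3 := by
      rw [Set.ncard_univ, Nat.card_eq_fintype_card, hcard, h3]
    have n2 : ({c : K | c ^ 3 = 1} : Set K).ncard ≤ 3 := by
      have hsub : ({c : K | c ^ 3 = 1} : Set K) ⊆ ((Polynomial.nthRoots 3 (1 : K)).toFinset : Set K) := by
        intro c hc
        rw [Finset.mem_coe, Multiset.mem_toFinset, Polynomial.mem_nthRoots (by norm_num)]
        exact hc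
      calc _ ≤ ((Polynomial.nthRoots 3 (1 : K)).toFinset : Set K).ncard := Set.ncard_le_ncard hsub (Set.toFinite _)
        _ = (Polynomial.nthRoots 3 (1 : K)).toFinset.card := Set.ncard_coe_finset _
        _ ≤ Multiset.card (Polynomial.nthRoots 3 (1 : K)) := Multiset.toFinset_card_le _
        _ ≤ 3 := Polynomial.card_nthRoots 3 1
    rw [n1] at c1
    have c3 := c2.trans (Nat.mul_le_mul_right _ n2)
    omega
  · intro h hh hs
    refine M.frame.kill hH (by omega) M.q4 ?_ hh hs
    intro k1 hk1 k2 hk2 k3 hk3 hr2 he2 he3 ⟨w, hw, hwf⟩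
    have d1 := M.nondiag hk1 hr2 hw hwf
    have d2 := M.nondiag hk2 (by rw [he2]; exact hr2) (by rw [he2]; exact hw) hwf
    have d3 := M.nondiag hk3 (by rw [he3]; exact hr2) (by rw [he3]; exact hw) hwf
    have img : ∀ k ∈ H, k ∉ (dg f : Subgroup (V ≃ₗ[K] V)) → (∃ c : K, k (f i0) = c • f i1) ∨ (∃ c : K, k (f i0) = c • f i2) := by
      intro k hk hd
      obtain ⟨τ, z, hz, hn, hinj⟩ := M.act hk
      have := (M.cyc3 h3 hk hd hz hinj i0).1
      rcases hcover (τ i0) with e | e | e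
      · exact absurd e this
      · left; exact ⟨z i0, by rw [hz, e]⟩
      · right; exact ⟨z i0, by rw [hz, e]⟩
    have r2' : Module.finrank K (mv k2) = 2 := by rw [he2]; exact hr2
    rcases img k1 hk1 d1 with ⟨a1, b1⟩ | ⟨a1, b1⟩ <;> rcases img k2 hk2 d2 with ⟨a2, b2⟩ | ⟨a2, b2⟩ <;>
      rcases img k3 hk3 d3 with ⟨a3, b3⟩ | ⟨a3, b3⟩
    · exact Or.inl (M.eq_of_line h3 hk1 hk2 hr2 he2 d1 b1 b2)
    · exact Or.inl (M.eq_of_line h3 hk1 hk2 hr2 he2 d1 b1 b2)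
    · exact Or.inr (Or.inl (M.eq_of_line h3 hk1 hk3 hr2 he3 d1 b1 b3))
    · exact Or.inr (Or.inr (M.eq_of_line h3 hk2 hk3 r2' (he3.trans he2.symm) d2 b2 b3))
    · exact Or.inr (Or.inr (M.eq_of_line h3 hk2 hk3 r2' (he3.trans he2.symm) d2 b2 b3))
    · exact Or.inr (Or.inl (M.eq_of_line h3 hk1 hk3 hr2 he3 d1 b1 b3))
    · exact Or.inl (M.eq_of_line h3 hk1 hk2 hr2 he2 d1 b1 b2)
    · exact Or.inl (M.eq_of_line h3 hk1 hk2 hr2 he2 d1 b1 b2)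

end Mono

theorem HallData.goal (hH : HallData D H Pi) : Goal D H := by
  rcases case_split hH with ⟨r, c⟩ | ⟨r, c⟩
  · by_cases he : 2 ≤ D.e r
    · exact c.goal_two he
    · have h1 := hH.e_pos c.hr
      obtain ⟨ι, _, f, M⟩ := c.exists_mono (by omega)
      by_cases h3 : D.n = 3
      · exact M.goal_three h3
      · exact M.goal_four (by have := hH.hn; omega)
  · by_cases h3 : D.n = 3
    · exact c.goal_three h3
    · exact c.goal_big h3

end mono3
end UData

theorem hall_conj_aux {G : Type} [Group G] [Finite G] (L H : Subgroup G) {t : ℕ} (ht : t.Prime)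
    (hd : ¬ t ∣ H.relIndex L) (P : Subgroup G) (hP : P ≤ L) (hp : IsPGroup t P) :
    ∃ g ∈ L, ∀ x ∈ P, g * x * g⁻¹ ∈ H := by
  haveI : Fact t.Prime := ⟨ht⟩
  have hp' : IsPGroup t (P.subgroupOf L) := hp.of_equiv (Subgroup.subgroupOfEquivOfLe hP).symm
  obtain ⟨a, ha⟩ := hp'.nonempty_fixed_point_of_prime_not_dvd_card (L ⧸ H.subgroupOf L) hd
  obtain ⟨g, rfl⟩ := QuotientGroup.mk_surjective a
  refine ⟨(g⁻¹ : L), (g⁻¹ : L).2, fun x hx => ?_⟩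
  have h1 := ha ⟨⟨x, hP hx⟩, hx⟩
  have h2 : (QuotientGroup.mk ((⟨x, hP hx⟩ : L) * g) : L ⧸ H.subgroupOf L) = QuotientGroup.mk g := h1
  have h3 := QuotientGroup.eq.mp h2.symm
  rw [Subgroup.mem_subgroupOf] at h3
  simpa [mul_assoc] using h3

/-- matrices as linear automorphisms -/
noncomputable def glEquiv (n : ℕ) (K : Type) [Field K] :
    GL (Fin n) K ≃* ((Fin n → K) ≃ₗ[K] (Fin n → K)) :=
  (Matrix.GeneralLinearGroup.toLin).trans (LinearMap.GeneralLinearGroup.generalLinearEquiv K (Fin n → K))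

theorem glEquiv_apply (n : ℕ) (K : Type) [Field K] (g : GL (Fin n) K) (v : Fin n → K) :
    glEquiv n K g v = (g : Matrix (Fin n) (Fin n) K) *ᵥ v := rfl

/-- the standard hermitian form -/
def stdB (n : ℕ) {K : Type} [Field K] (φ : K →+* K) (u : Fin n → K) : (Fin n → K) →ₗ[K] K where
  toFun w := (fun i => φ (u i)) ⬝ᵥ w
  map_add' x y := dotProduct_add _ _ _
  map_smul' c x := dotProduct_smul _ _ _

theorem stdB_apply (n : ℕ) {K : Type} [Field K] (φ : K →+* K) (u w : Fin n → K) :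
    stdB n φ u w = (fun i => φ (u i)) ⬝ᵥ w := rfl

theorem stdB_mulVec (n : ℕ) {K : Type} [Field K] (φ : K →+* K) (M : Matrix (Fin n) (Fin n) K)
    (u w : Fin n → K) :
    stdB n φ (M *ᵥ u) (M *ᵥ w) = (fun i => φ (u i)) ⬝ᵥ (((M.map φ)ᵀ * M) *ᵥ w) := by
  have h : (fun i => φ ((M *ᵥ u) i)) = (M.map φ) *ᵥ (fun i => φ (u i)) := by
    funext i
    simp [Matrix.mulVec, dotProduct]
  rw [stdB_apply, h, ← Matrix.mulVec_mulVec, Matrix.dotProduct_mulVec _ (M.map φ)ᵀ, Matrix.vecMul_transpose]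

/-- the standard hermitian space -/
noncomputable def stdD (p f q n : ℕ) (hp : p.Prime) (hf : 1 ≤ f) (hq : q = p ^ f)
    (K : Type) [Field K] [Fintype K] (hcard : Fintype.card K = q ^ 2)
    (φ : K →+* K) (hφ : ∀ x : K, φ x = x ^ q) : UData K (Fin n → K) where
  p := p
  f := f
  q := q
  n := n
  hp := hp
  hf := hf
  hq := hq
  hcard := by rw [Nat.card_eq_fintype_card, hcard]
  φ := φ
  hφ := hφ
  B := stdB n φ
  herm := by
    intro x y
    have h : ∀ a, φ (φ a) = a := fun a => by
      rw [hφ, hφ, ← pow_mul, ← sq, ← hcard, FiniteField.pow_card]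
    simp only [stdB_apply, dotProduct, map_sum, map_mul, h]
    exact Finset.sum_congr rfl fun i _ => mul_comm _ _
  b := Pi.basisFun K (Fin n)
  orth := by
    intro i j
    rw [stdB_apply, Pi.basisFun_apply, Pi.basisFun_apply, dotProduct_single]
    by_cases h : i = j
    · subst h; simp
    · simp [h, Ne.symm h]

theorem mem_GU_iff (p f q n : ℕ) (hp : p.Prime) (hf : 1 ≤ f) (hq : q = p ^ f)
    (K : Type) [Field K] [Fintype K] (hcard : Fintype.card K = q ^ 2)
    (φ : K →+* K) (hφ : ∀ x : K, φ x = x ^ q) (g : GL (Fin n) K) :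
    glEquiv n K g ∈ (stdD p f q n hp hf hq K hcard φ hφ).GU ↔ g ∈ GUgrp n φ := by
  have e1 : glEquiv n K g ∈ (stdD p f q n hp hf hq K hcard φ hφ).GU ↔
      ∀ x y, stdB n φ ((g : Matrix (Fin n) (Fin n) K) *ᵥ x) ((g : Matrix (Fin n) (Fin n) K) *ᵥ y) = stdB n φ x y := Iff.rfl
  have e2 : g ∈ GUgrp n φ ↔ ((g : Matrix (Fin n) (Fin n) K).map φ)ᵀ * (g : Matrix (Fin n) (Fin n) K) = 1 := Iff.rfl
  rw [e1, e2]
  constructor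
  · intro h
    ext i j
    have := h (Pi.single i 1) (Pi.single j 1)
    rw [stdB_mulVec, stdB_apply] at this
    have hs : (fun k => φ ((Pi.single i (1:K) : Fin n → K) k)) = Pi.single i 1 := by
      funext k
      by_cases hk : k = i
      · subst hk; simp
      · simp [hk]
    rw [hs] at this
    simpa [Matrix.one_apply, Pi.single_apply, eq_comm (a := i) (b := j)] using this
  · intro h x y
    rw [stdB_mulVec, h, Matrix.one_mulVec, stdB_apply]

theorem det_of_tv (n : ℕ) {K : Type} [Field K] (φ : K →+* K) (M : Matrix (Fin n) (Fin n) K)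
    (v : Fin n → K) (a : K) (hv : stdB n φ v v = 0)
    (h : ∀ y, M *ᵥ y = y + (a * stdB n φ v y) • v) : M.det = 1 := by
  have e : M = 1 + replicateCol Unit v * replicateRow Unit (fun i => a * φ (v i)) := by
    apply Matrix.ext_of_mulVec_single
    intro j
    rw [h]
    funext i
    simp [stdB_apply, Matrix.add_mulVec, Matrix.mul_apply, mul_comm, Matrix.one_apply, Pi.single_apply]
  rw [e, Matrix.det_one_add_replicateCol_mul_replicateRow]
  have : (fun i => a * φ (v i)) ⬝ᵥ v = a * stdB n φ v v := by
    simp [stdB_apply, dotProduct, Finset.mul_sum, mul_assoc]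
  rw [this, hv, mul_zero, add_zero]

theorem stmt2 (p f q n : ℕ) (hp : p.Prime) (hf : 1 ≤ f) (hq : q = p ^ f)
    (K : Type) [Field K] [Fintype K] (hcard : Fintype.card K = q ^ 2)
    (φ : K →+* K) (hφ : ∀ x : K, φ x = x ^ q)
    (hn : 3 ≤ n) (hnonsolv : ¬ IsSolvable ↥(GUgrp n φ))
    (π : Set ℕ) (hπ : ∀ r ∈ π, r.Prime) (h2pi : 2 ∉ π) (hppi : p ∉ π)
    (htwo : 2 ≤ (π ∩ {r : ℕ | r.Prime ∧ r ∣ Nat.card (GUgrp n φ)}).ncard)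
    (H : Subgroup (GL (Fin n) K)) (hH : IsHallSubgroupIn π (GUgrp n φ) H)
    :
    ∃ x y z : GL (Fin n) K,
      x ∈ (H : Set (GL (Fin n) K)) * ((GUgrp n φ ⊓ SLsub n K : Subgroup (GL (Fin n) K)) : Set (GL (Fin n) K)) ∧
      y ∈ (H : Set (GL (Fin n) K)) * ((GUgrp n φ ⊓ SLsub n K : Subgroup (GL (Fin n) K)) : Set (GL (Fin n) K)) ∧
      z ∈ (H : Set (GL (Fin n) K)) * ((GUgrp n φ ⊓ SLsub n K : Subgroup (GL (Fin n) K)) : Set (GL (Fin n) K)) ∧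
    ∀ g ∈ H ⊓ conjBy H x ⊓ conjBy H y ⊓ conjBy H z,
      ∃ c : K, (g : Matrix (Fin n) (Fin n) K) = c • (1 : Matrix (Fin n) (Fin n) K) := by
  classical
  obtain ⟨hle, hsub, hidx⟩ := hH
  haveI : Finite (GL (Fin n) K) := inferInstance
  have hGU := mem_GU_iff p f q n hp hf hq K hcard φ hφ
  have hB : (stdD p f q n hp hf hq K hcard φ hφ).B = stdB n φ := rfl
  have hDn : (stdD p f q n hp hf hq K hcard φ hφ).n = n := rfl
  have hDp : (stdD p f q n hp hf hq K hcard φ hφ).p = p := rfl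
  generalize hD : stdD p f q n hp hf hq K hcard φ hφ = D at hGU hB hDn hDp
  have hmap : D.GU = (GUgrp n φ).map (glEquiv n K).toMonoidHom := by
    ext x
    obtain ⟨g, rfl⟩ := (glEquiv n K).surjective x
    rw [hGU, Subgroup.mem_map]
    constructor
    · intro h; exact ⟨g, h, rfl⟩
    · rintro ⟨g', h, e⟩
      rw [← (glEquiv n K).injective e]; exact h
  have hcGU : Nat.card D.GU = Nat.card (GUgrp n φ) := by
    rw [hmap]
    exact Subgroup.card_map_of_injective (glEquiv n K).injective
  have hcH : Nat.card (H.map (glEquiv n K).toMonoidHom) = Nat.card H :=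
    Subgroup.card_map_of_injective (glEquiv n K).injective
  have hmemH : ∀ g, glEquiv n K g ∈ H.map (glEquiv n K).toMonoidHom ↔ g ∈ H := by
    intro g
    rw [Subgroup.mem_map]
    constructor
    · rintro ⟨g', h, e⟩
      rw [← (glEquiv n K).injective e]; exact h
    · intro h; exact ⟨g, h, rfl⟩
  have hall : UData.HallData D (H.map (glEquiv n K).toMonoidHom)
      (π ∩ {r : ℕ | r.Prime ∧ r ∣ Nat.card (GUgrp n φ)}) := by
    refine ⟨?_, ?_, ?_, ?_, ?_, ?_, ?_, ?_, ?_⟩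
    · rw [hmap]; exact Subgroup.map_mono hle
    · exact fun t ht => hπ t ht.1
    · rintro t ht rfl; exact h2pi ht.1
    · rintro t ht rfl; rw [hDp] at ht; exact hppi ht.1
    · intro t ht; rw [hcGU]; exact ht.2.2
    · intro t ht hd
      rw [hcH] at hd
      exact ⟨hsub t ht hd, ht, hd.trans (Subgroup.card_dvd_of_le hle)⟩
    · intro t ht P hP hpP
      have hpP' : IsPGroup t (P.comap (glEquiv n K).toMonoidHom) :=
        hpP.comap_of_injective _ (glEquiv n K).injective
      obtain ⟨g, hg, h⟩ := hall_conj_aux (GUgrp n φ) H (hπ t ht.1) (hidx t ht.1)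
        (P.comap (glEquiv n K).toMonoidHom) (fun x hx => (hGU x).mp (hP hx)) hpP'
      refine ⟨glEquiv n K g, (hGU g).mpr hg, fun x hx => ?_⟩
      obtain ⟨x, rfl⟩ := (glEquiv n K).surjective x
      rw [← map_inv, ← map_mul, ← map_mul, hmemH]
      exact h x hx
    · have h1 : 1 < (π ∩ {r : ℕ | r.Prime ∧ r ∣ Nat.card (GUgrp n φ)}).ncard := htwo
      obtain ⟨a, b, ha, hb, hab⟩ := (Set.one_lt_ncard_iff (Set.finite_of_ncard_pos (by omega))).mp h1
      exact ⟨a, ha, b, hb, hab⟩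
    · rw [hDn]; exact hn
  obtain ⟨x, y, z, hx, hy, hz, hgoal⟩ := hall.goal
  obtain ⟨x, rfl⟩ := (glEquiv n K).surjective x
  obtain ⟨y, rfl⟩ := (glEquiv n K).surjective y
  obtain ⟨z, rfl⟩ := (glEquiv n K).surjective z
  have key : ∀ w : GL (Fin n) K, UData.IsTv D (glEquiv n K w) →
      w ∈ (H : Set (GL (Fin n) K)) * ((GUgrp n φ ⊓ SLsub n K : Subgroup (GL (Fin n) K)) : Set (GL (Fin n) K)) := by
    rintro w ⟨h1, v, a, hv, ha, hw⟩
    refine Set.mem_mul.mpr ⟨1, H.one_mem, w, ⟨(hGU w).mp h1, ?_⟩, one_mul w⟩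
    rw [hB] at hv hw
    exact det_of_tv n φ _ v a hv hw
  have cj : ∀ w g : GL (Fin n) K, g ∈ conjBy H w →
      glEquiv n K w * glEquiv n K g * (glEquiv n K w)⁻¹ ∈ H.map (glEquiv n K).toMonoidHom := by
    rintro w g ⟨k, hk, rfl⟩
    rw [← map_inv, ← map_mul, ← map_mul, hmemH]
    have : w * (MulAut.conj w⁻¹).toMonoidHom k * w⁻¹ = k := by
      show w * (w⁻¹ * k * (w⁻¹)⁻¹) * w⁻¹ = k
      group
    rw [this]; exact hk
  refine ⟨x, y, z, key x hx, key y hy, key z hz, ?_⟩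
  rintro g ⟨⟨⟨g0, g1⟩, g2⟩, g3⟩
  obtain ⟨c, hc⟩ := hgoal (glEquiv n K g) ((hmemH g).mpr g0) (cj x g g1) (cj y g g2) (cj z g g3)
  refine ⟨c, ?_⟩
  apply Matrix.ext_of_mulVec_single
  intro i
  rw [← glEquiv_apply, hc, Matrix.smul_mulVec, Matrix.one_mulVec]
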